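/- (Littlewood restriction rule for O_n ⊆ GL_n.) Let λ be a non-negative integer partition with ℓ(λ) ≤ n/2 and let μ be a non-negative integer partition with (μ')₁ + (μ')₂ ≤ n. Then the multiplicity of the irreducible O_n(ℂ)-representation E^μ_(n) in the restriction of the irreducible GL_n(ℂ)-representation F^λ_(n) equals Σ_{2δ} c^λ_{μ, 2δ}, where the sum runs over all even partitions 2δ (all parts even). -/

import Mathlib

open scoped BigOperators TensorProduct
open Matrix

noncomputable section

def IsPartition (f : ℕ → ℕ) : Prop :=
  (∀ ⦃i j : ℕ⦄, i ≤ j → f j ≤ f i) ∧ ∃ N, f N = 0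

def Ptn : Type := {f : ℕ → ℕ // IsPartition f}

def plen (f : ℕ → ℕ) : ℕ := sInf {k | f k = 0}

def conj (f : ℕ → ℕ) : ℕ → ℕ := fun i => Set.ncard {j | i < f j}

def double (f : ℕ → ℕ) : ℕ → ℕ := fun i => 2 * f i

def InSkew (l m : ℕ → ℕ) (i j : ℕ) : Prop := m i ≤ j ∧ j < l i

def IsLRTableau (l m nu : ℕ → ℕ) (T : ℕ → ℕ → ℕ) : Prop :=
  (∀ i, m i ≤ l i) ∧
  (∀ i j, T i j ≠ 0 ↔ InSkew l m i j) ∧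
  (∀ i j k, InSkew l m i j → InSkew l m i k → j ≤ k → T i j ≤ T i k) ∧
  (∀ i k j, InSkew l m i j → InSkew l m k j → i < k → T i j < T k j) ∧
  (∀ r, Set.ncard {p : ℕ × ℕ | T p.1 p.2 = r + 1} = nu r) ∧
  (∀ i j r, Set.ncard {p : ℕ × ℕ | (p.1 < i ∨ (p.1 = i ∧ j ≤ p.2)) ∧ T p.1 p.2 = r + 2}
          ≤ Set.ncard {p : ℕ × ℕ | (p.1 < i ∨ (p.1 = i ∧ j ≤ p.2)) ∧ T p.1 p.2 = r + 1})

def lrCoeff (l m nu : ℕ → ℕ) : ℕ := Set.ncard {T : ℕ → ℕ → ℕ | IsLRTableau l m nu T}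

section Reps

variable {G : Type*} [Group G] {V W : Type*}
  [AddCommGroup V] [Module ℂ V] [AddCommGroup W] [Module ℂ W]

def IsSubrep (ρ : Representation ℂ G V) (U : Submodule ℂ V) : Prop :=
  ∀ g : G, ∀ x ∈ U, ρ g x ∈ U

def IsIrreducibleRep (ρ : Representation ℂ G V) : Prop :=
  Nontrivial V ∧ ∀ U : Submodule ℂ V, IsSubrep ρ U → U = ⊥ ∨ U = ⊤

def equivariantMaps (π : Representation ℂ G W) (ρ : Representation ℂ G V) :
    Submodule ℂ (W →ₗ[ℂ] V) where
  carrier := {f | ∀ g : G, f ∘ₗ (π g) = (ρ g) ∘ₗ f}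
  add_mem' := by
    intro f h hf hh g
    simp only [Set.mem_setOf_eq] at *
    rw [LinearMap.add_comp, LinearMap.comp_add, hf g, hh g]
  zero_mem' := by
    intro g
    simp only [Set.mem_setOf_eq, LinearMap.zero_comp, LinearMap.comp_zero]
  smul_mem' := by
    intro c f hf g
    simp only [Set.mem_setOf_eq] at *
    rw [LinearMap.smul_comp, LinearMap.comp_smul, hf g]

def repMult (ρ : Representation ℂ G V) (π : Representation ℂ G W) : ℕ :=
  Module.finrank ℂ (equivariantMaps π ρ)

end Reps

def IsUpperUni {N : ℕ} (A : Matrix (Fin N) (Fin N) ℂ) : Prop :=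
  (∀ i, A i i = 1) ∧ ∀ i j : Fin N, (j : ℕ) < (i : ℕ) → A i j = 0

def IsGLHW (n : ℕ) (a : Fin n → ℤ) {V : Type*} [AddCommGroup V] [Module ℂ V]
    (ρ : Representation ℂ (GL (Fin n) ℂ) V) : Prop :=
  IsIrreducibleRep ρ ∧ FiniteDimensional ℂ V ∧
  ∃ v : V, v ≠ 0 ∧
    (∀ g : GL (Fin n) ℂ, IsUpperUni (g : Matrix (Fin n) (Fin n) ℂ) → ρ g v = v) ∧
    (∀ (g : GL (Fin n) ℂ) (d : Fin n → ℂ),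
      (g : Matrix (Fin n) (Fin n) ℂ) = Matrix.diagonal d →
      ρ g v = (∏ i, d i ^ (a i)) • v)

def polyWeight (n : ℕ) (lam : ℕ → ℕ) : Fin n → ℤ := fun i => (lam (i : ℕ) : ℤ)

def ratWeight (n : ℕ) (lp lm : ℕ → ℕ) : Fin n → ℤ :=
  fun i => (lp (i : ℕ) : ℤ) - (lm (n - 1 - (i : ℕ)) : ℤ)

def formGroup {ι : Type*} [Fintype ι] [DecidableEq ι] (S : Matrix ι ι ℂ) :
    Subgroup (GL ι ℂ) where
  carrier := {g | (g : Matrix ι ι ℂ)ᵀ * S * (g : Matrix ι ι ℂ) = S}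
  one_mem' := by
    simp [Matrix.transpose_one]
  mul_mem' := by
    intro a b ha hb
    set A : Matrix ι ι ℂ := (a : Matrix ι ι ℂ) with hA
    set B : Matrix ι ι ℂ := (b : Matrix ι ι ℂ) with hB
    have ha' : Aᵀ * S * A = S := ha
    have hb' : Bᵀ * S * B = S := hb
    show ((↑(a * b) : Matrix ι ι ℂ))ᵀ * S * (↑(a * b) : Matrix ι ι ℂ) = S
    have hab : (↑(a * b) : Matrix ι ι ℂ) = A * B := Units.val_mul a b
    rw [hab, Matrix.transpose_mul]
    calc Bᵀ * Aᵀ * S * (A * B) = Bᵀ * (Aᵀ * S * A) * B := by noncomm_ring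
    _ = S := by rw [ha', hb']
  inv_mem' := by
    intro a ha
    set A : Matrix ι ι ℂ := (a : Matrix ι ι ℂ) with hA
    have ha' : Aᵀ * S * A = S := ha
    set C : Matrix ι ι ℂ := ((a⁻¹ : GL ι ℂ) : Matrix ι ι ℂ) with hC
    show Cᵀ * S * C = S
    have hac : A * C = 1 := by
      rw [hA, hC, ← Units.val_mul, mul_inv_cancel, Units.val_one]
    calc Cᵀ * S * C = Cᵀ * (Aᵀ * S * A) * C := by rw [ha']
    _ = (A * C)ᵀ * S * (A * C) := by rw [Matrix.transpose_mul]; noncomm_ring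
    _ = S := by rw [hac]; simp [Matrix.transpose_one]

def symForm (n : ℕ) : Matrix (Fin n) (Fin n) ℂ :=
  Matrix.of fun i j => if (i : ℕ) + (j : ℕ) = n - 1 then 1 else 0

def sympForm (n : ℕ) : Matrix (Fin (2 * n)) (Fin (2 * n)) ℂ :=
  Matrix.of fun i j =>
    if (i : ℕ) + (j : ℕ) = 2 * n - 1 then (if (i : ℕ) < n then 1 else -1) else 0

def OGL (n : ℕ) : Subgroup (GL (Fin n) ℂ) := formGroup (symForm n)

def SpGL (n : ℕ) : Subgroup (GL (Fin (2 * n)) ℂ) := formGroup (sympForm n)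

/-- The matrix of a distinguished reflection (an element of `O_n(ℂ)` of determinant `-1`
fixing the highest weight vectors of the representations `E^mu_(n)` for
`ℓ(mu) < n/2`): for odd `n`, the reflection negating the middle basis vector; for even
`n`, the permutation swapping the two middle basis vectors. -/
def reflMatrix (n : ℕ) : Matrix (Fin n) (Fin n) ℂ :=
  Matrix.of fun i j =>
    if 2 * (i : ℕ) + 1 = n ∧ i = j then -1
    else if (2 * (i : ℕ) = n ∧ 2 * (j : ℕ) + 2 = n) ∨ (2 * (i : ℕ) + 2 = n ∧ 2 * (j : ℕ) = n)
      then 1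
    else if i = j ∧ ¬(2 * (i : ℕ) = n ∨ 2 * (i : ℕ) + 2 = n) then 1
    else 0

/-- The partition associated to `mu` (with `(mu')_1 + (mu')_2 ≤ n`): the first column
length `(mu')_1` is replaced by `n - (mu')_1`.  One has `E^{assoc n mu} = E^mu ⊗ det`. -/
def assocPtn (n : ℕ) (mu : ℕ → ℕ) : ℕ → ℕ :=
  conj (fun j => if j = 0 then n - conj mu 0 else conj mu j)

/-- `v` is a highest weight vector of weight `mu` for (the identity component of)
`O_n(ℂ)`: it is fixed by all upper triangular unipotent elements, and the diagonal
torus elements of determinant one act via the character attached to `mu`. -/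
def IsOHWvec (n : ℕ) (mu : ℕ → ℕ) {V : Type*} [AddCommGroup V] [Module ℂ V]
    (ρ : Representation ℂ (OGL n) V) (v : V) : Prop :=
  (∀ g : OGL n, IsUpperUni ((g : GL (Fin n) ℂ) : Matrix (Fin n) (Fin n) ℂ) → ρ g v = v) ∧
  (∀ (g : OGL n) (d : Fin n → ℂ),
    ((g : GL (Fin n) ℂ) : Matrix (Fin n) (Fin n) ℂ) = Matrix.diagonal d →
    (∏ i, d i) = 1 →
    ρ g v = (∏ i, d i ^ (mu (i : ℕ))) • v)

/-- `ρ` is the irreducible rational representation `E^mu_(n)` of the complex orthogonal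
group `O_n(ℂ)`, indexed by a partition `mu` with `(mu')_1 + (mu')_2 ≤ n`. -/
def IsOIrrep (n : ℕ) (mu : ℕ → ℕ) {V : Type*} [AddCommGroup V] [Module ℂ V]
    (ρ : Representation ℂ (OGL n) V) : Prop :=
  IsIrreducibleRep ρ ∧ FiniteDimensional ℂ V ∧
  (if 2 * conj mu 0 ≤ n then
    ∃ v : V, v ≠ 0 ∧ IsOHWvec n mu ρ v ∧
      (2 * conj mu 0 = n ∨
        ∀ g : OGL n, ((g : GL (Fin n) ℂ) : Matrix (Fin n) (Fin n) ℂ) = reflMatrix n →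
          ρ g v = v)
  else
    ∃ v : V, v ≠ 0 ∧ IsOHWvec n (assocPtn n mu) ρ v ∧
      (∀ g : OGL n, ((g : GL (Fin n) ℂ) : Matrix (Fin n) (Fin n) ℂ) = reflMatrix n →
        ρ g v = - v))

/-- `ρ` is the irreducible rational representation `V^mu_(2n)` of `Sp_{2n}(ℂ)` with
highest weight `mu` (a partition with at most `n` parts). -/
def IsSpHW (n : ℕ) (mu : ℕ → ℕ) {V : Type*} [AddCommGroup V] [Module ℂ V]
    (ρ : Representation ℂ (SpGL n) V) : Prop :=
  IsIrreducibleRep ρ ∧ FiniteDimensional ℂ V ∧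
  ∃ v : V, v ≠ 0 ∧
    (∀ g : SpGL n,
      IsUpperUni ((g : GL (Fin (2 * n)) ℂ) : Matrix (Fin (2 * n)) (Fin (2 * n)) ℂ) →
      ρ g v = v) ∧
    (∀ (g : SpGL n) (d : Fin (2 * n) → ℂ),
      ((g : GL (Fin (2 * n)) ℂ) : Matrix (Fin (2 * n)) (Fin (2 * n)) ℂ) = Matrix.diagonal d →
      ρ g v = (∏ i, d i ^ (mu (i : ℕ))) • v)

namespace Littlewood

section

open Finset Submodule LinearMap

/-- Complex matrices of size `m × n`. -/
abbrev Mat (m n : ℕ) := Matrix (Fin m) (Fin n) ℂ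

section Abstract

variable {G V W : Type*} [Group G] [AddCommGroup V] [Module ℂ V] [AddCommGroup W] [Module ℂ W]

/-- Orthogonal projection to a finite dimensional subspace for a positive definite form. -/
theorem exists_proj (B : V →ₗ⋆[ℂ] V →ₗ[ℂ] ℂ) (hsymm : ∀ x y, star (B x y) = B y x)
    (hpos : ∀ x, x ≠ 0 → 0 < (B x x).re) (Y : Submodule ℂ V) [FiniteDimensional ℂ Y] (w : V) :
    ∃ z ∈ Y, ∀ y ∈ Y, B y (w - z) = 0 := by
  let core : InnerProductSpace.Core ℂ V :=
    { inner := fun x y => B x y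
      conj_inner_symm := fun x y => hsymm y x
      re_inner_nonneg := fun x => by
        by_cases hx : x = 0
        · simp [hx]
        · exact (hpos x hx).le
      add_left := fun x y z => by simp
      smul_left := fun x y r => by simp
      definite := fun x hx => by
        by_contra h
        have := hpos x h
        rw [show B x x = 0 from hx] at this
        simp at this }
  let : NormedAddCommGroup V := core.toNormedAddCommGroup
  let : InnerProductSpace ℂ V := InnerProductSpace.ofCore core.toCore
  refine ⟨Y.starProjection w, Y.starProjection_apply_mem w, fun y hy => ?_⟩
  have := Y.sub_starProjection_mem_orthogonal w
  rw [mem_orthogonal] at this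
  exact this y hy

/-- A criterion for the existence of an equivariant map with prescribed value at a vector. -/
theorem exists_equivariant (π : Representation ℂ G W) (ρ : Representation ℂ G V)
    (hπ : IsIrreducibleRep π)
    (B : V →ₗ⋆[ℂ] V →ₗ[ℂ] ℂ) (hsymm : ∀ x y, star (B x y) = B y x)
    (hpos : ∀ x, x ≠ 0 → 0 < (B x x).re) (st : G → G)
    (hst : ∀ g x y, B (ρ g x) y = B x (ρ (st g) y))
    (U : Submodule ℂ V) (hU : IsSubrep ρ U) [FiniteDimensional ℂ U]
    (w : W) (w' : V) (hw'U : w' ∈ U) (R : G → ℂ → Prop)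
    (hR : ∀ g c, R g c → ρ g w' = c • w')
    (φ : W →ₗ[ℂ] ℂ) (hφ : ∀ g c, R g c → ∀ x, φ (π (st g) x) = star c * φ x) (hφw : φ w ≠ 0)
    (H1 : ∀ Φ : (W × V) →ₗ[ℂ] ℂ,
      (∀ g c, R g c → ∀ x, Φ (π (st g) x.1, ρ (st g) x.2) = star c * Φ x) →
      Φ (w, w') = 0 → ∀ g, Φ (π g w, ρ g w') = 0) :
    ∃ T ∈ equivariantMaps π ρ, T w = w' := by
  set Z : Submodule ℂ (W × V) := Submodule.span ℂ (Set.range fun g => (π g w, ρ g w')) with hZ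
  have hZw : (w, w') ∈ Z := Submodule.subset_span ⟨1, by simp⟩
  have hZU : ∀ x ∈ Z, x.2 ∈ U := by
    have : Z ≤ U.comap (LinearMap.snd ℂ W V) := by
      rw [hZ, Submodule.span_le]
      rintro _ ⟨g, rfl⟩
      exact hU g _ hw'U
    exact fun x hx => this hx
  have hZst : ∀ g, ∀ x ∈ Z, (π g x.1, ρ g x.2) ∈ Z := by
    intro g
    have : Z ≤ Z.comap ((π g).prodMap (ρ g)) := by
      conv_lhs => rw [hZ]
      rw [Submodule.span_le]
      rintro _ ⟨h, rfl⟩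
      refine Submodule.subset_span ⟨g * h, ?_⟩
      simp
    exact fun x hx => this hx
  have hadj : ∀ g x y, B x (ρ g y) = B (ρ (st g) x) y := by
    intro g x y
    rw [← hsymm, hst, hsymm]
  set Y : Submodule ℂ V := Z.comap (LinearMap.inr ℂ W V)
  have memY : ∀ y, y ∈ Y ↔ ((0 : W), y) ∈ Z := fun y => Iff.rfl
  have hYst : ∀ g, ∀ y ∈ Y, ρ g y ∈ Y := by
    intro g y hy
    have := hZst g _ hy
    simpa [memY] using this
  have hYU : Y ≤ U := fun y hy => hZU _ hy
  have : FiniteDimensional ℂ Y := Submodule.finiteDimensional_of_le hYU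
  have hdef : ∀ x, B x x = 0 → x = 0 := by
    intro x hx
    by_contra h
    have := hpos x h
    rw [hx] at this
    simp at this
  obtain ⟨z, hzY, hz⟩ := exists_proj B hsymm hpos Y w'
  have hzR : ∀ g c, R g c → ρ g z = c • z := by
    intro g c hgc
    have key : ∀ y ∈ Y, B y (ρ g z - c • z) = 0 := by
      intro y hy
      have h1 : B y (ρ g (w' - z)) = 0 := by rw [hadj]; exact hz _ (hYst _ _ hy)
      have h2 := hz y hy
      rw [map_sub, hR g c hgc, map_sub, map_smul] at h1
      rw [map_sub] at h2
      rw [map_sub, map_smul]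
      simp only [smul_eq_mul] at *
      linear_combination c * h2 - h1
    have := hdef _ (key _ (Y.sub_mem (hYst g z hzY) (Y.smul_mem c hzY)))
    exact sub_eq_zero.mp this
  have hkill : ∀ x ∈ Z, (B z w' / φ w) * φ x.1 - B z x.2 = 0 := by
    set Φ : (W × V) →ₗ[ℂ] ℂ := (B z w' / φ w) • (φ ∘ₗ LinearMap.fst ℂ W V) -
      (B z) ∘ₗ LinearMap.snd ℂ W V with hΦ
    have hΦ' : ∀ x, Φ x = (B z w' / φ w) * φ x.1 - B z x.2 := fun x => by simp [hΦ]
    have hk := H1 Φ (by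
      intro g c hgc x
      rw [hΦ', hΦ', hφ g c hgc, ← hst, hzR g c hgc]
      simp
      ring) (by rw [hΦ']; field_simp; simp)
    have : Z ≤ LinearMap.ker Φ := by
      rw [hZ, Submodule.span_le]
      rintro _ ⟨g, rfl⟩
      exact hk g
    intro x hx
    rw [← hΦ']
    exact this hx
  have hz0 : z = 0 := by
    apply hdef
    have := hkill _ hzY
    simpa using this
  have hY0 : ∀ y ∈ Y, y = 0 := by
    intro y hy
    have h1 : ∀ x ∈ Z, B y x.2 = 0 := by
      have : Z ≤ LinearMap.ker ((B y) ∘ₗ LinearMap.snd ℂ W V) := by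
        rw [hZ, Submodule.span_le]
        rintro _ ⟨g, rfl⟩
        simp only [SetLike.mem_coe, LinearMap.mem_ker, LinearMap.comp_apply, LinearMap.snd_apply]
        rw [hadj]
        have := hz _ (hYst (st g) y hy)
        rwa [hz0, sub_zero] at this
      exact fun x hx => this hx
    exact hdef _ (h1 _ hy)
  have hinj : Function.Injective ((LinearMap.fst ℂ W V).domRestrict Z) := by
    rw [← LinearMap.ker_eq_bot, LinearMap.ker_eq_bot']
    rintro ⟨⟨a, b⟩, hx⟩ h
    have ha : a = 0 := h
    subst ha
    have hb := hY0 b hx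
    subst hb
    rfl
  have hsurj : Function.Surjective ((LinearMap.fst ℂ W V).domRestrict Z) := by
    rw [← LinearMap.range_eq_top]
    refine (hπ.2 _ ?_).resolve_left ?_
    · rintro g _ ⟨x, rfl⟩
      exact ⟨⟨_, hZst g _ x.2⟩, rfl⟩
    · intro h
      apply hφw
      have : w ∈ LinearMap.range ((LinearMap.fst ℂ W V).domRestrict Z) := ⟨⟨_, hZw⟩, rfl⟩
      rw [h] at this
      rw [(Submodule.mem_bot ℂ).mp this, map_zero]
  let e := LinearEquiv.ofBijective _ ⟨hinj, hsurj⟩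
  have he : ∀ z : Z, e z = z.1.1 := fun _ => rfl
  have hes : ∀ x : Z, (e.symm x.1.1) = x := fun x => by rw [← he, e.symm_apply_apply]
  refine ⟨(LinearMap.snd ℂ W V) ∘ₗ Z.subtype ∘ₗ e.symm.toLinearMap, ?_, ?_⟩
  · intro g
    ext x
    obtain ⟨y, rfl⟩ := e.surjective x
    have h1 := hes ⟨_, hZst g _ y.2⟩
    simp only [LinearMap.comp_apply, LinearEquiv.coe_coe, he] at h1 ⊢
    rw [h1, hes]
    rfl
  · have := hes ⟨_, hZw⟩
    simp only [LinearMap.comp_apply, LinearEquiv.coe_coe] at this ⊢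
    rw [this]
    rfl

theorem finset_span_range {ι : Type*} (v : ι → V)
    [FiniteDimensional ℂ (span ℂ (Set.range v))] :
    ∃ s : Finset ι, span ℂ (v '' s) = span ℂ (Set.range v) := by
  have hfg : (span ℂ (Set.range v)).FG :=
    Module.Finite.iff_fg.mp inferInstance
  obtain ⟨t, ht, hspan⟩ := fg_span_iff_fg_span_finset_subset (Set.range v) |>.mp hfg
  obtain ⟨s, hs⟩ : ∃ s : Finset ι, v '' s = t := by
    classical
    obtain ⟨s, -, hs⟩ := subset_set_image_iff.mp (show (t : Set V) ⊆ v '' Set.univ by simpa using ht)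
    exact ⟨s, by rw [← hs]; simp⟩
  exact ⟨s, by rw [hs, ← hspan]⟩

/-- If a functional vanishes on the good part of an orbit and any finite set of group elements
can be translated to good ones, it vanishes on the orbit. -/
theorem density (τ : Representation ℂ G V) (Φ : V →ₗ[ℂ] ℂ) (z : V) (H : Subgroup G)
    (U : Submodule ℂ V) (hU : IsSubrep τ U) [FiniteDimensional ℂ U] (hz : z ∈ U)
    (Good : G → Prop) (hgood : ∀ g ∈ H, Good g → Φ (τ g z) = 0)
    (hav : ∀ s : Finset G, (∀ g ∈ s, g ∈ H) → ∃ h ∈ H, ∀ g ∈ s, Good (h * g)) :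
    ∀ g ∈ H, Φ (τ g z) = 0 := by
  classical
  have hle : span ℂ (Set.range fun g : H => τ (g : G) z) ≤ U := by
    rw [span_le]
    rintro _ ⟨g, rfl⟩
    exact hU _ _ hz
  have := finiteDimensional_of_le hle
  obtain ⟨s, hs⟩ := finset_span_range (fun g : H => τ (g : G) z)
  obtain ⟨h, hh, hgd⟩ := hav (s.image Subtype.val) (by
    intro g hg
    obtain ⟨a, -, rfl⟩ := mem_image.mp hg
    exact a.2)
  have hker : span ℂ (Set.range fun g : H => τ (g : G) z) ≤ ker (Φ ∘ₗ τ h) := by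
    rw [← hs, span_le]
    rintro _ ⟨g, hg, rfl⟩
    have := hgood (h * g) (H.mul_mem hh g.2) (hgd _ (mem_image_of_mem _ hg))
    simpa using this
  intro g hg
  have := hker (subset_span ⟨⟨h⁻¹ * g, H.mul_mem (H.inv_mem hh) hg⟩, rfl⟩)
  simpa using this

end Abstract

end

section

open Submodule LinearMap Module

section Kolchin

variable {G V : Type*} [Group G] [AddCommGroup V] [Module ℂ V]

/-- A nonzero finite dimensional subspace stable under an operator contains an eigenvector. -/
theorem exists_eigenvector (f : End ℂ V) (U : Submodule ℂ V) [FiniteDimensional ℂ U]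
    (hU : U ≠ ⊥) (h : ∀ x ∈ U, f x ∈ U) : ∃ v ∈ U, v ≠ 0 ∧ ∃ c : ℂ, f v = c • v := by
  have : Nontrivial U := nontrivial_iff_ne_bot.mpr hU
  obtain ⟨c, hc⟩ := End.exists_eigenvalue (f.restrict h)
  obtain ⟨v, hv⟩ := hc.exists_hasEigenvector
  refine ⟨v.1, v.2, fun h0 => hv.2 (Subtype.ext h0), c, ?_⟩
  have := congrArg Subtype.val hv.apply_eq_smul
  simpa using this

theorem exists_common_eigenvector (S : Set (End ℂ V))
    (hS : ∀ f ∈ S, ∀ g ∈ S, f * g = g * f) (U : Submodule ℂ V) [hfd : FiniteDimensional ℂ U]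
    (hU : U ≠ ⊥) (h : ∀ f ∈ S, ∀ x ∈ U, f x ∈ U) :
    ∃ v ∈ U, v ≠ 0 ∧ ∀ f ∈ S, ∃ c : ℂ, f v = c • v := by
  induction hd : finrank ℂ U using Nat.strong_induction_on generalizing U with
  | _ d ih =>
    by_cases hsc : ∀ f ∈ S, ∃ c : ℂ, ∀ x ∈ U, f x = c • x
    · obtain ⟨v, hv, hv0⟩ := (Submodule.ne_bot_iff U).mp hU
      exact ⟨v, hv, hv0, fun f hf => (hsc f hf).imp fun c hc => hc v hv⟩
    · push Not at hsc
      obtain ⟨f, hf, hfc⟩ := hsc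
      obtain ⟨v, hvU, hv0, c, hv⟩ := exists_eigenvector f U hU (h f hf)
      set U' : Submodule ℂ V := U ⊓ ker (f - c • 1) with hU'
      have hmem : ∀ x, x ∈ U' ↔ x ∈ U ∧ f x = c • x := by
        intro x
        simp [hU', sub_eq_zero]
      have hlt : U' < U := by
        refine lt_of_le_of_ne inf_le_left fun heq => ?_
        obtain ⟨x, hx, hne⟩ := hfc c
        rw [← heq, hmem] at hx
        exact hne hx.2
      have : FiniteDimensional ℂ U' := finiteDimensional_of_le hlt.le
      obtain ⟨u, hu, hu0, hu2⟩ := ih _ (hd ▸ finrank_lt_finrank_of_lt hlt) U'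
        ((Submodule.ne_bot_iff _).mpr ⟨v, (hmem v).mpr ⟨hvU, hv⟩, hv0⟩) (by
          intro g hg x hx
          rw [hmem] at hx ⊢
          refine ⟨h g hg x hx.1, ?_⟩
          have := LinearMap.congr_fun (hS f hf g hg) x
          simp only [End.mul_apply] at this
          rw [this, hx.2, map_smul]) rfl
      exact ⟨u, hlt.le hu, hu0, hu2⟩

/-- An abelian group of operators normalized by elements acting on it by `p`-th powers
has a fixed vector. -/
theorem exists_fixed_step (τ : Representation ℂ G V) (A : Subgroup G)
    (hA : ∀ a ∈ A, ∀ b ∈ A, a * b = b * a) (T : ℕ → G)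
    (hT : ∀ p, 1 ≤ p → ∀ c ∈ A, c * T p = T p * c ^ p)
    (U : Submodule ℂ V) [FiniteDimensional ℂ U] (hU : U ≠ ⊥)
    (hUA : ∀ a ∈ A, ∀ x ∈ U, τ a x ∈ U) (hUT : ∀ p, 1 ≤ p → ∀ x ∈ U, τ (T p) x ∈ U) :
    ∃ v ∈ U, v ≠ 0 ∧ ∀ c ∈ A, τ c v = v := by
  obtain ⟨v, hvU, hv0, hv⟩ := exists_common_eigenvector (τ '' A) (by
    rintro _ ⟨a, ha, rfl⟩ _ ⟨b, hb, rfl⟩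
    rw [← map_mul, hA a ha b hb, map_mul]) U hU (by
    rintro _ ⟨a, ha, rfl⟩ x hx
    exact hUA a ha x hx)
  have hchar : ∀ c ∈ A, ∃ χ : ℂ, χ ≠ 0 ∧ τ c v = χ • v ∧
      ∀ p, 1 ≤ p → τ c (τ (T p) v) = χ ^ p • τ (T p) v := by
    intro c hc
    obtain ⟨χ, hχ⟩ := hv _ ⟨c, hc, rfl⟩
    refine ⟨χ, ?_, hχ, ?_⟩
    · rintro rfl
      apply hv0
      have : τ c⁻¹ (τ c v) = v := by simp
      rw [← this, hχ]
      simp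
    · intro p hp
      have h1 : τ (c ^ p) v = χ ^ p • v := by
        rw [map_pow]
        clear hp
        induction p with
        | zero => simp
        | succ p ih => rw [pow_succ', End.mul_apply, ih, map_smul, hχ, smul_smul, pow_succ]
      rw [← End.mul_apply, ← map_mul, hT p hp c hc, map_mul, End.mul_apply, h1,
        map_smul]
  set d := finrank ℂ U with hd
  have hTv : ∀ p, τ (T p) v ≠ 0 := by
    intro p h
    apply hv0
    have : τ (T p)⁻¹ (τ (T p) v) = v := by simp
    rw [← this, h, map_zero]
  refine ⟨τ (T d.factorial) v, hUT _ (Nat.factorial_pos d) v hvU, hTv _, fun c hc => ?_⟩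
  obtain ⟨χ, hχ0, hχ, hχp⟩ := hchar c hc
  suffices χ ^ d.factorial = 1 by
    rw [hχp _ (Nat.factorial_pos d), this, one_smul]
  have hninj : ¬ Function.Injective (fun i : Fin (d + 1) => χ ^ ((i : ℕ) + 1)) := by
    intro hinj
    have hli := End.eigenvectors_linearIndependent' (τ c) _ hinj
      (fun i => τ (T ((i : ℕ) + 1)) v) (fun i => by
        rw [End.hasEigenvector_iff]
        exact ⟨End.mem_eigenspace_iff.mpr (hχp _ (by omega)), hTv _⟩)
    have hli2 : LinearIndependent ℂ
        (fun i : Fin (d + 1) => (⟨_, hUT ((i : ℕ) + 1) (by omega) v hvU⟩ : U)) :=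
      LinearIndependent.of_comp U.subtype hli
    have := hli2.fintype_card_le_finrank
    rw [Fintype.card_fin, ← hd] at this
    omega
  rw [Function.Injective] at hninj
  push Not at hninj
  obtain ⟨i, j, hij, hne⟩ := hninj
  wlog hlt : (i : ℕ) < j generalizing i j
  · exact this j i hij.symm (Ne.symm hne) (by
      have : (i : ℕ) ≠ j := fun h => hne (Fin.ext h)
      omega)
  have h1 : χ ^ ((j : ℕ) - i) = 1 := by
    have : χ ^ ((j : ℕ) + 1) = χ ^ ((i : ℕ) + 1) * χ ^ ((j : ℕ) - i) := by
      rw [← pow_add]; congr 1; omega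
    have hij : χ ^ ((i : ℕ) + 1) = χ ^ ((j : ℕ) + 1) := hij
    rw [this] at hij
    exact (mul_right_eq_self₀.mp hij.symm).resolve_right (pow_ne_zero _ hχ0)
  obtain ⟨q, hq⟩ : (j : ℕ) - i ∣ d.factorial :=
    Nat.dvd_factorial (by omega) (by omega)
  rw [hq, pow_mul, h1, one_pow]

/-- Vectors of `U` fixed by the subgroups `A i`, `i < N`. -/
def fixedBy (τ : Representation ℂ G V) (A : ℕ → Subgroup G) (N : ℕ) (U : Submodule ℂ V) :
    Submodule ℂ V where
  carrier := {v | v ∈ U ∧ ∀ i < N, ∀ a ∈ A i, τ a v = v}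
  add_mem' := fun {x y} hx hy => ⟨U.add_mem hx.1 hy.1, fun i hi a ha => by
    rw [map_add, hx.2 i hi a ha, hy.2 i hi a ha]⟩
  zero_mem' := ⟨U.zero_mem, fun i hi a ha => map_zero _⟩
  smul_mem' := fun c x hx => ⟨U.smul_mem c hx.1, fun i hi a ha => by
    rw [map_smul, hx.2 i hi a ha]⟩

theorem fixedBy_le (τ : Representation ℂ G V) (A : ℕ → Subgroup G) (N : ℕ) (U : Submodule ℂ V) :
    fixedBy τ A N U ≤ U := fun _ hx => hx.1

theorem fixedBy_stable (τ : Representation ℂ G V) (A : ℕ → Subgroup G) (N : ℕ)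
    (U : Submodule ℂ V) (h : G) (hU : ∀ x ∈ U, τ h x ∈ U)
    (hn : ∀ i < N, ∀ a ∈ A i, h⁻¹ * a * h ∈ A i) :
    ∀ x ∈ fixedBy τ A N U, τ h x ∈ fixedBy τ A N U := by
  intro x hx
  refine ⟨hU x hx.1, fun i hi a ha => ?_⟩
  have h1 := hx.2 i hi _ (hn i hi a ha)
  have h2 : a * h = h * (h⁻¹ * a * h) := by group
  rw [← End.mul_apply, ← map_mul, h2, map_mul, End.mul_apply, h1]

theorem fixedBy_ne_bot (τ : Representation ℂ G V) (A : ℕ → Subgroup G) (N : ℕ)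
    (hA : ∀ i < N, ∀ a ∈ A i, ∀ b ∈ A i, a * b = b * a) (T : ℕ → ℕ → G)
    (hT : ∀ i < N, ∀ p, 1 ≤ p → ∀ c ∈ A i, c * T i p = T i p * c ^ p)
    (hAn : ∀ j < N, ∀ i < j, ∀ h ∈ A j, ∀ a ∈ A i, h⁻¹ * a * h ∈ A i)
    (hTn : ∀ j < N, ∀ i < j, ∀ p, 1 ≤ p → ∀ a ∈ A i, (T j p)⁻¹ * a * T j p ∈ A i)
    (U : Submodule ℂ V) (hUs : IsSubrep τ U) [FiniteDimensional ℂ U] (hU : U ≠ ⊥) :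
    fixedBy τ A N U ≠ ⊥ := by
  suffices ∀ j ≤ N, fixedBy τ A j U ≠ ⊥ from this N le_rfl
  intro j hj
  induction j with
  | zero =>
    obtain ⟨v, hv, hv0⟩ := (Submodule.ne_bot_iff U).mp hU
    exact (Submodule.ne_bot_iff _).mpr ⟨v, ⟨hv, by simp⟩, hv0⟩
  | succ j ih =>
    have : FiniteDimensional ℂ (fixedBy τ A j U) :=
      Submodule.finiteDimensional_of_le (fixedBy_le τ A j U)
    obtain ⟨v, hv, hv0, hvf⟩ := exists_fixed_step τ (A j) (hA j hj) (T j) (hT j hj)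
      (fixedBy τ A j U) (ih (by omega))
      (fun a ha => fixedBy_stable τ A j U a (hUs a) fun i hi b hb => hAn j hj i hi a ha b hb)
      (fun p hp => fixedBy_stable τ A j U _ (hUs _) fun i hi b hb => hTn j hj i hi p hp b hb)
    refine (Submodule.ne_bot_iff _).mpr ⟨v, ⟨hv.1, fun i hi a ha => ?_⟩, hv0⟩
    rcases Nat.lt_succ_iff_lt_or_eq.mp hi with h | rfl
    · exact hv.2 i h a ha
    · exact hvf a ha

end Kolchin

end

section

open MvPolynomial Kronecker Finset LinearMap

section Fischer

variable {σ : Type*}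

def multiFactorial (m : σ →₀ ℕ) : ℕ := m.prod fun _ e => e.factorial

theorem multiFactorial_add_single (m : σ →₀ ℕ) (s : σ) :
    multiFactorial (m + Finsupp.single s 1) = multiFactorial m * (m s + 1) := by
  classical
  unfold multiFactorial
  have h1 : (m + Finsupp.single s 1).prod (fun _ e => e.factorial) =
      ∏ t ∈ insert s m.support, ((m + Finsupp.single s 1 : σ →₀ ℕ) t).factorial := by
    refine Finsupp.prod_of_support_subset _ ?_ _ (by simp)
    intro t ht
    by_contra h
    simp only [mem_insert, Finsupp.mem_support_iff, not_or, not_not] at h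
    simp [h.2, Ne.symm h.1] at ht
  have h2 : m.prod (fun _ e => e.factorial) = ∏ t ∈ insert s m.support, (m t).factorial :=
    Finsupp.prod_of_support_subset _ (subset_insert _ _) _ (by simp)
  rw [h1, h2, ← mul_prod_erase _ _ (mem_insert_self s _),
    ← mul_prod_erase _ (fun t => (m t).factorial) (mem_insert_self s _)]
  have h3 : ∏ t ∈ (insert s m.support).erase s, ((m + Finsupp.single s 1 : σ →₀ ℕ) t).factorial =
      ∏ t ∈ (insert s m.support).erase s, (m t).factorial := by
    refine prod_congr rfl fun t ht => ?_
    rw [Finsupp.add_apply, Finsupp.single_eq_of_ne (ne_of_mem_erase ht), add_zero]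
  rw [h3]
  simp only [Finsupp.add_apply, Finsupp.single_eq_same, Nat.factorial_succ]
  ring

/-- The bilinear form for which monomials are orthogonal of norm `m!`. -/
def fischer : MvPolynomial σ ℂ →ₗ[ℂ] MvPolynomial σ ℂ →ₗ[ℂ] ℂ :=
  (basisMonomials σ ℂ).constr ℂ fun m => (multiFactorial m : ℂ) • lcoeff ℂ m

theorem fischer_monomial (m : σ →₀ ℕ) (c : ℂ) (g : MvPolynomial σ ℂ) :
    fischer (monomial m c) g = c * (multiFactorial m * coeff m g) := by
  have h : (monomial m c : MvPolynomial σ ℂ) = c • basisMonomials σ ℂ m := by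
    simp [coe_basisMonomials, smul_monomial]
  rw [h, map_smul, fischer, Module.Basis.constr_basis]
  simp

theorem fischer_X_mul (s : σ) (f g : MvPolynomial σ ℂ) :
    fischer (X s * f) g = fischer f (pderiv s g) := by
  induction f using MvPolynomial.induction_on' with
  | add p q hp hq => rw [mul_add, map_add, map_add, LinearMap.add_apply, LinearMap.add_apply, hp, hq]
  | monomial m c =>
    rw [X, monomial_mul, fischer_monomial, fischer_monomial, coeff_pderiv, add_comm _ m,
      multiFactorial_add_single]
    push_cast
    ring

variable [Fintype σ] [DecidableEq σ]

/-- Linear substitution of variables. -/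
def subst (A : Matrix σ σ ℂ) : MvPolynomial σ ℂ →ₐ[ℂ] MvPolynomial σ ℂ :=
  aeval fun s => ∑ r, A r s • X r

@[simp] theorem subst_X (A : Matrix σ σ ℂ) (s : σ) : subst A (X s) = ∑ r, A r s • X r := by
  simp [subst]

theorem eval_subst (A : Matrix σ σ ℂ) (f : MvPolynomial σ ℂ) (x : σ → ℂ) :
    eval x (subst A f) = eval (x ᵥ* A) f := by
  have : (aeval x).comp (subst A) = aeval (R := ℂ) (x ᵥ* A) := by
    ext s
    simp only [AlgHom.comp_apply, subst_X, map_sum, map_smul, aeval_X]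
    simp [vecMul, dotProduct, mul_comm]
  exact congrArg (fun h => h f) this

theorem coeff_zero_subst (A : Matrix σ σ ℂ) (f : MvPolynomial σ ℂ) :
    coeff 0 (subst A f) = coeff 0 f := by
  have h : ∀ g : MvPolynomial σ ℂ, coeff 0 g = eval 0 g := fun g => by
    rw [eval_zero, constantCoeff_eq]
  rw [h, h, eval_subst]
  simp

theorem pderiv_subst (A : Matrix σ σ ℂ) (f : MvPolynomial σ ℂ) (s : σ) :
    pderiv s (subst A f) = ∑ r, A s r • subst A (pderiv r f) := by
  induction f using MvPolynomial.induction_on with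
  | C a => simp [subst]
  | add p q hp hq => simp only [map_add, hp, hq, smul_add, sum_add_distrib]
  | mul_X p t hp =>
    have hX : pderiv s (subst A (X t)) = C (A s t) := by
      rw [subst_X, map_sum, sum_eq_single s]
      · rw [Derivation.map_smul, pderiv_X_self, smul_eq_C_mul, mul_one]
      · intro r _ hr
        rw [Derivation.map_smul, pderiv_X_of_ne hr, smul_zero]
      · simp
    have h2 : ∀ r, pderiv r (p * X t) = p * (if r = t then 1 else 0) + X t * pderiv r p := by
      intro r
      rw [Derivation.leibniz, smul_eq_mul, smul_eq_mul, pderiv_X, Pi.single_apply]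
      simp [eq_comm]
    rw [map_mul, Derivation.leibniz, hX, hp]
    simp only [h2, map_add, map_mul, smul_add, sum_add_distrib, smul_eq_mul]
    congr 1
    · rw [sum_eq_single t]
      · simp [smul_eq_C_mul, mul_comm]
      · intro r _ hr; simp [hr]
      · simp
    · rw [mul_sum]
      refine sum_congr rfl fun r _ => ?_
      rw [mul_smul_comm]

theorem fischer_subst (A : Matrix σ σ ℂ) (f g : MvPolynomial σ ℂ) :
    fischer (subst A f) g = fischer f (subst Aᵀ g) := by
  induction f using MvPolynomial.induction_on generalizing g with
  | C a =>
    have : subst A (C a) = C a := by simp [subst]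
    rw [this, C_apply, fischer_monomial, fischer_monomial, coeff_zero_subst]
  | add p q hp hq => simp only [map_add, LinearMap.add_apply, hp, hq]
  | mul_X p t hp =>
    rw [map_mul, mul_comm, mul_comm p, fischer_X_mul, pderiv_subst, subst_X, sum_mul,
      map_sum, map_sum, LinearMap.sum_apply]
    refine sum_congr rfl fun r _ => ?_
    rw [smul_mul_assoc, map_smul, LinearMap.smul_apply, fischer_X_mul, hp, map_smul,
      transpose_apply]

theorem fischer_comm {σ : Type*} (f g : MvPolynomial σ ℂ) : fischer f g = fischer g f := by
  classical
  induction f using MvPolynomial.induction_on' with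
  | add p q hp hq => simp only [map_add, LinearMap.add_apply, hp, hq]
  | monomial m c =>
    induction g using MvPolynomial.induction_on' with
    | add p q hp hq => simp only [map_add, LinearMap.add_apply, hp, hq]
    | monomial n d =>
      rw [fischer_monomial, fischer_monomial, coeff_monomial, coeff_monomial]
      by_cases h : m = n
      · subst h; simp; ring
      · simp [h, Ne.symm h]

/-- Coefficientwise complex conjugation. -/
def conjP {σ : Type*} : MvPolynomial σ ℂ →ₗ⋆[ℂ] MvPolynomial σ ℂ where
  toFun f := map (starRingEnd ℂ) f
  map_add' := map_add _
  map_smul' c f := by simp [smul_eq_C_mul]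

theorem conjP_apply {σ : Type*} (f : MvPolynomial σ ℂ) : conjP f = map (starRingEnd ℂ) f := rfl

theorem conjP_subst (A : Matrix σ σ ℂ) (f : MvPolynomial σ ℂ) :
    conjP (subst A f) = subst (A.map star) (conjP f) := by
  simp only [conjP_apply]
  induction f using MvPolynomial.induction_on with
  | C a => simp [subst]
  | add p q hp hq => simp only [map_add, hp, hq]
  | mul_X p t hp =>
    simp only [map_mul, hp, map_X, subst_X, map_sum]
    congr 1
    simp [smul_eq_C_mul]

/-- The hermitian Fischer form. -/
def fischerH {σ : Type*} : MvPolynomial σ ℂ →ₗ⋆[ℂ] MvPolynomial σ ℂ →ₗ[ℂ] ℂ :=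
  fischer.comp conjP

theorem fischerH_apply {σ : Type*} (f g : MvPolynomial σ ℂ) :
    fischerH f g = fischer (conjP f) g := rfl

theorem fischer_conj {σ : Type*} (f g : MvPolynomial σ ℂ) :
    star (fischer f g) = fischer (conjP f) (conjP g) := by
  induction f using MvPolynomial.induction_on' with
  | add p q hp hq => simp only [map_add, LinearMap.add_apply, star_add, hp, hq]
  | monomial m c =>
    rw [conjP_apply, map_monomial, fischer_monomial, fischer_monomial, conjP_apply, coeff_map]
    simp

theorem conjP_conjP {σ : Type*} (f : MvPolynomial σ ℂ) : conjP (conjP f) = f := by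
  ext m
  simp [conjP_apply, coeff_map]

theorem fischerH_symm {σ : Type*} (f g : MvPolynomial σ ℂ) :
    star (fischerH f g) = fischerH g f := by
  rw [fischerH_apply, fischer_conj, conjP_conjP, fischer_comm, fischerH_apply]

theorem fischerH_pos {σ : Type*} (f : MvPolynomial σ ℂ) (hf : f ≠ 0) : 0 < (fischerH f f).re := by
  have h : fischerH f f = ∑ m ∈ f.support, ((multiFactorial m * Complex.normSq (coeff m f) : ℝ) : ℂ) := by
    rw [fischerH_apply, fischer_comm]
    conv_lhs => rw [f.as_sum]
    rw [map_sum, LinearMap.sum_apply]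
    refine sum_congr rfl fun m _ => ?_
    have : conjP (∑ v ∈ f.support, monomial v (coeff v f)) = conjP f := by rw [← f.as_sum]
    rw [this, fischer_monomial, conjP_apply, coeff_map, Complex.ofReal_mul, Complex.normSq_eq_conj_mul_self]
    push_cast
    ring
  rw [h, ← Complex.ofReal_sum, Complex.ofReal_re]
  refine sum_pos (fun m hm => ?_) (support_nonempty.mpr hf)
  refine mul_pos ?_ (Complex.normSq_pos.mpr (mem_support_iff.mp hm))
  exact_mod_cast prod_pos fun _ _ => Nat.factorial_pos _

theorem fischerH_subst (A : Matrix σ σ ℂ) (f g : MvPolynomial σ ℂ) :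
    fischerH (subst A f) g = fischerH f (subst Aᴴ g) := by
  rw [fischerH_apply, conjP_subst, fischer_subst]
  rfl

theorem totalDegree_subst_le (A : Matrix σ σ ℂ) (f : MvPolynomial σ ℂ) :
    (subst A f).totalDegree ≤ f.totalDegree := by
  conv_lhs => rw [f.as_sum, map_sum]
  refine totalDegree_finsetSum_le fun m hm => ?_
  have h1 : (monomial m (coeff m f)).IsHomogeneous m.degree := isHomogeneous_monomial _ rfl
  have h2 : (subst A (monomial m (coeff m f))).IsHomogeneous (1 * m.degree) := by
    refine h1.aeval _ fun s => ?_
    refine IsHomogeneous.sum _ _ _ fun r _ => ?_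
    rw [smul_eq_C_mul]
    simpa using (isHomogeneous_C σ (A r s)).mul (isHomogeneous_X ℂ r)
  refine h2.totalDegree_le.trans ?_
  rw [one_mul]
  exact le_totalDegree hm

end Fischer

section Matrices

abbrev P (m n : ℕ) := MvPolynomial (Fin m × Fin n) ℂ

variable {m n : ℕ}

/-- Evaluation of a polynomial in matrix entries. -/
def ev (M : Mat m n) : P m n →ₐ[ℂ] ℂ := aeval fun p => M p.1 p.2

theorem ev_eq_eval (M : Mat m n) (f : P m n) :
    ev M f = eval (fun p => M p.1 p.2) f := rfl

@[simp] theorem ev_X (M : Mat m n) (p : Fin m × Fin n) :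
    ev M (X p) = M p.1 p.2 := by simp [ev]

theorem P_ext {f g : P m n} (h : ∀ M, ev M f = ev M g) : f = g := by
  refine MvPolynomial.funext fun x => ?_
  exact h (of fun i j => x (i, j))

def Lact (A : Mat m m) : P m n →ₐ[ℂ] P m n := subst (A ⊗ₖ 1)
def Ract (A : Mat n n) : P m n →ₐ[ℂ] P m n := subst (1 ⊗ₖ A)

theorem ev_Lact (A : Mat m m) (f : P m n) (M : Mat m n) :
    ev M (Lact A f) = ev (Aᵀ * M) f := by
  rw [ev_eq_eval, ev_eq_eval, Lact, eval_subst]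
  congr 2
  ext ⟨i, j⟩
  simp [vecMul, dotProduct, Fintype.sum_prod_type, mul_apply, one_apply, mul_comm]

theorem ev_Ract (A : Mat n n) (f : P m n) (M : Mat m n) :
    ev M (Ract A f) = ev (M * A) f := by
  rw [ev_eq_eval, ev_eq_eval, Ract, eval_subst]
  congr 2
  ext ⟨i, j⟩
  simp [vecMul, dotProduct, Fintype.sum_prod_type, mul_apply, one_apply]

/-- The representation of `GL_m` on polynomials through the row index. -/
def repL (m n : ℕ) : Representation ℂ (GL (Fin m) ℂ) (P m n) where
  toFun g := (Lact (g : Mat m m)).toLinearMap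
  map_one' := by
    ext1 f
    exact ext fun f => P_ext fun M => by simp [ev_Lact]
  map_mul' a b := by
    exact LinearMap.ext fun f => P_ext fun M => by simp [ev_Lact, Matrix.mul_assoc]

/-- The representation of `GL_n` on polynomials through the column index. -/
def repR (m n : ℕ) : Representation ℂ (GL (Fin n) ℂ) (P m n) where
  toFun g := (Ract (g : Mat n n)).toLinearMap
  map_one' := by
    exact ext fun f => P_ext fun M => by simp [ev_Ract]
  map_mul' a b := by
    exact LinearMap.ext fun f => P_ext fun M => by simp [ev_Ract, Matrix.mul_assoc]

theorem repL_apply (g : GL (Fin m) ℂ) (f : P m n) : repL m n g f = Lact (g : Matrix _ _ ℂ) f := rfl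
theorem repR_apply (g : GL (Fin n) ℂ) (f : P m n) : repR m n g f = Ract (g : Matrix _ _ ℂ) f := rfl

theorem Lact_Ract (A : Mat m m) (B : Mat n n) (f : P m n) :
    Lact A (Ract B f) = Ract B (Lact A f) :=
  P_ext fun M => by simp only [ev_Lact, ev_Ract, Matrix.mul_assoc]

theorem fischerH_repL (g : GL (Fin m) ℂ) (f h : P m n) :
    fischerH (repL m n g f) h = fischerH f (repL m n (star g) h) := by
  rw [repL_apply, repL_apply, Lact, Lact, fischerH_subst, conjTranspose_kronecker]
  simp [star_eq_conjTranspose]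

theorem fischerH_repR (g : GL (Fin n) ℂ) (f h : P m n) :
    fischerH (repR m n g f) h = fischerH f (repR m n (star g) h) := by
  rw [repR_apply, repR_apply, Ract, Ract, fischerH_subst, conjTranspose_kronecker]
  simp [star_eq_conjTranspose]

theorem isSubrep_repR (d : ℕ) : IsSubrep (repR m n) (restrictTotalDegree (Fin m × Fin n) ℂ d) := by
  intro g x hx
  rw [mem_restrictTotalDegree] at hx ⊢
  exact (totalDegree_subst_le _ _).trans hx

end Matrices

end

section

open Finset

section GLgroup

variable {n : ℕ}

/-- The standard basis vector with a natural number index. -/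
def ee (n j : ℕ) : Fin n → ℂ := fun i => if (i : ℕ) = j then 1 else 0

theorem ee_dot (j : ℕ) (hj : j < n) (v : Fin n → ℂ) : ee n j ⬝ᵥ v = v ⟨j, hj⟩ := by
  rw [dotProduct, sum_eq_single ⟨j, hj⟩]
  · simp [ee]
  · intro i _ hi
    simp [ee, Fin.ext_iff] at hi ⊢
    simp [hi]
  · simp

theorem dot_ee (j : ℕ) (hj : j < n) (v : Fin n → ℂ) : v ⬝ᵥ ee n j = v ⟨j, hj⟩ := by
  rw [dotProduct_comm, ee_dot j hj]

theorem ee_dot_of_le (j : ℕ) (hj : n ≤ j) (v : Fin n → ℂ) : ee n j ⬝ᵥ v = 0 := by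
  refine sum_eq_zero fun i _ => ?_
  have := i.2
  rw [ee, if_neg (by omega), zero_mul]

theorem ee_dot_ee (i j : ℕ) (h : i ≠ j) : ee n i ⬝ᵥ ee n j = 0 := by
  by_cases hi : i < n
  · rw [ee_dot i hi, ee, if_neg h]
  · rw [ee_dot_of_le i (by omega)]

theorem ee_dot_self (j : ℕ) (hj : j < n) : ee n j ⬝ᵥ ee n j = 1 := by
  rw [ee_dot j hj]; simp [ee]

theorem ee_dot_zero (j : ℕ) (v : Fin n → ℂ) (h : ∀ i : Fin n, (i : ℕ) = j → v i = 0) :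
    ee n j ⬝ᵥ v = 0 := by
  by_cases hj : j < n
  · rw [ee_dot j hj, h _ rfl]
  · exact ee_dot_of_le j (by omega) v

theorem rank_one_mul (u v : Fin n → ℂ) (A : Mat n n) :
    (1 + vecMulVec u v) * A = A + vecMulVec u (v ᵥ* A) := by
  rw [add_mul, one_mul, vecMulVec_mul]

theorem mul_rank_one (u v : Fin n → ℂ) (A : Mat n n) :
    A * (1 + vecMulVec u v) = A + vecMulVec (A *ᵥ u) v := by
  rw [mul_add, mul_one, mul_vecMulVec]

theorem rank_one_mulVec (u v x : Fin n → ℂ) :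
    (1 + vecMulVec u v) *ᵥ x = x + (v ⬝ᵥ x) • u := by
  rw [add_mulVec, one_mulVec, vecMulVec_mulVec]
  ext i; simp

theorem vecMul_rank_one (u v x : Fin n → ℂ) :
    x ᵥ* (1 + vecMulVec u v) = x + (x ⬝ᵥ u) • v := by
  rw [vecMul_add, vecMul_one, vecMul_vecMulVec]

/-- The unipotent element `1 + u vᵀ` for orthogonal `u`, `v`. -/
def unip (u v : Fin n → ℂ) (h : v ⬝ᵥ u = 0) : GL (Fin n) ℂ where
  val := 1 + vecMulVec u v
  inv := 1 + vecMulVec u (-v)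
  val_inv := by
    rw [rank_one_mul, vecMul_rank_one, h]
    ext i j; simp [vecMulVec]
  inv_val := by
    rw [rank_one_mul, vecMul_rank_one, neg_dotProduct, h]
    ext i j; simp [vecMulVec]

/-- The diagonal element with `s` at position `j`. -/
def tor (n j : ℕ) (s : ℂˣ) : GL (Fin n) ℂ where
  val := diagonal fun i => if (i : ℕ) = j then (s : ℂ) else 1
  inv := diagonal fun i => if (i : ℕ) = j then ((s⁻¹ : ℂˣ) : ℂ) else 1
  val_inv := by
    rw [diagonal_mul_diagonal, ← diagonal_one]
    congr 1
    ext i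
    by_cases h : (i : ℕ) = j <;> simp [h]
  inv_val := by
    rw [diagonal_mul_diagonal, ← diagonal_one]
    congr 1
    ext i
    by_cases h : (i : ℕ) = j <;> simp [h]

theorem tor_val (j : ℕ) (s : ℂˣ) : (tor n j s : Mat n n) =
    1 + vecMulVec (((s : ℂ) - 1) • ee n j) (ee n j) := by
  ext a b
  by_cases hab : a = b
  · subst hab
    by_cases h : (a : ℕ) = j <;> simp [tor, vecMulVec, ee, h]
  · have : ¬ ((a : ℕ) = j ∧ (b : ℕ) = j) := fun h => hab (Fin.ext (h.1.trans h.2.symm))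
    by_cases h : (a : ℕ) = j <;> by_cases h' : (b : ℕ) = j <;>
      simp_all [tor, vecMulVec, ee]

theorem tor_inv (j : ℕ) (s : ℂˣ) : (tor n j s)⁻¹ = tor n j s⁻¹ := by
  ext1
  rfl

/-- The subgroup of elements `1 + e_j ηᵀ` with `η` supported beyond `j`. -/
def Aplus (n j : ℕ) : Subgroup (GL (Fin n) ℂ) where
  carrier := {g | ∃ η : Fin n → ℂ, (∀ i : Fin n, (i : ℕ) ≤ j → η i = 0) ∧
    (g : Mat n n) = 1 + vecMulVec (ee n j) η}
  mul_mem' := by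
    rintro a b ⟨η, h, ha⟩ ⟨ξ, h', hb⟩
    refine ⟨η + ξ, fun i hi => by simp [h i hi, h' i hi], ?_⟩
    have : η ⬝ᵥ ee n j = 0 := by
      rw [dotProduct_comm]; exact ee_dot_zero _ _ fun i hi => h i hi.le
    rw [Units.val_mul, ha, hb, rank_one_mul, vecMul_rank_one, this, zero_smul, add_zero,
      vecMulVec_add]
    abel
  one_mem' := ⟨0, by simp, by ext i j; simp [vecMulVec]⟩
  inv_mem' := by
    rintro a ⟨η, h, ha⟩
    have h0 : η ⬝ᵥ ee n j = 0 := by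
      rw [dotProduct_comm]; exact ee_dot_zero _ _ fun i hi => h i hi.le
    have : a = unip (ee n j) η h0 := Units.ext ha
    rw [this]
    exact ⟨-η, fun i hi => by simp [h i hi], rfl⟩

/-- The subgroup of elements `1 + y e_jᵀ` with `y` supported beyond `j`. -/
def Aminus (n j : ℕ) : Subgroup (GL (Fin n) ℂ) where
  carrier := {g | ∃ y : Fin n → ℂ, (∀ i : Fin n, (i : ℕ) ≤ j → y i = 0) ∧
    (g : Mat n n) = 1 + vecMulVec y (ee n j)}
  mul_mem' := by
    rintro a b ⟨y, h, ha⟩ ⟨z, h', hb⟩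
    refine ⟨y + z, fun i hi => by simp [h i hi, h' i hi], ?_⟩
    have : ee n j ⬝ᵥ z = 0 := ee_dot_zero _ _ fun i hi => h' i hi.le
    rw [Units.val_mul, ha, hb, rank_one_mul, vecMul_rank_one, this, zero_smul, add_zero,
      add_vecMulVec]
    abel
  one_mem' := ⟨0, by simp, by ext i j; simp [vecMulVec]⟩
  inv_mem' := by
    rintro a ⟨y, h, ha⟩
    have h0 : ee n j ⬝ᵥ y = 0 := ee_dot_zero _ _ fun i hi => h i hi.le
    have : a = unip y (ee n j) h0 := Units.ext ha
    rw [this]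
    refine ⟨-y, fun i hi => by simp [h i hi], ?_⟩
    change 1 + vecMulVec y (-(ee n j)) = _
    rw [vecMulVec_neg, neg_vecMulVec]

theorem unip_mem_Aplus (j : ℕ) (η : Fin n → ℂ) (h : ∀ i : Fin n, (i : ℕ) ≤ j → η i = 0) (h0) :
    unip (ee n j) η h0 ∈ Aplus n j := ⟨η, h, rfl⟩

theorem unip_mem_Aminus (j : ℕ) (y : Fin n → ℂ) (h : ∀ i : Fin n, (i : ℕ) ≤ j → y i = 0) (h0) :
    unip y (ee n j) h0 ∈ Aminus n j := ⟨y, h, rfl⟩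

theorem Aplus_conj (h : GL (Fin n) ℂ) (i : ℕ) (c : ℂ)
    (h1 : ((h⁻¹ : GL (Fin n) ℂ) : Mat n n) *ᵥ ee n i = c • ee n i)
    (h2 : ∀ η : Fin n → ℂ, (∀ l : Fin n, (l : ℕ) ≤ i → η l = 0) →
      ∀ l : Fin n, (l : ℕ) ≤ i → (η ᵥ* (h : Mat n n)) l = 0) :
    ∀ a ∈ Aplus n i, h⁻¹ * a * h ∈ Aplus n i := by
  rintro a ⟨η, hη, ha⟩
  refine ⟨c • (η ᵥ* (h : Mat n n)), fun l hl => by simp [h2 η hη l hl], ?_⟩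
  rw [Units.val_mul, Units.val_mul, ha, mul_rank_one, add_mul, ← Units.val_mul,
    inv_mul_cancel, Units.val_one, h1, vecMulVec_mul, smul_vecMulVec, vecMulVec_smul]

theorem Aminus_conj (h : GL (Fin n) ℂ) (i : ℕ) (c : ℂ)
    (h1 : ee n i ᵥ* (h : Mat n n) = c • ee n i)
    (h2 : ∀ y : Fin n → ℂ, (∀ l : Fin n, (l : ℕ) ≤ i → y l = 0) →
      ∀ l : Fin n, (l : ℕ) ≤ i →
        (((h⁻¹ : GL (Fin n) ℂ) : Mat n n) *ᵥ y) l = 0) :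
    ∀ a ∈ Aminus n i, h⁻¹ * a * h ∈ Aminus n i := by
  rintro a ⟨y, hy, ha⟩
  refine ⟨c • (((h⁻¹ : GL (Fin n) ℂ) : Mat n n) *ᵥ y),
    fun l hl => by rw [Pi.smul_apply, h2 y hy l hl, smul_zero], ?_⟩
  rw [Units.val_mul, Units.val_mul, ha, mul_rank_one, add_mul, ← Units.val_mul,
    inv_mul_cancel, Units.val_one, vecMulVec_mul, h1, smul_vecMulVec, vecMulVec_smul]

theorem diag_mulVec_ee (d : Fin n → ℂ) (i : ℕ) : ∃ c : ℂ, diagonal d *ᵥ ee n i = c • ee n i := by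
  by_cases hi : i < n
  · refine ⟨d ⟨i, hi⟩, ?_⟩
    ext l
    rw [mulVec_diagonal]
    by_cases h : (l : ℕ) = i
    · subst h; simp
    · simp [ee, h]
  · refine ⟨0, ?_⟩
    ext l
    have := l.2
    rw [mulVec_diagonal, ee, if_neg (by omega)]
    simp

theorem Aplus_conj_diag (h : GL (Fin n) ℂ) (d d' : Fin n → ℂ)
    (hd : (h : Mat n n) = diagonal d)
    (hd' : ((h⁻¹ : GL (Fin n) ℂ) : Mat n n) = diagonal d') (i : ℕ) :
    ∀ a ∈ Aplus n i, h⁻¹ * a * h ∈ Aplus n i := by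
  obtain ⟨c, hc⟩ := diag_mulVec_ee d' i
  refine Aplus_conj h i c (by rw [hd', hc]) fun η hη l hl => ?_
  rw [hd, vecMul_diagonal, hη l hl, zero_mul]

theorem Aminus_conj_diag (h : GL (Fin n) ℂ) (d d' : Fin n → ℂ)
    (hd : (h : Mat n n) = diagonal d)
    (hd' : ((h⁻¹ : GL (Fin n) ℂ) : Mat n n) = diagonal d') (i : ℕ) :
    ∀ a ∈ Aminus n i, h⁻¹ * a * h ∈ Aminus n i := by
  obtain ⟨c, hc⟩ := diag_mulVec_ee d i
  refine Aminus_conj h i c ?_ fun y hy l hl => ?_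
  · rw [hd, ← hc]
    ext l
    rw [vecMul_diagonal, mulVec_diagonal, mul_comm]
  · rw [hd', mulVec_diagonal, hy l hl, mul_zero]

theorem Aplus_comm (j : ℕ) (a b : GL (Fin n) ℂ) (ha : a ∈ Aplus n j) (hb : b ∈ Aplus n j) :
    a * b = b * a := by
  obtain ⟨η, h, ha⟩ := ha
  obtain ⟨ξ, h', hb⟩ := hb
  have h1 : η ⬝ᵥ ee n j = 0 := by
    rw [dotProduct_comm]; exact ee_dot_zero _ _ fun i hi => h i hi.le
  have h2 : ξ ⬝ᵥ ee n j = 0 := by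
    rw [dotProduct_comm]; exact ee_dot_zero _ _ fun i hi => h' i hi.le
  ext1
  rw [Units.val_mul, Units.val_mul, ha, hb, rank_one_mul, rank_one_mul, vecMul_rank_one,
    vecMul_rank_one, h1, h2, zero_smul, zero_smul, add_zero, add_zero]
  abel

theorem Aminus_comm (j : ℕ) (a b : GL (Fin n) ℂ) (ha : a ∈ Aminus n j) (hb : b ∈ Aminus n j) :
    a * b = b * a := by
  obtain ⟨η, h, ha⟩ := ha
  obtain ⟨ξ, h', hb⟩ := hb
  have h1 : ee n j ⬝ᵥ η = 0 := ee_dot_zero _ _ fun i hi => h i hi.le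
  have h2 : ee n j ⬝ᵥ ξ = 0 := ee_dot_zero _ _ fun i hi => h' i hi.le
  ext1
  rw [Units.val_mul, Units.val_mul, ha, hb, rank_one_mul, rank_one_mul, vecMul_rank_one,
    vecMul_rank_one, h1, h2, zero_smul, add_zero]
  abel

theorem rank_one_pow (u v : Fin n → ℂ) (h : v ⬝ᵥ u = 0) (p : ℕ) :
    (1 + vecMulVec u v) ^ p = 1 + vecMulVec ((p : ℂ) • u) v := by
  induction p with
  | zero => simp
  | succ p ih =>
    rw [pow_succ, ih, rank_one_mul, vecMul_rank_one, h, zero_smul, add_zero]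
    push_cast
    rw [add_smul, add_vecMulVec, one_smul]
    abel

/-- The unit of `ℂ` given by a natural number, with `0` replaced by `1`. -/
def natUnit (p : ℕ) : ℂˣ := if h : p = 0 then 1 else Units.mk0 (p : ℂ) (by exact_mod_cast h)

theorem natUnit_val (p : ℕ) (hp : 1 ≤ p) : (natUnit p : ℂ) = p := by
  rw [natUnit, dif_neg (by omega)]; rfl

theorem Aplus_tor (j p : ℕ) (hp : 1 ≤ p) (c : GL (Fin n) ℂ) (hc : c ∈ Aplus n j) :
    c * tor n j (natUnit p)⁻¹ = tor n j (natUnit p)⁻¹ * c ^ p := by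
  obtain ⟨η, h, hc⟩ := hc
  have h1 : η ⬝ᵥ ee n j = 0 := by
    rw [dotProduct_comm]; exact ee_dot_zero _ _ fun i hi => h i hi.le
  have hp0 : (p : ℂ) ≠ 0 := by exact_mod_cast (by omega : p ≠ 0)
  ext1
  rw [Units.val_mul, Units.val_mul, Units.val_pow_eq_pow_val, hc, rank_one_pow _ _ h1,
    rank_one_mul, mul_rank_one, tor_val, vecMul_rank_one, rank_one_mulVec]
  by_cases hj : j < n
  · rw [dotProduct_smul, h1, smul_zero, zero_smul, add_zero, dotProduct_smul, ee_dot_self j hj,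
      Units.val_inv_eq_inv_val, natUnit_val p hp]
    congr 2
    ext i
    simp
    field_simp
    ring
  · have : ee n j = 0 := by
      ext i; have := i.2; rw [ee, if_neg (by omega)]; rfl
    rw [this]; simp

theorem Aminus_tor (j p : ℕ) (hp : 1 ≤ p) (c : GL (Fin n) ℂ) (hc : c ∈ Aminus n j) :
    c * tor n j (natUnit p) = tor n j (natUnit p) * c ^ p := by
  obtain ⟨y, h, hc⟩ := hc
  have h1 : ee n j ⬝ᵥ y = 0 := ee_dot_zero _ _ fun i hi => h i hi.le
  ext1
  rw [Units.val_mul, Units.val_mul, Units.val_pow_eq_pow_val, hc, rank_one_pow _ _ h1,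
    rank_one_mul, mul_rank_one, tor_val, vecMul_rank_one, rank_one_mulVec]
  by_cases hj : j < n
  · rw [dotProduct_smul, dotProduct_smul, h1, smul_zero, zero_smul, add_zero, ee_dot_self j hj,
      natUnit_val p hp]
    congr 1
    ext a b
    simp [vecMulVec]
    ring
  · have : ee n j = 0 := by
      ext i; have := i.2; rw [ee, if_neg (by omega)]; rfl
    rw [this]; simp

theorem Aplus_inv_val (j : ℕ) (a : GL (Fin n) ℂ) (η : Fin n → ℂ)
    (h : ∀ i : Fin n, (i : ℕ) ≤ j → η i = 0)
    (ha : (a : Mat n n) = 1 + vecMulVec (ee n j) η) :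
    ((a⁻¹ : GL (Fin n) ℂ) : Mat n n) = 1 + vecMulVec (ee n j) (-η) := by
  have h0 : η ⬝ᵥ ee n j = 0 := by
    rw [dotProduct_comm]; exact ee_dot_zero _ _ fun i hi => h i hi.le
  have : a = unip (ee n j) η h0 := Units.ext ha
  rw [this]; rfl

theorem Aplus_normal (i j : ℕ) (hij : i < j) (h : GL (Fin n) ℂ) (hh : h ∈ Aplus n j) :
    ∀ a ∈ Aplus n i, h⁻¹ * a * h ∈ Aplus n i := by
  obtain ⟨η, hη, hh⟩ := hh
  refine Aplus_conj h i 1 ?_ ?_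
  · rw [Aplus_inv_val j h η hη hh, rank_one_mulVec, dotProduct_comm,
      ee_dot_zero _ _ fun l hl => by simp [hη l (by omega)]]
    simp
  · intro ξ hξ l hl
    rw [hh, vecMul_rank_one, Pi.add_apply, hξ l hl, Pi.smul_apply, hη l (by omega)]
    simp

theorem Aminus_normal (i j : ℕ) (hij : i < j) (h : GL (Fin n) ℂ) (hh : h ∈ Aminus n j) :
    ∀ a ∈ Aminus n i, h⁻¹ * a * h ∈ Aminus n i := by
  have hh' := (Aminus n j).inv_mem hh
  obtain ⟨η, hη, hh⟩ := hh
  obtain ⟨ξ, hξ, hh'⟩ := hh'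
  refine Aminus_conj h i 1 ?_ ?_
  · rw [hh, vecMul_rank_one, ee_dot_zero _ _ fun l hl => hη l (by omega)]
    simp
  · intro y hy l hl
    rw [hh', rank_one_mulVec, Pi.add_apply, hy l hl, Pi.smul_apply, hξ l (by omega)]
    simp

theorem tor_diag (j : ℕ) (s : ℂˣ) : ∃ d, (tor n j s : Mat n n) = diagonal d :=
  ⟨_, rfl⟩

variable {X : Type*} [AddCommGroup X] [Module ℂ X]

theorem fixedBy_Aplus_ne_bot (τ : Representation ℂ (GL (Fin n) ℂ) X) (U : Submodule ℂ X)
    (hUs : IsSubrep τ U) [FiniteDimensional ℂ U] (hU : U ≠ ⊥) : fixedBy τ (Aplus n) n U ≠ ⊥ :=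
  fixedBy_ne_bot τ (Aplus n) n (fun i _ a ha b hb => Aplus_comm i a b ha hb)
    (fun i p => tor n i (natUnit p)⁻¹) (fun i _ p hp c hc => Aplus_tor i p hp c hc)
    (fun j _ i hi h hh => Aplus_normal i j hi h hh)
    (fun j _ i _ p _ => Aplus_conj_diag _ _ _ rfl rfl i) U hUs hU

theorem fixedBy_Aminus_ne_bot (τ : Representation ℂ (GL (Fin n) ℂ) X) (U : Submodule ℂ X)
    (hUs : IsSubrep τ U) [FiniteDimensional ℂ U] (hU : U ≠ ⊥) : fixedBy τ (Aminus n) n U ≠ ⊥ :=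
  fixedBy_ne_bot τ (Aminus n) n (fun i _ a ha b hb => Aminus_comm i a b ha hb)
    (fun i p => tor n i (natUnit p)) (fun i _ p hp c hc => Aminus_tor i p hp c hc)
    (fun j _ i hi h hh => Aminus_normal i j hi h hh)
    (fun j _ i _ p _ => Aminus_conj_diag _ _ _ rfl rfl i) U hUs hU

end GLgroup

end

section

open Finset Submodule LinearMap Polynomial Module

/-- A finite set of nonzero vectors with support in `[j, n)` is avoided by a vector of the form
`e_j + η` with `η` supported beyond `j`. -/
theorem exists_avoid {n : ℕ} (j : ℕ) (hj : j < n) {ι : Type*} (s : Finset ι) (v : ι → Fin n → ℂ)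
    (h0 : ∀ a ∈ s, v a ≠ 0) (hs : ∀ a ∈ s, ∀ i : Fin n, (i : ℕ) < j → v a i = 0) :
    ∃ η : Fin n → ℂ, (∀ i : Fin n, (i : ℕ) ≤ j → η i = 0) ∧
      ∀ a ∈ s, (ee n j + η) ⬝ᵥ v a ≠ 0 := by
  set q : ι → Polynomial ℂ := fun a => ∑ i : Fin n, C (v a i) * X ^ ((i : ℕ) - j)
  have hq : ∀ a ∈ s, q a ≠ 0 := by
    intro a ha hqa
    apply h0 a ha
    ext i
    by_cases hi : (i : ℕ) < j
    · exact hs a ha i hi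
    · have := congrArg (fun p => coeff p ((i : ℕ) - j)) hqa
      simp only [q, finsetSum_coeff, coeff_C_mul, coeff_X_pow,
        coeff_zero] at this
      rw [sum_eq_single i] at this
      · simpa using this
      · intro b _ hb
        by_cases hbj : (b : ℕ) < j
        · rw [hs a ha b hbj, zero_mul]
        · rw [if_neg, mul_zero]
          intro h
          apply hb
          ext
          omega
      · simp
  have hprod : ∏ a ∈ s, q a ≠ 0 := prod_ne_zero_iff.mpr hq
  obtain ⟨t, ht⟩ : ∃ t : ℂ, (∏ a ∈ s, q a).eval t ≠ 0 := by
    by_contra h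
    push Not at h
    exact hprod (funext fun t => by rw [h t, eval_zero])
  rw [eval_prod, prod_ne_zero_iff] at ht
  refine ⟨fun i => if (i : ℕ) ≤ j then 0 else t ^ ((i : ℕ) - j), fun i hi => by simp [hi], ?_⟩
  intro a ha
  convert ht a ha using 1
  simp only [q, eval_finsetSum, eval_mul, eval_C,
    eval_pow, eval_X, dotProduct]
  refine sum_congr rfl fun i _ => ?_
  rw [mul_comm]
  by_cases hij : (i : ℕ) < j
  · rw [hs a ha i hij]; simp
  · by_cases h2 : (i : ℕ) = j
    · simp [ee, h2]
    · simp [ee, h2, show ¬ (i : ℕ) ≤ j by omega]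

section GLchain

variable {n : ℕ}

/-- Matrices that are the identity on the first `j` rows and columns. -/
def stab (n j : ℕ) : Subgroup (GL (Fin n) ℂ) where
  carrier := {g | ∀ i < j, (g : Mat n n) *ᵥ ee n i = ee n i ∧
    ee n i ᵥ* (g : Mat n n) = ee n i}
  mul_mem' := by
    intro a b ha hb i hi
    rw [Units.val_mul, ← mulVec_mulVec, ← vecMul_vecMul, (ha i hi).2, (hb i hi).1]
    exact ⟨(ha i hi).1, (hb i hi).2⟩
  one_mem' := by
    intro i _
    simp
  inv_mem' := by
    intro a ha i hi
    constructor
    · conv_lhs => rw [← (ha i hi).1]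
      rw [mulVec_mulVec, ← Units.val_mul, inv_mul_cancel, Units.val_one, one_mulVec]
    · conv_lhs => rw [← (ha i hi).2]
      rw [vecMul_vecMul, ← Units.val_mul, mul_inv_cancel, Units.val_one, vecMul_one]

theorem Aplus_le_stab (j : ℕ) : Aplus n j ≤ stab n j := by
  rintro a ⟨η, hη, ha⟩ i hi
  rw [ha, rank_one_mulVec, vecMul_rank_one, ee_dot_ee i j hi.ne, dotProduct_comm,
    ee_dot_zero _ _ fun l hl => hη l (by omega)]
  simp

theorem Aminus_le_stab (j : ℕ) : Aminus n j ≤ stab n j := by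
  rintro a ⟨η, hη, ha⟩ i hi
  rw [ha, rank_one_mulVec, vecMul_rank_one, ee_dot_ee j i hi.ne',
    ee_dot_zero _ _ fun l hl => hη l (by omega)]
  simp

theorem tor_mem_stab (j : ℕ) (s : ℂˣ) : tor n j s ∈ stab n j := by
  intro i hi
  rw [tor_val, rank_one_mulVec, vecMul_rank_one, ee_dot_ee j i hi.ne', dotProduct_smul,
    ee_dot_ee i j hi.ne]
  simp

theorem tor_comm_stab (j : ℕ) (s : ℂˣ) (g : GL (Fin n) ℂ) (hg : g ∈ stab n (j + 1)) :
    tor n j s * g = g * tor n j s := by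
  ext1
  rw [Units.val_mul, Units.val_mul, tor_val, rank_one_mul, mul_rank_one, mulVec_smul,
    (hg j (by omega)).1, (hg j (by omega)).2]

theorem eq_one_of_mem_stab (g : GL (Fin n) ℂ) (hg : g ∈ stab n n) : g = 1 := by
  ext a b
  have := congrFun (hg b b.2).1 a
  rw [mulVec, dot_ee b b.2] at this
  rw [show (⟨(b : ℕ), b.2⟩ : Fin n) = b from rfl] at this
  rw [this]
  simp [ee, one_apply, Fin.ext_iff]

variable {X : Type*} [AddCommGroup X] [Module ℂ X]

theorem GL_factor (j : ℕ) (hj : j < n) (g : GL (Fin n) ℂ) (hg : g ∈ stab n j)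
    (hgj : g ⟨j, hj⟩ ⟨j, hj⟩ ≠ 0) :
    ∃ a ∈ Aminus n j, ∃ s : ℂˣ, ∃ g' ∈ stab n (j + 1), ∃ c ∈ Aplus n j,
      g = a * tor n j s * g' * c := by
  set s : ℂˣ := Units.mk0 _ hgj
  have hsv : (s : ℂ) = g ⟨j, hj⟩ ⟨j, hj⟩ := rfl
  have hs0 : (s : ℂ) ≠ 0 := s.ne_zero
  set M : Mat n n := (g : Mat n n) with hM
  set y : Fin n → ℂ := fun i => if (i : ℕ) ≤ j then 0 else (s : ℂ)⁻¹ * (M *ᵥ ee n j) i with hy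
  set η : Fin n → ℂ := fun i => if (i : ℕ) ≤ j then 0 else (s : ℂ)⁻¹ * (ee n j ᵥ* M) i with hη
  have hyz : ∀ i : Fin n, (i : ℕ) ≤ j → y i = 0 := fun i hi => by simp [hy, hi]
  have hηz : ∀ i : Fin n, (i : ℕ) ≤ j → η i = 0 := fun i hi => by simp [hη, hi]
  have hyj : ee n j ⬝ᵥ y = 0 := ee_dot_zero _ _ fun i hi => hyz i hi.le
  have hηj : η ⬝ᵥ ee n j = 0 := by
    rw [dotProduct_comm]; exact ee_dot_zero _ _ fun i hi => hηz i hi.le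
  have hcol : M *ᵥ ee n j = (s : ℂ) • (ee n j + y) := by
    ext i
    rcases lt_trichotomy (i : ℕ) j with h | h | h
    · have : ee n i ⬝ᵥ (M *ᵥ ee n j) = 0 := by
        rw [dotProduct_mulVec, (hg i h).2, ee_dot_ee _ _ h.ne]
      rw [ee_dot i i.2] at this
      rw [show (⟨(i : ℕ), i.2⟩ : Fin n) = i from rfl] at this
      rw [this, Pi.smul_apply, Pi.add_apply, hyz i h.le, ee, if_neg h.ne]
      simp
    · have : i = ⟨j, hj⟩ := Fin.ext h
      subst this
      rw [mulVec, dot_ee j hj, Pi.smul_apply, Pi.add_apply, hyz _ le_rfl, ee, if_pos rfl, hsv]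
      simp
    · rw [Pi.smul_apply, Pi.add_apply, ee, if_neg h.ne', hy]
      simp only [show ¬ (i : ℕ) ≤ j by omega, if_false]
      rw [zero_add, smul_eq_mul, mul_inv_cancel_left₀ hs0]
  have hrow : ee n j ᵥ* M = (s : ℂ) • (ee n j + η) := by
    ext i
    rcases lt_trichotomy (i : ℕ) j with h | h | h
    · have : (ee n j ᵥ* M) ⬝ᵥ ee n i = 0 := by
        rw [← dotProduct_mulVec, (hg i h).1, ee_dot_ee _ _ h.ne']
      rw [dot_ee i i.2] at this
      rw [show (⟨(i : ℕ), i.2⟩ : Fin n) = i from rfl] at this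
      rw [this, Pi.smul_apply, Pi.add_apply, hηz i h.le, ee, if_neg h.ne]
      simp
    · have : i = ⟨j, hj⟩ := Fin.ext h
      subst this
      rw [vecMul, ee_dot j hj, Pi.smul_apply, Pi.add_apply, hηz _ le_rfl, ee, if_pos rfl, hsv]
      simp
    · rw [Pi.smul_apply, Pi.add_apply, ee, if_neg h.ne', hη]
      simp only [show ¬ (i : ℕ) ≤ j by omega, if_false]
      rw [zero_add, smul_eq_mul, mul_inv_cancel_left₀ hs0]
  set a := unip y (ee n j) hyj
  set c := unip (ee n j) η hηj
  have ha : a ∈ Aminus n j := unip_mem_Aminus j y hyz hyj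
  have hc : c ∈ Aplus n j := unip_mem_Aplus j η hηz hηj
  have hinv : ((a⁻¹ : GL (Fin n) ℂ) : Mat n n) = 1 + vecMulVec y (-(ee n j)) := rfl
  have hcinv : ((c⁻¹ : GL (Fin n) ℂ) : Mat n n) = 1 + vecMulVec (ee n j) (-η) := rfl
  refine ⟨a, ha, s, (tor n j s)⁻¹ * a⁻¹ * g * c⁻¹, ?_, c, hc, by group⟩
  have hmem : (tor n j s)⁻¹ * a⁻¹ * g * c⁻¹ ∈ stab n j := by
    refine mul_mem (mul_mem (mul_mem (inv_mem (tor_mem_stab j s)) (inv_mem ?_)) hg) (inv_mem ?_)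
    · exact Aminus_le_stab j ha
    · exact Aplus_le_stab j hc
  intro i hi
  rcases Nat.lt_succ_iff_lt_or_eq.mp hi with h | rfl
  · exact hmem i h
  · rw [Units.val_mul, Units.val_mul, Units.val_mul, tor_inv]
    have hsinv : ((s⁻¹ : ℂˣ) : ℂ) = (s : ℂ)⁻¹ := Units.val_inv_eq_inv_val s
    constructor
    · rw [← mulVec_mulVec, ← mulVec_mulVec, ← mulVec_mulVec, hcinv, rank_one_mulVec,
        neg_dotProduct, hηj, neg_zero, zero_smul, add_zero, ← hM, hcol, hinv, rank_one_mulVec,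
        tor_val, rank_one_mulVec, hsinv]
      simp only [neg_dotProduct, dotProduct_smul, dotProduct_add, hyj, ee_dot_self i hj, smul_eq_mul,
        add_zero, mul_one]
      ext l
      simp only [Pi.add_apply, Pi.smul_apply, smul_eq_mul]
      simp only [mul_zero, neg_zero, mul_neg, add_zero, mul_one]
      field_simp
      ring
    · rw [← vecMul_vecMul, ← vecMul_vecMul, ← vecMul_vecMul, tor_val, vecMul_rank_one,
        dotProduct_smul, ee_dot_self i hj, hsinv]
      have e1 : ee n i + (((s : ℂ)⁻¹ - 1) • (1 : ℂ)) • ee n i = (s : ℂ)⁻¹ • ee n i := by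
        ext l; simp; ring
      rw [e1, hinv, vecMul_rank_one, smul_dotProduct, hyj, smul_zero, zero_smul, add_zero, ← hM,
        smul_vecMul, hrow, smul_smul, inv_mul_cancel₀ hs0, one_smul, hcinv, vecMul_rank_one,
        add_dotProduct, hηj, ee_dot_self i hj]
      simp

/-- A functional invariant under the lower unipotent elements that kills a highest weight vector
kills its orbit. -/
theorem GL_kill (τ : Representation ℂ (GL (Fin n) ℂ) X) (Φ : X →ₗ[ℂ] ℂ) (z : X)
    (U : Submodule ℂ X) (hU : IsSubrep τ U) [FiniteDimensional ℂ U] (hzU : z ∈ U)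
    (hΦ : ∀ j < n, ∀ c ∈ Aminus n j, ∀ x ∈ U, Φ (τ c x) = Φ x)
    (hz : ∀ j < n, ∀ c ∈ Aplus n j, τ c z = z)
    (ht : ∀ j < n, ∀ s, ∃ c : ℂ, τ (tor n j s) z = c • z) (h0 : Φ z = 0) :
    ∀ g, Φ (τ g z) = 0 := by
  suffices ∀ d ≤ n, ∀ g ∈ stab n (n - d), Φ (τ g z) = 0 from fun g => this n le_rfl g (by
    intro i hi; omega)
  intro d hd
  induction d with
  | zero =>
    intro g hg
    rw [Nat.sub_zero] at hg
    rw [eq_one_of_mem_stab g hg]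
    simpa using h0
  | succ d ih =>
    have ih := ih (by omega)
    set j := n - (d + 1)
    have hjn : j < n := by omega
    rw [show n - d = j + 1 by omega] at ih
    refine density τ Φ z (stab n j) U hU hzU (fun g => g ⟨j, hjn⟩ ⟨j, hjn⟩ ≠ 0) ?_ ?_
    · intro g hg hgj
      obtain ⟨a, ha, s, g', hg', c, hc, rfl⟩ := GL_factor j hjn g hg hgj
      obtain ⟨χ, hχ⟩ := ht j hjn s
      rw [mul_assoc, mul_assoc, map_mul, End.mul_apply, hΦ j hjn a ha _ (hU _ _ hzU), ← mul_assoc,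
        tor_comm_stab j s g' hg', mul_assoc, map_mul, map_mul, End.mul_apply,
        End.mul_apply, hz j hjn c hc, hχ, map_smul, map_smul, ih g' hg', smul_zero]
    · intro s hs
      obtain ⟨η, hη, hav⟩ := exists_avoid j hjn s
        (fun g => (g : Mat n n) *ᵥ ee n j) (by
          intro g hg h
          have h1 : ((g⁻¹ : GL (Fin n) ℂ) : Mat n n) *ᵥ
              ((g : Mat n n) *ᵥ ee n j) = 0 := by rw [h, mulVec_zero]
          rw [mulVec_mulVec, ← Units.val_mul, inv_mul_cancel, Units.val_one, one_mulVec] at h1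
          have := congrFun h1 ⟨j, hjn⟩
          simp [ee] at this) (by
          intro g hg i hi
          have : ee n i ⬝ᵥ ((g : Mat n n) *ᵥ ee n j) = 0 := by
            rw [dotProduct_mulVec, (hs g hg i hi).2, ee_dot_ee _ _ hi.ne]
          rwa [ee_dot i i.2] at this)
      have h0 : η ⬝ᵥ ee n j = 0 := by
        rw [dotProduct_comm]; exact ee_dot_zero _ _ fun i hi => hη i hi.le
      refine ⟨unip (ee n j) η h0, Aplus_le_stab j (unip_mem_Aplus j η hη h0), fun g hg => ?_⟩
      have h1 := hav g hg
      have h2 : ee n j ⬝ᵥ (((unip (ee n j) η h0 * g : GL (Fin n) ℂ) : Mat n n) *ᵥ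
          ee n j) = (ee n j + η) ⬝ᵥ ((g : Mat n n) *ᵥ ee n j) := by
        rw [Units.val_mul, ← mulVec_mulVec]
        change _ ⬝ᵥ ((1 + vecMulVec (ee n j) η) *ᵥ _) = _
        rw [rank_one_mulVec, dotProduct_add, dotProduct_smul, ee_dot_self j hjn, add_dotProduct]
        simp
      rw [← h2, ee_dot j hjn, mulVec, dot_ee j hjn] at h1
      exact h1

/-- `v` is a highest weight vector of weight `κ`. -/
def GLHW (τ : Representation ℂ (GL (Fin n) ℂ) X) (κ : ℕ → ℕ) (v : X) : Prop :=
  (∀ j < n, ∀ c ∈ Aplus n j, τ c v = v) ∧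
    ∀ j < n, ∀ s : ℂˣ, τ (tor n j s) v = (s : ℂ) ^ κ j • v

theorem star_Aplus (j : ℕ) (g : GL (Fin n) ℂ) (hg : g ∈ Aplus n j) : star g ∈ Aminus n j := by
  obtain ⟨η, hη, hg⟩ := hg
  refine ⟨star η, fun i hi => by simp [hη i hi], ?_⟩
  rw [Units.coe_star, hg]
  ext a b
  simp [vecMulVec, ee, one_apply, eq_comm, mul_comm]
  split_ifs <;> simp

theorem star_Aminus (j : ℕ) (g : GL (Fin n) ℂ) (hg : g ∈ Aminus n j) : star g ∈ Aplus n j := by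
  obtain ⟨η, hη, hg⟩ := hg
  refine ⟨star η, fun i hi => by simp [hη i hi], ?_⟩
  rw [Units.coe_star, hg]
  ext a b
  simp [vecMulVec, ee, one_apply, eq_comm]
  split_ifs <;> simp

theorem star_tor (j : ℕ) (s : ℂˣ) : star (tor n j s) = tor n j (star s) := by
  ext1
  rw [Units.coe_star]
  change star (diagonal _) = diagonal _
  rw [star_eq_conjTranspose, diagonal_conjTranspose]
  congr 1
  ext i
  by_cases h : (i : ℕ) = j <;> simp [h]

variable {V W : Type*} [AddCommGroup V] [Module ℂ V] [AddCommGroup W] [Module ℂ W]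

theorem span_orbit {G : Type*} [Group G] (π : Representation ℂ G W) (hπ : IsIrreducibleRep π)
    (w : W) (hw : w ≠ 0) (φ : W →ₗ[ℂ] ℂ) (h : ∀ g, φ (π g w) = 0) : φ = 0 := by
  have hsub : IsSubrep π (span ℂ (Set.range fun g => π g w)) := by
    intro g
    have : span ℂ (Set.range fun g => π g w) ≤
        (span ℂ (Set.range fun g => π g w)).comap (π g) := by
      rw [span_le]
      rintro _ ⟨k, rfl⟩
      exact subset_span ⟨g * k, by simp⟩
    exact fun x hx => this hx
  have htop := (hπ.2 _ hsub).resolve_left (by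
    intro h
    apply hw
    have : w ∈ span ℂ (Set.range fun g => π g w) := subset_span ⟨1, by simp⟩
    rwa [h, mem_bot] at this)
  have hker : span ℂ (Set.range fun g => π g w) ≤ ker φ := by
    rw [span_le]
    rintro _ ⟨g, rfl⟩
    exact h g
  rw [htop] at hker
  ext x
  exact hker (mem_top)

theorem GL_exists_equivariant [FiniteDimensional ℂ W] (π : Representation ℂ (GL (Fin n) ℂ) W)
    (ρ : Representation ℂ (GL (Fin n) ℂ) V) (hπ : IsIrreducibleRep π)
    (B : V →ₗ⋆[ℂ] V →ₗ[ℂ] ℂ) (hsymm : ∀ x y, star (B x y) = B y x)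
    (hpos : ∀ x, x ≠ 0 → 0 < (B x x).re)
    (hst : ∀ g x y, B (ρ g x) y = B x (ρ (star g) y))
    (U : Submodule ℂ V) (hU : IsSubrep ρ U) [FiniteDimensional ℂ U] (κ : ℕ → ℕ)
    (w : W) (hw0 : w ≠ 0) (hw : GLHW π κ w) (w' : V) (hw'U : w' ∈ U) (hw' : GLHW ρ κ w') :
    ∃ T ∈ equivariantMaps π ρ, T w = w' := by
  have : Nontrivial W := hπ.1
  have hne := fixedBy_Aminus_ne_bot π.dual ⊤ (fun _ _ _ => mem_top)
    (by exact top_ne_bot)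
  obtain ⟨φ, hφ, hφ0⟩ := (Submodule.ne_bot_iff _).mp hne
  have hφinv : ∀ j < n, ∀ c ∈ Aminus n j, ∀ x, φ (π c x) = φ x := by
    intro j hj c hc x
    have := hφ.2 j hj c⁻¹ (inv_mem hc)
    have := LinearMap.congr_fun this x
    rw [Representation.dual_apply, inv_inv] at this
    exact this
  have kill : ∀ ψ : W →ₗ[ℂ] ℂ, (∀ j < n, ∀ c ∈ Aminus n j, ∀ x, ψ (π c x) = ψ x) → ψ w = 0 →
      ψ = 0 := fun ψ hψ h0 => span_orbit π hπ w hw0 ψ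
        (GL_kill π ψ w ⊤ (fun _ _ _ => mem_top) mem_top (fun j hj c hc x _ => hψ j hj c hc x) hw.1
          (fun j hj s => ⟨_, hw.2 j hj s⟩) h0)
  have hφw : φ w ≠ 0 := fun h => hφ0 (kill φ hφinv h)
  have hφt : ∀ j < n, ∀ s : ℂˣ, ∀ x, φ (π (tor n j s) x) = (s : ℂ) ^ κ j * φ x := by
    intro j hj s x
    have := kill (φ ∘ₗ π (tor n j s) - (s : ℂ) ^ κ j • φ) (by
      intro i hi c hc y
      have h1 : tor n j s * c = ((tor n j s)⁻¹⁻¹ * c * (tor n j s)⁻¹) * tor n j s := by group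
      have h2 := Aminus_conj_diag (tor n j s)⁻¹ _ _ rfl rfl i c hc
      simp only [LinearMap.sub_apply, LinearMap.comp_apply, LinearMap.smul_apply, hφinv i hi c hc]
      rw [← End.mul_apply, ← map_mul, h1, map_mul, End.mul_apply, hφinv i hi _ h2])
      (by simp [hw.2 j hj s])
    have := LinearMap.congr_fun this x
    simpa [sub_eq_zero] using this
  refine exists_equivariant π ρ hπ B hsymm hpos star hst U hU w w' hw'U
    (fun g c => (∃ j < n, g ∈ Aplus n j ∧ c = 1) ∨
      ∃ j < n, ∃ s : ℂˣ, g = tor n j s ∧ c = (s : ℂ) ^ κ j) ?_ φ ?_ hφw ?_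
  · rintro g c (⟨j, hj, hg, rfl⟩ | ⟨j, hj, s, rfl, rfl⟩)
    · rw [hw'.1 j hj g hg, one_smul]
    · exact hw'.2 j hj s
  · rintro g c (⟨j, hj, hg, rfl⟩ | ⟨j, hj, s, rfl, rfl⟩) x
    · rw [hφinv j hj _ (star_Aplus j g hg)]; simp
    · rw [star_tor, hφt j hj]; simp
  · intro Φ hΦ h0 g
    let τ : Representation ℂ (GL (Fin n) ℂ) (W × V) := π.prod ρ
    have hτ : ∀ g x, τ g x = (π g x.1, ρ g x.2) := fun g x => rfl
    have := Finite.iff_fg.mpr ((Finite.fg_top (M := W)).prod (Finite.iff_fg.mp ‹FiniteDimensional ℂ U›))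
    refine GL_kill τ Φ (w, w') ((⊤ : Submodule ℂ W).prod U) (fun g x hx => ⟨trivial, hU g _ hx.2⟩)
      ⟨trivial, hw'U⟩ ?_ ?_ ?_ h0 g
    · intro j hj c hc x _
      have := hΦ _ _ (Or.inl ⟨j, hj, star_Aminus j c hc, rfl⟩) x
      rw [star_star] at this
      rw [hτ, this]; simp
    · intro j hj c hc
      rw [hτ, hw.1 j hj c hc, hw'.1 j hj c hc]
    · intro j hj s
      exact ⟨(s : ℂ) ^ κ j, by rw [hτ, hw.2 j hj s, hw'.2 j hj s]; rfl⟩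

end GLchain

end

section

/-- Joint eigenspace of a family of group elements with prescribed eigenvalues. -/
def eigSub {G V : Type*} [Group G] [AddCommGroup V] [Module ℂ V] (ρ : Representation ℂ G V)
    (R : G → ℂ → Prop) : Submodule ℂ V where
  carrier := {x | ∀ g c, R g c → ρ g x = c • x}
  add_mem' := fun {x y} hx hy g c h => by rw [map_add, hx g c h, hy g c h, smul_add]
  zero_mem' := fun g c _ => by rw [map_zero, smul_zero]
  smul_mem' := fun a x hx g c h => by rw [map_smul, hx g c h, smul_comm]

theorem sl2_bound {V : Type*} [AddCommGroup V] [Module ℂ V] (E F H : V →ₗ[ℂ] V)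
    (hEF : ∀ x, E (F x) = F (E x) + H x) (hHF : ∀ x, H (F x) = F (H x) - (2 : ℂ) • F x)
    (B : V →ₗ⋆[ℂ] V →ₗ[ℂ] ℂ) (hpos : ∀ x, x ≠ 0 → 0 < (B x x).re)
    (hB : ∀ x y, B (F x) y = B x (E y)) (v : V) (hE : E v = 0) (h : ℤ) (hH : H v = (h : ℂ) • v)
    (b : ℕ) (hb : (F ^ b) v ≠ 0) : (b : ℤ) ≤ h ∨ b = 0 := by
  have hw : ∀ j : ℕ, H ((F ^ j) v) = ((h : ℂ) - 2 * j) • (F ^ j) v := by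
    intro j
    induction j with
    | zero => simpa using hH
    | succ j ih =>
      rw [pow_succ', Module.End.mul_apply, hHF, ih, map_smul, ← sub_smul]
      push_cast
      ring_nf
  have he : ∀ j : ℕ, E ((F ^ (j + 1)) v) = ((j + 1 : ℂ) * ((h : ℂ) - j)) • (F ^ j) v := by
    intro j
    induction j with
    | zero => simp [hEF, hE, hH]
    | succ j ih =>
      rw [pow_succ', Module.End.mul_apply, hEF, ih, map_smul, hw, ← Module.End.mul_apply, ← pow_succ',
        ← add_smul]
      push_cast
      ring_nf
  have hne : ∀ j ≤ b, (F ^ j) v ≠ 0 := by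
    intro j hj h0
    apply hb
    rw [show b = (b - j) + j by omega, pow_add, Module.End.mul_apply, h0, map_zero]
  rcases b with _ | b
  · right; rfl
  left
  have h1 := hpos _ (hne (b + 1) le_rfl)
  have h2 := hpos _ (hne b (by omega))
  have h3 : B ((F ^ (b + 1)) v) ((F ^ (b + 1)) v) =
      ((b + 1 : ℂ) * ((h : ℂ) - b)) * B ((F ^ b) v) ((F ^ b) v) := by
    have h4 : F ((F ^ b) v) = (F ^ (b + 1)) v := by rw [pow_succ', Module.End.mul_apply]
    conv_lhs => rw [pow_succ', Module.End.mul_apply]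
    rw [hB, h4, he, map_smul, smul_eq_mul]
  have h4 : (((b + 1 : ℂ) * ((h : ℂ) - b)) * B ((F ^ b) v) ((F ^ b) v)).re =
      ((b + 1 : ℝ) * ((h : ℝ) - b)) * (B ((F ^ b) v) ((F ^ b) v)).re := by
    rw [← Complex.re_ofReal_mul]
    push_cast
    rfl
  rw [h3, h4] at h1
  have h5 : 0 < (b + 1 : ℝ) * ((h : ℝ) - b) := (pos_iff_pos_of_mul_pos h1).mpr h2
  have h6 : 0 < (h : ℝ) - b := (pos_iff_pos_of_mul_pos h5).mp (by positivity)
  have h7 : (b : ℤ) < h := by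
    have : ((b : ℤ) : ℝ) < (h : ℝ) := by push_cast; linarith
    exact_mod_cast this
  push_cast
  omega

open MvPolynomial Finset Finsupp Module
open scoped Kronecker

theorem coeff_subst_diagonal {σ : Type*} [Fintype σ] [DecidableEq σ] (D : σ → ℂ)
    (f : MvPolynomial σ ℂ) (e : σ →₀ ℕ) :
    coeff e (subst (diagonal D) f) = (∏ s, D s ^ e s) * coeff e f := by
  have hX : ∀ s, subst (diagonal D) (X s) = C (D s) * X s := by
    intro s
    rw [subst_X, Finset.sum_eq_single s]
    · simp [smul_eq_C_mul]
    · intro b _ hb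
      simp [hb]
    · simp
  induction f using MvPolynomial.induction_on generalizing e with
  | C a =>
    have : subst (diagonal D) (C a) = C a := by simp [subst]
    rw [this]
    by_cases he : e = 0
    · subst he; simp
    · rw [coeff_C, if_neg (Ne.symm he), mul_zero]
  | add p q hp hq => rw [map_add, coeff_add, coeff_add, hp, hq, mul_add]
  | mul_X p s hp =>
    rw [map_mul, hX, mul_left_comm, coeff_C_mul, coeff_mul_X', coeff_mul_X']
    by_cases hs : s ∈ e.support
    · rw [if_pos hs, if_pos hs, hp, ← mul_assoc]
      congr 1
      have h1 : 1 ≤ e s := Nat.one_le_iff_ne_zero.mpr (mem_support_iff.mp hs)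
      rw [← Finset.mul_prod_erase _ _ (Finset.mem_univ s),
        ← mul_prod_erase (f := fun s => D s ^ e s) _ (mem_univ s), ← mul_assoc]
      congr 1
      · rw [← pow_succ', tsub_apply, single_eq_same, Nat.sub_add_cancel h1]
      · refine prod_congr rfl fun t ht => ?_
        rw [tsub_apply, single_eq_of_ne (ne_of_mem_erase ht), Nat.sub_zero]
    · rw [if_neg hs, if_neg hs, mul_zero, mul_zero]

variable {m n : ℕ}

/-- Degree in the variables of row `i`. -/
def rowDeg (e : Fin m × Fin n →₀ ℕ) (i : Fin m) : ℕ := ∑ c, e (i, c)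

/-- Degree in the variables of column `c`. -/
def colDeg (e : Fin m × Fin n →₀ ℕ) (c : Fin n) : ℕ := ∑ i, e (i, c)

theorem coeff_Ract_diagonal (d : Fin n → ℂ) (f : P m n) (e) :
    coeff e (Ract (diagonal d) f) = (∏ c, d c ^ colDeg e c) * coeff e f := by
  have : (1 : Mat m m) ⊗ₖ diagonal d = diagonal fun p : Fin m × Fin n => d p.2 := by
    rw [← diagonal_one, diagonal_kronecker_diagonal]; simp
  rw [Ract, this, coeff_subst_diagonal, Fintype.prod_prod_type_right]
  simp_rw [colDeg, prod_pow_eq_pow_sum]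

theorem coeff_Lact_diagonal (d : Fin m → ℂ) (f : P m n) (e) :
    coeff e (Lact (diagonal d) f) = (∏ i, d i ^ rowDeg e i) * coeff e f := by
  have : diagonal d ⊗ₖ (1 : Mat n n) = diagonal fun p : Fin m × Fin n => d p.1 := by
    rw [← diagonal_one, diagonal_kronecker_diagonal]; simp
  rw [Lact, this, coeff_subst_diagonal, Fintype.prod_prod_type]
  simp_rw [rowDeg, prod_pow_eq_pow_sum]

theorem tor_eq (j : Fin n) (s : ℂˣ) : (tor n j s : Mat n n) =
    diagonal fun i => if i = j then (s : ℂ) else 1 := by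
  change diagonal _ = _
  simp [Fin.ext_iff]

theorem coeff_repR_tor (j : Fin n) (s : ℂˣ) (f : P m n) (e) :
    coeff e (repR m n (tor n j s) f) = (s : ℂ) ^ colDeg e j * coeff e f := by
  rw [repR_apply, tor_eq, coeff_Ract_diagonal, Finset.prod_eq_single j]
  · simp
  · intro b _ hb; simp [hb]
  · simp

theorem coeff_repL_tor (j : Fin m) (s : ℂˣ) (f : P m n) (e) :
    coeff e (repL m n (tor m j s) f) = (s : ℂ) ^ rowDeg e j * coeff e f := by
  rw [repL_apply, tor_eq, coeff_Lact_diagonal, Finset.prod_eq_single j]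
  · simp
  · intro b _ hb; simp [hb]
  · simp

theorem two_pow_inj {a b : ℕ} (h : (2 : ℂ) ^ a = 2 ^ b) : a = b := by
  have : (2 : ℕ) ^ a = 2 ^ b := by exact_mod_cast h
  exact Nat.pow_right_injective le_rfl this

theorem repR_tor_iff (j : Fin n) (a : ℕ) (f : P m n) :
    (∀ s : ℂˣ, repR m n (tor n j s) f = (s : ℂ) ^ a • f) ↔ ∀ e, coeff e f ≠ 0 → colDeg e j = a := by
  constructor
  · intro h e he
    have := congrArg (coeff e) (h (Units.mk0 2 two_ne_zero))
    rw [coeff_repR_tor, coeff_smul, smul_eq_mul, mul_left_inj' he] at this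
    exact two_pow_inj this
  · intro h s
    ext e
    rw [coeff_repR_tor, coeff_smul, smul_eq_mul]
    by_cases he : coeff e f = 0
    · simp [he]
    · rw [h e he]

theorem repL_tor_iff (j : Fin m) (a : ℕ) (f : P m n) :
    (∀ s : ℂˣ, repL m n (tor m j s) f = (s : ℂ) ^ a • f) ↔ ∀ e, coeff e f ≠ 0 → rowDeg e j = a := by
  constructor
  · intro h e he
    have := congrArg (coeff e) (h (Units.mk0 2 two_ne_zero))
    rw [coeff_repL_tor, coeff_smul, smul_eq_mul, mul_left_inj' he] at this
    exact two_pow_inj this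
  · intro h s
    ext e
    rw [coeff_repL_tor, coeff_smul, smul_eq_mul]
    by_cases he : coeff e f = 0
    · simp [he]
    · rw [h e he]

/-- The polarization operator `∑ᵢ x_{ir} ∂_{is}`. -/
def pol (m : ℕ) {n : ℕ} (r s : Fin n) : Derivation ℂ (P m n) (P m n) :=
  ∑ i, (X (i, r) : P m n) • pderiv (i, s)

theorem pol_apply (r s : Fin n) (f : P m n) : pol m r s f = ∑ i, X (i, r) * pderiv (i, s) f := by
  have h : ∀ t : Finset (Fin m), (∑ i ∈ t, (X (i, r) : P m n) • pderiv (R := ℂ) (i, s)) f =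
      ∑ i ∈ t, X (i, r) * pderiv (i, s) f := by
    intro t
    induction t using Finset.induction_on with
    | empty => simp
    | insert a t ha ih => rw [sum_insert ha, sum_insert ha, Derivation.add_apply, ih]; rfl
  exact h _

theorem pol_X (r s : Fin n) (p : Fin m × Fin n) :
    pol m r s (X p) = if p.2 = s then X (p.1, r) else 0 := by
  rw [pol_apply]
  rcases p with ⟨i, c⟩
  rw [Finset.sum_eq_single i]
  · by_cases h : c = s
    · subst h; simp
    · rw [pderiv_X_of_ne (by simp [h]), mul_zero, if_neg h]
  · intro b _ hb
    rw [pderiv_X_of_ne (by simp [Ne.symm hb]), mul_zero]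
  · simp

theorem pol_comm (r s t u : Fin n) (f : P m n) :
    pol m r s (pol m t u f) - pol m t u (pol m r s f) =
      (if t = s then pol m r u f else 0) - (if r = u then pol m t s f else 0) := by
  have : ⁅pol m r s, pol m t u⁆ =
      (if t = s then pol m r u else 0) - (if r = u then pol m t s else 0) := by
    refine derivation_ext fun p => ?_
    rw [Derivation.commutator_apply, pol_X, pol_X, Derivation.sub_apply]
    split_ifs <;> simp_all [pol_X]
  have := DFunLike.congr_fun this f
  rw [Derivation.commutator_apply] at this
  rw [this, Derivation.sub_apply]
  split_ifs <;> simp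

theorem fischerH_pol (r s : Fin n) (f g : P m n) :
    fischerH (pol m r s f) g = fischerH f (pol m s r g) := by
  have h1 : conjP (pol m r s f) = pol m r s (conjP f) := by
    rw [pol_apply, pol_apply, map_sum]
    refine sum_congr rfl fun i _ => ?_
    rw [conjP_apply, conjP_apply, map_mul, map_X, pderiv_map]
  rw [fischerH_apply, fischerH_apply, h1, pol_apply, pol_apply, map_sum, map_sum,
    LinearMap.sum_apply]
  refine sum_congr rfl fun i _ => ?_
  rw [fischer_X_mul, fischer_comm (conjP f), fischer_X_mul, fischer_comm]

theorem coeff_pol (r s : Fin n) (hrs : r ≠ s) (f : P m n) (e : Fin m × Fin n →₀ ℕ) :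
    coeff e (pol m r s f) = ∑ i, if e (i, r) = 0 then 0 else
      ((e (i, s) : ℂ) + 1) * coeff (e - single (i, r) 1 + single (i, s) 1) f := by
  rw [pol_apply, coeff_sum]
  refine sum_congr rfl fun i _ => ?_
  rw [coeff_X_mul']
  by_cases h : e (i, r) = 0
  · simp [h]
  · rw [if_pos (mem_support_iff.mpr h), if_neg h, coeff_pderiv, tsub_apply,
      single_eq_of_ne (by simp [Ne.symm hrs]), Nat.sub_zero, mul_comm]

theorem coeff_pol_self (r : Fin n) (f : P m n) (e : Fin m × Fin n →₀ ℕ) :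
    coeff e (pol m r r f) = (colDeg e r : ℂ) * coeff e f := by
  rw [pol_apply, coeff_sum, colDeg, Nat.cast_sum, Finset.sum_mul]
  refine Finset.sum_congr rfl fun i _ => ?_
  rw [coeff_X_mul']
  by_cases h : e (i, r) = 0
  · simp [h]
  · rw [if_pos (Finsupp.mem_support_iff.mpr h), coeff_pderiv, Finsupp.tsub_apply,
      Finsupp.single_eq_same]
    have h1 : e - Finsupp.single (i, r) 1 + Finsupp.single (i, r) 1 = e := by
      ext p
      by_cases hp : p = (i, r)
      · subst hp; simp; omega
      · simp [Finsupp.single_eq_of_ne hp]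
    rw [h1, mul_comm]
    congr 1
    have : 1 ≤ e (i, r) := Nat.one_le_iff_ne_zero.mpr h
    push_cast [this]
    ring

theorem mul_rank_one' {a b : ℕ} (u v : Fin b → ℂ) (M : Mat a b) :
    M * (1 + vecMulVec u v) = M + vecMulVec (M *ᵥ u) v := by
  rw [Matrix.mul_add, Matrix.mul_one, mul_vecMulVec]

theorem Ract_rank_one_X (r s : Fin n) (t : ℂ) (p : Fin m × Fin n) :
    Ract (1 + vecMulVec (ee n r) (t • ee n s)) (X p : P m n) =
      X p + if p.2 = s then C t * X (p.1, r) else 0 := by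
  refine P_ext fun M => ?_
  rw [ev_Ract, ev_X, mul_rank_one', Matrix.add_apply, vecMulVec_apply, mulVec, dot_ee r r.2, map_add,
    ev_X]
  split_ifs with h
  · rw [map_mul, ev_X, ev, aeval_C]
    simp [h, ee, mul_comm]
  · simp [ee, Fin.val_inj, h]

/-- The substitution `x_{is} ↦ x_{is} + T x_{ir}`. -/
def shear (m : ℕ) {n : ℕ} (r s : Fin n) : P m n →ₐ[ℂ] Polynomial (P m n) := aeval fun p =>
    Polynomial.C (X p) + (if p.2 = s then Polynomial.X * Polynomial.C (X (p.1, r)) else 0)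

theorem shear_X (r s : Fin n) (p : Fin m × Fin n) : shear m r s (X p) = Polynomial.C (X p) +
    (if p.2 = s then Polynomial.X * Polynomial.C (X (p.1, r)) else 0) := by
  rw [shear, aeval_X]

theorem shear_C (r s : Fin n) (a : ℂ) : shear m r s (C a) = Polynomial.C (C a) := by
  rw [← algebraMap_eq, AlgHom.commutes]; rfl

theorem eval_shear (r s : Fin n) (t : ℂ) (f : P m n) :
    (shear m r s f).eval (C t) = Ract (1 + vecMulVec (ee n r) (t • ee n s)) f := by
  induction f using MvPolynomial.induction_on with
  | C a => rw [shear_C, Polynomial.eval_C, ← algebraMap_eq, AlgHom.commutes]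
  | add p q hp hq => rw [map_add, Polynomial.eval_add, hp, hq, map_add]
  | mul_X p i hp =>
    rw [map_mul, Polynomial.eval_mul, hp, map_mul, shear_X, Ract_rank_one_X]
    split_ifs
    · rw [Polynomial.eval_add, Polynomial.eval_C, Polynomial.eval_mul, Polynomial.eval_X,
        Polynomial.eval_C]
    · simp

theorem coeff_zero_shear (r s : Fin n) (f : P m n) : (shear m r s f).coeff 0 = f := by
  induction f using MvPolynomial.induction_on with
  | C a => rw [shear_C, Polynomial.coeff_C_zero]
  | add p q hp hq => rw [map_add, Polynomial.coeff_add, hp, hq]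
  | mul_X p i hp =>
    rw [map_mul, Polynomial.mul_coeff_zero, hp, shear_X]
    split_ifs <;> simp

theorem coeff_one_shear (r s : Fin n) (f : P m n) : (shear m r s f).coeff 1 = pol m r s f := by
  induction f using MvPolynomial.induction_on with
  | C a => rw [shear_C, Polynomial.coeff_C_of_ne_zero one_ne_zero, derivation_C]
  | add p q hp hq => rw [map_add, Polynomial.coeff_add, hp, hq, map_add]
  | mul_X p i hp =>
    rw [map_mul, Polynomial.coeff_mul, Finset.Nat.antidiagonal_succ, Derivation.leibniz, pol_X,
      shear_X]
    simp only [Finset.Nat.antidiagonal_zero, Finset.map_singleton, Finset.sum_cons,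
      Finset.sum_singleton, coeff_zero_shear]
    split_ifs with h
    · simp [hp, smul_eq_mul]; ring
    · simp [hp, smul_eq_mul]; ring

/-- A polynomial invariant under adding multiples of column `r` to column `s` is killed by the
polarization operator. -/
theorem pol_eq_zero (r s : Fin n) (f : P m n)
    (hf : ∀ t : ℂ, Ract (1 + vecMulVec (ee n r) (t • ee n s)) f = f) : pol m r s f = 0 := by
  have hz : shear m r s f - Polynomial.C f = 0 := by
    apply Polynomial.eq_zero_of_infinite_isRoot
    refine Set.Infinite.mono ?_ (Set.infinite_range_of_injective (C_injective (Fin m × Fin n) ℂ))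
    rintro _ ⟨t, rfl⟩
    change Polynomial.eval _ _ = 0
    rw [Polynomial.eval_sub, Polynomial.eval_C, eval_shear, hf t, sub_self]
  rw [← coeff_one_shear, sub_eq_zero.mp hz, Polynomial.coeff_C_of_ne_zero one_ne_zero]

end

section

open MvPolynomial Finset LinearMap Module

variable {m n : ℕ}

/-- Exponents are compared at the last position where they differ, rows first. -/
def key (e : Fin m × Fin n →₀ ℕ) : Lex ((Fin m ×ₗ Fin n)ᵒᵈ → ℕ) :=
  toLex fun p => e (ofLex (OrderDual.ofDual p))

theorem key_injective : Function.Injective (key : (Fin m × Fin n →₀ ℕ) → _) := by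
  intro e e' h
  ext p
  exact congrFun (toLex.injective h) (OrderDual.toDual (toLex p))

theorem key_lt {e e' : Fin m × Fin n →₀ ℕ} (i : Fin m) (c : Fin n)
    (h1 : ∀ i' > i, ∀ c', e (i', c') = e' (i', c')) (h2 : ∀ c' > c, e (i, c') = e' (i, c'))
    (h3 : e (i, c) < e' (i, c)) : key e < key e' := by
  refine ⟨OrderDual.toDual (toLex (i, c)), ?_, h3⟩
  intro q hq
  obtain ⟨⟨i', c'⟩, rfl⟩ : ∃ q', OrderDual.toDual (toLex q') = q := ⟨_, rfl⟩
  rw [OrderDual.toDual_lt_toDual, Prod.Lex.toLex_lt_toLex] at hq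
  rcases hq with hq | ⟨hq, hq'⟩
  · exact h1 _ hq _
  · simp only at hq hq'
    subst hq
    exact h2 _ hq'

/-- `e` is the leading exponent of `f`. -/
def IsLead (f : P m n) (e : Fin m × Fin n →₀ ℕ) : Prop :=
  coeff e f ≠ 0 ∧ ∀ e', coeff e' f ≠ 0 → key e' ≤ key e

theorem exists_isLead (f : P m n) (hf : f ≠ 0) : ∃ e, IsLead f e := by
  obtain ⟨e, he, h⟩ := exists_max_image f.support key (support_nonempty.mpr hf)
  exact ⟨e, mem_support_iff.mp he, fun e' he' => h e' (mem_support_iff.mpr he')⟩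

theorem IsLead.coeff_eq_zero {f : P m n} {e e' : Fin m × Fin n →₀ ℕ} (h : IsLead f e)
    (i : Fin m) (c : Fin n) (h1 : ∀ i' > i, ∀ c', e (i', c') = e' (i', c'))
    (h2 : ∀ c' > c, e (i, c') = e' (i, c')) (h3 : e (i, c) < e' (i, c)) : coeff e' f = 0 := by
  by_contra h0
  exact absurd (h.2 e' h0) (not_le.mpr (key_lt i c h1 h2 h3))

theorem exists_coeff {σ : Type*} (φ : (σ →₀ ℕ) → ℂ) (h : {e | φ e ≠ 0}.Finite) :
    ∃ g : MvPolynomial σ ℂ, ∀ e, coeff e g = φ e := by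
  classical
  refine ⟨∑ e ∈ h.toFinset, monomial e (φ e), fun e => ?_⟩
  rw [coeff_sum]
  simp_rw [coeff_monomial]
  rw [sum_ite_eq']
  split_ifs with he
  · rfl
  · by_contra h0
    exact he (h.mem_toFinset.mpr (Ne.symm h0))

theorem finrank_le_of_support {σ : Type*} (U : Submodule ℂ (MvPolynomial σ ℂ))
    (S : Finset (σ →₀ ℕ)) (h : ∀ f ∈ U, f ≠ 0 → ∃ e ∈ S, coeff e f ≠ 0) :
    FiniteDimensional ℂ U ∧ finrank ℂ U ≤ S.card := by
  let T : U →ₗ[ℂ] (S → ℂ) := pi fun e => (lcoeff ℂ (e : σ →₀ ℕ)).comp U.subtype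
  have hT : Function.Injective T := by
    rw [← ker_eq_bot, ker_eq_bot']
    intro f hf
    by_contra h0
    obtain ⟨e, he, hne⟩ := h f f.2 (fun h => h0 (Subtype.ext h))
    exact hne (congrFun hf ⟨e, he⟩)
  refine ⟨FiniteDimensional.of_injective T hT, ?_⟩
  have := finrank_le_finrank_of_injective hT
  simpa using this

/-- Column sums over the first `i` rows. -/
def psum (e : Fin m × Fin n →₀ ℕ) (i : ℕ) (c : Fin n) : ℕ :=
  ∑ i' : Fin m, if (i' : ℕ) < i then e (i', c) else 0

theorem psum_succ (e : Fin m × Fin n →₀ ℕ) (i : Fin m) (c : Fin n) :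
    psum e (i + 1) c = psum e i c + e (i, c) := by
  have : e (i, c) = ∑ i' : Fin m, if i' = i then e (i', c) else 0 := by simp
  rw [psum, psum, this, ← sum_add_distrib]
  refine sum_congr rfl fun i' _ => ?_
  rcases lt_trichotomy (i' : ℕ) i with h | h | h
  · grind
  · grind
  · grind

theorem psum_zero (e : Fin m × Fin n →₀ ℕ) (c : Fin n) : psum e 0 c = 0 := by simp [psum]

theorem psum_of_le (e : Fin m × Fin n →₀ ℕ) {i : ℕ} (hi : m ≤ i) (c : Fin n) :
    psum e i c = colDeg e c := by
  refine sum_congr rfl fun i' _ => if_pos ?_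
  omega

theorem ballot_step (f : P m n) (e : Fin m × Fin n →₀ ℕ) (he : IsLead f e) (κ : Fin n → ℕ)
    (hcol : ∀ e, coeff e f ≠ 0 → ∀ c, colDeg e c = κ c) (r s : Fin n) (hrs : (r : ℕ) + 1 = s)
    (hpol : pol m r s f = 0) (i : Fin m) : psum e i s + e (i, s) ≤ psum e i r ∨ e (i, s) = 0 := by
  have hne : r ≠ s := by intro h; subst h; omega
  set a := e (i, r)
  set b := e (i, s)
  let low (x : Fin m × Fin n →₀ ℕ) : Prop := ∀ i' c, i ≤ i' → x (i', c) = 0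
  let cc (β : ℕ) : Fin m × Fin n →₀ ℕ := Finsupp.equivFunOnFinite.symm fun p =>
    if p.1 < i then 0 else if p = (i, r) then a + b - β else if p = (i, s) then β else e p
  have hex : ∀ β, ∃ g : P m n, ∀ x, coeff x g = if low x then coeff (x + cc β) f else 0 := by
    intro β
    refine exists_coeff _ (Set.Finite.subset ((f.support.image fun y => y - cc β).finite_toSet) ?_)
    intro x hx
    simp only [ne_eq, ite_eq_right_iff, Classical.not_imp, Set.mem_ofPred_eq] at hx
    rw [mem_coe, mem_image]
    exact ⟨x + cc β, mem_support_iff.mpr hx.2, by ext p; simp⟩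
  choose g hg using hex
  have rec_eq : ∀ β ≤ b, pol m r s (g β) = if β = b then 0 else -((β + 1 : ℂ) • g (β + 1)) := by
    intro β hβ
    ext x
    rw [coeff_pol r s hne]
    by_cases hx : low x
    · have h0 : coeff (x + cc β) (pol m r s f) = 0 := by rw [hpol, coeff_zero]
      rw [coeff_pol r s hne] at h0
      have hy : ∀ p, (x + cc β) p = if p.1 < i then x p else
          if p = (i, r) then a + b - β else if p = (i, s) then β else e p := fun p => by
        have := hx p.1 p.2
        simp only [Finsupp.add_apply, cc, Finsupp.equivFunOnFinite_symm_apply_apply]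
        grind
      have hz : ∀ i', i ≤ i' → (i' = i → β = b) →
          coeff (x + cc β - Finsupp.single (i', r) 1 + Finsupp.single (i', s) 1) f = 0 := by
        intro i' hi hb'
        refine he.coeff_eq_zero i' s (fun i'' hi' c => ?_) (fun c hc => ?_) ?_ <;>
          rw [Finsupp.add_apply, Finsupp.tsub_apply, hy, Finsupp.single_apply,
            Finsupp.single_apply] <;> grind
      have hterm : ∀ i', (if (x + cc β) (i', r) = 0 then 0 else
          (((x + cc β) (i', s) : ℂ) + 1) *
            coeff (x + cc β - Finsupp.single (i', r) 1 + Finsupp.single (i', s) 1) f) =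
          (if x (i', r) = 0 then 0 else
          ((x (i', s) : ℂ) + 1) *
            coeff (x - Finsupp.single (i', r) 1 + Finsupp.single (i', s) 1) (g β)) +
          (if i' = i then (if β = b then 0 else (β + 1 : ℂ) * coeff x (g (β + 1))) else 0) := by
        intro i'
        rcases lt_trichotomy i' i with h | h | h
        · rw [if_neg h.ne, add_zero, hy, hy, if_pos h, if_pos h, hg]
          split_ifs with h1 h2
          · rfl
          · congr 2
            ext p
            simp only [Finsupp.add_apply, Finsupp.tsub_apply, Finsupp.single_apply]
            grind
          · exact absurd (fun i'' c hi => by simp [hx _ _ hi, Finsupp.single_apply]; grind) h2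
        · subst h
          rw [if_pos rfl, if_pos (hx _ _ le_rfl), zero_add]
          by_cases hbb : β = b
          · rw [hz i' le_rfl fun _ => hbb, if_pos hbb, mul_zero, ite_self]
          · rw [if_neg hbb, hy, hy, if_neg (by simp; omega), hg, if_pos hx]
            congr 2
            · simp [Ne.symm hne]
            · ext p
              simp only [Finsupp.add_apply, Finsupp.tsub_apply, Finsupp.single_apply, cc,
                Finsupp.equivFunOnFinite_symm_apply_apply]
              grind
        · rw [if_neg h.ne', add_zero, if_pos (hx _ _ h.le), hz i' h.le fun h2 => absurd h2 h.ne',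
            mul_zero, ite_self]
      rw [sum_congr rfl fun i' _ => hterm i', sum_add_distrib,
        sum_ite_eq' univ i, if_pos (mem_univ i)] at h0
      rw [eq_neg_of_add_eq_zero_left h0]
      split_ifs with h1
      · simp
      · simp
    · have hR : coeff x (if β = b then 0 else -((β + 1 : ℂ) • g (β + 1))) = 0 := by
        split_ifs
        · simp
        · simp [hg, hx]
      rw [hR]
      refine sum_eq_zero fun i' _ => ?_
      split_ifs with h1
      · rfl
      · rw [hg, if_neg, mul_zero]
        intro hl
        apply hx
        intro i'' c hi
        have h2 := hl i'' c hi
        have h4 := hl i' s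
        by_cases h3 : i' = i''
        · subst h3
          have := hl i' s hi
          simp at this
        · simpa [h3, Ne.symm h3] using h2
  have hpow : ∀ β ≤ b, ((pol m r s : P m n →ₗ[ℂ] P m n) ^ β) (g 0) =
      ((-1 : ℂ) ^ β * (β.factorial : ℂ)) • g β := by
    intro β
    induction β with
    | zero => intro _; simp
    | succ β ih =>
      intro hβ
      rw [pow_succ', End.mul_apply, ih (by omega), map_smul]
      change _ • pol m r s (g β) = _
      rw [rec_eq β (by omega), if_neg (by omega), smul_neg, smul_smul, ← neg_smul]
      congr 1
      rw [Nat.factorial_succ]; push_cast; ring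
  have hgb : g b ≠ 0 := by
    intro h0
    let x : Fin m × Fin n →₀ ℕ := Finsupp.equivFunOnFinite.symm fun p => if p.1 < i then e p else 0
    have hx : low x := fun i' c hi => if_neg (not_lt.mpr hi)
    have h1 := hg b x
    rw [h0, coeff_zero, if_pos hx] at h1
    have h2 : x + cc b = e := by
      ext p
      simp only [x, cc, Finsupp.add_apply, Finsupp.equivFunOnFinite_symm_apply_apply]
      grind
    rw [h2] at h1
    exact he.1 h1.symm
  have hcolg : ∀ x, coeff x (g b) ≠ 0 → ∀ c, colDeg x c = psum e i c := by
    intro x hx c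
    rw [hg] at hx
    split_ifs at hx with hl
    · have h1 := hcol _ hx c
      have h2 := hcol _ he.1 c
      have h3 : colDeg (x + cc b) c = colDeg x c + colDeg (cc b) c := by
        simp [colDeg, sum_add_distrib]
      have h4 : colDeg e c = psum e i c + colDeg (cc b) c := by
        rw [colDeg, colDeg, psum, ← sum_add_distrib]
        refine sum_congr rfl fun i' _ => ?_
        simp only [cc, Finsupp.equivFunOnFinite_symm_apply_apply, Fin.lt_def]
        grind
      omega
    · grind
  have hEv : pol m r s (g b) = 0 := by rw [rec_eq b le_rfl, if_pos rfl]
  have hfis : ∀ β, ∀ x y : P m n, fischerH (((pol m s r : P m n →ₗ[ℂ] P m n) ^ β) x) y =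
      fischerH x (((pol m r s : P m n →ₗ[ℂ] P m n) ^ β) y) := by
    intro β
    induction β with
    | zero => intro x y; rfl
    | succ β ih =>
      intro x y
      rw [pow_succ', End.mul_apply, pow_succ, End.mul_apply, ← ih]
      exact fischerH_pol s r _ _
  have hF : ((pol m s r : P m n →ₗ[ℂ] P m n) ^ b) (g b) ≠ 0 := by
    intro h0
    have h1 := hfis b (g b) (g 0)
    rw [h0, hpow b le_rfl, map_zero, LinearMap.zero_apply, map_smul, smul_eq_mul] at h1
    have h2 := fischerH_pos (g b) hgb
    have h3 : fischerH (g b) (g b) = 0 := by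
      refine (mul_eq_zero.mp h1.symm).resolve_left (mul_ne_zero (pow_ne_zero _ (by norm_num)) ?_)
      exact_mod_cast b.factorial_ne_zero
    rw [h3] at h2
    simp at h2
  have key := sl2_bound (pol m r s : P m n →ₗ[ℂ] P m n) (pol m s r : P m n →ₗ[ℂ] P m n)
    ((pol m r r : P m n →ₗ[ℂ] P m n) - (pol m s s : P m n →ₗ[ℂ] P m n)) (fun x => ?_) (fun x => ?_)
    fischerH fischerH_pos (fun x y => fischerH_pol s r x y) (g b) hEv
    ((psum e i r : ℤ) - psum e i s) ?_ b hF
  · omega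
  · have := pol_comm r s s r x
    rw [if_pos rfl, if_pos rfl] at this
    exact eq_add_of_sub_eq' this
  · have h1 := pol_comm r r s r x
    have h2 := pol_comm s s s r x
    rw [if_neg (Ne.symm hne), if_pos rfl] at h1
    rw [if_pos rfl, if_neg (Ne.symm hne)] at h2
    change pol m r r (pol m s r x) - pol m s s (pol m s r x) =
      pol m s r (pol m r r x - pol m s s x) - (2 : ℂ) • pol m s r x
    rw [map_sub, sub_eq_iff_eq_add.mp h1, sub_eq_iff_eq_add.mp h2, two_smul]
    abel
  · ext x
    change coeff x (pol m r r (g b) - pol m s s (g b)) = _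
    rw [coeff_sub, coeff_pol_self, coeff_pol_self, coeff_smul, smul_eq_mul]
    by_cases hx : coeff x (g b) = 0
    · grind
    · rw [hcolg x hx, hcolg x hx]
      push_cast
      ring

end

section

open MvPolynomial Finset

/-- Gelfand–Tsetlin patterns with top row `κ`, all rows `i ≥ k` being equal to `κ`. -/
def GT (k : ℕ) (κ : ℕ → ℕ) : Set (ℕ → ℕ → ℕ) :=
  {p | (∀ r, p 0 r = 0) ∧ (∀ i, k ≤ i → p i = κ) ∧ (∀ i r, p i r ≤ p (i + 1) r) ∧
    ∀ i < k, ∀ r, p (i + 1) (r + 1) ≤ p i r}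

theorem GT_mono {k : ℕ} {κ : ℕ → ℕ} {p : ℕ → ℕ → ℕ} (hp : p ∈ GT k κ) {i j : ℕ} (h : i ≤ j) (r : ℕ) :
    p i r ≤ p j r :=
  monotone_nat_of_le_succ (f := fun i => p i r) (fun i => hp.2.2.1 i r) h

theorem GT_le {k : ℕ} {κ : ℕ → ℕ} {p : ℕ → ℕ → ℕ} (hp : p ∈ GT k κ) (i r : ℕ) : p i r ≤ κ r := by
  rcases le_total k i with h | h
  · rw [hp.2.1 i h]
  · rw [← hp.2.1 k le_rfl]; exact GT_mono hp h r

theorem GT_zero {k : ℕ} {κ : ℕ → ℕ} {p : ℕ → ℕ → ℕ} (hp : p ∈ GT k κ) {i r : ℕ} (hi : i ≤ k)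
    (hr : i ≤ r) : p i r = 0 := by
  induction i generalizing r with
  | zero => exact hp.1 r
  | succ i ih =>
    obtain ⟨r, rfl⟩ : ∃ r', r = r' + 1 := ⟨r - 1, by omega⟩
    exact Nat.le_zero.mp ((hp.2.2.2 i (by omega) r).trans (ih (by omega) (by omega)).le)

theorem GT_top_zero {k : ℕ} {κ : ℕ → ℕ} {p : ℕ → ℕ → ℕ} (hp : p ∈ GT k κ) {r : ℕ} (hr : k ≤ r) :
    κ r = 0 := by
  rw [← hp.2.1 k le_rfl]; exact GT_zero hp le_rfl hr

theorem GT_antitone {k : ℕ} {κ : ℕ → ℕ} {p : ℕ → ℕ → ℕ} (hp : p ∈ GT k κ) (r : ℕ) :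
    κ (r + 1) ≤ κ r := by
  rcases k with _ | k
  · rw [GT_top_zero hp (Nat.zero_le _)]; exact Nat.zero_le _
  · have h := hp.2.2.2 k (by omega) r
    rw [hp.2.1 (k + 1) le_rfl] at h
    exact h.trans (GT_le hp k r)

theorem GT_row_antitone {k : ℕ} {κ : ℕ → ℕ} {p : ℕ → ℕ → ℕ} (hp : p ∈ GT k κ) (i r : ℕ) :
    p i (r + 1) ≤ p i r := by
  rcases lt_or_ge i k with h | h
  · exact (hp.2.2.1 i (r + 1)).trans (hp.2.2.2 i h r)
  · rw [hp.2.1 i h]; exact GT_antitone hp r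

theorem GT_finite (k : ℕ) (κ : ℕ → ℕ) : (GT k κ).Finite := by
  let B := ∑ r ∈ range k, κ r
  refine Set.Finite.subset (Set.finite_range fun (q : Fin k → Fin k → Fin (B + 1)) (i r : ℕ) =>
    if hi : i < k then if hr : r < k then (q ⟨i, hi⟩ ⟨r, hr⟩ : ℕ) else 0 else κ r) ?_
  intro p hp
  have hb : ∀ i r, r < k → p i r < B + 1 := fun i r hr =>
    Nat.lt_succ_of_le ((GT_le hp i r).trans
      (single_le_sum (fun _ _ => Nat.zero_le _) (mem_range.mpr hr)))
  refine ⟨fun i r => ⟨p i r, hb i r r.2⟩, ?_⟩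
  ext i r
  by_cases hi : i < k
  · by_cases hr : r < k
    · grind
    · simp [hi, hr, GT_zero hp hi.le (by omega : i ≤ r)]
  · simp [hi, hp.2.1 i (by omega)]

/-- The finite set of Gelfand–Tsetlin patterns. -/
def gts (k : ℕ) (κ : ℕ → ℕ) : Finset (ℕ → ℕ → ℕ) := (GT_finite k κ).toFinset

theorem mem_gts {k : ℕ} {κ : ℕ → ℕ} {p : ℕ → ℕ → ℕ} : p ∈ gts k κ ↔ p ∈ GT k κ :=
  Set.Finite.mem_toFinset _

/-- The weight of a pattern. -/
def wt (k : ℕ) (p : ℕ → ℕ → ℕ) (i : Fin k) : ℕ := ∑ r ∈ range k, (p (i + 1) r - p i r)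

/-- Number of patterns with given top row and weight. -/
def kostka (k : ℕ) (κ : ℕ → ℕ) (γ : Fin k → ℕ) : ℕ := ((gts k κ).filter fun p => wt k p = γ).card

/-- Extension of a finite sequence by zero. -/
def ext0 {n : ℕ} (κ : Fin n → ℕ) (r : ℕ) : ℕ := if h : r < n then κ ⟨r, h⟩ else 0

theorem ext0_val {n : ℕ} (κ : Fin n → ℕ) (r : Fin n) : ext0 κ r = κ r := by simp [ext0]

theorem ext0_of_le {n : ℕ} (κ : Fin n → ℕ) {r : ℕ} (h : n ≤ r) : ext0 κ r = 0 := by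
  simp [ext0, not_lt.mpr h]

variable {m n : ℕ}

/-- The array of partial column sums of an exponent. -/
def pat (e : Fin m × Fin n →₀ ℕ) (i : ℕ) : ℕ → ℕ := ext0 (psum e i)

theorem pat_injective : Function.Injective (pat : (Fin m × Fin n →₀ ℕ) → _) := by
  intro e e' h
  ext ⟨i, c⟩
  have h1 := psum_succ e i c
  have h2 := psum_succ e' i c
  have h3 : ∀ j, psum e j c = psum e' j c := fun j => by
    have := congrFun (congrFun h j) c
    rwa [pat, pat, ext0_val, ext0_val] at this
  rw [h3, h3] at h1
  omega

theorem wt_pat {k : ℕ} (e : Fin k × Fin k →₀ ℕ) : wt k (pat e) = rowDeg e := by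
  funext i
  rw [wt, rowDeg, ← Fin.sum_univ_eq_sum_range (fun r => pat e (i + 1) r - pat e i r)]
  refine sum_congr rfl fun c _ => ?_
  rw [pat, pat, ext0_val, ext0_val, psum_succ]
  omega

theorem lead_GT (f : P m n) (e : Fin m × Fin n →₀ ℕ) (he : IsLead f e) (κ : Fin n → ℕ)
    (hcol : ∀ e, coeff e f ≠ 0 → ∀ c, colDeg e c = κ c)
    (hpol : ∀ r s : Fin n, (r : ℕ) + 1 = s → pol m r s f = 0) : pat e ∈ GT m (ext0 κ) := by
  have hmono : ∀ i r, pat e i r ≤ pat e (i + 1) r := by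
    intro i r
    rw [pat, pat, ext0, ext0]
    split_ifs with h
    · refine sum_le_sum fun i' _ => ?_
      split_ifs <;> omega
    · grind
  refine ⟨fun r => ?_, fun i hi => ?_, hmono, ?_⟩
  · rw [pat, ext0]
    split_ifs
    · exact psum_zero _ _
    · rfl
  · rw [pat]
    congr 1
    funext c
    rw [psum_of_le e hi, hcol e he.1]
  · intro i
    induction i with
    | zero =>
      intro hi r
      by_cases hr : r + 1 < n
      · have h := ballot_step f e he κ hcol ⟨r, by omega⟩ ⟨r + 1, hr⟩ rfl (hpol _ _ rfl) ⟨0, hi⟩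
        have h2 := psum_succ e ⟨0, hi⟩ ⟨r + 1, hr⟩
        have h3 := psum_zero e ⟨r + 1, hr⟩
        simp only [pat, ext0, hr, (by omega : r < n), dif_pos] at *
        omega
      · simp [pat, ext0, hr]
    | succ i ih =>
      intro hi r
      by_cases hr : r + 1 < n
      · have h := ballot_step f e he κ hcol ⟨r, by omega⟩ ⟨r + 1, hr⟩ rfl (hpol _ _ rfl) ⟨i + 1, hi⟩
        have h2 := psum_succ e ⟨i + 1, hi⟩ ⟨r + 1, hr⟩
        have h3 := ih (by omega) r
        have h4 := hmono i r
        simp only [pat, ext0, hr, (by omega : r < n), dif_pos] at *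
        omega
      · simp [pat, ext0, hr]

/-- Upper bound for the dimension of a space of highest weight vectors of given left weight. -/
theorem finrank_le_kostka {k : ℕ} (U : Submodule ℂ (P k k)) (κ γ : Fin k → ℕ)
    (hcol : ∀ f ∈ U, ∀ e, coeff e f ≠ 0 → colDeg e = κ)
    (hrow : ∀ f ∈ U, ∀ e, coeff e f ≠ 0 → rowDeg e = γ)
    (hpol : ∀ f ∈ U, ∀ r s : Fin k, (r : ℕ) + 1 = s → pol k r s f = 0) :
    FiniteDimensional ℂ U ∧ Module.finrank ℂ U ≤ kostka k (ext0 κ) γ := by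
  have := finrank_le_of_support U (((gts k (ext0 κ)).filter fun p => wt k p = γ).preimage pat
    pat_injective.injOn) (fun f hf hf0 => by
      obtain ⟨e, he⟩ := exists_isLead f hf0
      refine ⟨e, ?_, he.1⟩
      rw [mem_preimage, mem_filter, mem_gts, wt_pat]
      exact ⟨lead_GT f e he κ (fun e h c => congrFun (hcol f hf e h) c) (hpol f hf),
        hrow f hf e he.1⟩)
  refine ⟨this.1, this.2.trans ?_⟩
  refine card_le_card_of_injOn pat (fun e he => ?_) pat_injective.injOn
  exact mem_preimage.mp he

end

section

open MvPolynomial Finset Submodule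

variable {m n : ℕ}

theorem key_add (e e' : Fin m × Fin n →₀ ℕ) : key (e + e') = key e + key e' := rfl

theorem isLead_mul {f g : P m n} {e e' : Fin m × Fin n →₀ ℕ} (hf : IsLead f e) (hg : IsLead g e') :
    IsLead (f * g) (e + e') := by
  constructor
  · rw [coeff_mul, sum_eq_single (e, e')]
    · exact mul_ne_zero hf.1 hg.1
    · rintro ⟨x, y⟩ hxy hne
      rw [HasAntidiagonal.mem_antidiagonal] at hxy
      simp only at hxy ⊢
      by_contra h0
      have hx := hf.2 x (left_ne_zero_of_mul h0)
      have hy := hg.2 y (right_ne_zero_of_mul h0)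
      have h1 : key x + key y = key e + key e' := by rw [← key_add, hxy, key_add]
      have h2 : key x = key e := by
        by_contra h
        exact absurd h1 (add_lt_add_of_lt_of_le (lt_of_le_of_ne hx h) hy).ne
      have h3 : x = e := key_injective h2
      subst h3
      exact hne (Prod.ext rfl (add_left_cancel hxy))
    · intro h
      refine absurd ?_ h
      rw [HasAntidiagonal.mem_antidiagonal]
  · intro y hy
    rw [coeff_mul] at hy
    obtain ⟨⟨a, b⟩, hab, h0⟩ := exists_ne_zero_of_sum_ne_zero hy
    rw [HasAntidiagonal.mem_antidiagonal] at hab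
    simp only at hab h0
    rw [← hab, key_add, key_add]
    exact add_le_add (hf.2 a (left_ne_zero_of_mul h0)) (hg.2 b (right_ne_zero_of_mul h0))

theorem isLead_one : IsLead (1 : P m n) 0 := by
  refine ⟨by simp, fun e he => ?_⟩
  rw [coeff_one] at he
  split_ifs at he with h
  · rw [h]
  · exact absurd rfl he

theorem isLead_prod {ι : Type*} (s : Finset ι) (f : ι → P m n) (e : ι → Fin m × Fin n →₀ ℕ)
    (h : ∀ i ∈ s, IsLead (f i) (e i)) : IsLead (∏ i ∈ s, f i) (∑ i ∈ s, e i) := by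
  classical
  induction s using Finset.induction_on with
  | empty => exact isLead_one
  | insert a s ha ih =>
    rw [prod_insert ha, sum_insert ha]
    exact isLead_mul (h a (mem_insert_self _ _))
      (ih fun i hi => h i (mem_insert_of_mem hi))

theorem card_le_finrank {ι : Type*} (U : Submodule ℂ (P m n)) [FiniteDimensional ℂ U]
    (S : Finset ι) (F : ι → P m n) (e : ι → Fin m × Fin n →₀ ℕ) (hU : ∀ i ∈ S, F i ∈ U)
    (hl : ∀ i ∈ S, IsLead (F i) (e i)) (he : ∀ i ∈ S, ∀ j ∈ S, e i = e j → i = j) :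
    S.card ≤ Module.finrank ℂ U := by
  have hli : LinearIndependent ℂ fun i : S => (⟨F i, hU i i.2⟩ : U) := by
    rw [linearIndependent_iff']
    intro s g hg
    by_contra hcon
    push Not at hcon
    obtain ⟨i0, hi0, hgi0⟩ := hcon
    obtain ⟨i, hi, hmax⟩ := exists_max_image (s.filter fun i => g i ≠ 0)
      (fun i => key (e i)) ⟨i0, mem_filter.mpr ⟨hi0, hgi0⟩⟩
    rw [mem_filter] at hi
    have h1 := congrArg (fun x : U => coeff (e i) (x : P m n)) hg
    simp only [Submodule.coe_sum, Submodule.coe_smul, Submodule.coe_zero, coeff_sum, coeff_smul,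
      coeff_zero, smul_eq_mul] at h1
    rw [sum_eq_single i] at h1
    · exact (mul_ne_zero hi.2 (hl i i.2).1) h1
    · intro j hj hji
      by_contra h0
      have h2 := (hl j j.2).2 _ (right_ne_zero_of_mul h0)
      have h3 := hmax j (mem_filter.mpr ⟨hj, left_ne_zero_of_mul h0⟩)
      exact hji (Subtype.ext (he j j.2 i i.2 (key_injective (le_antisymm h3 h2))))
    · intro h; exact absurd hi.1 h
  have := hli.fintype_card_le_finrank
  simpa using this

/-- Minor on the first `h` columns. -/
def minor {h : ℕ} (hn : h ≤ n) (T : Fin h → Fin m) : P m n :=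
  det (of fun r s : Fin h => (X (T r, Fin.castLE hn s) : P m n))

theorem ev_minor {h : ℕ} (hn : h ≤ n) (T : Fin h → Fin m) (M : Mat m n) :
    ev M (minor hn T) = (M.submatrix T (Fin.castLE hn)).det := by
  rw [minor, AlgHom.map_det]
  congr 1
  ext r s
  simp [ev_X]

theorem Ract_minor {h : ℕ} (hn : h ≤ n) (T : Fin h → Fin m) (u : Mat n n)
    (hu : IsUpperUni u) : Ract u (minor hn T) = minor hn T := by
  refine P_ext fun M => ?_
  rw [ev_Ract, ev_minor, ev_minor]
  have h1 : (M * u).submatrix T (Fin.castLE hn) =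
      M.submatrix T (Fin.castLE hn) * u.submatrix (Fin.castLE hn) (Fin.castLE hn) := by
    ext r s
    rw [submatrix_apply, mul_apply, mul_apply]
    symm
    refine sum_of_injOn (Fin.castLE hn) (Fin.castLE_injective hn).injOn (by simp) ?_ ?_
    · intro a _ ha
      rw [hu.2 a (Fin.castLE hn s), mul_zero]
      by_contra hlt
      refine ha ⟨⟨a, ?_⟩, by simp, Fin.ext rfl⟩
      have := s.2
      simp at hlt
      omega
    · intro a _; rfl
  have h2 : (u.submatrix (Fin.castLE hn) (Fin.castLE hn)).det = 1 := by
    have h3 : (u.submatrix (Fin.castLE hn) (Fin.castLE hn)).BlockTriangular id :=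
      fun i j hij => hu.2 (Fin.castLE hn i) (Fin.castLE hn j) hij
    rw [det_of_upperTriangular h3, prod_eq_one]
    intro i _; exact hu.1 _
  rw [h1, det_mul, h2, mul_one]

/-- Exponent of the diagonal term of a minor. -/
def minorExp {h : ℕ} (hn : h ≤ n) (T : Fin h → Fin m) (σ : Equiv.Perm (Fin h)) :
    Fin m × Fin n →₀ ℕ := ∑ s, Finsupp.single (T (σ s), Fin.castLE hn s) 1

theorem minor_eq {h : ℕ} (hn : h ≤ n) (T : Fin h → Fin m) :
    minor hn T = ∑ σ : Equiv.Perm (Fin h), ((Equiv.Perm.sign σ : ℤ) : ℂ) •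
      monomial (minorExp hn T σ) 1 := by
  rw [minor, det_apply']
  refine sum_congr rfl fun σ _ => ?_
  have : (monomial (minorExp hn T σ) (1 : ℂ) : P m n) = ∏ s, X (T (σ s), Fin.castLE hn s) := by
    rw [minorExp, monomial_sum_one]
    rfl
  rw [this, smul_eq_C_mul]
  simp

theorem minorExp_apply {h : ℕ} (hn : h ≤ n) (T : Fin h → Fin m) (hT : Function.Injective T)
    (σ : Equiv.Perm (Fin h)) (a : Fin h) (c : Fin n) :
    minorExp hn T σ (T a, c) = if (σ⁻¹ a : ℕ) = c then 1 else 0 := by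
  rw [minorExp, Finsupp.finsetSum_apply, sum_eq_single (σ⁻¹ a)]
  · rw [show σ (σ⁻¹ a) = a from σ.apply_symm_apply a, Finsupp.single_apply]
    congr 1
    simp [Fin.ext_iff]
  · intro b _ hb
    rw [Finsupp.single_eq_of_ne]
    intro hc
    have := hT (Prod.ext_iff.mp hc).1
    exact hb (by rw [this]; exact (σ.symm_apply_apply b).symm)
  · simp

theorem minorExp_apply_of_notMem {h : ℕ} (hn : h ≤ n) (T : Fin h → Fin m)
    (σ : Equiv.Perm (Fin h)) (i : Fin m) (hi : ∀ a, T a ≠ i) (c : Fin n) :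
    minorExp hn T σ (i, c) = 0 := by
  rw [minorExp, Finsupp.finsetSum_apply]
  refine sum_eq_zero fun b _ => ?_
  rw [Finsupp.single_eq_of_ne]
  intro hc
  exact hi _ (Prod.ext_iff.mp hc).1.symm

theorem minorExp_lt {h : ℕ} (hn : h ≤ n) (T : Fin h → Fin m) (hT : StrictMono T)
    (σ : Equiv.Perm (Fin h)) (hσ : σ ≠ 1) : key (minorExp hn T σ) < key (minorExp hn T 1) := by
  obtain ⟨a0, ha0⟩ : ∃ a, σ⁻¹ a ≠ a := by
    by_contra hcon
    push Not at hcon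
    exact hσ (inv_eq_one.mp (Equiv.ext hcon))
  obtain ⟨a, ha, hmax⟩ := exists_max_image (univ.filter fun a => σ⁻¹ a ≠ a) id
    ⟨a0, mem_filter.mpr ⟨mem_univ _, ha0⟩⟩
  rw [mem_filter] at ha
  have hfix : ∀ b, a < b → σ⁻¹ b = b := fun b hb => by
    by_contra h
    exact absurd (hmax b (mem_filter.mpr ⟨mem_univ _, h⟩)) (not_le.mpr hb)
  have hlt : σ⁻¹ a < a := by
    refine lt_of_le_of_ne (not_lt.mp fun h => ?_) ha.2
    exact ha.2 (σ⁻¹.injective (hfix _ h))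
  refine key_lt (T a) (Fin.castLE hn a) ?_ ?_ ?_
  · intro i hi c
    by_cases hex : ∃ b, T b = i
    · obtain ⟨b, rfl⟩ := hex
      rw [minorExp_apply _ _ hT.injective, minorExp_apply _ _ hT.injective, hfix b (hT.lt_iff_lt.mp hi)]
      rfl
    · push Not at hex
      rw [minorExp_apply_of_notMem _ _ _ _ hex, minorExp_apply_of_notMem _ _ _ _ hex]
  · intro c hc
    rw [minorExp_apply _ _ hT.injective, minorExp_apply _ _ hT.injective, if_neg, if_neg]
    · have h1 := Fin.lt_def.mp hc
      simp only [Fin.val_castLE] at h1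
      simp
      omega
    · have h1 := Fin.lt_def.mp hc
      have h2 := Fin.lt_def.mp hlt
      simp only [Fin.val_castLE] at h1
      omega
  · rw [minorExp_apply _ _ hT.injective, minorExp_apply _ _ hT.injective, if_neg, if_pos]
    · norm_num
    · simp
    · have h2 := Fin.lt_def.mp hlt
      simp only [Fin.val_castLE]
      omega

theorem isLead_minor {h : ℕ} (hn : h ≤ n) (T : Fin h → Fin m) (hT : StrictMono T) :
    IsLead (minor hn T) (minorExp hn T 1) := by
  constructor
  · rw [minor_eq, coeff_sum, sum_eq_single 1]
    · simp
    · intro σ _ hσ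
      rw [coeff_smul, coeff_monomial, if_neg, smul_zero]
      intro h
      exact (minorExp_lt hn T hT σ hσ).ne (congrArg key h)
    · simp
  · intro e he
    rw [minor_eq, coeff_sum] at he
    obtain ⟨σ, _, h0⟩ := exists_ne_zero_of_sum_ne_zero he
    rw [coeff_smul, coeff_monomial] at h0
    split_ifs at h0 with h1
    · rw [← h1]
      by_cases hσ : σ = 1
      · rw [hσ]
      · exact (minorExp_lt hn T hT σ hσ).le
    · simp at h0

/-- All exponents of `f` have the given column and row degrees. -/
def HasDeg (f : P m n) (κ : Fin n → ℕ) (γ : Fin m → ℕ) : Prop :=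
  ∀ e, coeff e f ≠ 0 → colDeg e = κ ∧ rowDeg e = γ

theorem colDeg_add (e e' : Fin m × Fin n →₀ ℕ) : colDeg (e + e') = colDeg e + colDeg e' := by
  funext c; simp [colDeg, sum_add_distrib]

theorem rowDeg_add (e e' : Fin m × Fin n →₀ ℕ) : rowDeg (e + e') = rowDeg e + rowDeg e' := by
  funext c; simp [rowDeg, sum_add_distrib]

theorem HasDeg.mul {f g : P m n} {κ κ' : Fin n → ℕ} {γ γ' : Fin m → ℕ} (hf : HasDeg f κ γ)
    (hg : HasDeg g κ' γ') : HasDeg (f * g) (κ + κ') (γ + γ') := by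
  intro e he
  rw [coeff_mul] at he
  obtain ⟨⟨a, b⟩, hab, h0⟩ := exists_ne_zero_of_sum_ne_zero he
  rw [HasAntidiagonal.mem_antidiagonal] at hab
  obtain ⟨h1, h2⟩ := hf a (left_ne_zero_of_mul h0)
  obtain ⟨h3, h4⟩ := hg b (right_ne_zero_of_mul h0)
  rw [← hab, colDeg_add, rowDeg_add]
  exact ⟨by rw [h1, h3], by rw [h2, h4]⟩

theorem hasDeg_minor {h : ℕ} (hn : h ≤ n) (T : Fin h → Fin m) :
    ∃ κ γ, HasDeg (minor hn T) κ γ := by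
  refine ⟨fun c => ∑ s : Fin h, if Fin.castLE hn s = c then 1 else 0,
    fun i => ∑ s : Fin h, if T s = i then 1 else 0, fun e he => ?_⟩
  rw [minor_eq, coeff_sum] at he
  obtain ⟨σ, _, h0⟩ := exists_ne_zero_of_sum_ne_zero he
  rw [coeff_smul, coeff_monomial] at h0
  split_ifs at h0 with h1
  · subst h1
    constructor
    · funext c
      rw [colDeg]
      simp_rw [minorExp, Finsupp.finsetSum_apply]
      rw [sum_comm]
      refine sum_congr rfl fun s _ => ?_
      simp_rw [Finsupp.single_apply, Prod.mk.injEq]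
      by_cases hc : Fin.castLE hn s = c <;> simp [hc]
    · funext i
      rw [rowDeg, ← Equiv.sum_comp σ]
      simp_rw [minorExp, Finsupp.finsetSum_apply]
      rw [sum_comm]
      refine sum_congr rfl fun s _ => ?_
      simp_rw [Finsupp.single_apply, Prod.mk.injEq]
      by_cases hc : T (σ s) = i <;> simp [hc]
  · simp at h0

theorem hasDeg_prod {ι : Type*} (s : Finset ι) (f : ι → P m n)
    (h : ∀ i ∈ s, ∃ κ γ, HasDeg (f i) κ γ) : ∃ κ γ, HasDeg (∏ i ∈ s, f i) κ γ := by
  classical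
  induction s using Finset.induction_on with
  | empty =>
    refine ⟨0, 0, fun e he => ?_⟩
    rw [prod_empty, coeff_one] at he
    split_ifs at he with h
    · subst h; exact ⟨by funext c; simp [colDeg], by funext c; simp [rowDeg]⟩
    · exact absurd rfl he
  | insert a s ha ih =>
    rw [prod_insert ha]
    obtain ⟨κ, γ, h1⟩ := h a (mem_insert_self _ _)
    obtain ⟨κ', γ', h2⟩ := ih fun i hi => h i (mem_insert_of_mem hi)
    exact ⟨_, _, h1.mul h2⟩

end

section

open MvPolynomial Finset

variable {m n : ℕ}

/-- Highest weight vectors of weight `κ` for the right action. -/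
def HWs (m : ℕ) {n : ℕ} (κ : Fin n → ℕ) : Submodule ℂ (P m n) where
  carrier := {f | GLHW (repR m n) (ext0 κ) f}
  add_mem' := fun {x y} hx hy => ⟨fun j hj c hc => by rw [map_add, hx.1 j hj c hc, hy.1 j hj c hc],
    fun j hj s => by rw [map_add, hx.2 j hj s, hy.2 j hj s, smul_add]⟩
  zero_mem' := ⟨fun j hj c hc => map_zero _, fun j hj s => by rw [map_zero, smul_zero]⟩
  smul_mem' := fun a x hx => ⟨fun j hj c hc => by rw [map_smul, hx.1 j hj c hc],
    fun j hj s => by rw [map_smul, hx.2 j hj s, smul_comm]⟩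

theorem mem_HWs {κ : Fin n → ℕ} {f : P m n} : f ∈ HWs m κ ↔ GLHW (repR m n) (ext0 κ) f := Iff.rfl

/-- Polynomials of left weight `γ`. -/
def LWs {m : ℕ} (n : ℕ) (γ : Fin m → ℕ) : Submodule ℂ (P m n) where
  carrier := {f | ∀ e, coeff e f ≠ 0 → rowDeg e = γ}
  add_mem' := fun {x y} hx hy e he => by
    by_cases h : coeff e x = 0
    · rw [coeff_add, h, zero_add] at he; exact hy e he
    · exact hx e h
  zero_mem' := fun e he => absurd (coeff_zero e) he
  smul_mem' := fun a x hx e he => hx e fun h => he (by rw [coeff_smul, h, smul_zero])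

/-- Polynomials of right weight `κ`. -/
def RWs (m : ℕ) {n : ℕ} (κ : Fin n → ℕ) : Submodule ℂ (P m n) where
  carrier := {f | ∀ e, coeff e f ≠ 0 → colDeg e = κ}
  add_mem' := fun {x y} hx hy e he => by
    by_cases h : coeff e x = 0
    · rw [coeff_add, h, zero_add] at he; exact hy e he
    · exact hx e h
  zero_mem' := fun e he => absurd (coeff_zero e) he
  smul_mem' := fun a x hx e he => hx e fun h => he (by rw [coeff_smul, h, smul_zero])

theorem mem_RWs {κ : Fin n → ℕ} {f : P m n} :
    f ∈ RWs m κ ↔ ∀ j < n, ∀ s : ℂˣ, repR m n (tor n j s) f = (s : ℂ) ^ ext0 κ j • f := by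
  constructor
  · intro h j hj
    refine (repR_tor_iff ⟨j, hj⟩ _ f).mpr fun e he => ?_
    rw [h e he, ← ext0_val κ]
  · intro h e he
    funext c
    rw [(repR_tor_iff c _ f).mp (h c c.2) e he, ext0_val]

theorem mem_LWs {γ : Fin m → ℕ} {f : P m n} :
    f ∈ LWs n γ ↔ ∀ j < m, ∀ s : ℂˣ, repL m n (tor m j s) f = (s : ℂ) ^ ext0 γ j • f := by
  constructor
  · intro h j hj
    refine (repL_tor_iff ⟨j, hj⟩ _ f).mpr fun e he => ?_
    rw [h e he, ← ext0_val γ]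
  · intro h e he
    funext c
    rw [(repL_tor_iff c _ f).mp (h c c.2) e he, ext0_val]

theorem HWs_le_RWs (κ : Fin n → ℕ) : HWs m κ ≤ RWs m κ := fun _ hf => mem_RWs.mpr hf.2

theorem HWs_pol {κ : Fin n → ℕ} {f : P m n} (hf : f ∈ HWs m κ) (r s : Fin n)
    (h : (r : ℕ) + 1 = s) : pol m r s f = 0 := by
  refine pol_eq_zero r s f fun t => ?_
  have h0 : (t • ee n s) ⬝ᵥ ee n r = 0 := by
    rw [smul_dotProduct, ee_dot_ee _ _ (by omega), smul_zero]
  have := hf.1 r r.2 (unip (ee n r) (t • ee n s) h0) (unip_mem_Aplus _ _ (fun i hi => by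
    simp [ee]; intro h; omega) _)
  exact this

theorem isUpperUni_Aplus (j : ℕ) (g : GL (Fin n) ℂ) (hg : g ∈ Aplus n j) :
    IsUpperUni (g : Mat n n) := by
  obtain ⟨η, hη, hg⟩ := hg
  rw [hg]
  constructor
  · intro i
    rw [Matrix.add_apply, Matrix.one_apply_eq, vecMulVec_apply, ee]
    split_ifs with h
    · rw [hη i h.le]; simp
    · simp
  · intro a b hab
    rw [Matrix.add_apply, Matrix.one_apply_ne (by rintro rfl; omega), vecMulVec_apply, ee]
    split_ifs with h
    · rw [hη b (by omega)]; simp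
    · simp

theorem mem_HWs_of {κ : Fin n → ℕ} {f : P m n} (h : f ∈ RWs m κ)
    (hu : ∀ u, IsUpperUni u → Ract u f = f) : f ∈ HWs m κ :=
  ⟨fun j _ c hc => hu _ (isUpperUni_Aplus j c hc), mem_RWs.mp h⟩

theorem exists_standard {k : ℕ} (κ : Fin k → ℕ) (p : ℕ → ℕ → ℕ) (hp : p ∈ GT k (ext0 κ)) :
    ∃ F ∈ HWs k κ ⊓ LWs k (wt k p), ∃ e, pat e = p ∧ IsLead F e := by
  classical
  have hanti : ∀ i, Antitone (p i) := fun i => antitone_nat_of_succ_le (GT_row_antitone hp i)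
  have hκ : Antitone (ext0 κ) := antitone_nat_of_succ_le (GT_antitone hp)
  have hex : ∀ c r : ℕ, c < ext0 κ r → ∃ i : Fin k, p i r ≤ c ∧ c < p (i + 1) r := by
    intro c r hc
    have h1 : ∃ j, c < p j r := ⟨k, by rwa [hp.2.1 k le_rfl]⟩
    have h2 : Nat.find h1 ≠ 0 := by
      intro h
      have := Nat.find_spec h1
      rw [h, hp.1] at this
      omega
    have h3 : Nat.find h1 ≤ k := Nat.find_le (by rwa [hp.2.1 k le_rfl])
    refine ⟨⟨Nat.find h1 - 1, by omega⟩, ?_, ?_⟩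
    · exact not_lt.mp (Nat.find_min h1 (m := Nat.find h1 - 1) (by omega))
    · grind [Nat.find_spec h1]
  let h (c : ℕ) : ℕ := if hk : ∃ r, ext0 κ r ≤ c then Nat.find hk else 0
  have hh : ∀ c r, r < h c ↔ c < ext0 κ r := by
    intro c r
    have hk : ∃ r, ext0 κ r ≤ c := ⟨k, by rw [ext0_of_le κ le_rfl]; exact Nat.zero_le _⟩
    simp only [h, dif_pos hk]
    refine ⟨fun hr => not_le.mp (Nat.find_min hk hr), fun hr => ?_⟩
    by_contra hcon
    have := Nat.find_spec hk
    have := hκ (not_lt.mp hcon)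
    omega
  have hhk : ∀ c, h c ≤ k := by
    intro c
    by_contra hcon
    have := (hh c k).mp (not_le.mp hcon)
    rw [ext0_of_le κ le_rfl] at this
    omega
  choose! T hT1 hT2 using fun (c : ℕ) (r : Fin (h c)) => hex c r ((hh c r).mp r.2)
  have hTmono : ∀ c, StrictMono (T c) := by
    intro c r s hrs
    by_contra hcon
    have h1 : (T c s : ℕ) ≤ T c r := Fin.le_def.mp (not_lt.mp hcon)
    have h2 := hT2 c s
    have h3 := hT1 c r
    have h4 := hp.2.2.2 (T c s) (T c s).2 r
    have h5 : p (T c s + 1) s ≤ p (T c s + 1) (r + 1) := hanti _ (by have := Fin.lt_def.mp hrs; omega)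
    have h6 := GT_mono hp h1 r
    omega
  have huniq : ∀ c r i j, p i r ≤ c → c < p (i + 1) r → p j r ≤ c → c < p (j + 1) r → i = j := by
    intro c r i j h1 h2 h3 h4
    rcases lt_trichotomy i j with h | h | h
    · have := GT_mono hp (show i + 1 ≤ j from h) r; omega
    · exact h
    · have := GT_mono hp (show j + 1 ≤ i from h) r; omega
  let B := ext0 κ 0
  let F : P k k := ∏ c ∈ range B, minor (hhk c) (T c)
  let e : Fin k × Fin k →₀ ℕ := ∑ c ∈ range B, minorExp (hhk c) (T c) 1
  have hlead : IsLead F e := isLead_prod _ _ _ fun c _ => isLead_minor (hhk c) (T c) (hTmono c)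
  have hexp : ∀ c i s, minorExp (hhk c) (T c) 1 (i, s) =
      if p i s ≤ c ∧ c < p (i + 1) s then 1 else 0 := by
    intro c i s
    by_cases hi : ∃ a, T c a = i
    · obtain ⟨a, rfl⟩ := hi
      rw [minorExp_apply _ _ (hTmono c).injective]
      simp only [inv_one, Equiv.Perm.coe_one, id_eq]
      refine if_congr ⟨fun h1 => h1 ▸ ⟨hT1 c a, hT2 c a⟩, fun ⟨h1, h2⟩ => ?_⟩ rfl rfl
      have h3 : (s : ℕ) < h c := (hh c s).mpr (h2.trans_le (GT_le hp _ _))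
      have h4 := huniq c s _ _ h1 h2 (hT1 c ⟨s, h3⟩) (hT2 c ⟨s, h3⟩)
      rw [(hTmono c).injective (Fin.ext h4)]
    · push Not at hi
      rw [minorExp_apply_of_notMem _ _ _ _ hi, if_neg]
      rintro ⟨h1, h2⟩
      have h3 : (s : ℕ) < h c := (hh c s).mpr (h2.trans_le (GT_le hp _ _))
      exact hi ⟨s, h3⟩ (Fin.ext (huniq c s _ _ (hT1 c ⟨s, h3⟩) (hT2 c ⟨s, h3⟩) h1 h2))
  have he : ∀ i s : Fin k, e (i, s) = p (i + 1) s - p i s := by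
    intro i s
    have h1 : (range B).filter (fun c => p i s ≤ c ∧ c < p (i + 1) s) =
        Ico (p i s) (p (i + 1) s) := by
      ext c
      rw [mem_filter, mem_range, mem_Ico]
      exact ⟨fun h => h.2, fun h => ⟨h.2.trans_le ((GT_le hp _ _).trans (hκ (Nat.zero_le _))), h⟩⟩
    simp only [e, Finsupp.finsetSum_apply, hexp]
    rw [← card_filter, h1, Nat.card_Ico]
  have hpsum : ∀ i, i ≤ k → ∀ s : Fin k, psum e i s = p i s := by
    intro i
    induction i with
    | zero => intro _ s; rw [psum_zero, hp.1]
    | succ i ih =>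
      intro hi s
      have h1 := psum_succ e ⟨i, by omega⟩ s
      have h2 := ih (by omega) s
      have h3 := he ⟨i, by omega⟩ s
      have h4 := hp.2.2.1 i s
      simp only at h1 h3
      omega
  have hpat : pat e = p := by
    ext i s
    rw [pat, ext0]
    split_ifs with hs
    · rcases le_total i k with hi | hi
      · rw [hpsum i hi]
      · rw [psum_of_le e hi, ← psum_of_le e le_rfl, hpsum k le_rfl, hp.2.1 k le_rfl, hp.2.1 i hi]
    · have := GT_le hp i s
      rw [ext0_of_le κ (not_lt.mp hs)] at this
      omega
  obtain ⟨κ', γ', hdeg⟩ := hasDeg_prod (range B) (fun c => minor (hhk c) (T c))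
    fun c _ => hasDeg_minor (hhk c) (T c)
  obtain ⟨h1, h2⟩ := hdeg e hlead.1
  have h3 : κ' = κ := by
    rw [← h1]
    funext s
    rw [← psum_of_le e le_rfl, hpsum k le_rfl, hp.2.1 k le_rfl, ext0_val]
  have h4 : γ' = wt k p := by rw [← h2, ← hpat, wt_pat]
  subst h3 h4
  refine ⟨F, ⟨mem_HWs_of (fun e he => (hdeg e he).1) fun u hu => ?_, fun e he => (hdeg e he).2⟩,
    e, hpat, hlead⟩
  simp only [F, map_prod]
  exact prod_congr rfl fun c _ => Ract_minor _ _ u hu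

theorem finrank_HWs_inf_LWs {k : ℕ} (κ γ : Fin k → ℕ) :
    FiniteDimensional ℂ (HWs k κ ⊓ LWs k γ : Submodule ℂ (P k k)) ∧
    Module.finrank ℂ (HWs k κ ⊓ LWs k γ : Submodule ℂ (P k k)) = kostka k (ext0 κ) γ := by
  obtain ⟨h1, h2⟩ := finrank_le_kostka (HWs k κ ⊓ LWs k γ) κ γ
    (fun f hf => HWs_le_RWs κ hf.1) (fun f hf => hf.2) (fun f hf r s h => HWs_pol hf.1 r s h)
  refine ⟨h1, le_antisymm h2 ?_⟩
  have hex : ∀ p, ∃ F : P k k, ∃ e, p ∈ GT k (ext0 κ) →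
      (F ∈ HWs k κ ⊓ LWs k (wt k p) ∧ pat e = p ∧ IsLead F e) := by
    intro p
    by_cases hp : p ∈ GT k (ext0 κ)
    · obtain ⟨F, hF, e, h⟩ := exists_standard κ p hp
      exact ⟨F, e, fun _ => ⟨hF, h⟩⟩
    · exact ⟨0, 0, fun h => absurd h hp⟩
  choose F e hFe using hex
  refine card_le_finrank _ _ F e (fun p hp => ?_) (fun p hp => ?_) fun p hp q hq h => ?_
  · rw [mem_filter, mem_gts] at hp
    rw [← hp.2]
    exact (hFe p hp.1).1
  · rw [mem_filter, mem_gts] at hp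
    exact (hFe p hp.1).2.2
  · rw [mem_filter, mem_gts] at hp hq
    rw [← (hFe p hp.1).2.1, h, (hFe q hq.1).2.1]

end

section

open MvPolynomial Finset Submodule LinearMap

variable {m n k : ℕ}

theorem exists_line (f : P m n) (A B : Mat m n) :
    ∃ p : Polynomial ℂ, ∀ t : ℂ, p.eval t = ev (A + t • B) f := by
  let φ : P m n →ₐ[ℂ] Polynomial ℂ :=
    aeval fun p => Polynomial.C (A p.1 p.2) + Polynomial.X * Polynomial.C (B p.1 p.2)
  refine ⟨φ f, fun t => ?_⟩
  have : (Polynomial.aeval t).comp φ = ev (A + t • B) := by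
    refine MvPolynomial.algHom_ext fun p => ?_
    simp [φ, ev]
    ring
  rw [← this, AlgHom.comp_apply, Polynomial.coe_aeval_eq_eval]

theorem ev_eq_zero_of_line (f : P m n) (A B : Mat m n) (q : Polynomial ℂ)
    (hq : q ≠ 0) (h : ∀ t : ℂ, q.eval t ≠ 0 → ev (A + t • B) f = 0) : ev (A + B) f = 0 := by
  obtain ⟨p, hp⟩ := exists_line f A B
  have hpq : p * q = 0 := by
    refine Polynomial.funext fun t => ?_
    rw [Polynomial.eval_mul, Polynomial.eval_zero]
    by_cases ht : q.eval t = 0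
    · rw [ht, mul_zero]
    · rw [hp, h t ht, zero_mul]
  have hp0 := (mul_eq_zero.mp hpq).resolve_right hq
  have := hp 1
  rw [hp0, one_smul, Polynomial.eval_zero] at this
  exact this.symm

theorem exists_det_line (N : Mat n n) (A : Mat n n) :
    ∃ q : Polynomial ℂ, ∀ t : ℂ, q.eval t = (A + t • N).det := by
  obtain ⟨p, hp⟩ := exists_line (det (of fun r s : Fin n => (X (r, s) : P n n))) A N
  refine ⟨p, fun t => ?_⟩
  rw [hp, AlgHom.map_det]
  congr 1
  ext i j
  simp [ev]

theorem poly_ne_zero (q : Polynomial ℂ) (t : ℂ) (h : q.eval t ≠ 0) : q ≠ 0 := by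
  rintro rfl; simp at h

/-- The matrix whose top square block is the identity and whose other entries vanish. -/
def topE (n k : ℕ) : Mat n k := of fun i j => if (i : ℕ) = j then 1 else 0

theorem exists_extend (hk : k ≤ n) (M : Mat n k) :
    ∃ N : Mat n n, N * topE n k = M := by
  refine ⟨of fun i j => if h : (j : ℕ) < k then M i ⟨j, h⟩ else 0, ?_⟩
  ext i c
  rw [mul_apply, sum_eq_single (Fin.castLE hk c)]
  · simp [topE]
  · intro j _ hj
    have : ¬ ((j : ℕ) = c) := fun h => hj (Fin.ext h)
    simp [topE, this]
  · simp

theorem eq_zero_of_orbit (hk : k ≤ n) (f : P n k)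
    (h : ∀ g : GL (Fin n) ℂ, ev (topE n k) (repL n k g f) = 0) : f = 0 := by
  refine P_ext fun M => ?_
  rw [map_zero]
  obtain ⟨N, hN⟩ := exists_extend hk (M - topE n k)
  obtain ⟨q, hq⟩ := exists_det_line N 1
  have hq0 := poly_ne_zero q 0 (by simp [hq])
  have := ev_eq_zero_of_line f (topE n k) (M - topE n k) q hq0 fun t ht => by
    rw [hq] at ht
    let g := GeneralLinearGroup.mkOfDetNeZero (1 + t • N)ᵀ (by rwa [det_transpose])
    have hg := h g
    rw [repL_apply, ev_Lact] at hg
    rw [show (g : Mat n n) = (1 + t • N)ᵀ from rfl, Matrix.transpose_transpose, Matrix.add_mul, Matrix.one_mul, Matrix.smul_mul, hN] at hg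
    exact hg
  simpa using this

theorem colDeg_sum (e : Fin m × Fin n →₀ ℕ) : ∑ c, colDeg e c = ∑ p, e p := by
  rw [Fintype.sum_prod_type, sum_comm]; rfl

theorem RWs_le (κ : Fin n → ℕ) : RWs m κ ≤ restrictTotalDegree (Fin m × Fin n) ℂ (∑ c, κ c) := by
  intro f hf
  rw [mem_restrictTotalDegree]
  refine Finset.sup_le fun e he => ?_
  have := hf e (mem_support_iff.mp he)
  rw [← this, colDeg_sum, Finsupp.sum_fintype _ _ (fun _ => rfl)]

instance (κ : Fin n → ℕ) : FiniteDimensional ℂ (RWs m κ) := by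
  have : FiniteDimensional ℂ (restrictTotalDegree (Fin m × Fin n) ℂ (∑ c, κ c)) :=
    inferInstance
  exact finiteDimensional_of_le (RWs_le κ)

instance (κ : Fin n → ℕ) : FiniteDimensional ℂ (HWs m κ) :=
  finiteDimensional_of_le (HWs_le_RWs κ)

theorem isSubrep_HWs (κ : Fin n → ℕ) : IsSubrep (repL m n) (HWs m κ) := by
  intro g f hf
  constructor
  · intro j hj c hc
    rw [repR_apply, repL_apply, ← Lact_Ract, ← repR_apply, hf.1 j hj c hc]
  · intro j hj s
    rw [repR_apply, repL_apply, ← Lact_Ract, ← repR_apply, hf.2 j hj s, map_smul]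

theorem det_top_mul {h : ℕ} (hm : h ≤ m) (hn : h ≤ n) (M : Mat m n)
    (A : Mat n n) (hA : ∀ i j : Fin n, (j : ℕ) < i → A i j = 0) :
    ((M * A).submatrix (Fin.castLE hm) (Fin.castLE hn)).det =
      (M.submatrix (Fin.castLE hm) (Fin.castLE hn)).det *
        ∏ i : Fin h, A (Fin.castLE hn i) (Fin.castLE hn i) := by
  have h1 : (M * A).submatrix (Fin.castLE hm) (Fin.castLE hn) =
      M.submatrix (Fin.castLE hm) (Fin.castLE hn) *
        A.submatrix (Fin.castLE hn) (Fin.castLE hn) := by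
    ext i j
    simp only [submatrix_apply, mul_apply]
    symm
    refine Fintype.sum_of_injective (Fin.castLE hn) (Fin.castLE_injective hn) _ _ ?_ fun _ => rfl
    intro l hl
    rw [hA l _ ?_, mul_zero]
    by_contra hcon
    exact hl ⟨⟨l, by have := j.2; simp at hcon; omega⟩, rfl⟩
  rw [h1, det_mul, det_of_upperTriangular (M := A.submatrix _ _)]
  · rfl
  · intro i j hij
    exact hA _ _ hij

theorem det_mul_top {h : ℕ} (hm : h ≤ m) (hn : h ≤ n) (M : Mat m n)
    (A : Mat m m) (hA : ∀ i j : Fin m, (j : ℕ) < i → A i j = 0) :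
    ((Aᵀ * M).submatrix (Fin.castLE hm) (Fin.castLE hn)).det =
      (M.submatrix (Fin.castLE hm) (Fin.castLE hn)).det *
        ∏ i : Fin h, A (Fin.castLE hm i) (Fin.castLE hm i) := by
  have := det_top_mul hn hm Mᵀ A hA
  have h2 : (Mᵀ * A).submatrix (Fin.castLE hn) (Fin.castLE hm) =
      ((Aᵀ * M).submatrix (Fin.castLE hm) (Fin.castLE hn))ᵀ := by
    rw [transpose_submatrix, transpose_mul, transpose_transpose]
  rw [h2, ← transpose_submatrix, det_transpose, det_transpose] at this
  exact this

/-- Product of the leading principal minors with exponents prescribed by `κ`. -/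
def delta (hk : k ≤ n) (κ : Fin k → ℕ) : P n k :=
  ∏ r : Fin k, minor (m := n) (show (r : ℕ) + 1 ≤ k from r.2)
    (Fin.castLE (show (r : ℕ) + 1 ≤ n from r.2.trans_le hk)) ^ (κ r - ext0 κ (r + 1))

theorem ev_delta (hk : k ≤ n) (κ : Fin k → ℕ) (M : Mat n k) :
    ev M (delta hk κ) = ∏ r : Fin k, (M.submatrix
      (Fin.castLE (show (r : ℕ) + 1 ≤ n from r.2.trans_le hk))
      (Fin.castLE (show (r : ℕ) + 1 ≤ k from r.2))).det ^ (κ r - ext0 κ (r + 1)) := by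
  rw [delta, map_prod]
  exact prod_congr rfl fun r _ => by rw [map_pow, ev_minor]

theorem ext0_antitone {κ : Fin k → ℕ} (h : Antitone κ) : Antitone (ext0 κ) := by
  intro i j hij
  by_cases hj : j < k
  · rw [ext0, dif_pos hj, ext0, dif_pos (hij.trans_lt hj)]
    exact h hij
  · rw [ext0, dif_neg hj]; exact Nat.zero_le _

theorem sum_tail {κ : Fin k → ℕ} (h : Antitone κ) (j : ℕ) :
    ∑ r : Fin k, (if j ≤ (r : ℕ) then κ r - ext0 κ (r + 1) else 0) = ext0 κ j := by
  have h0 := ext0_antitone h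
  have h1 : ∀ N, ∑ r ∈ range N, (if j ≤ r then ext0 κ r - ext0 κ (r + 1) else 0)
      = ext0 κ j - ext0 κ (max j N) := by
    intro N
    induction N with
    | zero => simp
    | succ N ih =>
      rw [sum_range_succ, ih]
      split_ifs with hN
      · have := h0 N.le_succ
        have := h0 hN
        grind
      · grind
  rw [sum_congr rfl (g := fun r : Fin k => (fun r : ℕ => if j ≤ r then ext0 κ r - ext0 κ (r + 1) else 0) (r : ℕ))
    (fun r _ => by simp only [ext0_val]), Fin.sum_univ_eq_sum_range (fun r : ℕ => if j ≤ r then ext0 κ r - ext0 κ (r + 1) else 0), h1,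
    ext0_of_le κ (le_max_right _ _), Nat.sub_zero]

theorem prod_tor_diag {h N : ℕ} (hN : h ≤ N) (j : ℕ) (s : ℂˣ) :
    ∏ i : Fin h, (tor N j s : Mat N N) (Fin.castLE hN i) (Fin.castLE hN i) =
      if j < h then (s : ℂ) else 1 := by
  have : ∀ i : Fin h, (tor N j s : Mat N N) (Fin.castLE hN i) (Fin.castLE hN i)
      = if (i : ℕ) = j then (s : ℂ) else 1 := fun i => by simp [tor]
  simp_rw [this]
  split_ifs with hj
  · rw [prod_eq_single (⟨j, hj⟩ : Fin h)] <;> grind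
  · exact prod_eq_one fun i _ => by rw [if_neg]; omega

theorem delta_factor {ι : Type*} [Fintype ι] (a b : ι → ℂ) (c : ι → ℕ) :
    ∏ r, (a r * b r) ^ c r = (∏ r, b r ^ c r) * ∏ r, a r ^ c r := by
  rw [← prod_mul_distrib]
  exact prod_congr rfl fun r _ => by rw [mul_pow, mul_comm]

theorem prod_tail {κ : Fin k → ℕ} (h : Antitone κ) (j : ℕ) (s : ℂ) :
    ∏ r : Fin k, (if j < (r : ℕ) + 1 then s else 1) ^ (κ r - ext0 κ (r + 1)) = s ^ ext0 κ j := by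
  rw [← sum_tail h j, ← prod_pow_eq_pow_sum]
  refine prod_congr rfl fun r _ => ?_
  simp only [Nat.lt_succ_iff]
  split_ifs <;> simp

theorem Aplus_triangular (j : ℕ) (g : GL (Fin n) ℂ) (hg : g ∈ Aplus n j) :
    (∀ i l : Fin n, (l : ℕ) < i → g i l = 0) ∧ ∀ i, g i i = 1 :=
  ⟨(isUpperUni_Aplus j g hg).2, (isUpperUni_Aplus j g hg).1⟩

theorem tor_triangular (j : ℕ) (s : ℂˣ) (i l : Fin n) (h : (l : ℕ) < i) :
    (tor n j s : Mat n n) i l = 0 := by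
  obtain ⟨d, hd⟩ := tor_diag (n := n) j s
  rw [hd, diagonal_apply_ne]
  rintro rfl; omega

theorem delta_mem (hk : k ≤ n) {κ : Fin k → ℕ} (hκ : Antitone κ) : delta hk κ ∈ HWs n κ := by
  constructor
  · intro j _ c hc
    refine P_ext fun M => ?_
    rw [repR_apply, ev_Ract, ev_delta, ev_delta]
    refine prod_congr rfl fun r _ => ?_
    rw [det_top_mul _ _ _ _ (Aplus_triangular j c hc).1,
      prod_eq_one fun i _ => (Aplus_triangular j c hc).2 _, mul_one]
  · intro j _ s
    refine P_ext fun M => ?_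
    rw [repR_apply, ev_Ract, map_smul, ev_delta, ev_delta]
    simp_rw [det_top_mul _ _ M _ (tor_triangular j s), prod_tor_diag]
    rw [delta_factor, prod_tail hκ, smul_eq_mul]

theorem delta_GLHW (hk : k ≤ n) {κ : Fin k → ℕ} (hκ : Antitone κ) :
    GLHW (repL n k) (ext0 κ) (delta hk κ) := by
  constructor
  · intro j _ c hc
    refine P_ext fun M => ?_
    rw [repL_apply, ev_Lact, ev_delta, ev_delta]
    refine prod_congr rfl fun r _ => ?_
    rw [det_mul_top _ _ _ _ (Aplus_triangular j c hc).1,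
      prod_eq_one fun i _ => (Aplus_triangular j c hc).2 _, mul_one]
  · intro j _ s
    refine P_ext fun M => ?_
    rw [repL_apply, ev_Lact, map_smul, ev_delta, ev_delta]
    simp_rw [det_mul_top _ _ M _ (tor_triangular j s), prod_tor_diag]
    rw [delta_factor, prod_tail hκ, smul_eq_mul]

theorem ev_topE_delta (hk : k ≤ n) (κ : Fin k → ℕ) : ev (topE n k) (delta hk κ) = 1 := by
  rw [ev_delta]
  refine prod_eq_one fun r _ => ?_
  have : (topE n k).submatrix (Fin.castLE (show (r : ℕ) + 1 ≤ n from r.2.trans_le hk))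
      (Fin.castLE (show (r : ℕ) + 1 ≤ k from r.2)) = 1 := by
    ext i j
    simp [topE, one_apply, Fin.ext_iff]
  rw [this, det_one, one_pow]

theorem delta_ne_zero (hk : k ≤ n) (κ : Fin k → ℕ) : delta hk κ ≠ 0 := by
  intro h
  simpa [h] using ev_topE_delta hk κ

/-- In a finite-dimensional stable subspace there is a vector fixed by all the `Aplus`
which is an eigenvector of the torus. -/
theorem exists_HW {X : Type*} [AddCommGroup X] [Module ℂ X]
    (τ : Representation ℂ (GL (Fin n) ℂ) X) (U : Submodule ℂ X) (hUs : IsSubrep τ U)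
    [FiniteDimensional ℂ U] (hU : U ≠ ⊥) :
    ∃ v ∈ U, v ≠ 0 ∧ (∀ j < n, ∀ c ∈ Aplus n j, τ c v = v) ∧
      ∀ j < n, ∀ s, ∃ c : ℂ, τ (tor n j s) v = c • v := by
  have hU' := fixedBy_Aplus_ne_bot τ U hUs hU
  have : FiniteDimensional ℂ (fixedBy τ (Aplus n) n U) :=
    finiteDimensional_of_le (fixedBy_le _ _ _ _)
  obtain ⟨v, hv, hv0, hve⟩ := exists_common_eigenvector
    {f | ∃ j < n, ∃ s, f = τ (tor n j s)} (by
      rintro _ ⟨i, _, s, rfl⟩ _ ⟨j, _, t, rfl⟩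
      rw [← map_mul, ← map_mul]
      congr 1
      ext1
      obtain ⟨d, hd⟩ := tor_diag (n := n) i s
      obtain ⟨d', hd'⟩ := tor_diag (n := n) j t
      rw [Units.val_mul, Units.val_mul, hd, hd', diagonal_mul_diagonal, diagonal_mul_diagonal]
      congr 1; ext; ring) _ hU' (by
      rintro _ ⟨j, _, s, rfl⟩ x hx
      refine fixedBy_stable τ _ _ _ _ (hUs _) (fun i _ => ?_) x hx
      obtain ⟨d, hd⟩ := tor_diag (n := n) j s
      obtain ⟨d', hd'⟩ := tor_diag (n := n) j s⁻¹
      exact Aplus_conj_diag _ d d' hd (by rw [tor_inv]; exact hd') i)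
  exact ⟨v, hv.1, hv0, hv.2, fun j hj s => hve _ ⟨j, hj, s, rfl⟩⟩

theorem ev_topE_lower (κ : Fin k → ℕ) (hk : k ≤ n) (f : P n k) (hf : f ∈ HWs n κ) (j : ℕ)
    (c : GL (Fin n) ℂ) (hc : c ∈ Aminus n j) : ev (topE n k) (Lact c f) = ev (topE n k) f := by
  obtain ⟨y, hy, hc⟩ := hc
  rw [ev_Lact, hc, transpose_add, transpose_one, transpose_vecMulVec,
    Matrix.add_mul, Matrix.one_mul, Matrix.vecMulVec_mul]
  have h1 : y ᵥ* topE n k = fun c => y (Fin.castLE hk c) := by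
    ext c
    rw [vecMul, dotProduct, sum_eq_single (Fin.castLE hk c)]
    · simp [topE]
    · intro b _ hb
      have : ¬ ((b : ℕ) = c) := fun h => hb (Fin.ext h)
      simp [topE, this]
    · simp
  rw [h1]
  by_cases hj : j < k
  · have h2 : topE n k + vecMulVec (ee n j) (fun c => y (Fin.castLE hk c)) =
        topE n k * (1 + vecMulVec (ee k j) (fun c => y (Fin.castLE hk c))) := by
      rw [mul_rank_one']
      congr 2
      ext i
      rw [mulVec, dot_ee j hj]
      simp [topE, ee]
    have h0 : (fun c => y (Fin.castLE hk c)) ⬝ᵥ ee k j = 0 := by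
      rw [dot_ee j hj]; exact hy _ le_rfl
    rw [h2, ← ev_Ract]
    have := hf.1 j hj (unip (ee k j) _ h0) (unip_mem_Aplus _ _ (fun i hi => hy (Fin.castLE hk i) hi) _)
    rw [repR_apply] at this
    have h3 : ((unip (ee k j) _ h0 : GL (Fin k) ℂ) : Mat k k) =
      1 + vecMulVec (ee k j) (fun c => y (Fin.castLE hk c)) := rfl
    rw [h3] at this
    rw [this]
  · have h2 : (fun c : Fin k => y (Fin.castLE hk c)) = 0 := by
      funext c; exact hy _ (by simp; omega)
    rw [h2]
    congr 2
    ext i j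
    simp [vecMulVec]

theorem topE_tor (hk : k ≤ n) (j : ℕ) (hj : j < k) (s : ℂˣ) :
    (tor n j s : Mat n n)ᵀ * topE n k = topE n k * (tor k j s : Mat k k) := by
  ext a b
  simp [tor, topE]
  grind

theorem topE_tor' (hk : k ≤ n) (j : ℕ) (hj : k ≤ j) (s : ℂˣ) :
    (tor n j s : Mat n n)ᵀ * topE n k = topE n k := by
  ext a b
  simp [tor, topE]
  grind

theorem HWs_eq_zero (hk : k ≤ n) {κ : Fin k → ℕ} (f : P n k) (hf : f ∈ HWs n κ)
    (h1 : ∀ j < n, ∀ c ∈ Aplus n j, repL n k c f = f)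
    (h2 : ∀ j < n, ∀ s, ∃ c : ℂ, repL n k (tor n j s) f = c • f)
    (h0 : ev (topE n k) f = 0) : f = 0 :=
  eq_zero_of_orbit hk f (GL_kill (repL n k) (ev (topE n k)).toLinearMap f (HWs n κ)
    (isSubrep_HWs κ) hf (fun j _ c hc x hx => ev_topE_lower κ hk x hx j c hc) h1 h2 h0)

theorem HWs_HW (hk : k ≤ n) {κ : Fin k → ℕ} (hκ : Antitone κ) (f : P n k) (hf : f ∈ HWs n κ)
    (h1 : ∀ j < n, ∀ c ∈ Aplus n j, repL n k c f = f)
    (h2 : ∀ j < n, ∀ s, ∃ c : ℂ, repL n k (tor n j s) f = c • f) :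
    f = ev (topE n k) f • delta hk κ := by
  by_cases h0 : ev (topE n k) f = 0
  · rw [h0, zero_smul]; exact HWs_eq_zero hk f hf h1 h2 h0
  have h3 : ∀ j < n, ∀ s : ℂˣ, repL n k (tor n j s) f = (s : ℂ) ^ ext0 κ j • f := by
    intro j hj s
    obtain ⟨c, hc⟩ := h2 j hj s
    have h4 : ev (topE n k) (repL n k (tor n j s) f) = (s : ℂ) ^ ext0 κ j * ev (topE n k) f := by
      rw [repL_apply, ev_Lact]
      by_cases hjk : j < k
      · rw [topE_tor hk j hjk, ← ev_Ract, ← repR_apply, hf.2 j hjk, map_smul, smul_eq_mul]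
      · rw [topE_tor' hk j (not_lt.mp hjk), ext0_of_le κ (not_lt.mp hjk), pow_zero, one_mul]
    rw [hc, map_smul, smul_eq_mul] at h4
    rw [hc, mul_right_cancel₀ h0 h4]
  have hd := delta_GLHW hk hκ
  have := HWs_eq_zero hk (κ := κ) (f - ev (topE n k) f • delta hk κ)
    (Submodule.sub_mem _ hf (Submodule.smul_mem _ _ (delta_mem hk hκ)))
    (fun j hj c hc => by rw [map_sub, map_smul, h1 j hj c hc, hd.1 j hj c hc])
    (fun j hj s => ⟨(s : ℂ) ^ ext0 κ j, by
      rw [map_sub, map_smul, h3 j hj s, hd.2 j hj s, smul_sub, smul_comm]⟩)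
    (by rw [map_sub, map_smul, ev_topE_delta, smul_eq_mul, mul_one, sub_self])
  exact sub_eq_zero.mp this

/-- A stable subspace of `HWs n κ` containing `delta` is everything. -/
theorem HWs_le_of_delta_mem (hk : k ≤ n) {κ : Fin k → ℕ} (hκ : Antitone κ)
    (N : Submodule ℂ (P n k)) (hN : IsSubrep (repL n k) N) (hle : N ≤ HWs n κ)
    (hd : delta hk κ ∈ N) : HWs n κ ≤ N := by
  have : FiniteDimensional ℂ N := finiteDimensional_of_le hle
  let Y : Submodule ℂ (P n k) :=
    { carrier := {f | f ∈ HWs n κ ∧ ∀ y ∈ N, fischerH y f = 0}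
      add_mem' := fun {a b} ha hb => ⟨Submodule.add_mem _ ha.1 hb.1, fun y hy => by
        rw [map_add, ha.2 y hy, hb.2 y hy, add_zero]⟩
      zero_mem' := ⟨zero_mem _, fun y _ => map_zero _⟩
      smul_mem' := fun c a ha => ⟨smul_mem _ c ha.1, fun y hy => by
        rw [map_smul, ha.2 y hy, smul_zero]⟩ }
  have hYle : Y ≤ HWs n κ := fun f hf => hf.1
  have : FiniteDimensional ℂ Y := finiteDimensional_of_le hYle
  have hYs : IsSubrep (repL n k) Y := by
    intro g f hf
    refine ⟨isSubrep_HWs κ g f hf.1, fun y hy => ?_⟩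
    have h1 := fischerH_repL (star g) y f
    rw [star_star] at h1
    rw [← h1]
    exact hf.2 _ (hN _ _ hy)
  have hY : Y = ⊥ := by
    by_contra hne
    obtain ⟨v, hv, hv0, h1, h2⟩ := exists_HW (repL n k) Y hYs hne
    have hv' := HWs_HW hk hκ v hv.1 h1 h2
    have h3 := hv.2 _ hd
    rw [hv', map_smul] at h3
    have h4 := fischerH_pos _ (delta_ne_zero hk κ)
    rcases smul_eq_zero.mp h3 with h | h
    · rw [h, zero_smul] at hv'; exact hv0 hv'
    · rw [h] at h4; simp at h4
  intro f hf
  obtain ⟨z, hz, hzf⟩ := exists_proj fischerH fischerH_symm fischerH_pos N f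
  have : f - z ∈ Y := ⟨Submodule.sub_mem _ hf (hle hz), hzf⟩
  rw [hY, mem_bot, sub_eq_zero] at this
  rwa [this]

/-- Realization of an irreducible representation with highest weight `κ` on polynomials. -/
theorem exists_realization {V : Type*} [AddCommGroup V] [Module ℂ V] [FiniteDimensional ℂ V]
    (hk : k ≤ n) {κ : Fin k → ℕ} (hκ : Antitone κ) (ρ : Representation ℂ (GL (Fin n) ℂ) V)
    (hρ : IsIrreducibleRep ρ) (v : V) (hv0 : v ≠ 0) (hv : GLHW ρ (ext0 κ) v) :
    ∃ T ∈ equivariantMaps ρ (repL n k), Function.Injective T ∧ range T = HWs n κ := by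
  obtain ⟨T, hT, hTv⟩ := GL_exists_equivariant ρ (repL n k) hρ fischerH fischerH_symm
    fischerH_pos fischerH_repL (HWs n κ) (isSubrep_HWs κ) (ext0 κ) v hv0 hv (delta hk κ)
    (delta_mem hk hκ) (delta_GLHW hk hκ)
  have hT' : ∀ g x, T (ρ g x) = repL n k g (T x) := fun g x => LinearMap.congr_fun (hT g) x
  have hker : ker T = ⊥ := by
    refine (hρ.2 (ker T) fun g x hx => ?_).resolve_right fun h => ?_
    · rw [mem_ker] at hx ⊢
      rw [hT', hx, map_zero]
    · have : v ∈ ker T := h ▸ mem_top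
      rw [mem_ker, hTv] at this
      exact delta_ne_zero hk κ this
  have hrs : ∀ U : Submodule ℂ (P n k), IsSubrep (repL n k) U → IsSubrep ρ (U.comap T) :=
    fun U hU g x hx => by
      rw [mem_comap] at hx ⊢
      rw [hT']; exact hU g _ hx
  have hle : range T ≤ HWs n κ := by
    have h1 := (hρ.2 _ (hrs _ (isSubrep_HWs κ))).resolve_left fun h => by
      have h2 : v ∈ (HWs n κ).comap T := by
        rw [mem_comap, hTv]; exact delta_mem hk hκ
      rw [h] at h2
      exact hv0 ((mem_bot ℂ).mp h2)
    rintro _ ⟨x, rfl⟩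
    have : x ∈ (HWs n κ).comap T := h1 ▸ mem_top
    exact this
  refine ⟨T, hT, ker_eq_bot.mp hker, le_antisymm hle ?_⟩
  refine HWs_le_of_delta_mem hk hκ _ ?_ hle ⟨v, hTv⟩
  rintro g _ ⟨x, rfl⟩
  exact ⟨ρ g x, hT' g x⟩

end

section

open MvPolynomial Finset Submodule LinearMap Module

section Rep

variable {G V W : Type*} [Group G] [AddCommGroup V] [Module ℂ V] [AddCommGroup W] [Module ℂ W]

/-- Restriction of a representation to a stable subspace. -/
def resRep (ρ : Representation ℂ G V) (U : Submodule ℂ V) (hU : IsSubrep ρ U) :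
    Representation ℂ G U where
  toFun g := (ρ g).restrict (hU g)
  map_one' := ext fun x => Subtype.ext (by
    rw [coe_restrict_apply, map_one]; rfl)
  map_mul' a b := ext fun x => Subtype.ext (by
    rw [coe_restrict_apply, map_mul]; rfl)

theorem finrank_range_inf (f : W →ₗ[ℂ] V) (hf : Function.Injective f) (E : Submodule ℂ V) :
    finrank ℂ ↥(range f ⊓ E) = finrank ℂ ↥(E.comap f) := by
  rw [← map_comap_eq]
  exact (LinearEquiv.finrank_eq (equivMapOfInjective f hf _)).symm

theorem finrank_comap_subtype (U E : Submodule ℂ V) :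
    finrank ℂ ↥(E.comap U.subtype) = finrank ℂ ↥(U ⊓ E) := by
  rw [← finrank_range_inf _ U.subtype_injective, range_subtype]

theorem finrank_eigSub_split (ρ : Representation ℂ G V) (R : G → ℂ → Prop) (N N' : Submodule ℂ V)
    [FiniteDimensional ℂ N] [FiniteDimensional ℂ N'] (hN : IsSubrep ρ N) (hN' : IsSubrep ρ N')
    (hd : N ⊓ N' = ⊥) :
    finrank ℂ ↥((N ⊔ N') ⊓ eigSub ρ R) =
      finrank ℂ ↥(N ⊓ eigSub ρ R) + finrank ℂ ↥(N' ⊓ eigSub ρ R) := by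
  have h1 : (N ⊔ N') ⊓ eigSub ρ R = (N ⊓ eigSub ρ R) ⊔ (N' ⊓ eigSub ρ R) := by
    apply le_antisymm
    · rintro x ⟨hx, hxe⟩
      obtain ⟨a, ha, b, hb, rfl⟩ := mem_sup.mp hx
      have key : ∀ g c, R g c → ρ g a = c • a ∧ ρ g b = c • b := by
        intro g c hgc
        have h := hxe g c hgc
        rw [map_add, smul_add] at h
        have h2 : ρ g a - c • a = c • b - ρ g b := by
          rw [sub_eq_sub_iff_add_eq_add, h, add_comm]
        have h3 : ρ g a - c • a ∈ N ⊓ N' :=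
          ⟨N.sub_mem (hN g a ha) (N.smul_mem c ha),
            h2 ▸ N'.sub_mem (N'.smul_mem c hb) (hN' g b hb)⟩
        rw [hd, mem_bot] at h3
        rw [h3] at h2
        exact ⟨sub_eq_zero.mp h3, (sub_eq_zero.mp h2.symm).symm⟩
      exact add_mem_sup ⟨ha, fun g c h => (key g c h).1⟩
        ⟨hb, fun g c h => (key g c h).2⟩
    · exact sup_le (inf_le_inf_right _ le_sup_left) (inf_le_inf_right _ le_sup_right)
  have h2 : (N ⊓ eigSub ρ R) ⊓ (N' ⊓ eigSub ρ R) = ⊥ := by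
    rw [← le_bot_iff, ← hd]
    exact inf_le_inf inf_le_left inf_le_left
  have : FiniteDimensional ℂ ↥(N ⊓ eigSub ρ R) := finiteDimensional_of_le inf_le_left
  have : FiniteDimensional ℂ ↥(N' ⊓ eigSub ρ R) := finiteDimensional_of_le inf_le_left
  have := finrank_sup_add_finrank_inf_eq (N ⊓ eigSub ρ R) (N' ⊓ eigSub ρ R)
  rw [h2, finrank_bot, add_zero] at this
  rw [h1, this]

end Rep

variable {m k : ℕ}

theorem RWs_eq_eigSub (γ : Fin k → ℕ) : RWs m γ =
    eigSub (repR m k) fun g c => ∃ j < k, ∃ s : ℂˣ, g = tor k j s ∧ c = (s : ℂ) ^ ext0 γ j := by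
  ext f
  rw [mem_RWs]
  constructor
  · rintro h _ _ ⟨j, hj, s, rfl, rfl⟩; exact h j hj s
  · intro h j hj s; exact h _ _ ⟨j, hj, s, rfl, rfl⟩

theorem HWs_eq_eigSub (γ : Fin k → ℕ) : HWs m γ =
    eigSub (repR m k) fun g c => (∃ j < k, g ∈ Aplus k j ∧ c = 1) ∨
      ∃ j < k, ∃ s : ℂˣ, g = tor k j s ∧ c = (s : ℂ) ^ ext0 γ j := by
  ext f
  rw [mem_HWs]
  constructor
  · rintro h _ _ (⟨j, hj, hg, rfl⟩ | ⟨j, hj, s, rfl, rfl⟩)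
    · rw [one_smul]; exact h.1 j hj _ hg
    · exact h.2 j hj s
  · refine fun h => ⟨fun j hj c hc => ?_, fun j hj s => h _ _ (Or.inr ⟨j, hj, s, rfl, rfl⟩)⟩
    have := h _ _ (Or.inl ⟨j, hj, hc, rfl⟩)
    rwa [one_smul] at this

theorem antitone_of_HWs {κ : Fin k → ℕ} {f : P m k} (hf : f ∈ HWs m κ) (h0 : f ≠ 0) :
    Antitone κ := by
  obtain ⟨e, he⟩ := exists_isLead f h0
  have := lead_GT f e he κ (fun e he c => congrFun (HWs_le_RWs κ hf e he) c)
    fun r s => HWs_pol hf r s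
  have h1 : Antitone (ext0 κ) := antitone_nat_of_succ_le (GT_antitone this)
  intro i j hij
  rw [← ext0_val κ, ← ext0_val κ]
  exact h1 hij

theorem exists_mem_HWs (M : Submodule ℂ (P m k)) [FiniteDimensional ℂ M]
    (hM : IsSubrep (repR m k) M) (h : M ≠ ⊥) : ∃ κ : Fin k → ℕ, ∃ f ∈ M, f ≠ 0 ∧ f ∈ HWs m κ := by
  obtain ⟨v, hv, hv0, h1, h2⟩ := exists_HW (repR m k) M hM h
  obtain ⟨e, he⟩ := MvPolynomial.ne_zero_iff.mp hv0
  refine ⟨colDeg e, v, hv, hv0, h1, fun j hj s => ?_⟩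
  obtain ⟨c, hc⟩ := h2 j hj s
  have h3 := coeff_repR_tor ⟨j, hj⟩ s v e
  rw [hc, coeff_smul, smul_eq_mul] at h3
  rw [hc, mul_right_cancel₀ he h3, ← ext0_val (colDeg e)]

theorem irreducible_HWs (hk : m ≤ m) {κ : Fin m → ℕ} (hκ : Antitone κ) :
    IsIrreducibleRep (resRep (repL m m) (HWs m κ) (isSubrep_HWs κ)) := by
  refine ⟨⟨⟨⟨delta hk κ, delta_mem hk hκ⟩, 0, fun h => delta_ne_zero hk κ (congrArg Subtype.val h)⟩⟩,
    fun U hU => ?_⟩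
  by_cases h0 : U = ⊥
  · exact Or.inl h0
  right
  obtain ⟨v, hv, hv0, h1, h2⟩ := exists_HW _ U hU h0
  have hv' := HWs_HW hk hκ v v.2 (fun j hj c hc => congrArg Subtype.val (h1 j hj c hc))
    (fun j hj s => (h2 j hj s).imp fun c hc => congrArg Subtype.val hc)
  have hne : ev (topE m m) (v : P m m) ≠ 0 := by
    intro h
    rw [h, zero_smul] at hv'
    exact hv0 (Subtype.ext hv')
  have hd : delta hk κ ∈ U.map (HWs m κ).subtype := by
    refine ⟨(ev (topE m m) (v : P m m))⁻¹ • v, U.smul_mem _ hv, ?_⟩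
    rw [map_smul, subtype_apply]
    exact (inv_smul_eq_iff₀ hne).mpr hv'
  have hle := HWs_le_of_delta_mem hk hκ (U.map (HWs m κ).subtype) (by
    rintro g _ ⟨x, hx, rfl⟩
    exact ⟨_, hU g x hx, rfl⟩) (by rintro _ ⟨x, _, rfl⟩; exact x.2) hd
  rw [eq_top_iff]
  intro x _
  obtain ⟨y, hy, hyx⟩ := hle x.2
  rwa [Subtype.ext hyx] at hy

/-- An irreducible constituent of a `GL`-stable space of polynomials, with its multiplicities. -/
theorem exists_constituent (M : Submodule ℂ (P m k)) [FiniteDimensional ℂ M]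
    (hM : IsSubrep (repR m k) M) (h : M ≠ ⊥) : ∃ N ≤ M, IsSubrep (repR m k) N ∧ N ≠ ⊥ ∧
      ∃ κ₀ : Fin k → ℕ, Antitone κ₀ ∧
        (∀ γ, finrank ℂ ↥(N ⊓ RWs m γ) = kostka k (ext0 κ₀) γ) ∧
        ∀ κ, finrank ℂ ↥(N ⊓ HWs m κ) = if κ = κ₀ then 1 else 0 := by
  obtain ⟨κ₀, f, hfM, hf0, hf⟩ := exists_mem_HWs M hM h
  have hκ := antitone_of_HWs hf hf0
  have hk : k ≤ k := le_rfl
  have hirr := irreducible_HWs hk hκ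
  have hdG := delta_GLHW hk hκ
  let w : HWs k κ₀ := ⟨delta hk κ₀, delta_mem hk hκ⟩
  obtain ⟨T, hT, hTw⟩ := GL_exists_equivariant (resRep (repL k k) (HWs k κ₀) (isSubrep_HWs κ₀))
    (repR m k) hirr fischerH fischerH_symm fischerH_pos fischerH_repR M hM (ext0 κ₀) w
    (fun h => delta_ne_zero hk κ₀ (congrArg Subtype.val h))
    ⟨fun j hj c hc => Subtype.ext (hdG.1 j hj c hc), fun j hj s => Subtype.ext (hdG.2 j hj s)⟩
    f hfM hf
  have hT' : ∀ g x, T (resRep (repL k k) (HWs k κ₀) (isSubrep_HWs κ₀) g x) = repR m k g (T x) :=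
    fun g x => LinearMap.congr_fun (hT g) x
  have hrs : ∀ U : Submodule ℂ (P m k), IsSubrep (repR m k) U →
      IsSubrep (resRep (repL k k) (HWs k κ₀) (isSubrep_HWs κ₀)) (U.comap T) := fun U hU g x hx => by
    rw [mem_comap] at hx ⊢
    rw [hT']; exact hU g _ hx
  have hinj : Function.Injective T := by
    rw [← ker_eq_bot]
    refine (hirr.2 (ker T) (hrs ⊥ fun g x hx => ?_)).resolve_right fun h => hf0 ?_
    · rw [mem_bot] at hx ⊢; rw [hx, map_zero]
    · rw [← hTw]
      have : w ∈ ker T := h ▸ mem_top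
      exact this
  refine ⟨range T, ?_, ?_, ?_, κ₀, hκ, fun γ => ?_, fun κ => ?_⟩
  · have h1 := (hirr.2 _ (hrs M hM)).resolve_left fun h => by
      have h2 : w ∈ M.comap T := by rw [mem_comap, hTw]; exact hfM
      rw [h] at h2
      exact delta_ne_zero hk κ₀ (congrArg Subtype.val ((mem_bot ℂ).mp h2))
    rintro _ ⟨x, rfl⟩
    have : x ∈ M.comap T := h1 ▸ mem_top
    exact this
  · rintro g _ ⟨x, rfl⟩
    exact ⟨_, hT' g x⟩
  · intro h
    have : f ∈ range T := ⟨w, hTw⟩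
    rw [h] at this
    exact hf0 ((mem_bot ℂ).mp this)
  · rw [finrank_range_inf T hinj, ← (finrank_HWs_inf_LWs κ₀ γ).2, ← finrank_comap_subtype]
    suffices h : (RWs m γ).comap T = (LWs k γ).comap (HWs k κ₀).subtype by rw [h]
    ext x
    rw [mem_comap, mem_comap, mem_RWs, mem_LWs]
    refine forall_congr' fun j => forall_congr' fun hj => forall_congr' fun s => ?_
    rw [← hT', ← map_smul, hinj.eq_iff, Subtype.ext_iff]
    rfl
  · rw [finrank_range_inf T hinj]
    have hmem : ∀ x : HWs k κ₀, x ∈ (HWs m κ).comap T ↔ GLHW (repL k k) (ext0 κ) (x : P k k) := by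
      intro x
      rw [mem_comap, mem_HWs]
      refine and_congr ?_ ?_
      · refine forall_congr' fun j => forall_congr' fun hj => forall_congr' fun c =>
          forall_congr' fun hc => ?_
        rw [← hT', hinj.eq_iff, Subtype.ext_iff]
        rfl
      · refine forall_congr' fun j => forall_congr' fun hj => forall_congr' fun s => ?_
        rw [← hT', ← map_smul, hinj.eq_iff, Subtype.ext_iff]
        rfl
    have hspan : ∀ x : HWs k κ₀, x ∈ (HWs m κ).comap T → (x : P k k) = ev (topE k k) (x : P k k) • delta hk κ₀ := by
      intro x hx
      rw [hmem] at hx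
      exact HWs_HW hk hκ x x.2 hx.1 fun j hj s => ⟨_, hx.2 j hj s⟩
    split_ifs with hc
    · subst hc
      refine finrank_eq_one (⟨w, (hmem w).mpr hdG⟩ : ↥((HWs m κ).comap T)) ?_ ?_
      · intro h
        exact delta_ne_zero hk κ (congrArg (fun x => ((x : ↥(HWs k κ)) : P k k)) (congrArg Subtype.val h))
      · intro x
        exact ⟨_, Subtype.ext (Subtype.ext (hspan x x.2).symm)⟩
    · suffices h : (HWs m κ).comap T = ⊥ by rw [h, finrank_bot]
      rw [eq_bot_iff]
      intro x hx
      by_contra hx0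
      apply hc
      funext j
      have h1 := (hmem x).mp hx
      have h2 := hspan x hx
      have hx0' : (x : P k k) ≠ 0 := fun h => hx0 (Subtype.ext h)
      have h3 := h1.2 j j.2 (Units.mk0 2 two_ne_zero)
      have h4 := hdG.2 j j.2 (Units.mk0 2 two_ne_zero)
      conv_lhs at h3 => rw [h2, map_smul, h4, smul_comm, ← h2]
      have h5 := smul_left_injective ℂ hx0' h3
      rw [ext0_val, ext0_val] at h5
      exact (two_pow_inj h5).symm

theorem kostka_eq_zero {κ γ : Fin k → ℕ} (h : ∑ j, κ j ≠ ∑ j, γ j) :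
    kostka k (ext0 κ) γ = 0 := by
  rw [kostka, card_eq_zero, filter_eq_empty_iff]
  intro p hp hw
  rw [mem_gts] at hp
  apply h
  rw [← hw]
  have h1 : ∀ i, ∑ r ∈ range k, (p (i + 1) r - p i r) =
      ∑ r ∈ range k, p (i + 1) r - ∑ r ∈ range k, p i r := fun i =>
    sum_tsub_distrib _ fun r _ => hp.2.2.1 i r
  have h2 : ∀ N, ∑ i ∈ range N, ∑ r ∈ range k, (p (i + 1) r - p i r) =
      ∑ r ∈ range k, p N r := by
    intro N
    induction N with
    | zero => simp [hp.1]
    | succ N ih =>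
      rw [sum_range_succ, ih, h1]
      exact Nat.add_sub_cancel' (sum_le_sum fun r _ => hp.2.2.1 N r)
  have h3 : ∑ j, wt k p j = ∑ i ∈ range k, ∑ r ∈ range k, (p (i + 1) r - p i r) :=
    Fin.sum_univ_eq_sum_range (fun i => ∑ r ∈ range k, (p (i + 1) r - p i r)) k
  rw [h3, h2, hp.2.1 k le_rfl, ← Fin.sum_univ_eq_sum_range]
  exact sum_congr rfl fun r _ => (ext0_val κ r).symm

/-- The weight multiplicities of a stable space of polynomials are determined by its highest
weight multiplicities. -/
theorem finrank_inf_RWs (M : Submodule ℂ (P m k)) [FiniteDimensional ℂ M]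
    (hM : IsSubrep (repR m k) M) (γ : Fin k → ℕ) :
    finrank ℂ ↥(M ⊓ RWs m γ) =
      ∑ κ ∈ piAntidiag univ (∑ j, γ j),
        finrank ℂ ↥(M ⊓ HWs m κ) * kostka k (ext0 κ) γ := by
  induction hd : finrank ℂ M using Nat.strong_induction_on generalizing M with
  | _ d ih =>
  by_cases h0 : M = ⊥
  · subst h0
    have : ∀ E : Submodule ℂ (P m k), finrank ℂ ↥((⊥ : Submodule ℂ (P m k)) ⊓ E) = 0 :=
      fun E => by rw [bot_inf_eq, finrank_bot]
    simp [this]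
  obtain ⟨N, hNM, hN, hN0, κ₀, hκ₀, hNR, hNH⟩ := exists_constituent M hM h0
  have : FiniteDimensional ℂ N := finiteDimensional_of_le hNM
  let Y : Submodule ℂ (P m k) :=
    { carrier := {f | f ∈ M ∧ ∀ y ∈ N, fischerH y f = 0}
      add_mem' := fun {a b} ha hb => ⟨Submodule.add_mem _ ha.1 hb.1, fun y hy => by
        rw [map_add, ha.2 y hy, hb.2 y hy, add_zero]⟩
      zero_mem' := ⟨zero_mem _, fun y _ => map_zero _⟩
      smul_mem' := fun c a ha => ⟨smul_mem _ c ha.1, fun y hy => by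
        rw [map_smul, ha.2 y hy, smul_zero]⟩ }
  have hYle : Y ≤ M := fun f hf => hf.1
  have : FiniteDimensional ℂ Y := finiteDimensional_of_le hYle
  have hYs : IsSubrep (repR m k) Y := by
    intro g f hf
    refine ⟨hM g f hf.1, fun y hy => ?_⟩
    have h1 := fischerH_repR (star g) y f
    rw [star_star] at h1
    rw [← h1]
    exact hf.2 _ (hN _ _ hy)
  have hdisj : N ⊓ Y = ⊥ := by
    rw [eq_bot_iff]
    rintro x ⟨hx, hx'⟩
    by_contra hne
    have h1 := fischerH_pos x hne
    rw [hx'.2 x hx] at h1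
    simp at h1
  have hsup : N ⊔ Y = M := by
    refine le_antisymm (sup_le hNM hYle) fun f hf => ?_
    obtain ⟨z, hz, hzf⟩ := exists_proj fischerH fischerH_symm fischerH_pos N f
    rw [← add_sub_cancel z f]
    exact add_mem_sup hz ⟨M.sub_mem hf (hNM hz), hzf⟩
  have hlt : finrank ℂ Y < d := by
    have h1 := finrank_sup_add_finrank_inf_eq N Y
    rw [hsup, hdisj, finrank_bot, hd] at h1
    have h2 : 0 < finrank ℂ N := by
      rw [Nat.pos_iff_ne_zero]
      intro h; exact hN0 (finrank_eq_zero.mp h)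
    omega
  have hR := finrank_eigSub_split (repR m k) (fun g c => ∃ j < k, ∃ s : ℂˣ, g = tor k j s ∧
    c = (s : ℂ) ^ ext0 γ j) N Y hN hYs hdisj
  rw [← RWs_eq_eigSub, hsup, hNR, ih _ hlt Y hYs rfl] at hR
  have hH : ∀ κ : Fin k → ℕ, finrank ℂ ↥(M ⊓ HWs m κ) =
      (if κ = κ₀ then 1 else 0) + finrank ℂ ↥(Y ⊓ HWs m κ) := by
    intro κ
    rw [← hNH, HWs_eq_eigSub, ← finrank_eigSub_split _ _ N Y hN hYs hdisj, hsup]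
  rw [hR]
  simp_rw [hH, add_mul, sum_add_distrib]
  congr 1
  simp_rw [ite_mul, one_mul, zero_mul]
  rw [sum_ite_eq']
  split_ifs with hmem
  · rfl
  · refine kostka_eq_zero fun h => hmem ?_
    rw [mem_piAntidiag]
    exact ⟨h, fun i _ => mem_univ i⟩

end

section

open Finset

section Ogroup

variable {n : ℕ}

/-- The symmetric bilinear form with matrix `symForm n`. -/
def bf (x y : Fin n → ℂ) : ℂ := ∑ i, x i * y i.rev

theorem bf_comm (x y : Fin n → ℂ) : bf x y = bf y x := by
  unfold bf
  rw [← Equiv.sum_comp Fin.revPerm]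
  exact sum_congr rfl fun i _ => by simp [mul_comm]

theorem bf_add_left (x y z : Fin n → ℂ) : bf (x + y) z = bf x z + bf y z := by
  simp [bf, add_mul, sum_add_distrib]

theorem bf_smul_left (c : ℂ) (x z : Fin n → ℂ) : bf (c • x) z = c * bf x z := by
  simp [bf, mul_assoc, mul_sum]

theorem bf_add_right (x y z : Fin n → ℂ) : bf z (x + y) = bf z x + bf z y := by
  rw [bf_comm, bf_add_left, bf_comm x, bf_comm y]

theorem bf_smul_right (c : ℂ) (x z : Fin n → ℂ) : bf z (c • x) = c * bf z x := by
  rw [bf_comm, bf_smul_left, bf_comm]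

theorem bf_sub_left (x y z : Fin n → ℂ) : bf (x - y) z = bf x z - bf y z := by
  simp [bf, sub_mul, sum_sub_distrib]

theorem bf_sub_right (x y z : Fin n → ℂ) : bf z (x - y) = bf z x - bf z y := by
  rw [bf_comm, bf_sub_left, bf_comm x, bf_comm y]

theorem bf_neg_left (x z : Fin n → ℂ) : bf (-x) z = - bf x z := by simp [bf]

theorem bf_neg_right (x z : Fin n → ℂ) : bf z (-x) = - bf z x := by simp [bf]

theorem symForm_mulVec (y : Fin n → ℂ) : symForm n *ᵥ y = fun i => y i.rev := by
  ext i
  rw [mulVec, dotProduct, sum_eq_single i.rev]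
  · rw [symForm, of_apply, if_pos (by rw [Fin.val_rev]; omega), one_mul]
  · intro b _ hb
    rw [symForm, of_apply, if_neg, zero_mul]
    intro h
    apply hb
    ext
    rw [Fin.val_rev]
    omega
  · simp

theorem bf_eq (x y : Fin n → ℂ) : bf x y = x ⬝ᵥ (symForm n *ᵥ y) := by
  rw [symForm_mulVec]
  rfl

theorem bf_ee (j : ℕ) (hj : j < n) (x : Fin n → ℂ) : bf x (ee n j) = x (⟨j, hj⟩ : Fin n).rev := by
  rw [bf_comm, bf_eq, ee_dot j hj, symForm_mulVec]

theorem bf_ee_ee (i j : ℕ) (hj : j < n) : bf (ee n i) (ee n j) = if i + j + 1 = n then 1 else 0 := by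
  rw [bf_ee j hj, ee, Fin.val_rev]
  congr 1
  simp only [eq_iff_iff]
  omega

theorem vec_ext (x y : Fin n → ℂ) (h : ∀ l < n, bf x (ee n l) = bf y (ee n l)) : x = y := by
  ext i
  have := h i.rev i.rev.2
  rw [bf_ee _ i.rev.2, bf_ee _ i.rev.2] at this
  change x i.rev.rev = y i.rev.rev at this
  rwa [Fin.rev_rev] at this

theorem mat_ext (A A' : Mat n n) (h : ∀ l < n, A *ᵥ ee n l = A' *ᵥ ee n l) :
    A = A' := by
  ext i l
  have := congrFun (h l l.2) i
  rwa [mulVec, dot_ee _ l.2, mulVec, dot_ee _ l.2] at this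

theorem symForm_mul_self : symForm n * symForm n = 1 := by
  refine mat_ext _ _ fun l hl => ?_
  rw [← mulVec_mulVec, symForm_mulVec, symForm_mulVec, one_mulVec]
  ext i
  simp

theorem form_iff (A : Mat n n) :
    Aᵀ * symForm n * A = symForm n ↔ ∀ x y, bf (A *ᵥ x) (A *ᵥ y) = bf x y := by
  have key : ∀ x y, bf (A *ᵥ x) (A *ᵥ y) = x ⬝ᵥ ((Aᵀ * symForm n * A) *ᵥ y) := by
    intro x y
    rw [bf_eq, ← mulVec_mulVec, ← mulVec_mulVec, dotProduct_mulVec x, vecMul_transpose]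
  constructor
  · intro h x y
    rw [key, h, bf_eq]
  · intro h
    refine mat_ext _ _ fun l hl => ?_
    ext i
    have := h (ee n i) (ee n l)
    rwa [key, bf_eq, ee_dot i i.2, ee_dot i i.2] at this

/-- The matrix of an orthogonal group element. -/
def mat (g : OGL n) : Mat n n := ((g : GL (Fin n) ℂ) : Mat n n)

theorem mat_mul (g h : OGL n) : mat (g * h) = mat g * mat h := rfl

theorem mat_one : mat (1 : OGL n) = 1 := rfl

theorem mat_inj {g h : OGL n} (e : mat g = mat h) : g = h := Subtype.ext (Units.ext e)

/-- The action of an orthogonal group element on vectors. -/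
def act (g : OGL n) (x : Fin n → ℂ) : Fin n → ℂ := mat g *ᵥ x

theorem act_mul (g h : OGL n) (x : Fin n → ℂ) : act (g * h) x = act g (act h x) := by
  rw [act, mat_mul, ← mulVec_mulVec]; rfl

theorem act_one (x : Fin n → ℂ) : act (1 : OGL n) x = x := by rw [act, mat_one, one_mulVec]

theorem act_add (g : OGL n) (x y : Fin n → ℂ) : act g (x + y) = act g x + act g y := mulVec_add _ _ _

theorem act_sub (g : OGL n) (x y : Fin n → ℂ) : act g (x - y) = act g x - act g y := mulVec_sub _ _ _

theorem act_smul (g : OGL n) (c : ℂ) (x : Fin n → ℂ) : act g (c • x) = c • act g x :=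
  mulVec_smul _ _ _

theorem act_inv_act (g : OGL n) (x : Fin n → ℂ) : act g⁻¹ (act g x) = x := by
  rw [← act_mul, inv_mul_cancel, act_one]

theorem act_act_inv (g : OGL n) (x : Fin n → ℂ) : act g (act g⁻¹ x) = x := by
  rw [← act_mul, mul_inv_cancel, act_one]

theorem act_inv_of_fix (g : OGL n) (x : Fin n → ℂ) (h : act g x = x) : act g⁻¹ x = x := by
  conv_lhs => rw [← h]
  exact act_inv_act g x

theorem bf_act (g : OGL n) (x y : Fin n → ℂ) : bf (act g x) (act g y) = bf x y :=
  (form_iff _).mp g.2 x y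

theorem bf_act_of_fix (g : OGL n) (x y : Fin n → ℂ) (h : act g y = y) : bf (act g x) y = bf x y := by
  conv_lhs => rw [← h]
  exact bf_act g x y

theorem O_ext {g h : OGL n} (e : ∀ l < n, act g (ee n l) = act h (ee n l)) : g = h :=
  mat_inj (mat_ext _ _ e)

/-- The orthogonal group element attached to a matrix preserving the form. -/
def mkO (A : Mat n n) (h : ∀ x y, bf (A *ᵥ x) (A *ᵥ y) = bf x y) : OGL n :=
  ⟨{ val := A
     inv := symForm n * Aᵀ * symForm n
     inv_val := by
      rw [mul_assoc, mul_assoc, ← mul_assoc Aᵀ, (form_iff A).mpr h, symForm_mul_self]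
     val_inv := by
      have : (symForm n * Aᵀ * symForm n) * A = 1 := by
        rw [mul_assoc, mul_assoc, ← mul_assoc Aᵀ, (form_iff A).mpr h, symForm_mul_self]
      exact mul_eq_one_comm.mp this }, (form_iff A).mpr h⟩

theorem mat_mkO (A : Mat n n) (h) : mat (mkO A h) = A := rfl

/-- The Eichler transformation as a matrix. -/
def eichM (e y : Fin n → ℂ) : Mat n n :=
  1 + vecMulVec y (symForm n *ᵥ e) - vecMulVec e (symForm n *ᵥ y)
    - vecMulVec ((bf y y / 2) • e) (symForm n *ᵥ e)

theorem vecMulVec_mulVec' (u v x : Fin n → ℂ) : vecMulVec u v *ᵥ x = (v ⬝ᵥ x) • u := by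
  ext i
  simp only [mulVec, vecMulVec, dotProduct, of_apply, Pi.smul_apply, smul_eq_mul, sum_mul]
  exact sum_congr rfl fun j _ => by ring

theorem eichM_mulVec (e y x : Fin n → ℂ) :
    eichM e y *ᵥ x = x + bf x e • y - bf x y • e - (bf y y / 2 * bf x e) • e := by
  rw [eichM, sub_mulVec, sub_mulVec, add_mulVec, one_mulVec, vecMulVec_mulVec', vecMulVec_mulVec',
    vecMulVec_mulVec', bf_eq x, bf_eq x, dotProduct_comm, dotProduct_comm _ x, smul_smul,
    mul_comm (bf y y / 2)]

/-- The Eichler transformation as a group element (trivial unless `e` is isotropic and orthogonal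
to `y`). -/
def eich (e y : Fin n → ℂ) : OGL n :=
  open Classical in if h : bf e e = 0 ∧ bf y e = 0 then mkO (eichM e y) (by
    obtain ⟨h1, h2⟩ := h
    intro x z
    have h3 : bf e y = 0 := by rw [bf_comm, h2]
    simp only [eichM_mulVec, bf_add_left, bf_add_right, bf_sub_left, bf_sub_right, bf_smul_left,
      bf_smul_right, h1, h2, h3]
    rw [bf_comm e z, bf_comm y z]
    ring) else 1

theorem mat_eich {e y : Fin n → ℂ} (h1 : bf e e = 0) (h2 : bf y e = 0) : mat (eich e y) = eichM e y := by
  rw [eich, dif_pos ⟨h1, h2⟩, mat_mkO]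

theorem act_eich {e y : Fin n → ℂ} (h1 : bf e e = 0) (h2 : bf y e = 0) (x : Fin n → ℂ) :
    act (eich e y) x = x + bf x e • y - bf x y • e - (bf y y / 2 * bf x e) • e := by
  rw [act, mat_eich h1 h2, eichM_mulVec]

theorem eich_mul {e y z : Fin n → ℂ} (h1 : bf e e = 0) (h2 : bf y e = 0) (h3 : bf z e = 0) :
    eich e y * eich e z = eich e (y + z) := by
  have h4 : bf (y + z) e = 0 := by rw [bf_add_left, h2, h3, add_zero]
  have h5 : bf e y = 0 := by rw [bf_comm, h2]
  refine O_ext fun l _ => ?_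
  rw [act_mul, act_eich h1 h2, act_eich h1 h3, act_eich h1 h4]
  set x := ee n l
  simp only [bf_add_left, bf_add_right, bf_sub_left, bf_smul_left, h1, h3, h5]
  rw [bf_comm z y]
  ext i
  simp only [Pi.add_apply, Pi.sub_apply, Pi.smul_apply, smul_eq_mul]
  ring

theorem eich_zero {e : Fin n → ℂ} (h1 : bf e e = 0) : eich e 0 = 1 := by
  have h0 : ∀ x : Fin n → ℂ, bf x 0 = 0 := fun x => by simp [bf]
  have h2 : bf 0 e = 0 := by rw [bf_comm, h0]
  refine O_ext fun l _ => ?_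
  rw [act_eich h1 h2, act_one]
  simp [h0]

theorem eich_neg {e y : Fin n → ℂ} (h1 : bf e e = 0) (h2 : bf y e = 0) :
    (eich e y)⁻¹ = eich e (-y) := by
  rw [inv_eq_iff_mul_eq_one, eich_mul h1 h2 (by rw [bf_neg_left, h2, neg_zero]), add_neg_cancel,
    eich_zero h1]

theorem eich_pow {e y : Fin n → ℂ} (h1 : bf e e = 0) (h2 : bf y e = 0) (p : ℕ) :
    eich e y ^ p = eich e ((p : ℂ) • y) := by
  induction p with
  | zero => simp [eich_zero h1]
  | succ p ih =>
    rw [pow_succ, ih, eich_mul h1 (by rw [bf_smul_left, h2, mul_zero]) h2]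
    congr 1
    push_cast
    rw [add_smul, one_smul]

theorem eich_conj {e y : Fin n → ℂ} (h1 : bf e e = 0) (h2 : bf y e = 0) (h : OGL n) :
    h⁻¹ * eich e y * h = eich (act h⁻¹ e) (act h⁻¹ y) := by
  refine O_ext fun l _ => ?_
  have a1 := (bf_act h⁻¹ e e).trans h1
  have a2 := (bf_act h⁻¹ y e).trans h2
  rw [act_mul, act_mul, act_eich h1 h2, act_eich a1 a2]
  simp only [act_sub, act_add, act_smul, act_inv_act, bf_act]
  have : ∀ y, bf (act h (ee n l)) y = bf (ee n l) (act h⁻¹ y) := by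
    intro y
    rw [← bf_act h⁻¹, act_inv_act]
  rw [this, this]

theorem eich_smul {e y : Fin n → ℂ} (h1 : bf e e = 0) (h2 : bf y e = 0) (c : ℂ) :
    eich (c • e) y = eich e (c • y) := by
  refine O_ext fun l _ => ?_
  rw [act_eich (by rw [bf_smul_left, bf_smul_right, h1]; simp) (by rw [bf_smul_right, h2, mul_zero]),
    act_eich h1 (by rw [bf_smul_left, h2, mul_zero])]
  simp only [bf_smul_left, bf_smul_right]
  ext i
  simp only [Pi.add_apply, Pi.sub_apply, Pi.smul_apply, smul_eq_mul]
  ring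

/-- A vector is moved to an isotropic vector by an Eichler transformation. -/
theorem eich_move {e f x : Fin n → ℂ} (he : bf e e = 0) (hf : bf f f = 0) (hef : bf e f = 1)
    (hx : bf x x = 0) (hxf : bf x f = 1) :
    bf (x - e - bf x e • f) f = 0 ∧ bf (x - e - bf x e • f) e = 0 ∧
      act (eich f (x - e - bf x e • f)) e = x ∧ act (eich f (x - e - bf x e • f)) f = f := by
  set y := x - e - bf x e • f with hy
  have h1 : bf y f = 0 := by
    rw [hy, bf_sub_left, bf_sub_left, bf_smul_left, hxf, hef, hf]; ring
  have hfe : bf f e = 1 := by rw [bf_comm, hef]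
  have h2 : bf y e = 0 := by
    rw [hy, bf_sub_left, bf_sub_left, bf_smul_left, he, hfe]; ring
  have hyy : bf y y = - 2 * bf x e := by
    conv_lhs => arg 2; rw [hy]
    rw [bf_sub_right, bf_sub_right, bf_smul_right, h1, h2, hy, bf_sub_left, bf_sub_left,
      bf_smul_left, hx, bf_comm e x, bf_comm f x, hxf]
    ring
  refine ⟨h1, h2, ?_, ?_⟩
  · rw [act_eich hf h1, hef, bf_comm e y, h2, hyy, hy]
    ext i
    simp only [Pi.add_apply, Pi.sub_apply, Pi.smul_apply, smul_eq_mul]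
    ring
  · rw [act_eich hf h1, hf, bf_comm f y, h1]
    simp

end Ogroup

end

section Ochain

variable {n : ℕ}

theorem eich_eq_one {e : Fin n → ℂ} (y : Fin n → ℂ) (h1 : bf e e ≠ 0) : eich e y = 1 := by
  rw [eich, dif_neg fun h => h1 h.1]

/-- Vectors orthogonal to the first `j + 1` hyperbolic planes. -/
def Yset (n j : ℕ) : Submodule ℂ (Fin n → ℂ) where
  carrier := {y | ∀ l ≤ j, bf y (ee n l) = 0 ∧ bf y (ee n (n - 1 - l)) = 0}
  add_mem' := fun {x y} hx hy l hl => by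
    rw [bf_add_left, bf_add_left, (hx l hl).1, (hx l hl).2, (hy l hl).1, (hy l hl).2]; simp
  zero_mem' := fun l _ => by simp [bf]
  smul_mem' := fun c x hx l hl => by
    rw [bf_smul_left, bf_smul_left, (hx l hl).1, (hx l hl).2]; simp

/-- The abelian group of Eichler transformations with isotropic vector `e`. -/
def Esub (n j : ℕ) (e : Fin n → ℂ) : Subgroup (OGL n) where
  carrier := {g | ∃ y ∈ Yset n j, bf y e = 0 ∧ g = eich e y}
  mul_mem' := by
    rintro _ _ ⟨y, hy, hye, rfl⟩ ⟨z, hz, hze, rfl⟩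
    refine ⟨y + z, add_mem hy hz, by rw [bf_add_left, hye, hze, add_zero], ?_⟩
    by_cases h1 : bf e e = 0
    · exact eich_mul h1 hye hze
    · simp [eich_eq_one _ h1]
  one_mem' := ⟨0, zero_mem _, by simp [bf], by
    by_cases h1 : bf e e = 0
    · exact (eich_zero h1).symm
    · simp [eich_eq_one _ h1]⟩
  inv_mem' := by
    rintro _ ⟨y, hy, hye, rfl⟩
    refine ⟨-y, neg_mem hy, by rw [bf_neg_left, hye, neg_zero], ?_⟩
    by_cases h1 : bf e e = 0
    · exact eich_neg h1 hye
    · simp [eich_eq_one _ h1]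

theorem Esub_comm (j : ℕ) (e : Fin n → ℂ) : ∀ a ∈ Esub n j e, ∀ b ∈ Esub n j e, a * b = b * a := by
  rintro _ ⟨y, hy, hye, rfl⟩ _ ⟨z, hz, hze, rfl⟩
  by_cases h1 : bf e e = 0
  · rw [eich_mul h1 hye hze, eich_mul h1 hze hye, add_comm]
  · simp [eich_eq_one _ h1]

theorem Esub_conj (j : ℕ) (e : Fin n → ℂ) (h : OGL n) (c : ℂ) (hc : act h⁻¹ e = c • e)
    (hY : ∀ y ∈ Yset n j, act h⁻¹ y ∈ Yset n j) :
    ∀ a ∈ Esub n j e, h⁻¹ * a * h ∈ Esub n j e := by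
  rintro _ ⟨y, hy, hye, rfl⟩
  by_cases h1 : bf e e = 0
  · have h2 : c * bf (act h⁻¹ y) e = 0 := by rw [← bf_smul_right, ← hc, bf_act, hye]
    rw [eich_conj h1 hye, hc]
    by_cases hc0 : c = 0
    · rw [hc0, zero_smul] at hc ⊢
      have : e = 0 := by
        rw [← act_act_inv h e, hc]
        simp [act]
      subst this
      exact ⟨act h⁻¹ y, hY y hy, by rw [bf_comm]; simp [bf], rfl⟩
    · have h3 := (mul_eq_zero.mp h2).resolve_left hc0
      exact ⟨c • act h⁻¹ y, Submodule.smul_mem _ _ (hY y hy), by rw [bf_smul_left, h3, mul_zero],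
        eich_smul h1 h3 c⟩
  · rw [eich_eq_one _ h1]
    simp [one_mem]

/-- Elements fixing the first `j` hyperbolic pairs. -/
def stabO (n j : ℕ) : Subgroup (OGL n) where
  carrier := {g | ∀ i < j, act g (ee n i) = ee n i ∧ act g (ee n (n - 1 - i)) = ee n (n - 1 - i)}
  mul_mem' := by
    intro a b ha hb i hi
    rw [act_mul, act_mul, (hb i hi).1, (hb i hi).2, (ha i hi).1, (ha i hi).2]
    exact ⟨rfl, rfl⟩
  one_mem' := fun i _ => ⟨act_one _, act_one _⟩
  inv_mem' := by
    intro a ha i hi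
    exact ⟨act_inv_of_fix _ _ (ha i hi).1, act_inv_of_fix _ _ (ha i hi).2⟩

theorem stabO_Yset (j : ℕ) (g : OGL n) (hg : g ∈ stabO n (j + 1)) (y : Fin n → ℂ)
    (hy : y ∈ Yset n j) : act g y ∈ Yset n j := fun l hl => by
  rw [bf_act_of_fix _ _ _ (hg l (by omega)).1, bf_act_of_fix _ _ _ (hg l (by omega)).2]
  exact hy l hl

theorem stabO_mono {i j : ℕ} (h : i ≤ j) : stabO n j ≤ stabO n i :=
  fun _ hg l hl => hg l (hl.trans_le h)

/-- Upper unipotent Eichler subgroups. -/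
def Cp (n j : ℕ) : Subgroup (OGL n) := Esub n j (ee n j)

/-- Lower unipotent Eichler subgroups. -/
def Cm (n j : ℕ) : Subgroup (OGL n) := Esub n j (ee n (n - 1 - j))

theorem ee_isotropic (j : ℕ) (hj : 2 * j + 2 ≤ n) : bf (ee n j) (ee n j) = 0 ∧
    bf (ee n (n - 1 - j)) (ee n (n - 1 - j)) = 0 ∧ bf (ee n j) (ee n (n - 1 - j)) = 1 ∧
      bf (ee n (n - 1 - j)) (ee n j) = 1 := by
  refine ⟨?_, ?_, ?_, ?_⟩
  · rw [bf_ee_ee _ _ (by omega), if_neg (by omega)]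
  · rw [bf_ee_ee _ _ (by omega), if_neg (by omega)]
  · rw [bf_ee_ee _ _ (by omega), if_pos (by omega)]
  · rw [bf_ee_ee _ _ (by omega), if_pos (by omega)]

theorem ee_orth (i j : ℕ) (hij : i < j) (hj : 2 * j + 2 ≤ n) : bf (ee n j) (ee n i) = 0 ∧
    bf (ee n (n - 1 - j)) (ee n i) = 0 ∧ bf (ee n j) (ee n (n - 1 - i)) = 0 ∧
      bf (ee n (n - 1 - j)) (ee n (n - 1 - i)) = 0 := by
  refine ⟨?_, ?_, ?_, ?_⟩ <;>
  rw [bf_ee_ee _ _ (by omega), if_neg (by omega)]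

theorem eich_fix {e y x : Fin n → ℂ} (h1 : bf x e = 0) (h2 : bf x y = 0) : act (eich e y) x = x := by
  by_cases h : bf e e = 0 ∧ bf y e = 0
  · rw [act_eich h.1 h.2, h1, h2]
    simp
  · rw [eich, dif_neg h, act_one]

theorem Cp_le_stabO (j : ℕ) (hj : 2 * j + 2 ≤ n) : Cp n j ≤ stabO n j := by
  rintro _ ⟨y, hy, hye, rfl⟩ i hi
  obtain ⟨h1, h2, h3, h4⟩ := ee_orth i j hi hj
  exact ⟨eich_fix (by rw [bf_comm, h1]) (by rw [bf_comm, (hy i hi.le).1]),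
    eich_fix (by rw [bf_comm, h3]) (by rw [bf_comm, (hy i hi.le).2])⟩

theorem Cm_le_stabO (j : ℕ) (hj : 2 * j + 2 ≤ n) : Cm n j ≤ stabO n j := by
  rintro _ ⟨y, hy, hye, rfl⟩ i hi
  obtain ⟨h1, h2, h3, h4⟩ := ee_orth i j hi hj
  exact ⟨eich_fix (by rw [bf_comm, h2]) (by rw [bf_comm, (hy i hi.le).1]),
    eich_fix (by rw [bf_comm, h4]) (by rw [bf_comm, (hy i hi.le).2])⟩

/-- The torus elements of the orthogonal group. -/
def torO (n j : ℕ) (s : ℂˣ) : OGL n :=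
  open Classical in if hj : 2 * j + 2 ≤ n then
    mkO (1 + vecMulVec (((s : ℂ) - 1) • ee n j) (symForm n *ᵥ ee n (n - 1 - j)) +
      vecMulVec (((s⁻¹ : ℂˣ) - 1 : ℂ) • ee n (n - 1 - j)) (symForm n *ᵥ ee n j)) (by
    obtain ⟨h1, h2, h3, h4⟩ := ee_isotropic j hj
    intro x z
    have hs : ((s⁻¹ : ℂˣ) : ℂ) = (s : ℂ)⁻¹ := Units.val_inv_eq_inv_val s
    simp only [add_mulVec, one_mulVec, vecMulVec_mulVec', dotProduct_comm _ x, dotProduct_comm _ z, ← bf_eq,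
      bf_add_left, bf_add_right, bf_smul_left, bf_smul_right, h1, h2, h3, h4]
    rw [bf_comm (ee n j) z, bf_comm (ee n (n - 1 - j)) z, hs]
    field_simp
    ring) else 1

theorem act_torO (j : ℕ) (hj : 2 * j + 2 ≤ n) (s : ℂˣ) (x : Fin n → ℂ) :
    act (torO n j s) x = x + (bf x (ee n (n - 1 - j)) * ((s : ℂ) - 1)) • ee n j
      + (bf x (ee n j) * ((s : ℂ)⁻¹ - 1)) • ee n (n - 1 - j) := by
  rw [act, torO, dif_pos hj, mat_mkO, add_mulVec, add_mulVec, one_mulVec, vecMulVec_mulVec',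
    vecMulVec_mulVec', dotProduct_comm _ x, dotProduct_comm _ x, ← bf_eq, ← bf_eq, smul_smul, smul_smul,
    Units.val_inv_eq_inv_val]

theorem act_torO_fix (j : ℕ) (hj : 2 * j + 2 ≤ n) (s : ℂˣ) (x : Fin n → ℂ)
    (h1 : bf x (ee n j) = 0) (h2 : bf x (ee n (n - 1 - j)) = 0) : act (torO n j s) x = x := by
  rw [act_torO j hj, h1, h2]
  simp

theorem act_torO_ee (j : ℕ) (hj : 2 * j + 2 ≤ n) (s : ℂˣ) :
    act (torO n j s) (ee n j) = (s : ℂ) • ee n j ∧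
      act (torO n j s) (ee n (n - 1 - j)) = (s : ℂ)⁻¹ • ee n (n - 1 - j) := by
  obtain ⟨h1, h2, h3, h4⟩ := ee_isotropic j hj
  constructor
  · rw [act_torO j hj, h1, h3]
    ext i; simp; ring
  · rw [act_torO j hj, h2, h4]
    ext i; simp; ring

theorem torO_inv (j : ℕ) (hj : 2 * j + 2 ≤ n) (s : ℂˣ) : (torO n j s)⁻¹ = torO n j s⁻¹ := by
  rw [inv_eq_iff_mul_eq_one]
  refine O_ext fun l _ => ?_
  have hs : ((s⁻¹ : ℂˣ) : ℂ) = (s : ℂ)⁻¹ := Units.val_inv_eq_inv_val s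
  obtain ⟨h1, h2, h3, h4⟩ := ee_isotropic j hj
  rw [act_mul, act_one, act_torO j hj, act_torO j hj, hs]
  simp only [bf_add_left, bf_smul_left, h1, h2, h3, h4]
  ext i
  simp only [Pi.add_apply, Pi.smul_apply, smul_eq_mul, inv_inv]
  field_simp
  ring

theorem torO_mem_stabO (j : ℕ) (hj : 2 * j + 2 ≤ n) (s : ℂˣ) : torO n j s ∈ stabO n j := by
  intro i hi
  obtain ⟨h1, h2, h3, h4⟩ := ee_orth i j hi hj
  exact ⟨act_torO_fix j hj s _ (by rw [bf_comm, h1]) (by rw [bf_comm, h2]),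
    act_torO_fix j hj s _ (by rw [bf_comm, h3]) (by rw [bf_comm, h4])⟩

theorem torO_comm (j : ℕ) (hj : 2 * j + 2 ≤ n) (s : ℂˣ) (g : OGL n) (hg : g ∈ stabO n (j + 1)) :
    torO n j s * g = g * torO n j s := by
  refine O_ext fun l _ => ?_
  obtain ⟨h1, h2⟩ := hg j (by omega)
  rw [act_mul, act_mul, act_torO j hj, act_torO j hj, act_add, act_add, act_smul, act_smul, h1, h2,
    bf_act_of_fix _ _ _ h1, bf_act_of_fix _ _ _ h2]

/-- The factorization of the elements of the big cell. -/
theorem O_factor (j : ℕ) (hj : 2 * j + 2 ≤ n) (g : OGL n) (hg : g ∈ stabO n j)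
    (hgj : bf (act g (ee n j)) (ee n (n - 1 - j)) ≠ 0) :
    ∃ a ∈ Cm n j, ∃ s : ℂˣ, ∃ g' ∈ stabO n (j + 1), ∃ c ∈ Cp n j, g = a * torO n j s * g' * c := by
  obtain ⟨h1, h2, h3, h4⟩ := ee_isotropic j hj
  set s : ℂˣ := Units.mk0 _ hgj
  have hsv : (s : ℂ) = bf (act g (ee n j)) (ee n (n - 1 - j)) := rfl
  have hs0 : (s : ℂ) ≠ 0 := s.ne_zero
  have orth : ∀ g' ∈ stabO n j, ∀ x : Fin n → ℂ,
      (∀ i < j, bf x (ee n i) = 0 ∧ bf x (ee n (n - 1 - i)) = 0) →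
      ∀ i < j, bf (act g' x) (ee n i) = 0 ∧ bf (act g' x) (ee n (n - 1 - i)) = 0 := by
    intro g' hg' x hx i hi
    rw [bf_act_of_fix _ _ _ (hg' i hi).1, bf_act_of_fix _ _ _ (hg' i hi).2]
    exact hx i hi
  have ho1 : ∀ i < j, bf (ee n j) (ee n i) = 0 ∧ bf (ee n j) (ee n (n - 1 - i)) = 0 := fun i hi =>
    ⟨(ee_orth i j hi hj).1, (ee_orth i j hi hj).2.2.1⟩
  have ho2 : ∀ i < j, bf (ee n (n - 1 - j)) (ee n i) = 0 ∧ bf (ee n (n - 1 - j)) (ee n (n - 1 - i)) = 0 :=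
    fun i hi => ⟨(ee_orth i j hi hj).2.1, (ee_orth i j hi hj).2.2.2⟩
  set x := (s : ℂ)⁻¹ • act g (ee n j) with hx
  obtain ⟨m1, m2, m3, m4⟩ := eich_move (x := x) h1 h2 h3
    (by rw [hx, bf_smul_left, bf_smul_right, bf_act, h1]; simp)
    (by rw [hx, bf_smul_left, ← hsv, inv_mul_cancel₀ hs0])
  set y := x - ee n j - bf x (ee n j) • ee n (n - 1 - j) with hy
  have hyY : y ∈ Yset n j := by
    intro l hl
    rcases hl.lt_or_eq with hl | rfl
    · simp only [hy, hx, bf_sub_left, bf_smul_left, (ho1 l hl).1, (ho1 l hl).2, (ho2 l hl).1,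
        (ho2 l hl).2, (orth g hg _ ho1 l hl).1, (orth g hg _ ho1 l hl).2]
      simp
    · exact ⟨m2, m1⟩
  set a := eich (ee n (n - 1 - j)) y
  have haC : a ∈ Cm n j := ⟨y, hyY, m1, rfl⟩
  set g1 := (torO n j s)⁻¹ * a⁻¹ * g with hg1
  have hg1H : g1 ∈ stabO n j :=
    mul_mem (mul_mem (inv_mem (torO_mem_stabO j hj s)) (inv_mem (Cm_le_stabO j hj haC))) hg
  have hg1e : act g1 (ee n j) = ee n j := by
    have hgx : act g (ee n j) = (s : ℂ) • x := by rw [hx, smul_smul, mul_inv_cancel₀ hs0, one_smul]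
    have e1 : act a⁻¹ x = ee n j := by rw [← m3, act_inv_act]
    rw [hg1, act_mul, act_mul, hgx, act_smul, e1, ← (act_torO_ee j hj s).1, act_inv_act]
  set x2 := act g1⁻¹ (ee n (n - 1 - j)) with hx2
  obtain ⟨p1, p2, p3, p4⟩ := eich_move (x := x2) h2 h1 h4 (by rw [hx2, bf_act, h2])
    (by rw [hx2, bf_act_of_fix _ _ _ (act_inv_of_fix _ _ hg1e), h4])
  set y2 := x2 - ee n (n - 1 - j) - bf x2 (ee n (n - 1 - j)) • ee n j with hy2
  have hy2Y : y2 ∈ Yset n j := by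
    intro l hl
    rcases hl.lt_or_eq with hl | rfl
    · have := orth g1⁻¹ (inv_mem hg1H) _ ho2 l hl
      simp only [hy2, hx2, bf_sub_left, bf_smul_left, (ho1 l hl).1, (ho1 l hl).2, (ho2 l hl).1,
        (ho2 l hl).2, this.1, this.2]
      simp
    · exact ⟨p1, p2⟩
  set c := eich (ee n j) y2
  have hcC : c ∈ Cp n j := ⟨y2, hy2Y, p1, rfl⟩
  refine ⟨a, haC, s, g1 * c, ?_, c⁻¹, inv_mem hcC, by rw [hg1]; group⟩
  intro i hi
  rcases Nat.lt_succ_iff_lt_or_eq.mp hi with hi | rfl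
  · exact mul_mem hg1H (Cp_le_stabO j hj hcC) i hi
  · rw [act_mul g1 c, act_mul g1 c, p3, p4, hg1e, hx2, act_act_inv]
    exact ⟨rfl, rfl⟩

end Ochain

section

open Finset Polynomial Module

section Okill

variable {n : ℕ}

/-- The permutation underlying the distinguished reflection. -/
def rsw (i : Fin n) : Fin n := if 2 * (i : ℕ) = n ∨ 2 * (i : ℕ) + 2 = n then i.rev else i

/-- The sign underlying the distinguished reflection. -/
def rsg (i : Fin n) : ℂ := if 2 * (i : ℕ) + 1 = n then -1 else 1

theorem rsw_rsw (i : Fin n) : rsw (rsw i) = i := by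
  grind [rsw]

theorem rsw_rev (i : Fin n) : rsw i.rev = (rsw i).rev := by
  grind [rsw]

theorem rsg_mul (i : Fin n) : rsg i * rsg i.rev = 1 := by
  grind [rsg]

theorem reflMatrix_apply (i j : Fin n) : reflMatrix n i j = if j = rsw i then rsg i else 0 := by
  rw [reflMatrix, of_apply]
  grind [rsw, rsg]

theorem reflMatrix_mulVec (x : Fin n → ℂ) (i : Fin n) : (reflMatrix n *ᵥ x) i = rsg i * x (rsw i) := by
  rw [mulVec, dotProduct, sum_eq_single (rsw i)]
  · rw [reflMatrix_apply, if_pos rfl]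
  · intro j _ hj
    rw [reflMatrix_apply, if_neg hj, zero_mul]
  · simp

/-- The distinguished reflection. -/
def refl (n : ℕ) : OGL n := mkO (reflMatrix n) (by
  intro x y
  unfold bf
  rw [← Equiv.sum_comp (Function.Involutive.toPerm rsw rsw_rsw) fun i => x i * y i.rev]
  refine sum_congr rfl fun i _ => ?_
  change _ = x (rsw i) * y (rsw i).rev
  rw [reflMatrix_mulVec, reflMatrix_mulVec, rsw_rev, mul_mul_mul_comm, rsg_mul, one_mul])

theorem mat_refl : mat (refl n) = reflMatrix n := rfl

theorem act_refl (x : Fin n → ℂ) (i : Fin n) : act (refl n) x i = rsg i * x (rsw i) :=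
  reflMatrix_mulVec x i

theorem ee_apply (l : ℕ) (i : Fin n) : ee n l i = if (i : ℕ) = l then 1 else 0 := rfl

theorem act_refl_ee (l : ℕ) (h : 2 * l + 2 < n ∨ n < 2 * l) : act (refl n) (ee n l) = ee n l := by
  ext i
  rw [act_refl, ee_apply, ee_apply]
  grind [rsw, rsg]

theorem act_refl_odd (l : ℕ) (h : 2 * l + 1 = n) : act (refl n) (ee n l) = - ee n l := by
  ext i
  rw [act_refl, Pi.neg_apply, ee_apply, ee_apply]
  grind [rsw, rsg]

theorem act_refl_even (l : ℕ) (h : 2 * l = n ∨ 2 * l + 2 = n) :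
    act (refl n) (ee n l) = ee n (n - 1 - l) := by
  ext i
  rw [act_refl, ee_apply, ee_apply]
  grind [rsw, rsg]

theorem refl_mem_stabO (j : ℕ) (hj : j ≤ (n - 1) / 2) : refl n ∈ stabO n j :=
  fun i hi => ⟨act_refl_ee i (by omega), act_refl_ee _ (by omega)⟩

theorem refl_mul_refl : refl n * refl n = 1 := by
  refine mat_inj (mat_ext _ _ fun l _ => ?_)
  ext i
  rw [mat_mul, mat_refl, ← mulVec_mulVec, reflMatrix_mulVec, reflMatrix_mulVec, rsw_rsw, ← mul_assoc,
    mat_one, one_mulVec]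
  have : rsg i * rsg (rsw i) = 1 := by
    grind [rsw, rsg]
  rw [this, one_mul]

theorem stabO_fix (g : OGL n) (j : ℕ) (hg : g ∈ stabO n j) (l : ℕ) (hl : l < j ∨ (n ≤ l + j ∧ l < n)) :
    act g (ee n l) = ee n l := by
  rcases hl with hl | hl
  · exact (hg l hl).1
  · have := (hg (n - 1 - l) (by omega)).2
    rwa [show n - 1 - (n - 1 - l) = l by omega] at this

theorem O_base (g : OGL n) (hg : g ∈ stabO n ((n - 1) / 2)) :
    ∃ t : OGL n, (t = 1 ∨ ∃ j s, 2 * j + 2 ≤ n ∧ t = torO n j s) ∧ (g = t ∨ g = refl n * t) := by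
  rcases Nat.eq_zero_or_pos n with rfl | hn
  · exact ⟨1, Or.inl rfl, Or.inl (O_ext fun l hl => absurd hl (by omega))⟩
  set m := (n - 1) / 2
  by_cases hodd : 2 * m + 1 = n
  · refine ⟨1, Or.inl rfl, ?_⟩
    set c := bf (act g (ee n m)) (ee n m) with hc
    have h1 : act g (ee n m) = c • ee n m := by
      refine vec_ext _ _ fun l hl => ?_
      rw [bf_smul_left, bf_ee_ee _ _ hl]
      by_cases h : l = m
      · subst h
        rw [if_pos (by omega), ← hc, mul_one]
      · rw [if_neg (by omega), bf_act_of_fix _ _ _ (stabO_fix g m hg l (by omega)),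
          bf_ee_ee _ _ hl, if_neg (by omega), mul_zero]
    have h2 : c * c = 1 := by
      have := bf_act g (ee n m) (ee n m)
      rw [h1, bf_smul_left, bf_smul_right, bf_ee_ee _ _ (by omega), if_pos (by omega)] at this
      linear_combination this
    rcases mul_self_eq_one_iff.mp h2 with hc1 | hc1
    · left
      refine O_ext fun l hl => ?_
      rw [act_one]
      by_cases h : l = m
      · rw [h, h1, hc1, one_smul]
      · exact stabO_fix g m hg l (by omega)
    · right
      rw [mul_one]
      refine O_ext fun l hl => ?_
      by_cases h : l = m
      · rw [h, h1, hc1, act_refl_odd _ hodd, neg_one_smul]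
      · rw [stabO_fix g m hg l (by omega), act_refl_ee _ (by omega)]
  · have hn2 : 2 * m + 2 = n := by omega
    obtain ⟨b1, b2, b3, b4⟩ := ee_isotropic m hn2.le
    have expand : ∀ x : Fin n → ℂ, (∀ l < n, l ≠ m → l ≠ n - 1 - m → bf x (ee n l) = 0) →
        x = bf x (ee n (n - 1 - m)) • ee n m + bf x (ee n m) • ee n (n - 1 - m) := by
      intro x hx
      refine vec_ext _ _ fun l hl => ?_
      rw [bf_add_left, bf_smul_left, bf_smul_left, bf_ee_ee _ _ hl, bf_ee_ee _ _ hl]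
      by_cases h : l = m
      · subst h
        rw [if_neg (by omega), if_pos (by omega)]; ring
      · by_cases h' : l = n - 1 - m
        · subst h'
          rw [if_pos (by omega), if_neg (by omega)]; ring
        · rw [hx l hl h h', if_neg (by omega), if_neg (by omega)]; ring
    have hfix : ∀ h ∈ stabO n m, ∀ l < n, l ≠ m → l ≠ n - 1 - m → act h (ee n l) = ee n l :=
      fun h hh l hl h1 h2 => stabO_fix h m hh l (by omega)
    have hgo : ∀ h ∈ stabO n m, ∀ a, (a = m ∨ a = n - 1 - m) → ∀ l < n, l ≠ m → l ≠ n - 1 - m →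
        bf (act h (ee n a)) (ee n l) = 0 := by
      intro h hh a ha l hl h1 h2
      rw [bf_act_of_fix _ _ _ (hfix h hh l hl h1 h2), bf_ee_ee _ _ hl, if_neg (by omega)]
    have tcase : ∀ h ∈ stabO n m, ∀ a : ℂ, act h (ee n m) = a • ee n m →
        ∃ s, h = torO n m s := by
      intro h hh a ha
      have e2 := expand _ (hgo h hh _ (Or.inr rfl))
      set p := bf (act h (ee n (n - 1 - m))) (ee n (n - 1 - m))
      set q := bf (act h (ee n (n - 1 - m))) (ee n m)
      have h1 := bf_act h (ee n m) (ee n (n - 1 - m))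
      have h2 := bf_act h (ee n (n - 1 - m)) (ee n (n - 1 - m))
      rw [ha, e2, bf_smul_left, bf_add_right, bf_smul_right, bf_smul_right, b1, b3] at h1
      rw [e2, bf_add_left, bf_smul_left, bf_smul_left, bf_add_right, bf_add_right, bf_smul_right,
        bf_smul_right, bf_smul_right, bf_smul_right, b1, b2, b3, b4] at h2
      have haq : a * q = 1 := by linear_combination h1
      have ha0 : a ≠ 0 := left_ne_zero_of_mul_eq_one haq
      have hpq : p * q = 0 := by linear_combination h2 / 2
      have hp : p = 0 := (mul_eq_zero.mp hpq).resolve_right (right_ne_zero_of_mul_eq_one haq)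
      have hq : q = a⁻¹ := by field_simp; linear_combination haq
      refine ⟨Units.mk0 a ha0, O_ext fun l hl => ?_⟩
      by_cases hlm : l = m
      · rw [hlm, ha, (act_torO_ee m hn2.le _).1, Units.val_mk0]
      · by_cases hlm' : l = n - 1 - m
        · rw [hlm', e2, hp, hq, (act_torO_ee m hn2.le _).2, Units.val_mk0, zero_smul, zero_add]
        · rw [hfix h hh l hl hlm hlm', hfix _ (torO_mem_stabO m hn2.le _) l hl hlm hlm']
    have e1 := expand _ (hgo g hg m (Or.inl rfl))
    set a := bf (act g (ee n m)) (ee n (n - 1 - m))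
    set b := bf (act g (ee n m)) (ee n m)
    have h1 := bf_act g (ee n m) (ee n m)
    rw [e1, bf_add_left, bf_smul_left, bf_smul_left, bf_add_right, bf_add_right, bf_smul_right,
        bf_smul_right, bf_smul_right, bf_smul_right, b1, b2, b3, b4] at h1
    have hab : a * b = 0 := by linear_combination h1 / 2
    rcases mul_eq_zero.mp hab with h0 | h0
    · have hs : refl n * g ∈ stabO n m := mul_mem (refl_mem_stabO m le_rfl) hg
      obtain ⟨s, hs⟩ := tcase (refl n * g) hs b (by
        rw [act_mul, e1, h0, zero_smul, zero_add, act_smul, act_refl_even _ (by omega),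
          show n - 1 - (n - 1 - m) = m by omega])
      refine ⟨_, Or.inr ⟨m, s, hn2.le, rfl⟩, Or.inr ?_⟩
      rw [← hs, ← mul_assoc, refl_mul_refl, one_mul]
    · obtain ⟨s, hs⟩ := tcase g hg a (by rw [e1, h0, zero_smul, add_zero])
      exact ⟨_, Or.inr ⟨m, s, hn2.le, rfl⟩, Or.inl hs⟩

/-- Finitely many nonzero vectors, viewed as polynomials, have a common non-root. -/
theorem exists_eval_ne {ι : Type*} (s : Finset ι) (v : ι → Fin n → ℂ) (h0 : ∀ a ∈ s, v a ≠ 0) :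
    ∃ t : ℂ, t ≠ 0 ∧ ∀ a ∈ s, ∑ i : Fin n, v a i * t ^ (i : ℕ) ≠ 0 := by
  set q : ι → Polynomial ℂ := fun a => ∑ i : Fin n, C (v a i) * X ^ (i : ℕ)
  have hq : ∀ a ∈ s, q a ≠ 0 := by
    intro a ha hqa
    apply h0 a ha
    ext i
    have := congrArg (fun p => coeff p (i : ℕ)) hqa
    simp only [q, finsetSum_coeff, coeff_C_mul, coeff_X_pow,
      coeff_zero] at this
    rw [sum_eq_single i] at this
    · simpa using this
    · intro b _ hb
      rw [if_neg (fun h => hb (Fin.ext h.symm)), mul_zero]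
    · simp
  have hprod : X * ∏ a ∈ s, q a ≠ 0 :=
    mul_ne_zero X_ne_zero (prod_ne_zero_iff.mpr hq)
  obtain ⟨t, ht⟩ : ∃ t : ℂ, (X * ∏ a ∈ s, q a).eval t ≠ 0 := by
    by_contra h
    push Not at h
    exact hprod (funext fun t => by rw [h t, eval_zero])
  rw [eval_mul, eval_X, eval_prod] at ht
  have h1 := right_ne_zero_of_mul ht
  rw [prod_ne_zero_iff] at h1
  refine ⟨t, left_ne_zero_of_mul ht, fun a ha => ?_⟩
  convert h1 a ha using 1
  simp only [q, eval_finsetSum, eval_mul, eval_C,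
    eval_pow, eval_X]

/-- An upper Eichler transformation moves finitely many vectors to the big cell. -/
theorem O_avoid (j : ℕ) (hj : 2 * j + 3 ≤ n) {ι : Type*} (s : Finset ι) (v : ι → Fin n → ℂ)
    (h0 : ∀ a ∈ s, v a ≠ 0)
    (hs : ∀ a ∈ s, ∀ i < j, bf (v a) (ee n i) = 0 ∧ bf (v a) (ee n (n - 1 - i)) = 0) :
    ∃ c ∈ Cp n j, ∀ a ∈ s, bf (act c (v a)) (ee n (n - 1 - j)) ≠ 0 := by
  obtain ⟨b1, b2, b3, b4⟩ := ee_isotropic (n := n) j (by omega)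
  set κ : Fin n → ℂ := fun i => if (i : ℕ) ≤ j then 1 else if (i : ℕ) < n - 1 - j then -1
    else - ((n : ℂ) - 2 - 2 * j) / 2 with hκ
  have hκ0 : ∀ i, κ i ≠ 0 := by
    intro i
    simp only [hκ]
    split_ifs
    · exact one_ne_zero
    · exact neg_ne_zero.mpr one_ne_zero
    · have : ((n : ℂ) - 2 - 2 * j) = ((n - 2 - 2 * j : ℕ) : ℂ) := by
        rw [Nat.cast_sub (by omega), Nat.cast_sub (by omega)]; push_cast; ring
      rw [this]
      refine div_ne_zero (neg_ne_zero.mpr ?_) two_ne_zero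
      exact_mod_cast (by omega : n - 2 - 2 * j ≠ 0)
  have hsup : ∀ a ∈ s, ∀ i : Fin n, ((i : ℕ) < j ∨ n ≤ i + j) → v a i = 0 := by
    intro a ha i hi
    rcases hi with hi | hi
    · have := (hs a ha i hi).2
      rw [bf_ee _ (by omega)] at this
      convert this using 2
      ext
      rw [Fin.val_rev]
      simp only
      omega
    · have := (hs a ha (n - 1 - i) (by omega)).1
      rw [bf_ee _ (by omega)] at this
      convert this using 2
      ext
      rw [Fin.val_rev]
      simp only
      omega
  obtain ⟨t, ht0, ht⟩ := exists_eval_ne s (fun a i => κ i * v a i) (by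
    intro a ha h
    apply h0 a ha
    ext i
    have := congrFun h i
    simpa [hκ0] using this)
  set y : Fin n → ℂ := fun i => if j < (i : ℕ) ∧ (i : ℕ) < n - 1 - j then t ^ (n - 1 - j - (i : ℕ)) else 0 with hy
  have hyY : y ∈ Yset n j := by
    intro l hl
    rw [bf_ee _ (by omega), bf_ee _ (by omega)]
    simp only [hy, Fin.val_rev]
    exact ⟨if_neg (by omega), if_neg (by omega)⟩
  have hyy : bf y y = ((n : ℂ) - 2 - 2 * j) * t ^ (n - 1 - 2 * j) := by
    have h1 : ∀ i : Fin n, y i * y i.rev =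
        if j < (i : ℕ) ∧ (i : ℕ) < n - 1 - j then t ^ (n - 1 - 2 * j) else 0 := by
      intro i
      simp only [hy, Fin.val_rev]
      by_cases h : j < (i : ℕ) ∧ (i : ℕ) < n - 1 - j
      · rw [if_pos h, if_pos (by omega), if_pos h, ← pow_add]
        congr 1
        omega
      · rw [if_neg h, if_neg h, zero_mul]
    rw [bf, sum_congr rfl fun i _ => h1 i,
      Fin.sum_univ_eq_sum_range (fun i => if j < i ∧ i < n - 1 - j then t ^ (n - 1 - 2 * j) else 0) n,
      ← sum_filter, sum_const, nsmul_eq_mul]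
    congr 1
    rw [show (range n).filter (fun i => j < i ∧ i < n - 1 - j) = Ioo j (n - 1 - j) by
      ext i; simp; omega, Nat.card_Ioo]
    rw [show n - 1 - j - j - 1 = n - (2 + 2 * j) by omega, Nat.cast_sub (by omega)]
    push_cast
    ring
  refine ⟨eich (ee n j) y, ⟨y, hyY, (hyY j le_rfl).1, rfl⟩, fun a ha => ?_⟩
  have h1 := ht a ha
  intro h2
  apply h1
  rw [act_eich b1 (hyY j le_rfl).1, bf_sub_left, bf_sub_left, bf_add_left, bf_smul_left, bf_smul_left,
    bf_smul_left, (hyY j le_rfl).2, b3, hyy] at h2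
  have h3 : ∀ i : Fin n, κ i * v a i * t ^ (i : ℕ) = t ^ j * (
      (if (i : ℕ) = j then v a i else 0) - (v a i * y i.rev)
      - ((n : ℂ) - 2 - 2 * j) * t ^ (n - 1 - 2 * j) / 2 * (if (i : ℕ) = n - 1 - j then v a i else 0)) := by
    intro i
    by_cases c1 : (i : ℕ) < j ∨ n ≤ i + j
    · rw [hsup a ha i c1]; simp
    · by_cases c2 : (i : ℕ) = j
      · simp only [hκ, hy, Fin.val_rev]
        grind
      · by_cases c3 : (i : ℕ) = n - 1 - j
        · rw [if_neg (by omega), if_pos (by omega)]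
          simp only [hκ, hy, Fin.val_rev]
          rw [if_neg (by omega), if_neg (by omega), if_neg (by omega),
            show (i : ℕ) = j + (n - 1 - 2 * j) by omega, pow_add]
          ring
        · rw [if_neg (by omega), if_neg (by omega)]
          simp only [hκ, hy, Fin.val_rev]
          rw [if_neg (by omega), if_pos (by omega), if_pos (by omega)]
          have : t ^ (i : ℕ) = t ^ j * t ^ (n - 1 - j - (n - ((i : ℕ) + 1))) := by rw [← pow_add]; congr 1; omega
          rw [this]
          ring
  rw [sum_congr rfl fun i _ => h3 i, ← mul_sum, sum_sub_distrib,
    sum_sub_distrib, ← mul_sum]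
  have e1 : ∀ (l : ℕ) (hl : l < n), (∑ i : Fin n, if (i : ℕ) = l then v a i else 0) =
      bf (v a) (ee n (n - 1 - l)) := by
    intro l hl
    rw [bf_ee _ (by omega), sum_eq_single ⟨l, hl⟩]
    · rw [if_pos rfl]
      congr 1
      ext
      rw [Fin.val_rev]
      simp only
      omega
    · intro b _ hb
      rw [if_neg fun h => hb (Fin.ext h)]
    · simp
  rw [e1 _ (by omega), e1 _ (by omega), show n - 1 - (n - 1 - j) = j by omega]
  refine mul_eq_zero_of_right _ ?_
  change bf (v a) (ee n (n - 1 - j)) - bf (v a) y - _ = 0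
  linear_combination h2

variable {X : Type*} [AddCommGroup X] [Module ℂ X]

theorem O_kill (τ : Representation ℂ (OGL n) X) (Φ : X →ₗ[ℂ] ℂ) (z : X)
    (U : Submodule ℂ X) (hU : IsSubrep τ U) [FiniteDimensional ℂ U] (hzU : z ∈ U)
    (hΦ : ∀ j, 2 * j + 3 ≤ n → ∀ c ∈ Cm n j, ∀ x ∈ U, Φ (τ c x) = Φ x)
    (hz : ∀ j, 2 * j + 3 ≤ n → ∀ c ∈ Cp n j, τ c z = z)
    (ht : ∀ j, 2 * j + 2 ≤ n → ∀ s, ∃ c : ℂ, τ (torO n j s) z = c • z) (h0 : Φ z = 0)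
    (h0' : Φ (τ (refl n) z) = 0) :
    ∀ g, Φ (τ g z) = 0 := by
  suffices ∀ d j, j + d = (n - 1) / 2 → ∀ g ∈ stabO n j, Φ (τ g z) = 0 from
    fun g => this ((n - 1) / 2) 0 (by omega) g (fun i hi => absurd hi (by omega))
  intro d
  induction d with
  | zero =>
    rintro j rfl g hg
    obtain ⟨t, h1, h2⟩ := O_base g hg
    obtain ⟨χ, hχ⟩ : ∃ c : ℂ, τ t z = c • z := by
      rcases h1 with rfl | ⟨j, s, hj, rfl⟩
      · exact ⟨1, by simp⟩
      · exact ht j hj s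
    rcases h2 with rfl | rfl
    · rw [hχ, map_smul, h0, smul_zero]
    · rw [map_mul, End.mul_apply, hχ, map_smul, map_smul, h0', smul_zero]
  | succ d ih =>
    intro j hjd
    have ih := ih (j + 1) (by omega)
    have hj3 : 2 * j + 3 ≤ n := by omega
    refine density τ Φ z (stabO n j) U hU hzU
      (fun g => bf (act g (ee n j)) (ee n (n - 1 - j)) ≠ 0) ?_ ?_
    · intro g hg hgj
      obtain ⟨a, ha, s, g', hg', c, hc, rfl⟩ := O_factor j (by omega) g hg hgj
      obtain ⟨χ, hχ⟩ := ht j (by omega) s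
      rw [mul_assoc, mul_assoc, map_mul, End.mul_apply, hΦ j hj3 a ha _ (hU _ _ hzU),
        ← mul_assoc, torO_comm j (by omega) s g' hg', mul_assoc, map_mul, map_mul,
        End.mul_apply, End.mul_apply, hz j hj3 c hc, hχ, map_smul, map_smul, ih g' hg',
        smul_zero]
    · intro s hs
      obtain ⟨c, hc, hav⟩ := O_avoid j hj3 s (fun g => act g (ee n j)) (by
          intro g hg h
          have h1 := act_inv_act g (ee n j)
          rw [h] at h1
          have := congrFun h1 ⟨j, by omega⟩
          simp [ee, act] at this) (by
          intro g hg i hi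
          have := hs g hg i hi
          rw [bf_act_of_fix _ _ _ this.1, bf_act_of_fix _ _ _ this.2]
          exact ⟨(ee_orth i j hi (by omega)).1, (ee_orth i j hi (by omega)).2.2.1⟩)
      refine ⟨c, Cp_le_stabO j (by omega) hc, fun g hg => ?_⟩
      rw [act_mul]
      exact hav g hg

end Okill

end

section

open Submodule LinearMap Module

section Oequiv

variable {n : ℕ}

/-- The conjugate transpose of an element of `O_n(ℂ)`. -/
def stO (g : OGL n) : OGL n := ⟨star (g : GL (Fin n) ℂ), by
  have h1 : (mat g)ᵀ * symForm n * mat g = symForm n := g.2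
  have h2 : (symForm n * (mat g)ᵀ * symForm n) * mat g = 1 := by
    rw [mul_assoc, mul_assoc, ← mul_assoc (mat g)ᵀ, h1, symForm_mul_self]
  have h3 := mul_eq_one_comm.mp h2
  have h4 : mat g * symForm n * (mat g)ᵀ = symForm n := by
    have := congrArg (· * symForm n) h3
    simp only [one_mul] at this
    simpa only [mul_assoc, symForm_mul_self, mul_one] using this
  have h5 : (symForm n)ᴴ = symForm n := by
    ext i j
    rw [conjTranspose_apply, symForm, of_apply, of_apply, add_comm]
    split_ifs <;> simp
  change ((mat g)ᴴ)ᵀ * symForm n * (mat g)ᴴ = symForm n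
  have h6 := congrArg (fun A => (Aᴴ)ᵀ) h4
  simp only [conjTranspose_mul, transpose_mul, h5] at h6
  have h7 : (symForm n)ᵀ = symForm n := by
    ext i j
    rw [transpose_apply, symForm, of_apply, of_apply, add_comm]
  rw [h7] at h6
  exact h6⟩

theorem mat_stO (g : OGL n) : mat (stO g) = (mat g)ᴴ := rfl

theorem stO_stO (g : OGL n) : stO (stO g) = g := mat_inj (by rw [mat_stO, mat_stO, conjTranspose_conjTranspose])

/-- Reversal composed with complex conjugation. -/
def rv (x : Fin n → ℂ) : Fin n → ℂ := fun i => star (x i.rev)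

theorem bf_rv (x y : Fin n → ℂ) : bf (rv x) (rv y) = star (bf x y) := by
  rw [bf, bf, star_sum, ← Equiv.sum_comp Fin.revPerm]
  refine Finset.sum_congr rfl fun i _ => ?_
  simp [rv]

theorem rv_ee (l : ℕ) (hl : l < n) : rv (ee n l) = ee n (n - 1 - l) := by
  ext i
  rw [rv, ee_apply, ee_apply, Fin.val_rev]
  by_cases h : (i : ℕ) = n - 1 - l
  · rw [if_pos h, if_pos (by omega), star_one]
  · rw [if_neg h, if_neg (by omega), star_zero]

theorem rv_mem_Yset (j : ℕ) (hj : 2 * j + 2 ≤ n) (y : Fin n → ℂ) (hy : y ∈ Yset n j) :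
    -rv y ∈ Yset n j := by
  refine neg_mem fun l hl => ?_
  have h1 := rv_ee (n := n) l (by omega)
  have h2 := rv_ee (n := n) (n - 1 - l) (by omega)
  rw [show n - 1 - (n - 1 - l) = l by omega] at h2
  rw [← h1, bf_rv, (hy l hl).1]
  rw [← h2, bf_rv, (hy l hl).2]
  simp

theorem stO_eich {e y : Fin n → ℂ} (h1 : bf e e = 0) (h2 : bf y e = 0) :
    stO (eich e y) = eich (rv e) (-rv y) := by
  refine mat_inj ?_
  rw [mat_stO, mat_eich h1 h2, mat_eich (by rw [bf_rv, h1, star_zero])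
    (by rw [bf_neg_left, bf_rv, h2, star_zero, neg_zero])]
  have h3 : bf (-rv y) (-rv y) = star (bf y y) := by rw [bf_neg_left, bf_neg_right, neg_neg, bf_rv]
  ext i j
  rw [conjTranspose_apply, eichM, eichM, h3]
  simp only [Matrix.sub_apply, Matrix.add_apply, vecMulVec_apply, symForm_mulVec, rv, Pi.smul_apply, Pi.neg_apply,
    smul_eq_mul, star_add, star_sub, star_mul', star_div₀, Fin.rev_rev, one_apply]
  rw [show star (2 : ℂ) = 2 by simp, apply_ite star, star_one, star_zero]
  simp only [eq_comm (a := i)]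
  ring

theorem stO_Cp (j : ℕ) (hj : 2 * j + 2 ≤ n) (c : OGL n) (hc : c ∈ Cp n j) : stO c ∈ Cm n j := by
  obtain ⟨b1, b2, b3, b4⟩ := ee_isotropic j hj
  obtain ⟨y, hy, hye, rfl⟩ := hc
  have hY := rv_mem_Yset j hj y hy
  rw [stO_eich b1 hye, rv_ee j (by omega)]
  exact ⟨_, hY, (hY j le_rfl).2, rfl⟩

theorem stO_Cm (j : ℕ) (hj : 2 * j + 2 ≤ n) (c : OGL n) (hc : c ∈ Cm n j) : stO c ∈ Cp n j := by
  obtain ⟨b1, b2, b3, b4⟩ := ee_isotropic j hj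
  obtain ⟨y, hy, hye, rfl⟩ := hc
  have hY := rv_mem_Yset j hj y hy
  rw [stO_eich b2 hye, rv_ee (n - 1 - j) (by omega), show n - 1 - (n - 1 - j) = j by omega]
  exact ⟨_, hY, (hY j le_rfl).1, rfl⟩

theorem mat_torO (j : ℕ) (hj : 2 * j + 2 ≤ n) (s : ℂˣ) : mat (torO n j s) =
    diagonal fun i : Fin n => if (i : ℕ) = j then (s : ℂ) else if (i : ℕ) = n - 1 - j then (s : ℂ)⁻¹ else 1 := by
  refine mat_ext _ _ fun l hl => ?_
  change act (torO n j s) (ee n l) = _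
  have h1 : ∀ d : Fin n → ℂ, diagonal d *ᵥ ee n l = d ⟨l, hl⟩ • ee n l := by
    intro d
    ext i
    rw [mulVec_diagonal, Pi.smul_apply, ee_apply, smul_eq_mul]
    by_cases h : (i : ℕ) = l
    · subst h; rfl
    · rw [if_neg h]; simp
  rw [h1]
  simp only
  by_cases h : l = j
  · rw [if_pos h, h, (act_torO_ee j hj s).1]
  · rw [if_neg h]
    by_cases h' : l = n - 1 - j
    · rw [if_pos h', h', (act_torO_ee j hj s).2]
    · rw [if_neg h', act_torO_fix j hj _ _ (by rw [bf_ee_ee _ _ (by omega), if_neg (by omega)])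
        (by rw [bf_ee_ee _ _ (by omega), if_neg (by omega)]), one_smul]

theorem stO_torO (j : ℕ) (hj : 2 * j + 2 ≤ n) (s : ℂˣ) (hs : star (s : ℂ) = s) :
    stO (torO n j s) = torO n j s := by
  refine mat_inj ?_
  rw [mat_stO, mat_torO j hj, diagonal_conjTranspose]
  congr 1
  ext i
  rw [Pi.star_apply]
  split_ifs
  · exact hs
  · rw [star_inv₀, hs]
  · exact star_one _

theorem refl_inv : (refl n)⁻¹ = refl n := inv_eq_of_mul_eq_one_left refl_mul_refl

theorem Cm_conj (i j : ℕ) (hij : i < j) (h : OGL n) (hh : h ∈ stabO n j) :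
    ∀ a ∈ Cm n i, h⁻¹ * a * h ∈ Cm n i := by
  have hh1 : h⁻¹ ∈ stabO n (i + 1) := stabO_mono hij (inv_mem hh)
  refine Esub_conj i _ h 1 ?_ fun y hy => stabO_Yset i _ hh1 y hy
  rw [one_smul, (hh1 i (by omega)).2]

theorem refl_conj_torO (k : ℕ) (hk : 2 * (k + 1) = n) (s : ℂˣ) :
    torO n k s * refl n = refl n * torO n k s⁻¹ := by
  have hk2 : 2 * k + 2 ≤ n := by omega
  have h1 : act (refl n) (ee n k) = ee n (n - 1 - k) := act_refl_even k (by omega)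
  have h2 : act (refl n) (ee n (n - 1 - k)) = ee n k := by
    rw [act_refl_even _ (by omega)]; congr 1; omega
  refine O_ext fun l hl => ?_
  rw [act_mul, act_mul]
  by_cases h : l = k
  · rw [h, h1, (act_torO_ee k hk2 _).2, (act_torO_ee k hk2 _).1, act_smul, h1,
      Units.val_inv_eq_inv_val]
  · by_cases h' : l = n - 1 - k
    · rw [h', h2, (act_torO_ee k hk2 _).2, (act_torO_ee k hk2 _).1, act_smul, h2,
        Units.val_inv_eq_inv_val, inv_inv]
    · have h3 : ∀ s, act (torO n k s) (ee n l) = ee n l := fun s =>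
        stabO_fix _ k (torO_mem_stabO k hk2 s) l (by omega)
      rw [h3, act_refl_ee _ (by omega), h3]

variable {V W X : Type*} [AddCommGroup V] [Module ℂ V] [AddCommGroup W] [Module ℂ W]
  [AddCommGroup X] [Module ℂ X]

theorem fixedBy_Cm_ne_bot (τ : Representation ℂ (OGL n) X) (U : Submodule ℂ X)
    (hUs : IsSubrep τ U) [FiniteDimensional ℂ U] (hU : U ≠ ⊥) :
    fixedBy τ (Cm n) ((n - 1) / 2) U ≠ ⊥ := by
  refine fixedBy_ne_bot τ (Cm n) _ (fun i _ => Esub_comm i _)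
    (fun i p => torO n i (natUnit p)) ?_ ?_ ?_ U hUs hU
  · intro i hi p hp c hc
    have hi2 : 2 * i + 2 ≤ n := by omega
    obtain ⟨b1, b2, b3, b4⟩ := ee_isotropic i hi2
    obtain ⟨y, hy, hye, rfl⟩ := hc
    have h1 := eich_conj b2 hye (torO n i (natUnit p))
    rw [torO_inv i hi2, (act_torO_ee i hi2 _).2, act_torO_fix i hi2 _ y (hy i le_rfl).1 (hy i le_rfl).2,
      Units.val_inv_eq_inv_val, inv_inv, eich_smul b2 hye, natUnit_val p hp, ← eich_pow b2 hye,
      ← torO_inv i hi2] at h1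
    rw [← h1]
    group
  · intro j hj i hij h hh
    exact Cm_conj i j hij h (Cm_le_stabO j (by omega) hh)
  · intro j hj i hij p _
    exact Cm_conj i j hij _ (torO_mem_stabO j (by omega) _)

/-- Highest weight data for the identity component. -/
def OHW (π : Representation ℂ (OGL n) X) (μ : ℕ → ℕ) (w : X) : Prop :=
  (∀ j, 2 * j + 3 ≤ n → ∀ c ∈ Cp n j, π c w = w) ∧
  ∀ j, 2 * j + 2 ≤ n → ∀ s : ℂˣ, π (torO n j s) w = (s : ℂ) ^ μ j • w

theorem exists_Cm_fixed (π : Representation ℂ (OGL n) W) [FiniteDimensional ℂ W] [Nontrivial W]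
    (t : OGL n) (ht : ∃ s, 2 * ((n - 1) / 2) + 2 ≤ n ∧ t = torO n ((n - 1) / 2) s ∨ t = 1) :
    ∃ φ : W →ₗ[ℂ] ℂ, φ ≠ 0 ∧ (∀ j, 2 * j + 3 ≤ n → ∀ c ∈ Cm n j, ∀ x, φ (π c x) = φ x) ∧
      ∃ c : ℂ, ∀ x, φ (π t x) = c * φ x := by
  set F := fixedBy π.dual (Cm n) ((n - 1) / 2) ⊤
  have hne : F ≠ ⊥ := fixedBy_Cm_ne_bot π.dual ⊤ (fun _ _ _ => mem_top)
    (by exact top_ne_bot)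
  have hts : t⁻¹ ∈ stabO n ((n - 1) / 2) := by
    obtain ⟨s, ⟨h, rfl⟩ | rfl⟩ := ht
    · exact inv_mem (torO_mem_stabO _ h s)
    · simp
  obtain ⟨φ, hφ, hφ0, c, hc⟩ := exists_eigenvector (π.dual t⁻¹) F hne
    (fixedBy_stable _ _ _ _ _ (fun _ _ => mem_top) fun i hi => Cm_conj i _ hi _ hts)
  refine ⟨φ, hφ0, ?_, c, fun x => ?_⟩
  · intro j hj c hc x
    have := LinearMap.congr_fun (hφ.2 j (by omega) c⁻¹ (inv_mem hc)) x
    rw [Representation.dual_apply, inv_inv] at this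
    exact this
  · have := LinearMap.congr_fun hc x
    rw [Representation.dual_apply, inv_inv] at this
    exact this

/-- Existence of equivariant maps sending a highest weight vector to a highest weight vector of
the same type. -/
theorem O_exists_equivariant [FiniteDimensional ℂ W] (π : Representation ℂ (OGL n) W)
    (ρ : Representation ℂ (OGL n) V) (hπ : IsIrreducibleRep π)
    (B : V →ₗ⋆[ℂ] V →ₗ[ℂ] ℂ) (hsymm : ∀ x y, star (B x y) = B y x)
    (hpos : ∀ x, x ≠ 0 → 0 < (B x x).re)
    (hst : ∀ g x y, B (ρ g x) y = B x (ρ (stO g) y))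
    (U : Submodule ℂ V) (hU : IsSubrep ρ U) [FiniteDimensional ℂ U] (μ : ℕ → ℕ)
    (w : W) (hw0 : w ≠ 0) (hw : OHW π μ w) (w' : V) (hw'U : w' ∈ U) (hw' : OHW ρ μ w')
    (hcase : (∃ ε : ℂ, π (refl n) w = ε • w ∧ ρ (refl n) w' = ε • w') ∨
      ∃ k, 2 * (k + 1) = n ∧ μ k ≠ 0) :
    ∃ T ∈ equivariantMaps π ρ, T w = w' := by
  have : Nontrivial W := hπ.1
  have := Finite.iff_fg.mpr ((Finite.fg_top (M := W)).prod (Finite.iff_fg.mp ‹FiniteDimensional ℂ U›))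
  let τ : Representation ℂ (OGL n) (W × V) := π.prod ρ
  have hτ : ∀ g x, τ g x = (π g x.1, ρ g x.2) := fun g x => rfl
  have kill : ∀ ψ : W →ₗ[ℂ] ℂ, (∀ j, 2 * j + 3 ≤ n → ∀ c ∈ Cm n j, ∀ x, ψ (π c x) = ψ x) → ψ w = 0 →
      ψ (π (refl n) w) = 0 → ψ = 0 := fun ψ hψ h0 h0' => span_orbit π hπ w hw0 ψ
        (O_kill π ψ w ⊤ (fun _ _ _ => mem_top) mem_top
          (fun j hj c hc x _ => hψ j hj c hc x) hw.1 (fun j hj s => ⟨_, hw.2 j hj s⟩) h0 h0')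
  have kill2 : ∀ Φ : (W × V) →ₗ[ℂ] ℂ, (∀ j, 2 * j + 3 ≤ n → ∀ c ∈ Cp n j, ∀ x, Φ (τ (stO c) x) = Φ x) →
      Φ (w, w') = 0 → Φ (τ (refl n) (w, w')) = 0 → ∀ g, Φ (τ g (w, w')) = 0 := by
    intro Φ hΦ h0 h0'
    refine O_kill τ Φ (w, w') ((⊤ : Submodule ℂ W).prod U) (fun g x hx => ⟨trivial, hU g _ hx.2⟩)
      ⟨trivial, hw'U⟩ ?_ ?_ ?_ h0 h0'
    · intro j hj c hc x _
      have := hΦ j hj _ (stO_Cm j (by omega) c hc) x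
      rwa [stO_stO] at this
    · intro j hj c hc
      rw [hτ, hw.1 j hj c hc, hw'.1 j hj c hc]
    · intro j hj s
      exact ⟨(s : ℂ) ^ μ j, by rw [hτ, hw.2 j hj s, hw'.2 j hj s]; rfl⟩
  rcases hcase with ⟨ε, hε, hε'⟩ | ⟨k, hk, hμk⟩
  · obtain ⟨φ, hφ0, hφ, -⟩ := exists_Cm_fixed π 1 ⟨1, Or.inr rfl⟩
    have hφw : φ w ≠ 0 := fun h => hφ0 (kill φ hφ h (by rw [hε, map_smul, h, smul_zero]))
    refine exists_equivariant π ρ hπ B hsymm hpos stO hst U hU w w' hw'U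
      (fun g c => (∃ j, 2 * j + 3 ≤ n ∧ g ∈ Cp n j) ∧ c = 1) ?_ φ ?_ hφw ?_
    · rintro g c ⟨⟨j, hj, hg⟩, rfl⟩
      rw [hw'.1 j hj g hg, one_smul]
    · rintro g c ⟨⟨j, hj, hg⟩, rfl⟩ x
      rw [hφ j hj _ (stO_Cp j (by omega) g hg), star_one, one_mul]
    · intro Φ hΦ h0 g
      refine kill2 Φ (fun j hj c hc x => ?_) h0 ?_ g
      · rw [hτ, hΦ c 1 ⟨⟨j, hj, hc⟩, rfl⟩ x, star_one, one_mul]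
      · rw [hτ, hε, hε']
        change Φ (ε • (w, w')) = 0
        rw [map_smul, h0, smul_zero]
  · have hk2 : 2 * k + 2 ≤ n := by omega
    set u : ℂˣ := Units.mk0 2 two_ne_zero
    have hu2 : (u : ℂ) = 2 := rfl
    set t := torO n k u with ht
    have hst0 : stO t = t := stO_torO k hk2 u (by rw [hu2]; simp)
    have hrt : t * refl n = refl n * t⁻¹ := by rw [ht, torO_inv k hk2, refl_conj_torO k hk]
    have hrt' : refl n * t = t⁻¹ * refl n := by
      rw [eq_inv_mul_iff_mul_eq, ← mul_assoc, hrt, mul_assoc, inv_mul_cancel, mul_one]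
    have main : ∃ φ : W →ₗ[ℂ] ℂ, φ w ≠ 0 ∧
        (∀ j, 2 * j + 3 ≤ n → ∀ c ∈ Cm n j, ∀ x, φ (π c x) = φ x) ∧ ∃ c : ℂ, ∀ x, φ (π t x) = c * φ x := by
      obtain ⟨φ, hφ0, hφ, c, hc⟩ := exists_Cm_fixed π t
        ⟨u, Or.inl ⟨by omega, by rw [ht]; congr 1; omega⟩⟩
      by_cases h : φ w = 0
      · refine ⟨φ ∘ₗ π (refl n), fun h' => hφ0 (kill φ hφ h h'), ?_, c⁻¹, ?_⟩
        · intro j hj a ha x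
          have h1 := Cm_conj j _ (by omega : j < (n - 1) / 2) _ (refl_mem_stabO _ le_rfl) a ha
          rw [refl_inv] at h1
          rw [LinearMap.comp_apply, LinearMap.comp_apply, ← hφ j hj _ h1 (π (refl n) x),
            ← End.mul_apply, ← End.mul_apply, ← map_mul, ← map_mul, mul_assoc, mul_assoc,
            refl_mul_refl, mul_one]
        · intro x
          have hc0 : c ≠ 0 := by
            rintro rfl
            apply hφ0
            ext y
            have := hc (π t⁻¹ y)
            rw [← End.mul_apply, ← map_mul, mul_inv_cancel, map_one] at this
            simpa using this
          have := hc (π t⁻¹ (π (refl n) x))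
          rw [← End.mul_apply, ← map_mul, mul_inv_cancel, map_one, ← End.mul_apply (π t⁻¹),
            ← map_mul, ← hrt', map_mul] at this
          rw [LinearMap.comp_apply, LinearMap.comp_apply, eq_inv_mul_iff_mul_eq₀ hc0]
          exact this.symm
      · exact ⟨φ, h, hφ, c, hc⟩
    obtain ⟨φ, hφw, hφ, c, hc⟩ := main
    have hc2 : c = 2 ^ μ k := by
      have := hc w
      rw [hw.2 k hk2 u, map_smul, smul_eq_mul, hu2] at this
      exact (mul_right_cancel₀ hφw this).symm
    refine exists_equivariant π ρ hπ B hsymm hpos stO hst U hU w w' hw'U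
      (fun g c => ((∃ j, 2 * j + 3 ≤ n ∧ g ∈ Cp n j) ∧ c = 1) ∨ (g = t ∧ c = 2 ^ μ k)) ?_ φ ?_ hφw ?_
    · rintro g c (⟨⟨j, hj, hg⟩, rfl⟩ | ⟨rfl, rfl⟩)
      · rw [hw'.1 j hj g hg, one_smul]
      · exact hw'.2 k hk2 u
    · rintro g c (⟨⟨j, hj, hg⟩, rfl⟩ | ⟨rfl, rfl⟩) x
      · rw [hφ j hj _ (stO_Cp j (by omega) g hg), star_one, one_mul]
      · rw [hst0, hc, hc2]; simp
    · intro Φ hΦ h0 g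
      refine kill2 Φ (fun j hj c hc x => ?_) h0 ?_ g
      · rw [hτ, hΦ c 1 (Or.inl ⟨⟨j, hj, hc⟩, rfl⟩) x, star_one, one_mul]
      · have h1 := hΦ t _ (Or.inr ⟨rfl, rfl⟩) (τ (refl n) (w, w'))
        rw [hst0, ← hτ, ← End.mul_apply, ← map_mul, hrt, map_mul, End.mul_apply] at h1
        have h2 : τ t⁻¹ (w, w') = ((2 : ℂ)⁻¹ ^ μ k) • (w, w') := by
          rw [hτ, ht, torO_inv k hk2, hw.2 k hk2, hw'.2 k hk2, Units.val_inv_eq_inv_val, hu2]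
          rfl
        rw [h2, map_smul, map_smul, smul_eq_mul, star_pow, show star (2 : ℂ) = 2 by simp] at h1
        have h3 : ((2 : ℂ)⁻¹ ^ μ k - 2 ^ μ k) * Φ (τ (refl n) (w, w')) = 0 := by
          linear_combination h1
        refine (mul_eq_zero.mp h3).resolve_left fun h4 => ?_
        have h5 : (2 : ℂ) ^ (μ k + μ k) = 1 := by
          rw [pow_add]
          have := sub_eq_zero.mp h4
          rw [inv_pow] at this
          calc (2 : ℂ) ^ μ k * 2 ^ μ k = 2 ^ μ k * (2 ^ μ k)⁻¹ := by rw [this]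
            _ = 1 := mul_inv_cancel₀ (pow_ne_zero _ two_ne_zero)
        have h6 : (2 : ℕ) ^ (μ k + μ k) = 1 := by exact_mod_cast h5
        rw [Nat.pow_eq_one] at h6
        omega

end Oequiv

end

section

open MvPolynomial Finset

variable {m n k : ℕ}

theorem Ract_mul (A B : Mat n n) (f : P m n) :
    Ract (A * B) f = Ract A (Ract B f) :=
  P_ext fun M => by rw [ev_Ract, ev_Ract, ev_Ract, Matrix.mul_assoc]

theorem Ract_one (f : P m n) : Ract 1 f = f :=
  P_ext fun M => by rw [ev_Ract, Matrix.mul_one]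

theorem HWs_upper {κ : Fin n → ℕ} {f : P m n} (hf : f ∈ HWs m κ)
    (u : Mat n n) (hu : IsUpperUni u) : Ract u f = f := by
  have key : ∀ j ≤ n, ∀ u : Mat n n, IsUpperUni u →
      (∀ i : Fin n, (i : ℕ) < n - j → ∀ l, u i l = (1 : Mat n n) i l) →
      Ract u f = f := by
    intro j
    induction j with
    | zero =>
      intro _ u _ h
      have : u = 1 := by ext i l; exact h i (by omega) l
      rw [this, Ract_one]
    | succ j ih =>
      intro hj u hu h
      set r : Fin n := ⟨n - (j + 1), by omega⟩
      set η : Fin n → ℂ := fun l => u r l - (1 : Mat n n) r l with hη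
      have hη0 : ∀ i : Fin n, (i : ℕ) ≤ n - (j + 1) → η i = 0 := by
        intro i hi
        rcases eq_or_lt_of_le hi with h1 | h1
        · have : i = r := Fin.ext h1
          subst this
          simp only [hη, hu.1, one_apply_eq, sub_self]
        · simp only [hη]
          rw [hu.2 r i h1, one_apply_ne (fun h2 => by rw [← h2] at h1; exact absurd h1 (lt_irrefl _)), sub_self]
      have h0 : η ⬝ᵥ ee n (n - (j + 1)) = 0 := by
        rw [dotProduct_comm]
        exact ee_dot_zero _ _ fun i hi => hη0 i hi.le
      set u' : Mat n n := of fun i l => if i = r then (1 : Mat n n) i l else u i l with hu'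
      have hcol : u' *ᵥ ee n (n - (j + 1)) = ee n (n - (j + 1)) := by
        funext i
        have : (u' *ᵥ ee n (n - (j + 1))) i = u' i r := dot_ee _ _ _
        rw [this, ee_apply]
        simp only [hu', of_apply]
        by_cases h1 : i = r
        · rw [h1, if_pos rfl, one_apply_eq, if_pos rfl]
        · have h1' : (i : ℕ) ≠ n - (j + 1) := fun h2 => h1 (Fin.ext h2)
          rw [if_neg h1, if_neg h1']
          rcases lt_or_gt_of_ne h1' with h2 | h2
          · rw [h i h2, one_apply_ne h1]
          · exact hu.2 i r h2
      have hprod : u = u' * (1 + vecMulVec (ee n (n - (j + 1))) η) := by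
        rw [mul_rank_one, hcol]
        ext i l
        rw [Matrix.add_apply, vecMulVec_apply, ee_apply]
        simp only [hu', of_apply, hη]
        by_cases h1 : i = r
        · rw [h1, if_pos rfl, if_pos rfl]; ring
        · have h1' : (i : ℕ) ≠ n - (j + 1) := fun h2 => h1 (Fin.ext h2)
          simp [h1, h1']
      have hc := hf.1 (n - (j + 1)) (by omega) _ (unip_mem_Aplus _ η hη0 h0)
      rw [repR_apply] at hc
      change Ract (1 + vecMulVec (ee n (n - (j + 1))) η) f = f at hc
      rw [hprod, Ract_mul, hc]
      refine ih (by omega) u' ⟨fun i => ?_, fun i l hil => ?_⟩ fun i hi l => ?_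
      · simp only [hu', of_apply, hu.1, one_apply_eq, ite_self]
      · simp only [hu', of_apply]
        rw [hu.2 i l hil, one_apply_ne (fun h2 => by rw [h2] at hil; exact absurd hil (lt_irrefl _)), ite_self]
      · simp only [hu', of_apply]
        by_cases h1 : i = r
        · simp [h1]
        · rw [if_neg h1]
          exact h i (by have h1' : (i : ℕ) ≠ n - (j + 1) := fun h2 => h1 (Fin.ext h2)
                        omega) l
  exact key n le_rfl u hu fun i hi => by omega

theorem eichM_apply (e y : Fin n → ℂ) (i l : Fin n) :
    eichM e y i l = (1 : Mat n n) i l + y i * e l.rev - e i * y l.rev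
      - bf y y / 2 * e i * e l.rev := by
  simp only [eichM, Matrix.sub_apply, Matrix.add_apply, vecMulVec_apply, symForm_mulVec,
    Pi.smul_apply, smul_eq_mul]

/-- The matrix of an Eichler transformation attached to `ee n j` is upper unitriangular as soon
as `y` is orthogonal to the first `j + 1` basis vectors and has no coordinate above `j`. -/
theorem isUpperUni_eich (j : ℕ) (hj : 2 * j + 2 ≤ n) (y : Fin n → ℂ) (hy : y ∈ Yset n j) :
    IsUpperUni (eichM (ee n j) y) := by
  have h1 : ∀ i : Fin n, (i : ℕ) ≤ j → y i = 0 := fun i hi => by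
    have := (hy i hi).2
    rw [bf_ee _ (by omega)] at this
    convert this using 2
    ext; simp only [Fin.val_rev]; omega
  have h2 : ∀ i : Fin n, n - 1 - j ≤ (i : ℕ) → y i = 0 := fun i hi => by
    have := (hy (n - 1 - i) (by omega)).1
    rw [bf_ee _ (by omega)] at this
    convert this using 2
    ext; simp only [Fin.val_rev]; omega
  refine ⟨fun i => ?_, fun i l hil => ?_⟩
  · rw [eichM_apply, one_apply_eq, ee_apply, ee_apply, Fin.val_rev]
    by_cases h3 : (i : ℕ) = j
    · rw [h2 i.rev (by rw [Fin.val_rev]; omega), h1 i h3.le, if_neg (by omega : ¬ (n - (i + 1) = j))]; ring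
    · rw [if_neg h3]
      by_cases h4 : n - ((i : ℕ) + 1) = j
      · rw [h2 i (by omega)]; ring
      · rw [if_neg h4]; ring
  · rw [eichM_apply, one_apply_ne (fun h2 => by rw [h2] at hil; exact absurd hil (lt_irrefl _)), ee_apply, ee_apply, Fin.val_rev]
    by_cases h3 : (i : ℕ) = j
    · rw [h2 l.rev (by rw [Fin.val_rev]; omega), h1 i h3.le, if_neg (by omega : ¬ (n - (l + 1) = j))]; ring
    · rw [if_neg h3]
      by_cases h4 : n - ((l : ℕ) + 1) = j
      · rw [h2 i (by omega)]; ring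
      · rw [if_neg h4]; ring

variable {X : Type*} [AddCommGroup X] [Module ℂ X]

theorem prod_torO (j : ℕ) (hj : 2 * j + 2 ≤ n) (s : ℂˣ) (ν : ℕ → ℕ)
    (hν : ν (n - 1 - j) = 0) :
    ∏ i : Fin n, (if (i : ℕ) = j then (s : ℂ) else if (i : ℕ) = n - 1 - j then (s : ℂ)⁻¹ else 1)
      ^ ν i = (s : ℂ) ^ ν j := by
  rw [prod_eq_single (⟨j, by omega⟩ : Fin n)]
  · simp
  · intro i _ hi
    rw [if_neg fun h => hi (Fin.ext h)]
    by_cases h : (i : ℕ) = n - 1 - j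
    · rw [h, hν, pow_zero]
    · rw [if_neg h, one_pow]
  · simp

theorem OHW_of_IsOHWvec (π : Representation ℂ (OGL n) X) (ν : ℕ → ℕ) (w : X)
    (hν : ∀ i, n ≤ 2 * i + 1 → ν i = 0) (hw : IsOHWvec n ν π w) : OHW π ν w := by
  constructor
  · rintro j hj c ⟨y, hy, hye, rfl⟩
    refine hw.1 _ ?_
    have h1 := (ee_isotropic (n := n) j (by omega)).1
    change IsUpperUni (mat (eich (ee n j) y))
    rw [mat_eich h1 hye]
    exact isUpperUni_eich j (by omega) y hy
  · intro j hj s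
    have := hw.2 (torO n j s) _ (mat_torO j hj s) ?_
    · rw [this, prod_torO j hj s ν (hν _ (by omega))]
    · rw [prod_eq_mul (⟨j, by omega⟩ : Fin n) ⟨n - 1 - j, by omega⟩]
      · rw [if_pos rfl, if_neg (by simp only []; omega), if_pos rfl, mul_inv_cancel₀ s.ne_zero]
      · intro h; simp only [Fin.mk.injEq] at h; omega
      · intro i _ hi
        rw [if_neg fun h => hi.1 (Fin.ext h), if_neg fun h => hi.2 (Fin.ext h)]
      · simp
      · simp

/-- The restriction of the left regular representation on `P n k` to the orthogonal group. -/
def repO (n k : ℕ) : Representation ℂ (OGL n) (P n k) := (repL n k).comp (OGL n).subtype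

theorem repO_apply (g : OGL n) (f : P n k) : repO n k g f = Lact (mat g) f := rfl

theorem ev_repO (g : OGL n) (f : P n k) (M) : ev M (repO n k g f) = ev ((mat g)ᵀ * M) f := by
  rw [repO_apply, ev_Lact]

/-- Highest weight vectors of weight `ν` for the orthogonal group in `P n k`. -/
def Dsub (n : ℕ) (ν : Fin k → ℕ) : Submodule ℂ (P n k) where
  carrier := {f | IsOHWvec n (ext0 ν) (repO n k) f}
  add_mem' := fun {x y} hx hy => ⟨fun g hg => by rw [map_add, hx.1 g hg, hy.1 g hg],
    fun g d hg hd => by rw [map_add, hx.2 g d hg hd, hy.2 g d hg hd, smul_add]⟩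
  zero_mem' := ⟨fun g _ => map_zero _, fun g d _ _ => by rw [map_zero, smul_zero]⟩
  smul_mem' := fun a x hx => ⟨fun g hg => by rw [map_smul, hx.1 g hg],
    fun g d hg hd => by rw [map_smul, hx.2 g d hg hd, smul_comm]⟩

theorem mem_Dsub {ν : Fin k → ℕ} {f : P n k} :
    f ∈ Dsub n ν ↔ IsOHWvec n (ext0 ν) (repO n k) f := Iff.rfl

theorem isSubrep_Dsub (ν : Fin k → ℕ) : IsSubrep (repR n k) (Dsub n ν) := by
  intro g f hf
  refine ⟨fun h hh => ?_, fun h d hh hd => ?_⟩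
  · rw [repO_apply, repR_apply, Lact_Ract, ← repO_apply, hf.1 h hh]
  · rw [repO_apply, repR_apply, Lact_Ract, ← repO_apply, hf.2 h d hh hd, map_smul]

end

section

open MvPolynomial Finset LinearMap Finsupp Module

variable {m n k : ℕ}

abbrev Up (k : ℕ) := {p : Fin k × Fin k // p.1 ≤ p.2}

def gram (M : Mat n k) (p : Up k) : ℂ :=
  bf (fun i => M i p.1.1) fun i => M i p.1.2

/-- The transpose of the top square block. -/
def topT (hk : k ≤ n) (M : Mat n k) : Mat k k :=
  of fun b a => M (Fin.castLE hk a) b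

def gramP (n : ℕ) (p : Up k) : P n k := ∑ i : Fin n, X (i, p.1.1) * X (i.rev, p.1.2)

def emb (hk : k ≤ n) : P k k →ₐ[ℂ] P n k := aeval fun p => X (Fin.castLE hk p.2, p.1)

def swt (e : Up k →₀ ℕ) (c : Fin k) : ℕ :=
  ∑ p : Up k, e p * ((if p.1.1 = c then 1 else 0) + if p.1.2 = c then 1 else 0)

theorem ev_gramP (M : Mat n k) (p : Up k) : ev M (gramP n p) = gram M p := by
  simp [ev, gramP, gram, bf]

theorem ev_emb (hk : k ≤ n) (M : Mat n k) (f : P k k) :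
    ev M (emb hk f) = ev (topT hk M) f := by
  have : (ev M).comp (emb hk) = ev (topT hk M) := by
    ext p; simp [ev, emb, topT]
  rw [← this]; rfl

theorem sum_lt_eq (hk : k ≤ n) (f : Fin k → ℂ) :
    ∑ i : Fin n, (if h : (i : ℕ) < k then f ⟨i, h⟩ else 0) = ∑ a, f a := by
  symm
  rw [← sum_subset (subset_univ (univ.map (Fin.castLEEmb hk)))]
  · rw [sum_map]
    exact sum_congr rfl fun a _ => by simp
  · intro i _ hi
    rw [dif_neg]
    intro h
    exact hi (mem_map.mpr ⟨⟨i, h⟩, mem_univ _, Fin.ext rfl⟩)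

theorem prod_ext0 (hk : k ≤ n) (d : Fin n → ℂ) (ν : Fin k → ℕ) :
    ∏ i : Fin n, d i ^ ext0 ν i = ∏ c : Fin k, d (Fin.castLE hk c) ^ ν c := by
  rw [← prod_subset (subset_univ (univ.map (Fin.castLEEmb hk)))]
  · rw [prod_map]
    refine prod_congr rfl fun a _ => ?_
    rw [Fin.castLEEmb_apply, Fin.val_castLE, ext0_val]
  · intro i _ hi
    rw [ext0_of_le, pow_zero]
    by_contra h
    exact hi (mem_map.mpr ⟨⟨i, by omega⟩, mem_univ _, Fin.ext rfl⟩)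

/-- The matrix with top block `Bᵀ`, bottom block `Y` (upside down) and zero middle row. -/
def mkX (n : ℕ) (B Y : Mat k k) : Mat n k :=
  of fun i b => if h : (i : ℕ) < k then B b ⟨i, h⟩
    else if h : (i.rev : ℕ) < k then Y ⟨i.rev, h⟩ b else 0

theorem topT_mkX (hk : k ≤ n) (B Y : Mat k k) : topT hk (mkX n B Y) = B := by
  ext a b; simp [topT, mkX]

theorem bf_mkX (hk : 2 * k ≤ n) (B Y : Mat k k) (a b : Fin k) :
    bf (fun i => mkX n B Y i a) (fun i => mkX n B Y i b) = (B * Y) a b + (B * Y) b a := by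
  rw [Matrix.mul_apply, Matrix.mul_apply, ← sum_lt_eq (n := n) (by omega) fun j => B a j * Y j b,
    ← sum_lt_eq (n := n) (by omega) fun j => B b j * Y j a]
  rw [← Equiv.sum_comp Fin.revPerm fun i : Fin n => if h : (i : ℕ) < k then B b ⟨i, h⟩ * Y ⟨i, h⟩ a else 0,
    ← Finset.sum_add_distrib]
  unfold bf
  refine Finset.sum_congr rfl fun i _ => ?_
  simp only [mkX, Matrix.of_apply, Fin.revPerm_apply, Fin.rev_rev]
  by_cases h1 : (i : ℕ) < k
  · have h2 : ¬ (i.rev : ℕ) < k := by rw [Fin.val_rev]; omega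
    simp only [h1, h2, ↓reduceDIte, add_zero]
  · by_cases h2 : (i.rev : ℕ) < k
    · simp only [h1, h2, ↓reduceDIte, zero_add]
      exact mul_comm _ _
    · simp only [h1, h2, ↓reduceDIte, zero_add, mul_zero]

def symM (q : Up k → ℂ) : Mat k k :=
  of fun a b => if h : a ≤ b then q ⟨(a, b), h⟩
    else q ⟨(b, a), (le_of_not_ge h)⟩

theorem symM_symm (q : Up k → ℂ) (a b : Fin k) : symM q a b = symM q b a := by
  simp only [symM, of_apply]
  grind

theorem symM_up (q : Up k → ℂ) (p : Up k) : symM q p.1.1 p.1.2 = q p := by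
  simp only [symM, of_apply]
  rw [dif_pos p.2]

theorem exists_gram (hk : 2 * k ≤ n) (B : Mat k k) (hB : B.det ≠ 0)
    (q : Up k → ℂ) : ∃ M : Mat n k,
      topT (show k ≤ n by omega) M = B ∧ gram M = q := by
  refine ⟨mkX n B (B⁻¹ * ((2 : ℂ)⁻¹ • symM q)), topT_mkX _ _ _, funext fun p => ?_⟩
  rw [gram, bf_mkX hk, ← Matrix.mul_assoc, Matrix.mul_nonsing_inv _ (Ne.isUnit hB), Matrix.one_mul,
    Matrix.smul_apply, Matrix.smul_apply, symM_symm q p.1.2, symM_up, smul_eq_mul]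
  ring

theorem P_zero_of_det {f : P k k} (h : ∀ B : Mat k k, B.det ≠ 0 → ev B f = 0) :
    f = 0 := by
  refine P_ext fun B => ?_
  obtain ⟨q, hq⟩ := exists_det_line (B - 1) (1 : Mat k k)
  have := ev_eq_zero_of_line f 1 (B - 1) q
    (poly_ne_zero q 0 (by simp [hq]))
    (fun t ht => h _ (by rw [← hq]; exact ht))
  rw [map_zero, ← this, add_sub_cancel]

theorem Ract_diagonal_RWs {κ : Fin n → ℕ} {f : P m n} (hf : f ∈ RWs m κ) (d : Fin n → ℂ) :
    Ract (diagonal d) f = (∏ c, d c ^ κ c) • f := by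
  ext e
  rw [coeff_Ract_diagonal, coeff_smul, smul_eq_mul]
  by_cases h : coeff e f = 0
  · rw [h, mul_zero, mul_zero]
  · rw [hf e h]

theorem Lact_diagonal_LWs {γ : Fin m → ℕ} {f : P m n} (hf : f ∈ LWs n γ) (d : Fin m → ℂ) :
    Lact (diagonal d) f = (∏ c, d c ^ γ c) • f := by
  ext e
  rw [coeff_Lact_diagonal, coeff_smul, smul_eq_mul]
  by_cases h : coeff e f = 0
  · rw [h, mul_zero, mul_zero]
  · rw [hf e h]

theorem prod_swt (d : Fin k → ℂ) (e : Up k →₀ ℕ) :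
    ∏ p : Up k, (d p.1.1 * d p.1.2) ^ e p = ∏ c, d c ^ swt e c := by
  have h : ∀ c, d c ^ swt e c = ∏ p : Up k,
      (d c ^ (if p.1.1 = c then 1 else 0) * d c ^ (if p.1.2 = c then 1 else 0)) ^ e p := by
    intro c
    rw [swt, ← Finset.prod_pow_eq_pow_sum]
    refine Finset.prod_congr rfl fun p _ => ?_
    rw [mul_comm (e p), pow_mul, pow_add]
  simp_rw [h]
  rw [Finset.prod_comm]
  refine Finset.prod_congr rfl fun p _ => ?_
  rw [Finset.prod_pow, Finset.prod_mul_distrib]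
  simp

theorem gram_mul_diagonal (M : Mat n k) (d : Fin k → ℂ) (p : Up k) :
    gram (M * diagonal d) p = (d p.1.1 * d p.1.2) * gram M p := by
  simp only [gram, bf, Matrix.mul_diagonal, Finset.mul_sum]
  exact Finset.sum_congr rfl fun i _ => by ring

theorem topT_mul_diagonal (hk : k ≤ n) (M : Mat n k) (d : Fin k → ℂ) :
    topT hk (M * diagonal d) = diagonal d * topT hk M := by
  ext a b
  simp only [topT, of_apply, mul_diagonal, diagonal_mul]
  ring

theorem bf_transpose (g : OGL n) (x y : Fin n → ℂ) :
    bf ((mat g)ᵀ *ᵥ x) ((mat g)ᵀ *ᵥ y) = bf x y := by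
  revert x y
  rw [← form_iff, transpose_transpose]
  have h1 : (mat g)ᵀ * symForm n * mat g = symForm n := g.2
  have h2 : (symForm n * (mat g)ᵀ * symForm n) * mat g = 1 := by
    rw [mul_assoc, mul_assoc, ← mul_assoc (mat g)ᵀ, h1, symForm_mul_self]
  have h3 := mul_eq_one_comm.mp h2
  calc mat g * symForm n * (mat g)ᵀ
      = (mat g * (symForm n * (mat g)ᵀ * symForm n)) * symForm n := by
        rw [mul_assoc, mul_assoc, mul_assoc (symForm n * _), symForm_mul_self, mul_one]
    _ = symForm n := by rw [h3, one_mul]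

theorem gram_transpose (g : OGL n) (M : Mat n k) :
    gram ((mat g)ᵀ * M) = gram M :=
  funext fun p => bf_transpose g (fun i => M i p.1.1) fun i => M i p.1.2

theorem topT_transpose (hk : k ≤ n) (A : Mat n n)
    (hA : ∀ i j : Fin n, (j : ℕ) < i → A i j = 0) (M : Mat n k) :
    topT hk (Aᵀ * M) = topT hk M * A.submatrix (Fin.castLE hk) (Fin.castLE hk) := by
  ext b a
  simp only [topT, Matrix.of_apply, Matrix.mul_apply, Matrix.transpose_apply, Matrix.submatrix_apply]
  rw [← sum_lt_eq hk]
  refine Finset.sum_congr rfl fun i _ => ?_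
  by_cases h : (i : ℕ) < k
  · rw [dif_pos h, mul_comm]; rfl
  · rw [dif_neg h, hA i _ (by rw [Fin.val_castLE]; omega), zero_mul]

/-- The product of a polynomial in the top block and a monomial in the Gram matrix. -/
def lam (hk : k ≤ n) (e : Up k →₀ ℕ) : P k k →ₗ[ℂ] P n k :=
  mulRight ℂ (∏ p, gramP n p ^ e p) ∘ₗ (emb hk).toLinearMap

theorem ev_lam (hk : k ≤ n) (e : Up k →₀ ℕ) (f : P k k) (M) :
    ev M (lam hk e f) = ev (topT hk M) f * ∏ p, gram M p ^ e p := by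
  simp only [lam, LinearMap.comp_apply, LinearMap.mulRight_apply, AlgHom.toLinearMap_apply, map_mul,
    ev_emb, map_prod, map_pow, ev_gramP]

theorem lam_mem_Dsub (hk : k ≤ n) (e : Up k →₀ ℕ) {ν : Fin k → ℕ} {f : P k k}
    (hf : f ∈ HWs k ν) : lam hk e f ∈ Dsub n ν := by
  constructor
  · intro g hg
    refine P_ext fun M => ?_
    change IsUpperUni (mat g) at hg
    rw [ev_repO, ev_lam, ev_lam, gram_transpose, topT_transpose hk _ hg.2, ← ev_Ract,
      HWs_upper hf ((mat g).submatrix (Fin.castLE hk) (Fin.castLE hk))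
        ⟨fun i => hg.1 _, fun i j hij => hg.2 (Fin.castLE hk i) (Fin.castLE hk j) hij⟩]
  · intro g d hg _
    refine P_ext fun M => ?_
    change mat g = _ at hg
    have h1 : (diagonal d).submatrix (Fin.castLE hk) (Fin.castLE hk)
        = diagonal fun c => d (Fin.castLE hk c) := by
      rw [submatrix_diagonal _ _ (Fin.castLE_injective hk)]; rfl
    rw [ev_repO, ev_lam, map_smul, ev_lam, gram_transpose, hg, topT_transpose hk _ fun i j hij =>
      diagonal_apply_ne _ (by rintro rfl; exact lt_irrefl _ hij), ← ev_Ract, h1,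
      Ract_diagonal_RWs (HWs_le_RWs _ hf), map_smul, prod_ext0 hk, smul_eq_mul, smul_eq_mul, mul_assoc]

theorem lam_mem_RWs (hk : k ≤ n) (e : Up k →₀ ℕ) {γ : Fin k → ℕ} {f : P k k}
    (he : ∀ c, swt e c ≤ γ c) (hf : f ∈ LWs k (fun c => γ c - swt e c)) :
    lam hk e f ∈ RWs n γ := by
  rw [mem_RWs]
  intro j hj s
  refine P_ext fun M => ?_
  rw [repR_apply, ev_Ract, ev_lam, map_smul, ev_lam, tor_eq ⟨j, hj⟩, topT_mul_diagonal]
  have h1 := congrArg (ev (topT hk M)) (Lact_diagonal_LWs hf fun i => if i = ⟨j, hj⟩ then (s : ℂ) else 1)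
  rw [ev_Lact, diagonal_transpose, map_smul] at h1
  rw [h1]
  simp_rw [gram_mul_diagonal, mul_pow]
  rw [prod_mul_distrib]
  simp_rw [← mul_pow]
  rw [prod_swt (fun i => if i = ⟨j, hj⟩ then (s : ℂ) else 1)]
  have h2 : ∀ w : Fin k → ℕ, ∏ c, (if c = ⟨j, hj⟩ then (s : ℂ) else 1) ^ w c = (s : ℂ) ^ w ⟨j, hj⟩ := by
    simp [ite_pow]
  rw [h2, h2]
  have h3 : ext0 γ j = (γ ⟨j, hj⟩ - swt e ⟨j, hj⟩) + swt e ⟨j, hj⟩ := by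
    rw [Nat.sub_add_cancel (he _)]; exact ext0_val γ ⟨j, hj⟩
  rw [h3, pow_add, smul_eq_mul, smul_eq_mul]
  ring

theorem swt_finite (γ : Fin k → ℕ) : {e : Up k →₀ ℕ | ∀ c, swt e c ≤ γ c}.Finite := by
  refine (Set.finite_Iic (equivFunOnFinite.symm fun p : Up k => γ p.1.1)).subset ?_
  intro e he p
  refine le_trans ?_ (he p.1.1)
  unfold swt
  refine le_trans ?_ (single_le_sum (f := fun p' : Up k => e p' * ((if p'.1.1 = p.1.1 then 1 else 0) +
    if p'.1.2 = p.1.1 then 1 else 0)) (fun _ _ => Nat.zero_le _) (mem_univ p))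
  rw [if_pos rfl]
  exact Nat.le_mul_of_pos_right _ (by omega)

def swts (γ : Fin k → ℕ) : Finset (Up k →₀ ℕ) := (swt_finite γ).toFinset

theorem mem_swts {γ : Fin k → ℕ} {e : Up k →₀ ℕ} : e ∈ swts γ ↔ ∀ c, swt e c ≤ γ c :=
  (swt_finite γ).mem_toFinset

theorem sum_lam_injective (hk : 2 * k ≤ n) (S : Finset (Up k →₀ ℕ)) (F : (Up k →₀ ℕ) → P k k)
    (h : ∑ e ∈ S, lam (show k ≤ n by omega) e (F e) = 0) : ∀ e ∈ S, F e = 0 := by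
  intro e he
  refine P_zero_of_det fun B hB => ?_
  have h1 : (∑ e ∈ S, monomial e (ev B (F e)) : MvPolynomial (Up k) ℂ) = 0 := by
    refine MvPolynomial.funext fun q => ?_
    obtain ⟨M, hM, hq⟩ := exists_gram hk B hB q
    have := congrArg (ev M) h
    rw [map_sum, map_zero] at this
    rw [map_sum, map_zero, ← this]
    refine sum_congr rfl fun e' _ => ?_
    rw [ev_lam, hM, hq, eval_monomial, prod_fintype _ _ (fun _ => pow_zero _)]
  have h2 := congrArg (coeff e) h1
  rw [coeff_sum, coeff_zero] at h2
  simp_rw [coeff_monomial] at h2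
  rwa [sum_ite_eq' S e, if_pos he] at h2

/-- The space of all families of coefficients, mapped into highest weight vectors. -/
def lamS (hk : k ≤ n) (ν γ : Fin k → ℕ) :
    ((e : swts γ) → ↥(HWs k ν ⊓ LWs k (fun c => γ c - swt e.1 c))) →ₗ[ℂ] P n k :=
  ∑ e : swts γ, lam hk e.1 ∘ₗ Submodule.subtype _ ∘ₗ proj e

theorem lamS_apply (hk : k ≤ n) (ν γ : Fin k → ℕ) (F) :
    lamS hk ν γ F = ∑ e : swts γ, lam hk e.1 (F e : P k k) := by
  simp [lamS]

theorem lamS_injective (hk : 2 * k ≤ n) (ν γ : Fin k → ℕ) :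
    Function.Injective (lamS (n := n) (show k ≤ n by omega) ν γ) := by
  rw [← ker_eq_bot, ker_eq_bot']
  intro F hF
  rw [lamS_apply] at hF
  have h1 := sum_lam_injective hk (swts γ) (fun e => if h : e ∈ swts γ then (F ⟨e, h⟩ : P k k) else 0) ?_
  · funext e
    have := h1 e.1 e.2
    simp only [e.2, dif_pos] at this
    exact Subtype.ext this
  · rw [← hF, ← sum_coe_sort]
    exact sum_congr rfl fun e _ => by simp only [e.2, dif_pos]

theorem lamS_mem (hk : k ≤ n) (ν γ : Fin k → ℕ) (F) : lamS hk ν γ F ∈ Dsub n ν ⊓ RWs n γ := by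
  rw [lamS_apply]
  refine sum_mem fun e _ => ⟨lam_mem_Dsub hk _ (F e).2.1, lam_mem_RWs hk _ (mem_swts.mp e.2) (F e).2.2⟩

theorem finrank_lamS (hk : 2 * k ≤ n) (ν γ : Fin k → ℕ) :
    finrank ℂ (range (lamS (n := n) (show k ≤ n by omega) ν γ))
      = ∑ e ∈ swts γ, kostka k (ext0 ν) fun c => γ c - swt e c := by
  rw [finrank_range_of_inj (lamS_injective hk ν γ)]
  have := fun e : swts γ => (finrank_HWs_inf_LWs ν fun c => γ c - swt e.1 c).1
  rw [finrank_pi_fintype,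
    ← sum_coe_sort (swts γ) fun e => kostka k (ext0 ν) fun c => γ c - swt e c]
  exact sum_congr rfl fun e _ => (finrank_HWs_inf_LWs ν fun c => γ c - swt e.1 c).2

end

section

open MvPolynomial Finset

variable {n k : ℕ}

def trO (g : OGL n) : OGL n := mkO (mat g)ᵀ (bf_transpose g)

theorem mat_trO (g : OGL n) : mat (trO g) = (mat g)ᵀ := mat_mkO _ _

theorem ev_Dsub_unip {ν : Fin k → ℕ} {f : P n k} (hf : f ∈ Dsub n ν) (g : OGL n)
    (hg : IsUpperUni (mat g)ᵀ) (M : Mat n k) : ev (mat g * M) f = ev M f := by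
  have h := hf.1 (trO g) (by change IsUpperUni (mat (trO g)); rwa [mat_trO])
  have := congrArg (ev M) h
  rwa [ev_repO, mat_trO, transpose_transpose] at this

theorem gram_mat_mul (g : OGL n) (M : Mat n k) : gram (mat g * M) = gram M :=
  funext fun p => bf_act g (fun i => M i p.1.1) fun i => M i p.1.2

theorem isUpperUni_eich_transpose (hk : 2 * k ≤ n) (i : ℕ) (hi : i < k) (v : Fin n → ℂ)
    (hv : ∀ l : Fin n, (l : ℕ) < k → v l = 0) :
    IsUpperUni (eichM (ee n (n - 1 - i)) v)ᵀ := by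
  refine ⟨fun l => ?_, fun j l hjl => ?_⟩
  · rw [transpose_apply, eichM_apply, one_apply_eq, ee_apply, ee_apply, Fin.val_rev]
    grind
  · rw [transpose_apply, eichM_apply, one_apply_ne (fun h2 => by rw [h2] at hjl; exact absurd hjl (lt_irrefl _)), ee_apply, ee_apply, Fin.val_rev]
    grind

theorem Dsub_move (hk : 2 * k ≤ n) {ν : Fin k → ℕ} {f : P n k} (hf : f ∈ Dsub n ν) (i : Fin k)
    (v : Fin n → ℂ) (hv : ∀ l : Fin n, (l : ℕ) < k → v l = 0) (M : Mat n k) :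
    ∃ N : Mat n k, ev N f = ev M f ∧ gram N = gram M ∧
      ∀ l b, N l b = M l b + M (Fin.castLE (by omega) i) b * v l -
        bf (fun j => M j b) v * ee n (n - 1 - i) l
        - bf v v / 2 * M (Fin.castLE (by omega) i) b * ee n (n - 1 - i) l := by
  have hi := i.2
  have h1 : bf (ee n (n - 1 - i)) (ee n (n - 1 - i)) = 0 :=
    (ee_isotropic (n := n) i (by omega)).2.1
  have h3 : ∀ x : Fin n → ℂ, bf x (ee n (n - 1 - i)) = x (Fin.castLE (by omega) i) := by
    intro x
    rw [bf_ee _ (by omega)]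
    congr 1; ext; simp only [Fin.val_rev, Fin.val_castLE]; omega
  have h2 : bf v (ee n (n - 1 - i)) = 0 := by rw [h3]; exact hv _ hi
  refine ⟨mat (eich (ee n (n - 1 - i)) v) * M, ?_, gram_mat_mul _ _, fun l b => ?_⟩
  · refine ev_Dsub_unip hf _ ?_ M
    rw [mat_eich h1 h2]
    exact isUpperUni_eich_transpose hk i hi v hv
  · have := congrFun (act_eich h1 h2 fun j => M j b) l
    rw [h3] at this
    exact this

theorem topT_congr (hk : k ≤ n) {M N : Mat n k}
    (h : ∀ (l : Fin n) b, (l : ℕ) < k → N l b = M l b) : topT hk N = topT hk M := by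
  ext b a
  exact h _ _ a.2

theorem Dsub_mid (hk : n = 2 * k + 1) {ν : Fin k → ℕ} {f : P n k} (hf : f ∈ Dsub n ν)
    (M : Mat n k) (t : Fin k → ℂ) (s : Finset (Fin k)) :
    ∃ N : Mat n k, ev N f = ev M f ∧ gram N = gram M ∧
      (∀ (l : Fin n) b, (l : ℕ) < k → N l b = M l b) ∧
      ∀ (l : Fin n) b, (l : ℕ) = k → N l b = M l b + ∑ i ∈ s, t i * M (Fin.castLE (by omega) i) b := by
  induction s using Finset.induction_on with
  | empty => exact ⟨M, rfl, rfl, fun _ _ _ => rfl, fun l b _ => by simp⟩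
  | insert i s his ih =>
    obtain ⟨N, h1, h2, h3, h4⟩ := ih
    obtain ⟨N', h1', h2', h3'⟩ := Dsub_move (by omega) hf i (t i • ee n k) (fun l hl => by
      rw [Pi.smul_apply, ee_apply, if_neg (by omega), smul_zero]) N
    have hi := i.2
    refine ⟨N', h1'.trans h1, h2'.trans h2, fun l b hl => ?_, fun l b hl => ?_⟩
    · rw [h3', ← h3 l b hl, Pi.smul_apply, ee_apply, ee_apply, if_neg (by omega), if_neg (by omega)]
      simp
    · rw [h3', h4 l b hl, Pi.smul_apply, ee_apply, ee_apply, if_pos hl, if_neg (by omega),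
        h3 _ _ (show (Fin.castLE _ i : Fin n).val < k from hi), sum_insert his]
      simp only [smul_eq_mul]
      ring

theorem Dsub_bot (hk : 2 * k ≤ n) {ν : Fin k → ℕ} {f : P n k} (hf : f ∈ Dsub n ν)
    (M : Mat n k) (t : Fin k → Fin k → ℂ) (s : Finset (Fin k)) :
    ∃ N : Mat n k, ev N f = ev M f ∧
      (∀ (l : Fin n) b, (l : ℕ) < n - k → N l b = M l b) ∧
      ∀ a b, N (Fin.castLE (by omega) a : Fin n).rev b = M (Fin.castLE (by omega) a : Fin n).rev b +
        ∑ i ∈ s, (t i a * M (Fin.castLE (by omega) i) b -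
          if a = i then ∑ j, t i j * M (Fin.castLE (by omega) j) b else 0) := by
  induction s using Finset.induction_on with
  | empty => exact ⟨M, rfl, fun _ _ _ => rfl, fun l b => by simp⟩
  | insert i s his ih =>
    obtain ⟨N, h1, h2, h3⟩ := ih
    set v : Fin n → ℂ := fun l => if h : (l.rev : ℕ) < k then t i ⟨l.rev, h⟩ else 0 with hv
    have hv0 : ∀ l : Fin n, (l : ℕ) < n - k → v l = 0 := fun l hl => by
      simp only [hv]
      rw [dif_neg]
      rw [Fin.val_rev]; omega
    have hvv : ∀ x : Fin n → ℂ, bf x v = ∑ j, t i j * x (Fin.castLE (by omega) j) := by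
      intro x
      rw [← sum_lt_eq (n := n) (by omega) fun j => t i j * x (Fin.castLE (by omega) j)]
      unfold bf
      refine sum_congr rfl fun l _ => ?_
      simp only [hv, Fin.rev_rev]
      by_cases h : (l : ℕ) < k
      · simp only [h, ↓reduceDIte]
        exact mul_comm _ _
      · simp only [h, ↓reduceDIte, mul_zero]
    have hvv0 : bf v v = 0 := by
      rw [hvv]
      refine sum_eq_zero fun j _ => ?_
      rw [hv0 _ (by rw [Fin.val_castLE]; omega), mul_zero]
    obtain ⟨N', h1', _, h3'⟩ := Dsub_move hk hf i v (fun l hl => hv0 l (by omega)) N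
    refine ⟨N', h1'.trans h1, fun l b hl => ?_, fun a b => ?_⟩
    · rw [h3', hv0 l hl, h2 l b hl, ee_apply, if_neg (by omega)]
      ring
    · have ha := a.2
      have e1 : v (Fin.castLE (by omega) a : Fin n).rev = t i a := by
        simp only [hv, Fin.rev_rev]
        rw [dif_pos (show (Fin.castLE _ a : Fin n).val < k from ha)]; rfl
      have e2 : ee n (n - 1 - i) (Fin.castLE (by omega) a : Fin n).rev = if a = i then 1 else 0 := by
        rw [ee_apply, Fin.val_rev, Fin.val_castLE]
        refine if_congr ?_ rfl rfl
        rw [Fin.ext_iff]; omega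
      rw [h3', h3, e1, e2, hvv0, hvv, sum_insert his, h2 _ _ (by rw [Fin.val_castLE]; omega)]
      have e3 : ∀ j : Fin k, N (Fin.castLE (by omega) j) b = M (Fin.castLE (by omega) j) b :=
        fun j => h2 _ _ (by rw [Fin.val_castLE]; omega)
      simp only [e3]
      split_ifs <;> ring

theorem exists_row (hk : k ≤ n) (M : Mat n k) (hM : (topT hk M).det ≠ 0)
    (y : Fin k → ℂ) : ∃ t : Fin k → ℂ, ∀ b, ∑ i, t i * M (Fin.castLE hk i) b = y b := by
  refine ⟨(topT hk M)⁻¹ *ᵥ y, fun b => ?_⟩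
  have : (topT hk M *ᵥ ((topT hk M)⁻¹ *ᵥ y)) b = y b := by
    rw [mulVec_mulVec, mul_nonsing_inv _ (Ne.isUnit hM), one_mulVec]
  rw [← this]
  simp only [mulVec, dotProduct]
  refine sum_congr rfl fun i _ => ?_
  simp only [topT, of_apply]
  ring

/-- A highest weight vector only depends on the top block and the Gram matrix. -/
theorem Dsub_congr (hk : 2 * k ≤ n) (hk' : n ≤ 2 * k + 1) {ν : Fin k → ℕ} {f : P n k}
    (hf : f ∈ Dsub n ν) (M M' : Mat n k)
    (hM : (topT (show k ≤ n by omega) M).det ≠ 0)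
    (h1 : topT (show k ≤ n by omega) M' = topT (show k ≤ n by omega) M)
    (h2 : gram M' = gram M) : ev M' f = ev M f := by
  have htop : ∀ (l : Fin n) b, (l : ℕ) < k → M' l b = M l b := fun l b hl =>
    congrFun (congrFun h1 b) ⟨l, hl⟩
  obtain ⟨N, e1, e2, e3, e4⟩ : ∃ N : Mat n k, ev N f = ev M f ∧ gram N = gram M ∧
      (∀ (l : Fin n) b, (l : ℕ) < k → N l b = M' l b) ∧ ∀ (l : Fin n) b, (l : ℕ) < n - k → N l b = M' l b := by
    rcases Nat.lt_or_ge n (2 * k + 1) with h | h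
    · exact ⟨M, rfl, rfl, fun l b hl => (htop l b hl).symm, fun l b hl => (htop l b (by omega)).symm⟩
    · have hn : n = 2 * k + 1 := by omega
      obtain ⟨t, ht⟩ := exists_row _ M hM fun b => M' ⟨k, by omega⟩ b - M ⟨k, by omega⟩ b
      obtain ⟨N, e1, e2, e3, e4⟩ := Dsub_mid hn hf M t univ
      refine ⟨N, e1, e2, fun l b hl => by rw [e3 l b hl, htop l b hl], fun l b hl => ?_⟩
      rcases Nat.lt_or_ge l k with h3 | h3
      · rw [e3 l b h3, htop l b h3]
      · have hl' : l = ⟨k, by omega⟩ := Fin.ext (show (l : ℕ) = k by omega)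
        rw [e4 l b (by omega), ht, hl']; ring
  set A := topT (show k ≤ n by omega) M
  have hMk : ∀ (l : Fin k) b, M' (Fin.castLE (by omega) l) b = A b l := fun l b => htop _ b l.2
  have hNk : ∀ (l : Fin k) b, N (Fin.castLE (by omega) l) b = A b l := fun l b => by
    rw [e3 _ b l.2, hMk]
  set Δ : Mat k k := of fun a b =>
    M' (Fin.castLE (by omega) a : Fin n).rev b - N (Fin.castLE (by omega) a : Fin n).rev b with hΔ
  have hgram : ∀ a b : Fin k, a ≤ b → (A * Δ) a b + (A * Δ) b a = 0 := by
    intro a b hab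
    have h3 : bf (fun i => M' i a) (fun i => M' i b) = bf (fun i => N i a) (fun i => N i b) :=
      congrFun (h2.trans e2.symm) ⟨(a, b), hab⟩
    rw [← sub_eq_zero] at h3
    rw [← h3, mul_apply, mul_apply, ← sum_lt_eq (n := n) (by omega) fun j => A a j * Δ j b,
      ← sum_lt_eq (n := n) (by omega) fun j => A b j * Δ j a, ← Equiv.sum_comp Fin.revPerm fun i : Fin n => if h : (i : ℕ) < k then A b ⟨i, h⟩ * Δ ⟨i, h⟩ a else 0,
      ← sum_add_distrib]
    unfold bf
    rw [← sum_sub_distrib]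
    refine sum_congr rfl fun i _ => ?_
    simp only [Fin.revPerm_apply]
    by_cases h4 : (i : ℕ) < k
    · have h5 : ¬ (i.rev : ℕ) < k := by rw [Fin.val_rev]; omega
      rw [dif_pos h4, dif_neg h5, add_zero, e3 i a h4, ← hMk ⟨i, h4⟩ a]
      simp only [hΔ, of_apply, Fin.castLE_mk, Fin.eta]
      ring
    · by_cases h5 : (i.rev : ℕ) < k
      · rw [dif_neg h4, dif_pos h5, zero_add, e3 i.rev b h5, ← hMk ⟨i.rev, h5⟩ b]
        simp only [hΔ, of_apply, Fin.castLE_mk, Fin.eta, Fin.rev_rev]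
        ring
      · rw [dif_neg h4, dif_neg h5, e4 i a (by rw [Fin.val_rev] at h5; omega),
          e4 i.rev b (by rw [Fin.val_rev]; omega)]
        ring
  have hanti : (A * Δ)ᵀ = -(A * Δ) := by
    ext a b
    rw [transpose_apply, neg_apply]
    rcases le_total a b with h | h
    · linear_combination hgram a b h
    · linear_combination hgram b a h
  set S := Δ * (Aᵀ)⁻¹ with hS
  have hAu : IsUnit A.det := Ne.isUnit hM
  have hAu' : IsUnit (Aᵀ).det := by rwa [det_transpose]
  have hS1 : S * Aᵀ = Δ := by rw [hS, mul_assoc, nonsing_inv_mul _ hAu', mul_one]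
  have hSanti : Sᵀ = -S := by
    have h3 : A * S * Aᵀ = A * Δ := by rw [mul_assoc, hS1]
    have h4 : A * Sᵀ * Aᵀ = A * (-S) * Aᵀ := by
      have h5 := hanti
      rw [← h3] at h5
      rw [transpose_mul, transpose_mul, transpose_transpose] at h5
      rw [mul_assoc, h5]; simp
    have h7 : ∀ Z : Mat k k, A⁻¹ * (A * Z * Aᵀ) * (Aᵀ)⁻¹ = Z := by
      intro Z
      rw [mul_assoc A, ← mul_assoc, nonsing_inv_mul _ hAu, one_mul,
        mul_assoc, mul_nonsing_inv _ hAu', mul_one]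
    rw [← h7 Sᵀ, h4, h7]
  obtain ⟨N', g1, g2, g3⟩ := Dsub_bot hk hf N (fun i a => -(S i a) / 2) univ
  have : N' = M' := by
    ext l b
    rcases Nat.lt_or_ge l (n - k) with h | h
    · rw [g2 l b h, e4 l b h]
    · have hl := l.2
      obtain ⟨a, ha⟩ : ∃ a : Fin k, l = (Fin.castLE (by omega) a : Fin n).rev :=
        ⟨⟨n - 1 - l, by omega⟩, by ext; simp only [Fin.val_rev, Fin.val_castLE]; omega⟩
      rw [ha, g3 a b]
      have h8 : Δ a b = ∑ i, S a i * A b i := by rw [← hS1, mul_apply]; rfl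
      have h9 : M' (Fin.castLE (by omega) a : Fin n).rev b = N (Fin.castLE (by omega) a : Fin n).rev b + Δ a b := by
        simp only [hΔ, of_apply]; ring
      rw [h9, h8]
      congr 1
      rw [sum_sub_distrib, sum_ite_eq univ a, if_pos (mem_univ _),
        ← sum_sub_distrib]
      refine sum_congr rfl fun i _ => ?_
      have h10 : S i a = - S a i := congrFun (congrFun hSanti a) i
      rw [h10, hNk]; ring
  rw [← this, g1, e1]

theorem Dsub_eq_zero (hk : 2 * k ≤ n) {f : P n k}
    (h : ∀ M : Mat n k, (topT (show k ≤ n by omega) M).det ≠ 0 → ev M f = 0) :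
    f = 0 := by
  refine P_ext fun M => ?_
  rw [map_zero]
  have hlin : ∀ (t : ℂ) (A B : Mat n k), topT (show k ≤ n by omega) (A + t • B)
      = topT (show k ≤ n by omega) A + t • topT (show k ≤ n by omega) B := fun t A B => rfl
  obtain ⟨q, hq⟩ := exists_det_line (topT (show k ≤ n by omega) (M - mkX n 1 0)) (1 : Mat k k)
  have := ev_eq_zero_of_line f (mkX n 1 0) (M - mkX n 1 0) q
    (poly_ne_zero q 0 (by simp [hq]))
    (fun t ht => h _ (by rw [hlin, topT_mkX, ← hq]; exact ht))
  rwa [add_sub_cancel] at this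

end

section

open MvPolynomial Finset Submodule LinearMap Module

variable {n k : ℕ}

theorem GT_ge_shift {ν : Fin k → ℕ} {a : ℕ} {p : ℕ → ℕ → ℕ} (hp : p ∈ GT k (ext0 fun c => ν c + a))
    (i r : ℕ) (hr : r < i) (hrk : r < k) : a ≤ p i r := by
  rcases le_total k i with h | h
  · rw [hp.2.1 i h, ext0, dif_pos hrk]; exact Nat.le_add_left _ _
  · obtain ⟨d, hd⟩ := Nat.exists_eq_add_of_le h
    induction d generalizing i r with
    | zero => rw [hp.2.1 i (by omega), ext0, dif_pos hrk]; exact Nat.le_add_left _ _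
    | succ d ih =>
      exact (ih (i + 1) (r + 1) (by omega) (by omega) (by omega) (by omega)).trans
        (hp.2.2.2 i (by omega) r)

theorem kostka_shift_ge {ν : Fin k → ℕ} {a : ℕ} {β : Fin k → ℕ}
    (h : kostka k (ext0 fun c => ν c + a) β ≠ 0) (c : Fin k) : a ≤ β c := by
  obtain ⟨p, hp⟩ := card_ne_zero.mp h
  rw [mem_filter, mem_gts] at hp
  rw [← hp.2]
  refine le_trans ?_ (single_le_sum (f := fun r => p (c + 1) r - p c r)
    (fun r _ => Nat.zero_le _) (mem_range.mpr c.2))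
  change a ≤ p (c + 1) c - p c c
  rw [GT_zero hp.1 c.2.le le_rfl, Nat.sub_zero]
  exact GT_ge_shift hp.1 _ _ (Nat.lt_succ_self _) c.2

theorem kostka_shift_le (ν : Fin k → ℕ) (a : ℕ) (β : Fin k → ℕ) :
    kostka k (ext0 fun c => ν c + a) β ≤ kostka k (ext0 ν) fun c => β c - a := by
  refine card_le_card_of_injOn
    (fun p i r => if r < i ∧ r < k then p i r - a else p i r) (fun p hp => ?_) fun p hp p' hp' h => ?_
  · have hp := mem_coe.mp hp
    rw [mem_filter, mem_gts] at hp
    obtain ⟨hp, hw⟩ := hp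
    have hz : ∀ i r, ¬ (r < i ∧ r < k) → p i r = 0 := by
      intro i r h
      rcases le_total k i with h1 | h1
      · rw [hp.2.1 i h1, ext0_of_le _ (by omega)]
      · exact GT_zero hp h1 (by omega)
    refine mem_coe.mpr (mem_filter.mpr ⟨mem_gts.mpr ⟨fun r => ?_, fun i hi => ?_, fun i r => ?_,
      fun i hi r => ?_⟩, ?_⟩)
    · simp [hp.1]
    · funext r
      simp only [hp.2.1 i hi, ext0]
      grind
    · have := hp.2.2.1 i r
      grind
    · have := hp.2.2.2 i hi r
      grind
    · funext c
      rw [← hw]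
      simp only [wt]
      rw [← add_sum_erase _ _ (mem_range.mpr c.2),
        ← add_sum_erase _ (fun r => p (c + 1) r - p c r) (mem_range.mpr c.2)]
      have h1 := GT_ge_shift hp (c + 1) c (Nat.lt_succ_self _) c.2
      have h2 : ∑ x ∈ (range k).erase ↑c,
          ((if x < (c : ℕ) + 1 ∧ x < k then p (c + 1) x - a else p (c + 1) x) -
            if x < (c : ℕ) ∧ x < k then p c x - a else p c x) =
          ∑ x ∈ (range k).erase ↑c, (p (c + 1) x - p c x) := by
        refine sum_congr rfl fun r hr => ?_
        rw [mem_erase, mem_range] at hr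
        have := GT_ge_shift hp c r
        grind
      rw [h2, if_pos ⟨Nat.lt_succ_self _, c.2⟩, if_neg (fun h => lt_irrefl _ h.1), GT_zero hp c.2.le le_rfl]
      omega
  · have hp := mem_coe.mp hp
    have hp' := mem_coe.mp hp'
    rw [mem_filter, mem_gts] at hp hp'
    funext i r
    have := congrFun (congrFun h i) r
    have h2 := GT_ge_shift hp.1 i r
    have h3 := GT_ge_shift hp'.1 i r
    grind

/-- The matrix of coordinates. -/
def genM (k : ℕ) : Matrix (Fin k) (Fin k) (P k k) := of fun a b => X (a, b)

theorem ev_genM (B : Mat k k) : (genM k).map (ev B) = B := by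
  ext a b; simp [genM]

theorem ev_adjugate (B : Mat k k) (a b : Fin k) :
    ev B ((genM k).adjugate a b) = B.adjugate a b := by
  have := congrFun (congrFun (AlgHom.map_adjugate (ev B) (genM k)) a) b
  rw [AlgHom.mapMatrix_apply, AlgHom.mapMatrix_apply, ev_genM] at this
  exact this

def symX (a b : Fin k) : MvPolynomial (Up k) (P k k) :=
  if h : a ≤ b then X ⟨(a, b), h⟩ else X ⟨(b, a), le_of_not_ge h⟩

/-- The entries of the section used to bound the number of highest weight vectors. -/
def sliceX (n : ℕ) (p : Fin n × Fin k) : MvPolynomial (Up k) (P k k) :=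
  if h : (p.1 : ℕ) < k then C (X (p.2, ⟨p.1, h⟩))
  else if h : (p.1.rev : ℕ) < k then
    ∑ c, C (C (2 : ℂ)⁻¹ * (genM k).adjugate ⟨p.1.rev, h⟩ c) * symX c p.2
  else 0

def slice (n : ℕ) : P n k →ₐ[ℂ] MvPolynomial (Up k) (P k k) := aeval (sliceX n)

def mkQ (n : ℕ) (B : Mat k k) (q : Up k → ℂ) : Mat n k :=
  mkX n B (B.adjugate * ((2 : ℂ)⁻¹ • symM q))

theorem eval_slice (B : Mat k k) (q : Up k → ℂ) (f : P n k) :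
    eval q (map (ev B).toRingHom (slice n f)) = ev (mkQ n B q) f := by
  induction f using MvPolynomial.induction_on with
  | C a =>
    have h1 : slice n (C a : P n k) = C (C a) := by
      rw [slice, aeval_C]; rfl
    rw [h1, map_C, eval_C]
    change ev B (C a) = _
    rw [ev, ev, aeval_C, aeval_C]
  | add f g hf hg => rw [map_add, map_add, map_add, map_add, hf, hg]
  | mul_X f p hf =>
    have h0 : slice n (f * X p) = slice n f * sliceX n p := by rw [map_mul, slice, aeval_X]
    rw [h0, RingHom.map_mul (MvPolynomial.map _), RingHom.map_mul (eval q), hf, map_mul (ev (mkQ n B q)), ev_X]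
    congr 1
    rw [sliceX, mkQ, mkX, of_apply]
    by_cases h : (p.1 : ℕ) < k
    · rw [dif_pos h, dif_pos h, map_C, eval_C]
      exact ev_X _ _
    · rw [dif_neg h, dif_neg h]
      by_cases h : (p.1.rev : ℕ) < k
      · rw [dif_pos h, dif_pos h, map_sum, map_sum, mul_apply]
        refine sum_congr rfl fun c _ => ?_
        rw [map_mul, map_mul, map_C, eval_C]
        have h1 : eval q (map (ev B).toRingHom (symX c p.2)) = symM q c p.2 := by
          rw [symX, symM, of_apply]
          split_ifs <;> rw [map_X, eval_X]
        have h2 : (ev B).toRingHom (C (2 : ℂ)⁻¹ * (genM k).adjugate ⟨p.1.rev, h⟩ c)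
            = 2⁻¹ * B.adjugate ⟨p.1.rev, h⟩ c := by
          change ev B _ = _
          rw [map_mul, ev_adjugate, ev, aeval_C]; rfl
        rw [h1, h2, Matrix.smul_apply, smul_eq_mul]
        ring
      · rw [dif_neg h, dif_neg h, map_zero, map_zero]

theorem topT_mkQ (hk : k ≤ n) (B : Mat k k) (q : Up k → ℂ) :
    topT hk (mkQ n B q) = B := topT_mkX _ _ _

theorem gram_mkQ (hk : 2 * k ≤ n) (B : Mat k k) (q : Up k → ℂ) (p : Up k) :
    gram (mkQ n B q) p = B.det * q p := by
  rw [gram, mkQ, bf_mkX hk, ← Matrix.mul_assoc, Matrix.mul_adjugate, Matrix.smul_mul, Matrix.one_mul,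
    Matrix.smul_apply, Matrix.smul_apply, Matrix.smul_apply, Matrix.smul_apply,
    symM_symm q p.1.2, symM_up, smul_eq_mul, smul_eq_mul]
  ring

/-- Coefficients of the section. -/
def scoef (n : ℕ) (e : Up k →₀ ℕ) : P n k →ₗ[ℂ] P k k :=
  (lcoeff (P k k) e).restrictScalars ℂ ∘ₗ (slice n).toLinearMap

theorem ev_scoef (e : Up k →₀ ℕ) (f : P n k) (B) :
    ev B (scoef n e f) = coeff e (map (ev B).toRingHom (slice n f)) := by
  rw [coeff_map]; rfl

theorem scoef_compare (f : P n k) (B B' : Mat k k) (t : Up k → ℂ) (c : ℂ)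
    (h : ∀ q, ev (mkQ n B' q) f = c * ev (mkQ n B fun p => q p * t p) f) (e : Up k →₀ ℕ) :
    ev B' (scoef n e f) = c * (∏ p, t p ^ e p) * ev B (scoef n e f) := by
  have : map (ev B').toRingHom (slice n f)
      = C c * subst (diagonal t) (map (ev B).toRingHom (slice n f)) := by
    refine MvPolynomial.funext fun q => ?_
    rw [map_mul, eval_C, eval_subst, eval_slice, eval_slice, h, show q ᵥ* diagonal t = fun p => q p * t p from funext fun p => vecMul_diagonal _ _ p]
  rw [ev_scoef, this, coeff_C_mul, coeff_subst_diagonal, ev_scoef, mul_assoc]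

theorem det_isUpperUni {A : Mat k k} (hA : IsUpperUni A) : A.det = 1 := by
  rw [det_of_upperTriangular fun i j h => hA.2 i j h]
  exact prod_eq_one fun i _ => hA.1 i

theorem ev_mkQ_of (hk : 2 * k ≤ n) (hk' : n ≤ 2 * k + 1) {ν : Fin k → ℕ} {f : P n k}
    (hf : f ∈ Dsub n ν) {B : Mat k k} (hB : B.det ≠ 0) (q : Up k → ℂ)
    (M : Mat n k) (h1 : topT (show k ≤ n by omega) M = B)
    (h2 : ∀ p, gram M p = B.det * q p) : ev (mkQ n B q) f = ev M f :=
  Dsub_congr hk hk' hf _ _ (by rw [h1]; exact hB) (by rw [topT_mkQ, h1])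
    (funext fun p => by rw [gram_mkQ hk, h2])

theorem scoef_unip (hk : 2 * k ≤ n) (hk' : n ≤ 2 * k + 1) {ν : Fin k → ℕ} {f : P n k}
    (hf : f ∈ Dsub n ν) (e : Up k →₀ ℕ) (j : ℕ) (hj : j < k) (c : GL (Fin k) ℂ) (hc : c ∈ Aplus k j) :
    Ract (c : Mat k k) (scoef n e f) = scoef n e f := by
  have hcd := det_isUpperUni (isUpperUni_Aplus j c hc)
  obtain ⟨η, hη, hc⟩ := hc
  rw [← sub_eq_zero]
  refine P_zero_of_det fun B hB => ?_
  rw [map_sub, ev_Ract, sub_eq_zero]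
  set y : Fin n → ℂ := fun l => if h : (l.rev : ℕ) < k then - η ⟨l.rev, h⟩ else 0 with hy
  have hy0 : ∀ l : Fin n, (l : ℕ) < n - k → y l = 0 := fun l hl => by
    simp only [hy]
    rw [dif_neg]
    rw [Fin.val_rev]; omega
  have hy1 : ∀ l : Fin n, (l : ℕ) ≤ j → y l.rev = 0 := fun l hl => by
    simp only [hy, Fin.rev_rev]
    rw [dif_pos (show (l : ℕ) < k by omega), hη _ hl, neg_zero]
  have hyY : y ∈ Yset n j := fun l hl => by
    rw [bf_ee l (by omega), bf_ee _ (by omega)]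
    exact ⟨hy1 _ hl, hy0 _ (by rw [Fin.val_rev]; dsimp only; omega)⟩
  have h1 := (ee_isotropic (n := n) j (by omega)).1
  have h2 : bf y (ee n j) = 0 := (hyY j le_rfl).1
  have hu : IsUpperUni (mat (eich (ee n j) y)) := by
    rw [mat_eich h1 h2]; exact isUpperUni_eich j (by omega) y hyY
  have hyy : bf y y = 0 := by
    refine sum_eq_zero fun l _ => ?_
    by_cases h : (l : ℕ) < n - k
    · rw [hy0 l h, zero_mul]
    · rw [hy0 l.rev (by rw [Fin.val_rev]; omega), mul_zero]
  have htop : (mat (eich (ee n j) y)).submatrix (Fin.castLE (show k ≤ n by omega)) (Fin.castLE (show k ≤ n by omega))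
      = (c : Mat k k) := by
    ext a b
    rw [mat_eich h1 h2, submatrix_apply, eichM_apply, hyy,
      hy0 (Fin.castLE _ a) (by rw [Fin.val_castLE]; omega), hc, Matrix.add_apply, vecMulVec_apply]
    have e1 : y (Fin.castLE (show k ≤ n by omega) b).rev = - η b := by
      simp only [hy, Fin.rev_rev]
      rw [dif_pos (show (Fin.castLE _ b : Fin n).val < k from b.2)]; rfl
    rw [e1, one_apply, one_apply]
    simp only [ee_apply, Fin.ext_iff, Fin.val_castLE]
    ring
  have key := scoef_compare f B (B * (c : Mat k k)) (fun _ => 1) 1 (fun q => ?_) e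
  · simpa using key
  · have hd := congrArg (ev (mkQ n B q)) (hf.1 _ hu)
    rw [ev_repO] at hd
    have h9 := ev_mkQ_of hk hk' hf (B := B * (c : Mat k k))
      (by rw [det_mul, hcd, mul_one]; exact hB) q ((mat (eich (ee n j) y))ᵀ * mkQ n B q)
      (by rw [topT_transpose _ _ hu.2, topT_mkQ, htop])
      (fun p => by rw [gram_transpose, gram_mkQ hk, det_mul, hcd, mul_one])
    rw [one_mul, h9, hd]
    simp only [mul_one]

theorem det_tor (j : Fin k) (s : ℂˣ) : (tor k j s : Mat k k).det = s := by
  rw [tor_eq, det_diagonal, prod_ite_eq' univ j, if_pos (mem_univ _)]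

theorem scoef_right (hk : 2 * k ≤ n) (hk' : n ≤ 2 * k + 1) {ν : Fin k → ℕ} {f : P n k}
    (hf : f ∈ Dsub n ν) (e : Up k →₀ ℕ) (j : Fin k) (s : ℂˣ) :
    Ract (tor k j s : Mat k k) (scoef n e f)
      = (s : ℂ) ^ (ν j + ∑ p, e p) • scoef n e f := by
  rw [← sub_eq_zero]
  refine P_zero_of_det fun B hB => ?_
  rw [map_sub, ev_Ract, sub_eq_zero, map_smul]
  have key := scoef_compare f B (B * (tor k j s : Mat k k)) (fun _ => s) ((s : ℂ) ^ ν j) (fun q => ?_) e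
  · rw [key, prod_pow_eq_pow_sum, ← pow_add, smul_eq_mul]
  · have hO := OHW_of_IsOHWvec (repO n k) (ext0 ν) f (fun i hi => ext0_of_le _ (by omega)) hf
    have hd := congrArg (ev (mkQ n B fun p => q p * s)) (hO.2 j (by omega) s)
    rw [ev_repO, map_smul, ext0_val, smul_eq_mul] at hd
    have hm := mat_torO (n := n) j (by omega) s
    rw [← hd]
    refine ev_mkQ_of hk hk' hf (by rw [det_mul, det_tor]; exact mul_ne_zero hB s.ne_zero) q _ ?_
      (fun p => by rw [gram_transpose, gram_mkQ hk, det_mul, det_tor]; ring)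
    rw [topT_transpose _ (mat (torO n j s)) (fun a b hab => by
      rw [hm]; exact diagonal_apply_ne _ (by rintro rfl; exact lt_irrefl _ hab)), topT_mkQ, hm,
      submatrix_diagonal _ _ (Fin.castLE_injective _), tor_eq]
    congr 2
    funext i
    simp only [Function.comp_apply, Fin.val_castLE, Fin.ext_iff]
    rw [if_neg (by omega : ¬ ((i : ℕ) = n - 1 - j))]

theorem prod_ite_pow (j : Fin k) (s : ℂ) (w : Fin k → ℕ) :
    ∏ c, (if c = j then s else 1) ^ w c = s ^ w j := by
  simp [ite_pow]

theorem scoef_left (hk : 2 * k ≤ n) (hk' : n ≤ 2 * k + 1) {ν γ : Fin k → ℕ} {f : P n k}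
    (hf : f ∈ Dsub n ν) (hγ : f ∈ RWs n γ) (e : Up k →₀ ℕ) (j : Fin k) (s : ℂˣ) :
    (s : ℂ) ^ swt e j • Lact (tor k j s : Mat k k) (scoef n e f)
      = (s : ℂ) ^ (γ j + ∑ p, e p) • scoef n e f := by
  rw [← sub_eq_zero]
  refine P_zero_of_det fun B hB => ?_
  rw [map_sub, map_smul, ev_Lact, sub_eq_zero, map_smul, tor_eq, diagonal_transpose, ← tor_eq]
  set d : Fin k → ℂ := fun i => if i = j then (s : ℂ) else 1 with hd
  have hd0 : ∀ i, d i ≠ 0 := fun i => by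
    simp only [hd]; split_ifs; exacts [s.ne_zero, one_ne_zero]
  have key := scoef_compare f B ((tor k j s : Mat k k) * B)
    (fun p => s * (d p.1.1 * d p.1.2)⁻¹) ((s : ℂ) ^ γ j) (fun q => ?_) e
  · rw [key, smul_eq_mul, smul_eq_mul]
    simp_rw [mul_pow]
    rw [prod_mul_distrib, prod_pow_eq_pow_sum]
    have : ∏ p : Up k, (d p.1.1 * d p.1.2)⁻¹ ^ e p = ((s : ℂ) ^ swt e j)⁻¹ := by
      simp_rw [inv_pow]
      rw [prod_inv_distrib, prod_swt, prod_ite_pow]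
    rw [this, pow_add]
    field_simp [s.ne_zero]
  · have h1 := congrArg (ev (mkQ n B fun p => q p * (s * (d p.1.1 * d p.1.2)⁻¹)))
      (Ract_diagonal_RWs hγ d)
    rw [ev_Ract, map_smul, smul_eq_mul, prod_ite_pow] at h1
    rw [← h1]
    refine ev_mkQ_of hk hk' hf (by rw [det_mul, det_tor]; exact mul_ne_zero s.ne_zero hB) q _
      (by rw [topT_mul_diagonal, topT_mkQ, tor_eq]) fun p => ?_
    have h2 := hd0 p.1.1
    have h3 := hd0 p.1.2
    rw [gram_mul_diagonal, gram_mkQ hk, det_mul, det_tor]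
    field_simp

theorem scoef_mem_HWs (hk : 2 * k ≤ n) (hk' : n ≤ 2 * k + 1) {ν : Fin k → ℕ} {f : P n k}
    (hf : f ∈ Dsub n ν) (e : Up k →₀ ℕ) : scoef n e f ∈ HWs k fun c => ν c + ∑ p, e p := by
  refine mem_HWs.mpr ⟨fun j hj c hc => scoef_unip hk hk' hf e j hj c hc, fun j hj s => ?_⟩
  have := scoef_right hk hk' hf e ⟨j, hj⟩ s
  rw [repR_apply, this, ext0, dif_pos hj]

theorem scoef_weight (hk : 2 * k ≤ n) (hk' : n ≤ 2 * k + 1) {ν γ : Fin k → ℕ} {f : P n k}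
    (hf : f ∈ Dsub n ν) (hγ : f ∈ RWs n γ) (e : Up k →₀ ℕ) (m) (hm : coeff m (scoef n e f) ≠ 0)
    (j : Fin k) : rowDeg m j + swt e j = γ j + ∑ p, e p := by
  have h := congrArg (coeff m) (scoef_left hk hk' hf hγ e j (natUnit 2))
  rw [coeff_smul, coeff_smul, tor_eq, coeff_Lact_diagonal, prod_ite_pow, natUnit_val 2 (by omega),
    smul_eq_mul, smul_eq_mul, ← mul_assoc, ← pow_add] at h
  have h2 := mul_right_cancel₀ hm h
  have h3 : 2 ^ (swt e j + rowDeg m j) = 2 ^ (γ j + ∑ p, e p) := by exact_mod_cast h2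
  have := Nat.pow_right_injective le_rfl h3
  omega

theorem finrank_HWs_inf_shift (ν γ : Fin k → ℕ) (e : Up k →₀ ℕ) (a : ℕ) (he : e ∈ swts γ) :
    finrank ℂ ↥(HWs k (fun c => ν c + a) ⊓ LWs k fun c => γ c + a - swt e c)
      ≤ kostka k (ext0 ν) fun c => γ c - swt e c := by
  rw [(finrank_HWs_inf_LWs _ _).2]
  refine (kostka_shift_le _ _ _).trans (le_of_eq ?_)
  congr 1
  funext c
  have := mem_swts.mp he c
  omega

theorem scoef_eq_zero (hk : 2 * k ≤ n) (hk' : n ≤ 2 * k + 1) {ν γ : Fin k → ℕ} {f : P n k}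
    (hf : f ∈ Dsub n ν) (hγ : f ∈ RWs n γ) (e : Up k →₀ ℕ) (he : e ∉ swts γ) : scoef n e f = 0 := by
  by_contra h0
  set β : Fin k → ℕ := fun c => γ c + ∑ p, e p - swt e c with hβ
  obtain ⟨m, hm⟩ := MvPolynomial.ne_zero_iff.mp h0
  have hw := scoef_weight hk hk' hf hγ e m hm
  have hmem : scoef n e f ∈ HWs k (fun c => ν c + ∑ p, e p) ⊓ LWs k β :=
    ⟨scoef_mem_HWs hk hk' hf e, fun m' hm' => funext fun j => by
      have := scoef_weight hk hk' hf hγ e m' hm' j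
      simp only [hβ]; omega⟩
  obtain ⟨hfd, hfr⟩ := finrank_HWs_inf_LWs (fun c => ν c + ∑ p, e p) β
  have hk0 : kostka k (ext0 fun c => ν c + ∑ p, e p) β ≠ 0 := by
    rw [← hfr]
    intro h
    have := finrank_zero_iff.mp h
    exact h0 (congrArg Subtype.val (Subsingleton.elim (⟨_, hmem⟩ : ↥(HWs k (fun c => ν c + ∑ p, e p) ⊓ LWs k β)) 0))
  refine he (mem_swts.mpr fun c => ?_)
  have h1 := kostka_shift_ge hk0 c
  have := hw c
  simp only [hβ] at h1
  omega

theorem finrank_Dsub_inf_RWs_le (hk : 2 * k ≤ n) (hk' : n ≤ 2 * k + 1) (ν γ : Fin k → ℕ) :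
    Module.finrank ℂ ↥(Dsub n ν ⊓ RWs n γ) ≤ ∑ e ∈ swts γ, kostka k (ext0 ν) fun c => γ c - swt e c := by
  let T : ↥(Dsub n ν ⊓ RWs n γ) →ₗ[ℂ] ((e : swts γ) →
      ↥(HWs k (fun c => ν c + ∑ p, e.1 p) ⊓ LWs k fun c => γ c + ∑ p, e.1 p - swt e.1 c)) :=
    LinearMap.pi fun e => (scoef n e.1 ∘ₗ Submodule.subtype _).codRestrict _ fun f =>
      ⟨scoef_mem_HWs hk hk' f.2.1 e.1, fun m' hm' => funext fun j => by
        have := scoef_weight hk hk' f.2.1 f.2.2 e.1 m' hm' j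
        omega⟩
  have := fun e : swts γ => (finrank_HWs_inf_LWs (fun c => ν c + ∑ p, e.1 p) fun c => γ c + ∑ p, e.1 p - swt e.1 c).1
  have hT : Function.Injective T := by
    refine (injective_iff_map_eq_zero T).mpr fun f hf => ?_
    have h0 : slice n (f : P n k) = 0 := by
      ext1 e
      by_cases he : e ∈ swts γ
      · exact congrArg Subtype.val (congrFun hf ⟨e, he⟩)
      · exact scoef_eq_zero hk hk' f.2.1 f.2.2 e he
    refine Subtype.ext (Dsub_eq_zero hk fun M hM => ?_)
    set B := topT (show k ≤ n by omega) M
    have h1 := ev_mkQ_of hk hk' f.2.1 hM (fun p => B.det⁻¹ * gram M p) M rfl fun p => by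
      rw [← mul_assoc, mul_inv_cancel₀ hM, one_mul]
    rw [← h1, ← eval_slice, h0, map_zero, map_zero]
  refine (finrank_le_finrank_of_injective hT).trans ?_
  rw [finrank_pi_fintype,
    ← sum_coe_sort (swts γ) fun e => kostka k (ext0 ν) fun c => γ c - swt e c]
  exact sum_le_sum fun e _ => finrank_HWs_inf_shift ν γ e.1 _ e.2

theorem range_lamS (hk : 2 * k ≤ n) (hk' : n ≤ 2 * k + 1) (ν γ : Fin k → ℕ) :
    range (lamS (n := n) (show k ≤ n by omega) ν γ) = Dsub n ν ⊓ RWs n γ := by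
  have : FiniteDimensional ℂ ↥(Dsub n ν ⊓ RWs n γ) :=
    finiteDimensional_of_le (inf_le_right : _ ≤ RWs n γ)
  refine eq_of_le_of_finrank_le ?_ ?_
  · rintro _ ⟨F, rfl⟩; exact lamS_mem _ _ _ F
  · rw [finrank_lamS hk]; exact finrank_Dsub_inf_RWs_le hk hk' ν γ

theorem finrank_Dsub_inf_RWs (hk : 2 * k ≤ n) (hk' : n ≤ 2 * k + 1) (ν γ : Fin k → ℕ) :
    finrank ℂ ↥(Dsub n ν ⊓ RWs n γ) = ∑ e ∈ swts γ, kostka k (ext0 ν) fun c => γ c - swt e c := by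
  rw [← range_lamS hk hk', finrank_lamS hk]

end

section

open MvPolynomial Finset Submodule LinearMap Module

variable {n k : ℕ}

theorem ev_congr_of_RWs {m : ℕ} {ν : Fin k → ℕ} {f : P m k} (hf : f ∈ RWs m ν)
    (B B' : Mat m k) (h : ∀ a, ν a ≠ 0 → ∀ b, B' b a = B b a) :
    ev B' f = ev B f := by
  have h1 : Ract (diagonal fun a => if ν a = 0 then (0 : ℂ) else 1) f = f := by
    rw [Ract_diagonal_RWs hf, prod_eq_one, one_smul]
    intro a _
    split_ifs with h0
    · rw [h0, pow_zero]
    · rw [one_pow]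
  have h2 : B' * (diagonal fun a => if ν a = 0 then (0 : ℂ) else 1) =
      B * diagonal fun a => if ν a = 0 then (0 : ℂ) else 1 := by
    ext b a
    rw [mul_diagonal, mul_diagonal]
    split_ifs with h0
    · simp
    · rw [h a h0]
  calc ev B' f = ev B' (Ract (diagonal fun a => if ν a = 0 then (0 : ℂ) else 1) f) := by rw [h1]
    _ = ev B (Ract (diagonal fun a => if ν a = 0 then (0 : ℂ) else 1) f) := by
      rw [ev_Ract, ev_Ract, h2]
    _ = ev B f := by rw [h1]

theorem reflMatrix_transpose : (reflMatrix n)ᵀ = reflMatrix n := by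
  ext i j
  simp only [transpose_apply, reflMatrix, of_apply]
  have h1 : (2 * (j : ℕ) + 1 = n ∧ j = i) ↔ (2 * (i : ℕ) + 1 = n ∧ i = j) := by
    constructor <;> rintro ⟨h, rfl⟩ <;> exact ⟨h, rfl⟩
  have h2 : (j = i ∧ ¬(2 * (j : ℕ) = n ∨ 2 * (j : ℕ) + 2 = n)) ↔
      (i = j ∧ ¬(2 * (i : ℕ) = n ∨ 2 * (i : ℕ) + 2 = n)) := by
    constructor <;> rintro ⟨rfl, h⟩ <;> exact ⟨rfl, h⟩
  have h3 : ((2 * (j : ℕ) = n ∧ 2 * (i : ℕ) + 2 = n) ∨ (2 * (j : ℕ) + 2 = n ∧ 2 * (i : ℕ) = n)) ↔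
      ((2 * (i : ℕ) = n ∧ 2 * (j : ℕ) + 2 = n) ∨ (2 * (i : ℕ) + 2 = n ∧ 2 * (j : ℕ) = n)) := by
    tauto
  simp only [h1, h2, h3]

/-- On highest weight vectors of weight `ν` with `2ℓ(ν) < n` the reflection acts trivially. -/
theorem repO_refl (hk : 2 * k ≤ n) (hk' : n ≤ 2 * k + 1) {ν γ : Fin k → ℕ}
    (hν : ∀ c : Fin k, 2 * ((c : ℕ) + 1) = n → ν c = 0) {f : P n k} (hf : f ∈ Dsub n ν)
    (hγ : f ∈ RWs n γ) : repO n k (refl n) f = f := by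
  have h := (range_lamS hk hk' ν γ).symm ▸ mem_inf.mpr ⟨hf, hγ⟩
  obtain ⟨F, rfl⟩ := h
  rw [lamS_apply, map_sum]
  refine sum_congr rfl fun e _ => P_ext fun M => ?_
  rw [ev_repO, ev_lam, ev_lam, gram_transpose]
  congr 1
  refine ev_congr_of_RWs (HWs_le_RWs ν (mem_inf.mp (F e).2).1) _ _ fun a ha b => ?_
  have ha' : ¬ 2 * ((a : ℕ) + 1) = n := fun h => ha (hν a h)
  have h0 : (mat (refl n) *ᵥ fun i => M i b) (Fin.castLE (show k ≤ n by omega) a) =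
      M (Fin.castLE (show k ≤ n by omega) a) b := by
    change act (refl n) _ _ = _
    rw [act_refl]
    unfold rsg rsw
    rw [if_neg (by rw [Fin.val_castLE]; omega), if_neg (by rw [Fin.val_castLE]; omega), one_mul]
  rw [mat_refl, reflMatrix_transpose, ← mat_refl]
  exact h0

section Mult

variable {V W : Type*} [AddCommGroup V] [Module ℂ V] [AddCommGroup W] [Module ℂ W]

theorem mult_range (π : Representation ℂ (OGL n) W) (hπ : IsIrreducibleRep π)
    {ρ : Representation ℂ (GL (Fin n) ℂ) V} {κ ν : Fin k → ℕ}
    (T : V →ₗ[ℂ] P n k) (hT : T ∈ equivariantMaps ρ (repL n k)) (hTi : Function.Injective T)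
    (hTr : range T = HWs n κ) (w : W) (hw0 : w ≠ 0) (hw : IsOHWvec n (ext0 ν) π w) :
    ∃ Φ : equivariantMaps π (ρ.comp (OGL n).subtype) →ₗ[ℂ] P n k, Function.Injective Φ ∧
      (∀ S, Φ S ∈ HWs n κ ⊓ Dsub n ν) ∧ (∀ S, Φ S = T (S.1 w)) ∧
      ∀ S, repO n k (refl n) (Φ S) = T (S.1 (π (refl n) w)) := by
  have hTS : ∀ (S : equivariantMaps π (ρ.comp (OGL n).subtype)) g x,
      repO n k g (T (S.1 x)) = T (S.1 (π g x)) := by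
    intro S g x
    have h1 := LinearMap.congr_fun (S.2 g) x
    have h2 := LinearMap.congr_fun (hT (g : GL (Fin n) ℂ)) (S.1 x)
    simp only [LinearMap.comp_apply] at h1 h2
    rw [h1]
    exact h2.symm
  refine ⟨T ∘ₗ LinearMap.applyₗ w ∘ₗ Submodule.subtype _, ?_, fun S => ⟨?_, ?_, ?_⟩, fun S => rfl,
    fun S => hTS S _ _⟩
  · rw [injective_iff_map_eq_zero]
    intro S hS
    have hS' : S.1 w = 0 := hTi (by rw [map_zero]; exact hS)
    rcases hπ.2 (ker S.1) (fun g x hx => by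
      rw [mem_ker] at hx ⊢
      have := LinearMap.congr_fun (S.2 g) x
      simp only [LinearMap.comp_apply] at this
      rw [this, hx, map_zero]) with h | h
    · exact absurd ((mem_bot ℂ).mp (h ▸ mem_ker.mpr hS')) hw0
    · exact Subtype.ext (ker_eq_top.mp h)
  · rw [← hTr]; exact mem_range_self _ _
  · intro g hg
    exact (hTS S g w).trans (by rw [hw.1 g hg]; rfl)
  · intro g d hg hd
    exact (hTS S g w).trans (by rw [hw.2 g d hg hd, map_smul, map_smul]; rfl)

/-- The multiplicity is the dimension of a space of polynomials. -/
theorem repMult_eq_finrank (hk : 2 * k ≤ n) (hk' : n ≤ 2 * k + 1) [FiniteDimensional ℂ W]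
    (π : Representation ℂ (OGL n) W) (hπ : IsIrreducibleRep π)
    {ρ : Representation ℂ (GL (Fin n) ℂ) V} {κ ν : Fin k → ℕ}
    (T : V →ₗ[ℂ] P n k) (hT : T ∈ equivariantMaps ρ (repL n k)) (hTi : Function.Injective T)
    (hTr : range T = HWs n κ) (w : W) (hw0 : w ≠ 0) (hw : IsOHWvec n (ext0 ν) π w)
    (hs : (∃ c : Fin k, 2 * ((c : ℕ) + 1) = n ∧ ν c ≠ 0) ∨ π (refl n) w = w) :
    repMult (ρ.comp (OGL n).subtype) π = finrank ℂ ↥(HWs n κ ⊓ Dsub n ν) := by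
  obtain ⟨Φ, hΦi, hΦm, hΦ, -⟩ := mult_range π hπ T hT hTi hTr w hw0 hw
  have hν0 : ∀ i, n ≤ 2 * i + 1 → ext0 ν i = 0 := fun i hi => by
    by_cases h : k ≤ i
    · exact ext0_of_le ν h
    · omega
  have hr : range Φ = HWs n κ ⊓ Dsub n ν := by
    refine le_antisymm (by rintro _ ⟨S, rfl⟩; exact hΦm S) fun f hf => ?_
    obtain ⟨hf1, hf2⟩ := mem_inf.mp hf
    have hU : IsSubrep (repO n k) (HWs n κ) := fun g x hx => isSubrep_HWs κ (g : GL (Fin n) ℂ) x hx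
    obtain ⟨S, hS, hSw⟩ := O_exists_equivariant π (repO n k) hπ fischerH fischerH_symm fischerH_pos
      (fun g x y => fischerH_repL (g : GL (Fin n) ℂ) x y) (HWs n κ) hU (ext0 ν) w hw0
      (OHW_of_IsOHWvec π _ w hν0 hw) f hf1 (OHW_of_IsOHWvec _ _ f hν0 (mem_Dsub.mp hf2)) (by
        by_cases hc : ∃ c : Fin k, 2 * ((c : ℕ) + 1) = n ∧ ν c ≠ 0
        · obtain ⟨c, hc1, hc2⟩ := hc
          exact Or.inr ⟨c, hc1, by rwa [ext0_val]⟩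
        · refine Or.inl ⟨1, by rw [one_smul]; exact hs.resolve_left hc, ?_⟩
          push Not at hc
          rw [one_smul]
          exact repO_refl hk hk' hc hf2 (HWs_le_RWs κ hf1))
    have hS' : ∀ x, S x ∈ range T := by
      rw [hTr]
      rcases hπ.2 ((HWs n κ).comap S) (fun g x hx => by
        have := LinearMap.congr_fun (hS g) x
        simp only [LinearMap.comp_apply] at this
        rw [mem_comap, this]
        exact hU g _ hx) with h | h
      · have : w ∈ (HWs n κ).comap S := by rw [mem_comap, hSw]; exact hf1
        rw [h] at this
        exact absurd ((mem_bot ℂ).mp this) hw0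
      · intro x
        have : x ∈ (HWs n κ).comap S := h ▸ mem_top
        exact this
    let S' : W →ₗ[ℂ] V := (LinearEquiv.ofInjective T hTi).symm.toLinearMap ∘ₗ
      codRestrict (range T) S hS'
    have hTS : ∀ x, T (S' x) = S x := fun x => by
      have := LinearEquiv.apply_symm_apply (LinearEquiv.ofInjective T hTi)
        (codRestrict (range T) S hS' x)
      exact congrArg Subtype.val this
    refine ⟨⟨S', fun g => ext fun x => hTi ?_⟩, ?_⟩
    · have h1 := LinearMap.congr_fun (hS g) x
      have h2 := LinearMap.congr_fun (hT (g : GL (Fin n) ℂ)) (S' x)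
      simp only [LinearMap.comp_apply] at h1 h2 ⊢
      rw [hTS, h1, ← hTS]
      exact h2.symm
    · rw [hΦ, hTS, hSw]
  rw [← hr, finrank_range_of_inj hΦi]
  rfl

theorem repMult_eq_zero (hk : 2 * k ≤ n) (hk' : n ≤ 2 * k + 1)
    (π : Representation ℂ (OGL n) W) (hπ : IsIrreducibleRep π)
    {ρ : Representation ℂ (GL (Fin n) ℂ) V} {κ ν : Fin k → ℕ}
    (T : V →ₗ[ℂ] P n k) (hT : T ∈ equivariantMaps ρ (repL n k)) (hTi : Function.Injective T)
    (hTr : range T = HWs n κ) (w : W) (hw0 : w ≠ 0) (hw : IsOHWvec n (ext0 ν) π w)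
    (hν : ∀ c : Fin k, 2 * ((c : ℕ) + 1) = n → ν c = 0) (hs : π (refl n) w = -w) :
    repMult (ρ.comp (OGL n).subtype) π = 0 := by
  obtain ⟨Φ, hΦi, hΦm, hΦ, hΦr⟩ := mult_range π hπ T hT hTi hTr w hw0 hw
  have h0 : ∀ S : equivariantMaps π (ρ.comp (OGL n).subtype), S = 0 := fun S => hΦi (by
    have h1 := hΦr S
    rw [repO_refl hk hk' hν (hΦm S).2 (HWs_le_RWs κ (hΦm S).1), hs, map_neg, map_neg, ← hΦ,
      self_eq_neg] at h1
    rw [h1, map_zero])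
  have : Subsingleton (equivariantMaps π (ρ.comp (OGL n).subtype)) :=
    ⟨fun a b => (h0 a).trans (h0 b).symm⟩
  exact finrank_zero_of_subsingleton

theorem exists_GL_realization (hk : k ≤ n) {κ : Fin k → ℕ} (hκ : Antitone κ) {lam : ℕ → ℕ}
    (hlam : ext0 κ = lam) (ρ : Representation ℂ (GL (Fin n) ℂ) V)
    (hρ : IsGLHW n (polyWeight n lam) ρ) :
    ∃ T ∈ equivariantMaps ρ (repL n k), Function.Injective T ∧ range T = HWs n κ := by
  obtain ⟨h1, h2, v, hv0, hu, ht⟩ := hρ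
  have := h2
  refine exists_realization hk hκ ρ h1 v hv0 ⟨fun j hj c hc => hu c (isUpperUni_Aplus j c hc),
    fun j hj s => ?_⟩
  rw [ht _ _ (tor_eq ⟨j, hj⟩ s), hlam]
  congr 1
  simp only [polyWeight, zpow_natCast]
  rw [prod_ite_pow ⟨j, hj⟩ (s : ℂ) fun i : Fin n => lam i]

end Mult

end

section

open MvPolynomial Finset Module

variable {n k : ℕ}

/-- The Gram matrix of the columns. -/
def gm (M : Mat n k) : Mat k k := Mᵀ * M.submatrix Fin.rev id

theorem gm_apply (M : Mat n k) (a b : Fin k) :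
    gm M a b = bf (fun i => M i a) fun i => M i b := rfl

theorem gm_mul (M : Mat n k) (b : Mat k k) :
    gm (M * b) = bᵀ * gm M * b := by
  rw [gm, gm, transpose_mul, show (M * b).submatrix Fin.rev id = M.submatrix Fin.rev id * b from rfl]
  simp only [Matrix.mul_assoc]

theorem gm_transpose (M : Mat n k) : (gm M)ᵀ = gm M := by
  ext a b
  rw [transpose_apply, gm_apply, gm_apply, bf_comm]

theorem gm_repO (g : OGL n) (M : Mat n k) : gm ((mat g)ᵀ * M) = gm M := by
  ext a b
  exact bf_transpose g _ _

theorem exists_gm_one (hk : 2 * k ≤ n) : ∃ E : Mat n k, gm E = 1 := by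
  obtain ⟨E, -, hE⟩ := exists_gram hk (1 : Mat k k) (by simp)
    fun p => if p.1.1 = p.1.2 then 1 else 0
  have h : ∀ a b : Fin k, a ≤ b → gm E a b = if a = b then 1 else 0 := fun a b hab =>
    congrFun hE ⟨(a, b), hab⟩
  refine ⟨E, ?_⟩
  ext a b
  rw [one_apply]
  rcases le_total a b with hab | hab
  · exact h a b hab
  · rw [← gm_transpose, transpose_apply, h b a hab]
    simp only [eq_comm]

/-- The quadratic form `∑_{l ≤ i} x_{li} x_{lj}`. -/
def chol (p : Up k) : P k k :=
  ∑ l ∈ univ.filter fun l : Fin k => l ≤ p.1.1, X (l, p.1.1) * X (l, p.1.2)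

def cholE (p : Up k) (l : Fin k) : Fin k × Fin k →₀ ℕ :=
  Finsupp.single (l, p.1.1) 1 + Finsupp.single (l, p.1.2) 1

theorem cholE_apply (p : Up k) (l i c : Fin k) : cholE p l (i, c) =
    if l = i then (if p.1.1 = c then 1 else 0) + (if p.1.2 = c then 1 else 0) else 0 := by
  simp only [cholE, Finsupp.add_apply, Finsupp.single_apply, Prod.mk.injEq]
  by_cases h : l = i <;> simp [h]

theorem isLead_chol (p : Up k) : IsLead (chol p) (cholE p p.1.1) := by
  have hc : ∀ e, coeff e (chol p) =
      ∑ l ∈ univ.filter fun l : Fin k => l ≤ p.1.1, if cholE p l = e then (1 : ℂ) else 0 := by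
    intro e
    rw [chol, coeff_sum]
    refine sum_congr rfl fun l _ => ?_
    rw [X, X, monomial_mul, coeff_monomial, one_mul]
    rfl
  have hlt : ∀ l < p.1.1, key (cholE p l) < key (cholE p p.1.1) := by
    intro l hl
    refine key_lt p.1.1 p.1.2 (fun i hi c => ?_) (fun c hc => ?_) ?_
    · rw [cholE_apply, cholE_apply, if_neg (hl.trans hi).ne, if_neg hi.ne]
    · rw [cholE_apply, cholE_apply, if_neg hl.ne, if_pos rfl, if_neg (p.2.trans_lt hc).ne,
        if_neg hc.ne]
    · rw [cholE_apply, cholE_apply, if_neg hl.ne, if_pos rfl, if_pos rfl]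
      omega
  constructor
  · rw [hc, sum_eq_single p.1.1, if_pos rfl]
    · exact one_ne_zero
    · intro l hl hne
      rw [if_neg]
      intro h
      exact (hlt l (lt_of_le_of_ne (mem_filter.mp hl).2 hne)).ne (congrArg key h)
    · intro h; exact absurd (by simp) h
  · intro e he
    rw [hc] at he
    obtain ⟨l, hl, h0⟩ := exists_ne_zero_of_sum_ne_zero he
    have h1 : cholE p l = e := by by_contra h; exact h0 (if_neg h)
    rw [← h1]
    rcases (mem_filter.mp hl).2.lt_or_eq with h | h
    · exact (hlt l h).le
    · rw [h]

def cholL (e : Up k →₀ ℕ) : Fin k × Fin k →₀ ℕ := ∑ p : Up k, e p • cholE p p.1.1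

theorem cholL_injective : Function.Injective (cholL : (Up k →₀ ℕ) → _) := by
  have h : ∀ (e : Up k →₀ ℕ) (i j : Fin k) (hij : i < j), cholL e (i, j) = e ⟨(i, j), hij.le⟩ := by
    intro e i j hij
    rw [cholL, Finsupp.finsetSum_apply, sum_eq_single ⟨(i, j), hij.le⟩]
    · rw [Finsupp.smul_apply, cholE_apply, if_pos rfl, if_neg hij.ne, if_pos rfl]; simp
    · intro p _ hp
      rw [Finsupp.smul_apply, cholE_apply]
      split_ifs with h1 h2 h3 h3
      · exact absurd (h1.symm.trans h2) hij.ne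
      · exact absurd (h1.symm.trans h2) hij.ne
      · exact absurd (Subtype.ext (Prod.ext h1 h3)) hp
      · simp
      · simp
    · simp
  have h2 : ∀ (e : Up k →₀ ℕ) (i : Fin k), cholL e (i, i) =
      e ⟨(i, i), le_rfl⟩ + ∑ p : Up k, if p.1.1 = i then e p else 0 := by
    intro e i
    have h3 : e ⟨(i, i), le_rfl⟩ = ∑ p : Up k, if p = ⟨(i, i), le_rfl⟩ then e p else 0 := by simp
    rw [cholL, Finsupp.finsetSum_apply, h3, ← sum_add_distrib]
    refine sum_congr rfl fun p _ => ?_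
    rw [Finsupp.smul_apply, cholE_apply, smul_eq_mul]
    by_cases h1 : p.1.1 = i
    · by_cases h3 : p.1.2 = i
      · have : p = ⟨(i, i), le_rfl⟩ := Subtype.ext (Prod.ext h1 h3)
        rw [if_pos h1, if_pos h1, if_pos h3, if_pos this, if_pos h1]; ring
      · have : p ≠ ⟨(i, i), le_rfl⟩ := fun h => h3 (by rw [h])
        rw [if_pos h1, if_pos h1, if_neg h3, if_neg this, if_pos h1]; ring
    · have : p ≠ ⟨(i, i), le_rfl⟩ := fun h => h1 (by rw [h])
      rw [if_neg h1, if_neg this, if_neg h1]; rfl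
  intro e e' hee
  have hoff : ∀ i j : Fin k, ∀ hij : i < j, e ⟨(i, j), hij.le⟩ = e' ⟨(i, j), hij.le⟩ :=
    fun i j hij => by rw [← h e i j hij, ← h e' i j hij, hee]
  ext ⟨⟨i, j⟩, hij⟩
  rcases lt_or_eq_of_le hij with h3 | h3
  · exact hoff i j h3
  · obtain rfl : i = j := h3
    have h4 := h2 e i
    rw [hee, h2 e' i] at h4
    have h5 : ∀ f : Up k →₀ ℕ, ∑ p : Up k, (if p.1.1 = i then f p else 0) =
        f ⟨(i, i), le_rfl⟩ + ∑ p ∈ univ.erase (⟨(i, i), le_rfl⟩ : Up k),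
          if p.1.1 = i then f p else 0 := fun f => by
      rw [← add_sum_erase _ _ (mem_univ (⟨(i, i), le_rfl⟩ : Up k)), if_pos rfl]
    have h6 : ∑ p ∈ univ.erase (⟨(i, i), le_rfl⟩ : Up k), (if p.1.1 = i then e p else 0) =
        ∑ p ∈ univ.erase (⟨(i, i), le_rfl⟩ : Up k), if p.1.1 = i then e' p else 0 := by
      refine sum_congr rfl fun p hp => ?_
      split_ifs with h7
      · refine hoff p.1.1 p.1.2 (lt_of_le_of_ne p.2 fun h8 => ne_of_mem_erase hp ?_)
        exact Subtype.ext (Prod.ext h7 (h8.symm.trans h7))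
      · rfl
    rw [h5 e, h5 e', h6] at h4
    show e ⟨(i, i), _⟩ = e' ⟨(i, i), _⟩
    omega

theorem chol_independent (S : Finset (Up k →₀ ℕ)) (c : (Up k →₀ ℕ) → ℂ)
    (h : ∑ e ∈ S, c e • ∏ p : Up k, chol p ^ e p = 0) : ∀ e ∈ S, c e = 0 := by
  by_contra! hne
  obtain ⟨e0, he0, hc0⟩ := hne
  obtain ⟨e1, he1, hmax⟩ := exists_max_image (S.filter fun e => c e ≠ 0)
    (fun e => key (cholL e)) ⟨e0, mem_filter.mpr ⟨he0, hc0⟩⟩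
  have hl : ∀ e : Up k →₀ ℕ, IsLead (∏ p : Up k, chol p ^ e p) (cholL e) := fun e =>
    isLead_prod _ _ _ fun p _ => by
      have := isLead_prod (range (e p)) (fun _ => chol p) (fun _ => cholE p p.1.1)
        fun _ _ => isLead_chol p
      simpa using this
  have h1 := congrArg (coeff (cholL e1)) h
  rw [coeff_sum, sum_eq_single e1, coeff_smul, coeff_zero, smul_eq_mul] at h1
  · rcases mul_eq_zero.mp h1 with h2 | h2
    · exact (mem_filter.mp he1).2 h2
    · exact (hl e1).1 h2
  · intro e he hne
    rw [coeff_smul, smul_eq_mul]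
    by_cases hce : c e = 0
    · rw [hce, zero_mul]
    · by_contra h3
      have h4 := (hl e).2 _ (right_ne_zero_of_mul h3)
      have h5 := hmax e (mem_filter.mpr ⟨he, hce⟩)
      exact hne (cholL_injective (key_injective (le_antisymm h5 h4)))
  · intro h3; exact absurd (mem_filter.mp he1).1 h3

theorem Dsub_zero_eq (hk : 2 * k ≤ n) (hk' : n ≤ 2 * k + 1) {κ : Fin k → ℕ} {f : P n k}
    (hf : f ∈ Dsub n (0 : Fin k → ℕ)) (hκ : f ∈ RWs n κ) :
    ∃ c : (Up k →₀ ℕ) → ℂ, ∀ M, ev M f = ∑ e ∈ swts κ, c e * ∏ p, gram M p ^ e p := by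
  have h := (range_lamS hk hk' 0 κ).symm ▸ Submodule.mem_inf.mpr ⟨hf, hκ⟩
  obtain ⟨F, rfl⟩ := h
  refine ⟨fun e => if he : e ∈ swts κ then ev 0 (F ⟨e, he⟩ : P k k) else 0, fun M => ?_⟩
  rw [lamS_apply, map_sum, ← sum_coe_sort (swts κ)]
  refine sum_congr rfl fun e _ => ?_
  rw [ev_lam]
  dsimp only
  rw [dif_pos e.2]
  congr 1
  exact ev_congr_of_RWs (HWs_le_RWs _ (Submodule.mem_inf.mp (F e).2).1) _ _
    fun a ha => absurd rfl ha

theorem HWs_Ract_upper {m : ℕ} {κ : Fin k → ℕ} {f : P m k} (hf : f ∈ HWs m κ)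
    (b : Mat k k) (hb : ∀ i j : Fin k, (j : ℕ) < i → b i j = 0)
    (hd : ∀ i, b i i ≠ 0) : Ract b f = (∏ i, b i i ^ κ i) • f := by
  have h1 : b = (b * diagonal fun i => (b i i)⁻¹) * diagonal fun i => b i i := by
    rw [mul_assoc, diagonal_mul_diagonal]
    simp [hd]
  have h2 : IsUpperUni (b * diagonal fun i => (b i i)⁻¹) := by
    refine ⟨fun i => ?_, fun i j hij => ?_⟩
    · rw [mul_diagonal, mul_inv_cancel₀ (hd i)]
    · rw [mul_diagonal, hb i j hij, zero_mul]
  conv_lhs => rw [h1]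
  rw [Ract_mul, Ract_diagonal_RWs (HWs_le_RWs κ hf), map_smul, HWs_upper hf _ h2]

theorem ev_ne_zero_of_gm_one (hk : 2 * k ≤ n) (hk' : n ≤ 2 * k + 1) {κ : Fin k → ℕ} {f : P n k}
    (hf : f ∈ Dsub n (0 : Fin k → ℕ)) (hκ : f ∈ HWs n κ) (E : Mat n k)
    (hE : gm E = 1) (h0 : ev E f = 0) : f = 0 := by
  obtain ⟨c, hc⟩ := Dsub_zero_eq hk hk' hf (HWs_le_RWs κ hκ)
  have hH : (∑ e ∈ swts κ, c e • ∏ p : Up k, chol p ^ e p) * ∏ i : Fin k, X (i, i) = 0 := by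
    refine P_ext fun B => ?_
    rw [map_mul, map_zero, map_prod]
    by_cases hB : ∀ i, B i i ≠ 0
    · set b : Mat k k := of fun i j => if i ≤ j then B i j else 0 with hb
      have hb1 : ∀ i j : Fin k, i ≤ j → b i j = B i j := fun i j h => if_pos h
      have hb2 : ∀ i j : Fin k, (j : ℕ) < i → b i j = 0 := fun i j h => if_neg (not_le.mpr h)
      have h1 := ev_Ract b f E
      rw [HWs_Ract_upper hκ b hb2 (fun i => by rw [hb1 i i le_rfl]; exact hB i), map_smul, h0,
        smul_zero, hc] at h1
      rw [map_sum, mul_eq_zero]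
      left
      rw [h1]
      refine sum_congr rfl fun e _ => ?_
      rw [map_smul, smul_eq_mul, map_prod]
      congr 1
      refine prod_congr rfl fun p _ => ?_
      rw [map_pow]
      congr 1
      have h2 : gram (E * b) p = (bᵀ * b) p.1.1 p.1.2 := by
        rw [← mul_one bᵀ, ← hE, ← gm_mul]; rfl
      rw [h2, mul_apply, chol, map_sum, sum_filter]
      refine sum_congr rfl fun l _ => ?_
      rw [transpose_apply]
      split_ifs with hl
      · rw [hb1 l _ hl, hb1 l _ (hl.trans p.2), map_mul]
        simp [ev]
      · rw [hb2 l _ (not_le.mp hl), zero_mul]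
    · push Not at hB
      obtain ⟨i, hi⟩ := hB
      rw [prod_eq_zero (mem_univ i) (by simpa [ev] using hi), mul_zero]
  have h3 := chol_independent _ _ ((mul_eq_zero.mp hH).resolve_right
    (prod_ne_zero_iff.mpr fun i _ => X_ne_zero _))
  refine P_ext fun M => ?_
  rw [hc, map_zero]
  exact sum_eq_zero fun e he => by rw [h3 e he, zero_mul]

theorem even_of_mem (hk : 2 * k ≤ n) (hk' : n ≤ 2 * k + 1) {κ : Fin k → ℕ} {f : P n k}
    (hf : f ∈ Dsub n (0 : Fin k → ℕ)) (hκ : f ∈ HWs n κ) (h0 : f ≠ 0) (j : Fin k) :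
    Even (κ j) := by
  obtain ⟨E, hE⟩ := exists_gm_one hk
  obtain ⟨c, hc⟩ := Dsub_zero_eq hk hk' hf (HWs_le_RWs κ hκ)
  have h1 := ev_Ract (diagonal fun i => if i = j then (-1 : ℂ) else 1) f E
  rw [Ract_diagonal_RWs (HWs_le_RWs κ hκ), prod_ite_pow, map_smul, hc (E * _)] at h1
  have h2 : gram (E * diagonal fun i => if i = j then (-1 : ℂ) else 1) = gram E := by
    funext p
    rw [gram_mul_diagonal]
    have h3 : gram E p = (1 : Mat k k) p.1.1 p.1.2 := by rw [← hE]; rfl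
    rw [h3, one_apply]
    split_ifs with h4 h5 <;> simp_all
  rw [h2, ← hc] at h1
  by_contra h3
  rw [Nat.not_even_iff_odd] at h3
  rw [h3.neg_one_pow, neg_one_smul, neg_eq_self] at h1
  exact h0 (ev_ne_zero_of_gm_one hk hk' hf hκ E hE h1)

theorem exists_even (hk : 2 * k ≤ n) {δ : Fin k → ℕ} (hδ : Antitone δ) :
    ∃ f ∈ Dsub n (0 : Fin k → ℕ) ⊓ HWs n (fun c => 2 * δ c), f ≠ 0 := by
  let f : P n k := aeval (fun p : Fin k × Fin k =>
    ∑ i : Fin n, (X (i, p.1) * X (i.rev, p.2) : P n k)) (delta le_rfl δ)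
  have hf : ∀ M, ev M f = ev (gm M) (delta le_rfl δ) := by
    intro M
    have h := comp_aeval_apply (fun p : Fin k × Fin k =>
      ∑ i : Fin n, (X (i, p.1) * X (i.rev, p.2) : P n k)) (ev M) (delta (le_refl k) δ)
    rw [h, ev]
    congr 2
    funext p
    rw [map_sum]
    simp [gm, mul_apply]
  have hT : ∀ S : Mat k k, ev Sᵀ (delta (le_refl k) δ) = ev S (delta le_rfl δ) := by
    intro S
    rw [ev_delta, ev_delta]
    refine prod_congr rfl fun r _ => ?_
    rw [← det_transpose]
    rfl
  have hm := delta_mem (le_refl k) hδ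
  have hA : ∀ (b : Mat k k) (c : ℂ),
      Ract b (delta (le_refl k) δ) = c • delta le_rfl δ → Ract b f = (c * c) • f := by
    intro b c hb
    refine P_ext fun M => ?_
    rw [ev_Ract, hf, gm_mul, ← ev_Ract, hb, map_smul, map_smul, hf, ← hT, transpose_mul,
      transpose_transpose, gm_transpose, ← ev_Ract, hb, map_smul, smul_smul]
  obtain ⟨E, hE⟩ := exists_gm_one hk
  refine ⟨f, ⟨⟨fun g _ => P_ext fun M => by rw [ev_repO, hf, hf, gm_repO], fun g d _ _ =>
    P_ext fun M => ?_⟩, mem_HWs_of (mem_RWs.mpr fun j hj s => ?_) fun u hu => ?_⟩, fun h0 => ?_⟩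
  · rw [ev_repO, hf, gm_repO, ← hf, prod_eq_one, one_smul]
    intro i _
    simp [ext0]
  · rw [repR_apply, hA _ ((s : ℂ) ^ δ ⟨j, hj⟩), ← pow_add, ← two_mul, ext0, dif_pos hj]
    have := mem_RWs.mp (HWs_le_RWs δ hm) j hj s
    rw [repR_apply, ext0, dif_pos hj] at this
    exact this
  · rw [hA u 1 (by rw [HWs_upper hm u hu, one_smul]), one_mul, one_smul]
  · have h1 := hf E
    rw [h0, map_zero, hE, ev_delta] at h1
    refine one_ne_zero (α := ℂ) (Eq.trans ?_ h1.symm)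
    refine (prod_eq_one fun r _ => ?_).symm
    rw [submatrix_one _ (Fin.castLE_injective _), det_one, one_pow]

open Classical in
/-- The orthogonal invariants of highest weight `κ` are one-dimensional for even `κ`. -/
theorem finrank_Dsub_zero (hk : 2 * k ≤ n) (hk' : n ≤ 2 * k + 1) (κ : Fin k → ℕ) :
    finrank ℂ ↥(Dsub n (0 : Fin k → ℕ) ⊓ HWs n κ) =
      if Antitone κ ∧ ∀ c, Even (κ c) then 1 else 0 := by
  split_ifs with h
  · obtain ⟨h1, h2⟩ := h
    choose δ hδ using fun c => (h2 c).exists_two_nsmul _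
    obtain rfl : κ = fun c => 2 * δ c := funext fun c => by rw [hδ]; rfl
    obtain ⟨f, hf, hf0⟩ := exists_even (n := n) hk (δ := δ) fun i j hij => by
      have := h1 hij
      dsimp only at this
      omega
    obtain ⟨E, hE⟩ := exists_gm_one hk
    rw [finrank_eq_one_iff_of_nonzero' (⟨f, hf⟩ : ↥(Dsub n (0 : Fin k → ℕ) ⊓ HWs n fun c => 2 * δ c))
      (fun h => hf0 (congrArg Subtype.val h))]
    rintro ⟨g, hg⟩
    have hE0 : ev E f ≠ 0 := fun h => hf0 (ev_ne_zero_of_gm_one hk hk' hf.1 hf.2 E hE h)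
    refine ⟨ev E g / ev E f, Subtype.ext (sub_eq_zero.mp ?_)⟩
    have hs := Submodule.sub_mem _ (Submodule.smul_mem _ (ev E g / ev E f) hf) hg
    refine ev_ne_zero_of_gm_one hk hk' hs.1 hs.2 E hE ?_
    show ev E ((ev E g / ev E f) • f - g) = 0
    rw [map_sub, map_smul, smul_eq_mul, div_mul_cancel₀ _ hE0, sub_self]
  · have h0 : Dsub n (0 : Fin k → ℕ) ⊓ HWs n κ = ⊥ := by
      rw [Submodule.eq_bot_iff]
      rintro f ⟨h1, h2⟩
      by_contra h0
      exact h ⟨antitone_of_HWs h2 h0, even_of_mem hk hk' h1 h2 h0⟩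
    rw [h0, finrank_bot]

/-- Dimension count in a fixed right weight. -/
theorem sum_finrank_Dsub (hk : 2 * k ≤ n) (hk' : n ≤ 2 * k + 1) (ν γ : Fin k → ℕ) :
    ∑ κ ∈ piAntidiag univ (∑ j, γ j),
      finrank ℂ ↥(Dsub n ν ⊓ HWs n κ) * kostka k (ext0 κ) γ =
    ∑ e ∈ swts γ, kostka k (ext0 ν) fun c => γ c - swt e c := by
  let R : Submodule ℂ (P n k) := restrictTotalDegree (Fin n × Fin k) ℂ (∑ j, γ j)
  have : FiniteDimensional ℂ R := inferInstanceAs (FiniteDimensional ℂ (restrictTotalDegree _ _ _))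
  have : FiniteDimensional ℂ ↥(Dsub n ν ⊓ R) := Submodule.finiteDimensional_of_le inf_le_right
  have h := finrank_inf_RWs (Dsub n ν ⊓ R)
    (fun g x hx => ⟨isSubrep_Dsub ν g x hx.1, isSubrep_repR _ g x hx.2⟩) γ
  rw [inf_assoc, inf_eq_right.mpr (RWs_le γ), finrank_Dsub_inf_RWs hk hk'] at h
  rw [h]
  refine sum_congr rfl fun κ hκ => ?_
  have h1 : HWs n κ ≤ R := (HWs_le_RWs κ).trans
    ((RWs_le κ).trans_eq (by rw [(mem_piAntidiag.mp hκ).1]))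
  rw [inf_assoc, inf_eq_right.mpr h1]

end

section

open Finset

/-- Partial sums. -/
def cs (f : ℕ → ℕ) (r : ℕ) : ℕ := ∑ s ∈ range r, f s

theorem cs_succ (f : ℕ → ℕ) (r : ℕ) : cs f (r + 1) = cs f r + f r := sum_range_succ f r

/-- `c i r` is the number of cells in row `i` of shape `lam` with entry at most `r`. -/
structure Cut (lam : ℕ → ℕ) (T c : ℕ → ℕ → ℕ) : Prop where
  le_iff : ∀ i j r, j < lam i → (T i j ≤ r ↔ j < c i r)
  le : ∀ i r, c i r ≤ lam i
  zero : ∀ i j, lam i ≤ j → T i j = 0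

/-- Number of entries `r + 1` in the rows above row `i`, in terms of cuts. -/
def cutGT (c : ℕ → ℕ → ℕ) (i r : ℕ) : ℕ := ∑ i' ∈ range i, (c i' (r + 1) - c i' r)

theorem cutGT_succ (c : ℕ → ℕ → ℕ) (i r : ℕ) :
    cutGT c (i + 1) r = cutGT c i r + (c i (r + 1) - c i r) := sum_range_succ _ _

namespace Cut

variable {lam mu nu : ℕ → ℕ} {T T' c c' : ℕ → ℕ → ℕ} {k : ℕ}

theorem mono (h : Cut lam T c) (i : ℕ) : Monotone (c i) := fun r s hrs =>
  le_of_forall_lt fun j hj => (h.le_iff i j s (hj.trans_le (h.le i r))).mp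
    (((h.le_iff i j r (hj.trans_le (h.le i r))).mpr hj).trans hrs)

theorem unique (h : Cut lam T c) (h' : Cut lam T c') : c = c' := by
  funext i r
  refine eq_of_forall_lt_iff fun j => ⟨fun hj => ?_, fun hj => ?_⟩
  · have := hj.trans_le (h.le i r)
    exact (h'.le_iff i j r this).mp ((h.le_iff i j r this).mpr hj)
  · have := hj.trans_le (h'.le i r)
    exact (h.le_iff i j r this).mp ((h'.le_iff i j r this).mpr hj)

theorem unique_left (h : Cut lam T c) (h' : Cut lam T' c) : T = T' := by
  funext i j
  rcases lt_or_ge j (lam i) with hj | hj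
  · exact eq_of_forall_ge_iff fun r => (h.le_iff i j r hj).trans (h'.le_iff i j r hj).symm
  · rw [h.zero i j hj, h'.zero i j hj]

theorem eq_succ_iff (h : Cut lam T c) (i j r : ℕ) :
    T i j = r + 1 ↔ c i r ≤ j ∧ j < c i (r + 1) := by
  rcases lt_or_ge j (lam i) with hj | hj
  · rw [← h.le_iff i j _ hj, ← not_lt, ← h.le_iff i j _ hj]
    omega
  · have := h.le i (r + 1)
    rw [h.zero i j hj]
    omega

theorem ncard_eq (h : Cut lam T c) (i j r : ℕ) :
    Set.ncard {p : ℕ × ℕ | (p.1 < i ∨ (p.1 = i ∧ j ≤ p.2)) ∧ T p.1 p.2 = r + 1} =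
      cutGT c i r + (c i (r + 1) - max j (c i r)) := by
  have hs : {p : ℕ × ℕ | (p.1 < i ∨ (p.1 = i ∧ j ≤ p.2)) ∧ T p.1 p.2 = r + 1} =
      (((range (i + 1)).sigma fun a => Ico (max (if a < i then 0 else j) (c a r))
        (c a (r + 1))).map (Equiv.sigmaEquivProd ℕ ℕ).toEmbedding : Finset (ℕ × ℕ)) := by
    ext ⟨a, b⟩
    rw [mem_coe, mem_map_equiv]
    show ((a < i ∨ (a = i ∧ j ≤ b)) ∧ T a b = r + 1) ↔ _
    rw [h.eq_succ_iff, mem_sigma]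
    simp only [Equiv.sigmaEquivProd_symm_apply, mem_range, mem_Ico, max_le_iff]
    split_ifs with h1 <;> omega
  rw [hs, Set.ncard_coe_finset, card_map, card_sigma, sum_range_succ,
    if_neg (lt_irrefl i), Nat.card_Ico]
  congr 1
  refine sum_congr rfl fun a ha => ?_
  rw [if_pos (mem_range.mp ha), Nat.card_Ico, Nat.zero_max]

theorem ncard_content (h : Cut lam T c) (hk : ∀ i, k ≤ i → lam i = 0) (r : ℕ) :
    Set.ncard {p : ℕ × ℕ | T p.1 p.2 = r + 1} = cutGT c k r := by
  have h1 := h.ncard_eq k 0 r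
  have h2 := h.le k (r + 1)
  rw [hk k le_rfl] at h2
  rw [show c k (r + 1) - max 0 (c k r) = 0 by omega, add_zero] at h1
  rw [← h1]
  congr 1
  ext ⟨a, b⟩
  refine ⟨fun h3 => ⟨Or.inl (not_le.mp fun h4 => ?_), h3⟩, fun h3 => h3.2⟩
  have h5 : T a b = r + 1 := h3
  rw [h.zero a b (by rw [hk a h4]; exact Nat.zero_le b)] at h5
  omega

/-- Littlewood–Richardson tableaux in terms of their cuts. -/
theorem isLRTableau_iff (h : Cut lam T c) (hlam : Antitone lam) (hmu : Antitone mu)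
    (hk : ∀ i, k ≤ i → lam i = 0) :
    IsLRTableau lam mu nu T ↔ (∀ i, c i 0 = mu i) ∧ (∀ i r, c (i + 1) (r + 1) ≤ c i r) ∧
      (∀ r, cutGT c k r = nu r) ∧ ∀ i r, cutGT c (i + 1) (r + 1) ≤ cutGT c i r := by
  constructor
  · rintro ⟨h1, h2, h3, h4, h5, h6⟩
    have h0 : ∀ i, c i 0 = mu i := fun i => by
      refine eq_of_forall_lt_iff fun j => ?_
      rcases lt_or_ge j (lam i) with hj | hj
      · rw [← h.le_iff i j 0 hj, Nat.le_zero, ← not_iff_not, ← Ne, h2 i j, InSkew]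
        omega
      · have := h.le i 0
        have := h1 i
        omega
    refine ⟨h0, fun i r => le_of_forall_lt fun j hj => ?_, fun r => ?_, fun i r => ?_⟩
    · have hj1 := hj.trans_le (h.le (i + 1) (r + 1))
      have hj2 := hj1.trans_le (hlam (Nat.le_succ i))
      rcases lt_or_ge j (mu i) with h7 | h7
      · exact (h7.trans_eq (h0 i).symm).trans_le (h.mono i (Nat.zero_le r))
      · have h8 := h4 i (i + 1) j ⟨h7, hj2⟩ ⟨(hmu (Nat.le_succ i)).trans h7, hj1⟩ (Nat.lt_succ_self i)
        have h9 := (h.le_iff (i + 1) j (r + 1) hj1).mpr hj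
        exact (h.le_iff i j r hj2).mp (by omega)
    · rw [← h5, h.ncard_content hk]
    · have h7 := h6 i (c i (r + 1)) r
      rw [h.ncard_eq i (c i (r + 1)) (r + 1), h.ncard_eq i (c i (r + 1)) r] at h7
      rw [cutGT_succ]
      omega
  · rintro ⟨h0, hc, h5, h6⟩
    have hml : ∀ i, mu i ≤ lam i := fun i => (h0 i).symm.le.trans (h.le i 0)
    have h2 : ∀ i j, T i j ≠ 0 ↔ InSkew lam mu i j := fun i j => by
      rcases lt_or_ge j (lam i) with hj | hj
      · rw [InSkew, ← Nat.pos_iff_ne_zero, ← not_le, h.le_iff i j 0 hj, h0]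
        omega
      · rw [h.zero i j hj, InSkew]
        omega
    refine ⟨hml, h2, fun i j l _ hl hjl => ?_, fun i l j hi hl hil => ?_, fun r => ?_,
      fun i j r => ?_⟩
    · exact (h.le_iff i j _ (hjl.trans_lt hl.2)).mpr
        (hjl.trans_lt ((h.le_iff i l _ hl.2).mp le_rfl))
    · have step : ∀ a, i ≤ a → j < lam (a + 1) → T a j < T (a + 1) j := fun a ha hj => by
        have h7 : T (a + 1) j ≠ 0 := (h2 _ _).mpr ⟨(hmu (ha.trans (Nat.le_succ a))).trans hi.1, hj⟩
        obtain ⟨r, hr⟩ := Nat.exists_eq_succ_of_ne_zero h7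
        have h8 := ((h.le_iff (a + 1) j (r + 1) hj).mp hr.le).trans_le (hc a r)
        have := (h.le_iff a j r (hj.trans_le (hlam (Nat.le_succ a)))).mpr h8
        omega
      have key : ∀ d, j < lam (i + d + 1) → T i j < T (i + d + 1) j := fun d => by
        induction d with
        | zero => exact step i le_rfl
        | succ d ih =>
          intro hj
          have h7 := ih (hj.trans_le (hlam (Nat.le_succ (i + d + 1))))
          exact h7.trans (step (i + d + 1) (by omega) hj)
      obtain ⟨d, rfl⟩ := Nat.exists_eq_add_of_lt hil
      exact key d hl.2
    · rw [h.ncard_content hk, h5]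
    · have h7 := h6 i r
      rw [cutGT_succ] at h7
      rw [h.ncard_eq i j (r + 1), h.ncard_eq i j r]
      omega

theorem of_monotone (h1 : ∀ i j l, j ≤ l → l < lam i → T i j ≤ T i l)
    (h2 : ∀ i j, lam i ≤ j → T i j = 0) :
    Cut lam T fun i r => ((range (lam i)).filter fun j => T i j ≤ r).card := by
  refine ⟨fun i j r hj => ⟨fun h => ?_, fun h => ?_⟩, fun i r => ?_, h2⟩
  · refine Nat.succ_le_iff.mp ((card_range (j + 1)).symm.le.trans ?_)
    refine card_le_card fun l hl => ?_
    have hl := mem_range.mp hl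
    exact mem_filter.mpr ⟨mem_range.mpr (by omega), (h1 i l j (by omega) hj).trans h⟩
  · by_contra hn
    refine h.not_ge ((card_le_card fun l hl => ?_).trans (card_range j).le)
    obtain ⟨hl1, hl2⟩ := mem_filter.mp hl
    rw [mem_range] at hl1 ⊢
    by_contra hlj
    exact hn ((h1 i j l (by omega) hl1).trans hl2)
  · exact (card_filter_le _ _).trans (card_range _).le

end Cut

/-- The condition on a pattern corresponding to column strictness. -/
def Good (k : ℕ) (mu : ℕ → ℕ) (p : ℕ → ℕ → ℕ) : Prop := ∀ i r, i + 1 < k → r < k →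
  mu (i + 1) + cs (p (i + 1 + 1)) (r + 1) + cs (p i) r ≤
    mu i + cs (p (i + 1)) (r + 1) + cs (p (i + 1)) r

section

variable {k : ℕ} {lam mu nu : ℕ → ℕ} {p : ℕ → ℕ → ℕ}

theorem cs_le (hp : p ∈ GT k nu) (i r : ℕ) : cs (p i) r ≤ cs (p (i + 1)) r :=
  sum_le_sum fun s _ => hp.2.2.1 i s

theorem cs_of_le (hp : p ∈ GT k nu) (i : ℕ) {r : ℕ} (hr : k ≤ r) : cs (p i) r = cs (p i) k :=
  eventually_constant_sum
    (fun s hs => Nat.le_zero.mp ((GT_le hp i s).trans (GT_top_zero hp hs).le)) hr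

/-- The cuts of the tableau with pattern `p`. -/
def gtCut (mu : ℕ → ℕ) (p : ℕ → ℕ → ℕ) (i r : ℕ) : ℕ := mu i + cs (p (i + 1)) r - cs (p i) r

theorem gtCut_succ_sub (hp : p ∈ GT k nu) (i r : ℕ) :
    gtCut mu p i (r + 1) = gtCut mu p i r + (p (i + 1) r - p i r) := by
  have := cs_le hp i r
  have := hp.2.2.1 i r
  rw [gtCut, gtCut, cs_succ, cs_succ]
  omega

theorem cutGT_gtCut (hp : p ∈ GT k nu) : cutGT (gtCut mu p) = p := by
  funext i r
  induction i with
  | zero => exact (hp.1 r).symm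
  | succ i ih =>
    have := hp.2.2.1 i r
    rw [cutGT_succ, ih, gtCut_succ_sub hp]
    omega

theorem gtCut_of_ge (hp : p ∈ GT k nu) (hmk : ∀ i, k ≤ i → mu i = 0) {i : ℕ} (hi : k ≤ i) (r : ℕ) :
    gtCut mu p i r = 0 := by
  rw [gtCut, hp.2.1 i hi, hp.2.1 (i + 1) (by omega), hmk i hi]
  omega

/-- The tableau with pattern `p`. -/
def gtTab (lam mu : ℕ → ℕ) (p : ℕ → ℕ → ℕ) (i j : ℕ) : ℕ :=
  sInf {r | lam i ≤ j ∨ j < gtCut mu p i r}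

theorem gtCut_eq_of_le (hp : p ∈ GT k nu)
    (hw : ∀ i < k, mu i + cs (p (i + 1)) k = lam i + cs (p i) k) {i r : ℕ} (hi : i < k)
    (hr : k ≤ r) : gtCut mu p i r = lam i := by
  have := hw i hi
  rw [gtCut, cs_of_le hp _ hr, cs_of_le hp _ hr]
  omega

theorem cut_gtTab (hlk : ∀ i, k ≤ i → lam i = 0) (hmk : ∀ i, k ≤ i → mu i = 0) (hp : p ∈ GT k nu)
    (hw : ∀ i < k, mu i + cs (p (i + 1)) k = lam i + cs (p i) k) :
    Cut lam (gtTab lam mu p) (gtCut mu p) := by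
  have hm : ∀ i, Monotone (gtCut mu p i) := fun i => monotone_nat_of_le_succ fun r => by
    rw [gtCut_succ_sub hp]; exact Nat.le_add_right _ _
  refine ⟨fun i j r hj => ⟨fun h => ?_, fun h => Nat.sInf_le (Or.inr h)⟩, fun i r => ?_,
    fun i j hj => Nat.le_zero.mp (Nat.sInf_le (Or.inl hj))⟩
  · have hi : i < k := not_le.mp fun hi => by rw [hlk i hi] at hj; omega
    have hne : k ∈ {r | lam i ≤ j ∨ j < gtCut mu p i r} :=
      Or.inr (by rw [gtCut_eq_of_le hp hw hi le_rfl]; exact hj)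
    rcases Nat.sInf_mem ⟨k, hne⟩ with h1 | h1
    · omega
    · exact h1.trans_le (hm i h)
  · rcases lt_or_ge i k with hi | hi
    · rw [← gtCut_eq_of_le hp hw hi (le_max_right r k)]
      exact hm i (le_max_left r k)
    · rw [gtCut_of_ge hp hmk hi]; exact Nat.zero_le _

open Classical in
/-- Littlewood–Richardson coefficients count patterns. -/
theorem lrCoeff_eq_card (hlam : Antitone lam) (hmu : Antitone mu) (hlk : ∀ i, k ≤ i → lam i = 0)
    (hmk : ∀ i, k ≤ i → mu i = 0) :
    lrCoeff lam mu nu = ((gts k nu).filter fun p => Good k mu p ∧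
      ∀ i < k, mu i + cs (p (i + 1)) k = lam i + cs (p i) k).card := by
  have hs : {T | IsLRTableau lam mu nu T} = gtTab lam mu '' ((gts k nu).filter fun p => Good k mu p ∧
      ∀ i < k, mu i + cs (p (i + 1)) k = lam i + cs (p i) k : Finset (ℕ → ℕ → ℕ)) := by
    ext T
    constructor
    · intro hT
      have hT : IsLRTableau lam mu nu T := hT
      have hz : ∀ i j, ¬ InSkew lam mu i j → T i j = 0 := fun i j h => by
        by_contra h0
        exact h ((hT.2.1 i j).mp h0)
      have hc : ∃ c, Cut lam T c := ⟨_, Cut.of_monotone (fun i j l hjl hl => by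
        by_cases hj : mu i ≤ j
        · exact hT.2.2.1 i j l ⟨hj, hjl.trans_lt hl⟩ ⟨hj.trans hjl, hl⟩ hjl
        · rw [hz i j fun h => hj h.1]; exact Nat.zero_le _)
        fun i j hj => hz i j fun h => by have := h.2; omega⟩
      obtain ⟨c, hc⟩ := hc
      obtain ⟨h0, h1, h2, h3⟩ := (hc.isLRTableau_iff hlam hmu hlk).mp hT
      have hck : ∀ i r, k ≤ i → c i r = 0 := fun i r hi =>
        Nat.le_zero.mp ((hc.le i r).trans (hlk i hi).le)
      have hp : cutGT c ∈ GT k nu := by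
        refine ⟨fun r => rfl, fun i hi => funext fun r => ?_, fun i r => ?_, fun i _ r => h3 i r⟩
        · rw [← h2]
          exact eventually_constant_sum (fun a ha => by rw [hck a _ ha, Nat.zero_sub]) hi
        · rw [cutGT_succ]; exact Nat.le_add_right _ _
      have hcc : ∀ i r, mu i + cs (cutGT c (i + 1)) r = c i r + cs (cutGT c i) r := fun i r => by
        induction r with
        | zero => rw [h0]; rfl
        | succ r ih =>
          have := hc.mono i (Nat.le_add_right r 1)
          rw [cs_succ, cs_succ, cutGT_succ]
          omega
      have hcp : gtCut mu (cutGT c) = c := funext fun i => funext fun r => by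
        have := hcc i r
        rw [gtCut]
        omega
      have hck' : ∀ i, i < k → c i k = lam i := fun i hi => by
        refine (hc.le i k).antisymm (le_of_forall_lt fun j hj => ?_)
        have h4 := (hc.le_iff i j _ hj).mp (le_max_left (T i j) k)
        have h5 : c i (max (T i j) k) = c i k := by
          rw [← hcp, gtCut, gtCut, cs_of_le hp _ (le_max_right _ _), cs_of_le hp _ (le_max_right _ _)]
        rwa [h5] at h4
      have hw : ∀ i < k, mu i + cs (cutGT c (i + 1)) k = lam i + cs (cutGT c i) k := fun i hi => by
        rw [hcc, hck' i hi]
      refine ⟨cutGT c, mem_coe.mpr (mem_filter.mpr ⟨mem_gts.mpr hp, fun i r _ _ => ?_,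
        hw⟩), (hcp ▸ cut_gtTab hlk hmk hp hw).unique_left hc⟩
      have := h1 i r
      have := hcc (i + 1) (r + 1)
      have := hcc i r
      omega
    · rintro ⟨p, hp, rfl⟩
      obtain ⟨hp, hg, hw⟩ := mem_filter.mp (mem_coe.mp hp)
      rw [mem_gts] at hp
      refine ((cut_gtTab hlk hmk hp hw).isLRTableau_iff hlam hmu hlk).mpr ⟨fun i => rfl, fun i r => ?_, ?_⟩
      · rcases lt_or_ge (i + 1) k with hi | hi
        · rcases lt_or_ge r k with hr | hr
          · have := hg i r hi hr
            have := cs_le hp i r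
            have := cs_le hp (i + 1) (r + 1)
            rw [gtCut, gtCut]
            omega
          · rw [gtCut_eq_of_le hp hw hi (by omega), gtCut_eq_of_le hp hw (by omega) hr]
            exact hlam (Nat.le_succ i)
        · rw [gtCut_of_ge hp hmk hi]; exact Nat.zero_le _
      · rw [cutGT_gtCut hp, hp.2.1 k le_rfl]
        refine ⟨fun r => rfl, fun i r => ?_⟩
        rcases lt_or_ge i k with hi | hi
        · exact hp.2.2.2 i hi r
        · rw [hp.2.1 i hi, hp.2.1 (i + 1) (by omega)]; exact GT_antitone hp r
  rw [lrCoeff, hs, Set.ncard_image_of_injOn, Set.ncard_coe_finset]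
  intro p hp q hq hpq
  obtain ⟨hp, _, hw⟩ := mem_filter.mp (mem_coe.mp hp)
  obtain ⟨hq, _, hw'⟩ := mem_filter.mp (mem_coe.mp hq)
  rw [mem_gts] at hp hq
  rw [← cutGT_gtCut (mu := mu) hp, ← cutGT_gtCut (mu := mu) hq]
  have h1 := cut_gtTab hlk hmk hp hw
  rw [show gtTab lam mu p = gtTab lam mu q from hpq] at h1
  rw [h1.unique (cut_gtTab hlk hmk hq hw')]

end

end

section

open Finset Submodule LinearMap Module

variable {k : ℕ}

theorem kostka_comp_perm_le (κ γ : Fin k → ℕ) (σ : Equiv.Perm (Fin k)) :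
    kostka k (ext0 κ) γ ≤ kostka k (ext0 κ) (γ ∘ σ) := by
  obtain ⟨_, h1⟩ := finrank_HWs_inf_LWs κ γ
  obtain ⟨_, h2⟩ := finrank_HWs_inf_LWs κ (γ ∘ σ)
  rw [← h1, ← h2]
  let g : GL (Fin k) ℂ := GeneralLinearGroup.mkOfDetNeZero (Equiv.Perm.permMatrix ℂ σ)
    (by rw [det_permutation]; exact_mod_cast (Equiv.Perm.sign σ).ne_zero)
  have hg : ∀ (j : Fin k) s, tor k j s * g = g * tor k (σ j) s := fun j s => Units.ext (by
    show (tor k j s : Mat k k) * Equiv.Perm.permMatrix ℂ σ =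
      Equiv.Perm.permMatrix ℂ σ * (tor k (σ j) s : Mat k k)
    ext a b
    rw [tor_eq, tor_eq, diagonal_mul, mul_diagonal, Equiv.Perm.permMatrix, PEquiv.toMatrix_apply]
    by_cases h : b = σ a
    · subst h; simp [mul_comm]
    · simp [Ne.symm h])
  refine LinearMap.finrank_le_finrank_of_injective
    (f := ((repL k k g).comp (Submodule.subtype _)).codRestrict _ fun f =>
      Submodule.mem_inf.mpr ⟨isSubrep_HWs κ g _ f.2.1, mem_LWs.mpr fun j hj s => ?_⟩) ?_
  · have h3 := mem_LWs.mp f.2.2 (σ ⟨j, hj⟩) (σ ⟨j, hj⟩).2 s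
    have h4 := LinearMap.congr_fun (congrArg (repL k k) (hg ⟨j, hj⟩ s)) (f : P k k)
    rw [map_mul, map_mul] at h4
    refine h4.trans ?_
    show repL k k g (repL k k (tor k (σ ⟨j, hj⟩) s) (f : P k k)) = _
    rw [h3, map_smul, ext0_val, ext0, dif_pos hj]
    rfl
  · intro x y hxy
    have h3 : repL k k g (x : P k k) = repL k k g (y : P k k) := congrArg Subtype.val hxy
    have h4 := congrArg (repL k k g⁻¹) h3
    rw [← Module.End.mul_apply, ← Module.End.mul_apply, ← map_mul, inv_mul_cancel, map_one] at h4
    exact Subtype.ext h4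

/-- Integral weight of a pattern. -/
def wtz (k : ℕ) (p : ℕ → ℕ → ℕ) (i : Fin k) : ℤ := (cs (p (i + 1)) k : ℤ) - cs (p i) k

theorem wtz_eq {κ : ℕ → ℕ} {p : ℕ → ℕ → ℕ} (hp : p ∈ GT k κ) (i : Fin k) : wtz k p i = wt k p i := by
  have h : cs (p (i + 1)) k = cs (p i) k + wt k p i := by
    rw [wt, cs, cs, ← sum_add_distrib]
    exact sum_congr rfl fun r _ => by have := hp.2.2.1 i r; omega
  rw [wtz, h]
  push_cast
  ring

/-- Number of patterns of given integral weight. -/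
def kz (κ : Fin k → ℕ) (x : Fin k → ℤ) : ℤ := ∑ p ∈ gts k (ext0 κ), if wtz k p = x then 1 else 0

theorem kz_natCast (κ γ : Fin k → ℕ) : kz κ (fun i => (γ i : ℤ)) = kostka k (ext0 κ) γ := by
  rw [kz, sum_boole, kostka]
  congr 2
  refine filter_congr fun p hp => ⟨fun h => funext fun i => ?_, fun h => funext fun i => ?_⟩
  · have := congrFun h i
    rw [wtz_eq (mem_gts.mp hp)] at this
    exact_mod_cast this
  · rw [wtz_eq (mem_gts.mp hp), h]

theorem kz_neg (κ : Fin k → ℕ) {x : Fin k → ℤ} {i : Fin k} (h : x i < 0) : kz κ x = 0 :=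
  sum_eq_zero fun p hp => if_neg fun h1 => by
    rw [← h1, wtz_eq (mem_gts.mp hp)] at h
    omega

theorem kz_comp_perm (κ : Fin k → ℕ) (x : Fin k → ℤ) (σ : Equiv.Perm (Fin k)) :
    kz κ (x ∘ σ) = kz κ x := by
  by_cases hx : ∀ i, 0 ≤ x i
  · choose γ hγ using fun i => Int.eq_ofNat_of_zero_le (hx i)
    obtain rfl : x = fun i => (γ i : ℤ) := funext hγ
    have h1 := kostka_comp_perm_le κ (γ ∘ σ) σ⁻¹
    rw [Function.comp_assoc, ← Equiv.Perm.coe_mul, mul_inv_cancel, Equiv.Perm.coe_one,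
      Function.comp_id] at h1
    rw [kz_natCast, show (fun i => (γ i : ℤ)) ∘ σ = fun i => ((γ ∘ σ) i : ℤ) from rfl, kz_natCast,
      h1.antisymm (kostka_comp_perm_le κ γ σ)]
  · push Not at hx
    obtain ⟨i, hi⟩ := hx
    rw [kz_neg κ hi, kz_neg κ (i := σ⁻¹ i) (by simpa using hi)]

/-- Coefficient of `x ^ u` in the alternant `∑ w, sgn w x ^ (v ∘ w)`. -/
def alt (u v : Fin k → ℤ) : ℤ :=
  ∑ w : Equiv.Perm (Fin k), (Equiv.Perm.sign w : ℤ) * if v ∘ w = u then 1 else 0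

theorem alt_comp (u v : Fin k → ℤ) (σ : Equiv.Perm (Fin k)) :
    alt u (v ∘ σ) = Equiv.Perm.sign σ * alt u v := by
  rw [alt, alt, mul_sum]
  refine Fintype.sum_equiv (Equiv.mulLeft σ) _ _ fun w => ?_
  rw [Equiv.coe_mulLeft, Equiv.Perm.sign_mul, Function.comp_assoc, ← Equiv.Perm.coe_mul,
    Units.val_mul, ← mul_assoc, ← mul_assoc, ← Units.val_mul, Int.units_mul_self, Units.val_one,
    one_mul]

theorem alt_of_strictAnti {u v : Fin k → ℤ} (hu : StrictAnti u) (hv : StrictAnti v) :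
    alt u v = if v = u then 1 else 0 := by
  rw [alt, sum_eq_single 1]
  · simp
  · intro w _ hw
    rw [if_neg, mul_zero]
    intro h
    refine hw (Equiv.ext fun i => ?_)
    have hm : StrictMono w := fun i j hij => by
      have := hu hij
      rw [← h] at this
      exact hv.lt_iff_gt.mp this
    have h1 := Subsingleton.elim (hm.orderIsoOfSurjective w w.surjective) (OrderIso.refl _)
    exact DFunLike.congr_fun h1 i
  · grind

/-- Multiplying an alternant with a Schur polynomial. -/
theorem sum_sign_kz (κ : Fin k → ℕ) (u v : Fin k → ℤ) :
    ∑ w : Equiv.Perm (Fin k), (Equiv.Perm.sign w : ℤ) * kz κ (u - v ∘ w) =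
      ∑ p ∈ gts k (ext0 κ), alt u (v + wtz k p) := by
  simp_rw [alt]
  rw [sum_comm]
  refine sum_congr rfl fun w _ => ?_
  rw [← mul_sum, ← kz_comp_perm κ _ w⁻¹, kz]
  congr 1
  refine sum_congr rfl fun p _ => ?_
  congr 1
  rw [eq_iff_iff]
  constructor
  · intro h
    funext i
    have := congrFun h (w i)
    simp only [Function.comp_apply, Pi.sub_apply, Pi.add_apply, show w⁻¹ (w i) = i by simp] at this ⊢
    omega
  · rintro rfl
    funext i
    simp

end

section

open Finset

section

variable {m0 m1 r : ℕ} {a b c : ℕ → ℕ}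

/-- Three consecutive rows of a pattern. -/
structure Rows (a b c : ℕ → ℕ) : Prop where
  ab : ∀ s, a s ≤ b s
  bc : ∀ s, b s ≤ c s
  ba : ∀ s, b (s + 1) ≤ a s
  cb : ∀ s, c (s + 1) ≤ b s

/-- Failure at `r` of the condition corresponding to column strictness. -/
def Viol (m0 m1 : ℕ) (a b c : ℕ → ℕ) (r : ℕ) : Prop :=
  m0 + cs b (r + 1) + cs b r < m1 + cs c (r + 1) + cs a r

/-- Stembridge's toggle of the middle row at `r`. -/
def tog (m0 m1 : ℕ) (a b c : ℕ → ℕ) (r s : ℕ) : ℕ :=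
  if s < r then b s else if s = r then
    max (a r) (c (r + 1)) + (m1 + cs c (r + 1) + cs a r - (m0 + cs b (r + 1) + cs b r)) - 1
  else max (a s) (c (s + 1)) + min (a (s - 1)) (c s) - b s

theorem tog_lt {s : ℕ} (h : s < r) : tog m0 m1 a b c r s = b s := if_pos h

theorem tog_self : tog m0 m1 a b c r r = max (a r) (c (r + 1)) +
    (m1 + cs c (r + 1) + cs a r - (m0 + cs b (r + 1) + cs b r)) - 1 := by
  rw [tog, if_neg (lt_irrefl r), if_pos rfl]

theorem tog_gt {s : ℕ} (h : r ≤ s) :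
    tog m0 m1 a b c r (s + 1) = max (a (s + 1)) (c (s + 1 + 1)) + min (a s) (c (s + 1)) - b (s + 1) := by
  rw [tog, if_neg (by omega), if_neg (by omega)]; rfl

theorem cs_tog {t : ℕ} (h : t ≤ r) : cs (tog m0 m1 a b c r) t = cs b t :=
  sum_congr rfl fun s hs => tog_lt ((mem_range.mp hs).trans_le h)

theorem rows_tog (h : Rows a b c) (hm : m1 ≤ m0) (hv : Viol m0 m1 a b c r) (hn : ∀ t < r, ¬ Viol m0 m1 a b c t) :
    Rows a (tog m0 m1 a b c r) c := by
  have key : tog m0 m1 a b c r r ≤ c r ∧ ∀ t, t + 1 = r → tog m0 m1 a b c r r ≤ a t := by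
    have h1 := h.ab r
    have h4 := h.cb r
    rw [tog_self]
    rw [Viol, cs_succ, cs_succ] at hv
    rcases r with _ | t
    · simp only [cs_succ, show ∀ f, cs f 0 = 0 from fun f => rfl] at hv ⊢
      exact ⟨by omega, fun t ht => by omega⟩
    · have h5 := hn t (Nat.lt_succ_self t)
      have h7 := h.cb t
      have h8 := h.ab t
      rw [Viol, cs_succ, cs_succ] at h5
      simp only [cs_succ] at hv ⊢
      refine ⟨by omega, fun t' ht => ?_⟩
      obtain rfl : t' = t := by omega
      omega
  have key2 : a r ≤ tog m0 m1 a b c r r ∧ c (r + 1) ≤ tog m0 m1 a b c r r := by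
    rw [tog_self]
    rw [Viol] at hv
    omega
  refine ⟨fun s => ?_, fun s => ?_, fun s => ?_, fun s => ?_⟩
  · rcases lt_trichotomy s r with hs | rfl | hs
    · rw [tog_lt hs]; exact h.ab s
    · exact key2.1
    · obtain ⟨s, rfl⟩ : ∃ t, s = t + 1 := ⟨s - 1, by omega⟩
      have := h.ba s
      have := h.bc (s + 1)
      rw [tog_gt (by omega)]
      omega
  · rcases lt_trichotomy s r with hs | rfl | hs
    · rw [tog_lt hs]; exact h.bc s
    · exact key.1
    · obtain ⟨s, rfl⟩ : ∃ t, s = t + 1 := ⟨s - 1, by omega⟩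
      have := h.ab (s + 1)
      have := h.cb (s + 1)
      rw [tog_gt (by omega)]
      omega
  · rcases lt_trichotomy (s + 1) r with hs | hs | hs
    · rw [tog_lt hs]; exact h.ba s
    · have := key.2 s hs
      rwa [← hs] at this ⊢
    · have := h.ab (s + 1)
      have := h.cb (s + 1)
      rw [tog_gt (by omega)]
      omega
  · rcases lt_trichotomy s r with hs | rfl | hs
    · rw [tog_lt hs]; exact h.cb s
    · exact key2.2
    · obtain ⟨s, rfl⟩ : ∃ t, s = t + 1 := ⟨s - 1, by omega⟩
      have := h.ba s
      have := h.bc (s + 1)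
      rw [tog_gt (by omega)]
      omega

theorem viol_tog (h : Rows a b c) (hv : Viol m0 m1 a b c r) :
    Viol m0 m1 a (tog m0 m1 a b c r) c r := by
  have h1 := h.ab r
  have h2 := h.cb r
  rw [Viol] at hv ⊢
  rw [cs_succ (tog _ _ _ _ _ _), cs_tog le_rfl, tog_self]
  rw [cs_succ b] at hv ⊢
  omega

theorem tog_tog (h : Rows a b c) (hv : Viol m0 m1 a b c r) :
    tog m0 m1 a (tog m0 m1 a b c r) c r = b := by
  funext s
  rcases lt_trichotomy s r with hs | rfl | hs
  · rw [tog_lt hs, tog_lt hs]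
  · have h1 := h.ab s
    have h2 := h.cb s
    rw [tog_self, cs_succ (tog _ _ _ _ _ _), cs_tog le_rfl, tog_self]
    rw [Viol] at hv
    rw [cs_succ b] at hv ⊢
    omega
  · obtain ⟨s, rfl⟩ : ∃ t, s = t + 1 := ⟨s - 1, by omega⟩
    have := h.ba s
    have := h.bc (s + 1)
    have := h.ab (s + 1)
    have := h.cb (s + 1)
    rw [tog_gt (by omega), tog_gt (by omega)]
    omega

theorem cs_tog_add (h : Rows a b c) (hv : Viol m0 m1 a b c r) (d : ℕ) :
    cs (tog m0 m1 a b c r) (r + 1 + d) + cs b (r + 1 + d) + m0 + 1 + a (r + d) =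
      cs a (r + 1 + d) + cs c (r + 1 + d) + m1 + max (a (r + d)) (c (r + d + 1)) := by
  induction d with
  | zero =>
    simp only [Nat.add_zero]
    rw [cs_succ (tog _ _ _ _ _ _), cs_tog le_rfl, tog_self, cs_succ a]
    rw [Viol] at hv
    rw [cs_succ b] at hv ⊢
    omega
  | succ d ih =>
    have h1 : b (r + d + 1) ≤ a (r + d) := h.ba (r + d)
    have h2 := h.bc (r + d + 1)
    rw [show r + 1 + (d + 1) = r + 1 + d + 1 by omega, show r + (d + 1) = r + d + 1 by omega]
    rw [cs_succ (tog _ _ _ _ _ _), cs_succ a, cs_succ b, cs_succ c, show r + 1 + d = r + d + 1 by omega,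
      tog_gt (by omega)]
    rw [show r + 1 + d = r + d + 1 by omega] at ih
    omega

end

/-- The first violation: least `r`, then greatest `i`. -/
structure FirstViol (k : ℕ) (mu : ℕ → ℕ) (p : ℕ → ℕ → ℕ) (i r : ℕ) : Prop where
  hi : i + 1 < k
  hr : r < k
  viol : Viol (mu i) (mu (i + 1)) (p i) (p (i + 1)) (p (i + 1 + 1)) r
  lt : ∀ t < r, ∀ j, j + 1 < k → ¬ Viol (mu j) (mu (j + 1)) (p j) (p (j + 1)) (p (j + 1 + 1)) t
  gt : ∀ j, i < j → j + 1 < k → ¬ Viol (mu j) (mu (j + 1)) (p j) (p (j + 1)) (p (j + 1 + 1)) r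

/-- Toggle row `i + 1` of `p` at `r`. -/
def togRow (mu : ℕ → ℕ) (p : ℕ → ℕ → ℕ) (i r : ℕ) : ℕ → ℕ → ℕ :=
  Function.update p (i + 1) (tog (mu i) (mu (i + 1)) (p i) (p (i + 1)) (p (i + 1 + 1)) r)

variable {k : ℕ} {mu κ : ℕ → ℕ} {p : ℕ → ℕ → ℕ} {i r : ℕ}

theorem exists_firstViol (h : ¬ Good k mu p) : ∃ i r, FirstViol k mu p i r := by
  classical
  simp only [Good, not_forall, not_le] at h
  obtain ⟨i0, r0, hi0, hr0, h0⟩ := h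
  have hex : ∃ r, ∃ i, i + 1 < k ∧ Viol (mu i) (mu (i + 1)) (p i) (p (i + 1)) (p (i + 1 + 1)) r :=
    ⟨r0, i0, hi0, h0⟩
  have hmin := fun t => Nat.find_min hex (m := t)
  have hle := Nat.find_min' hex ⟨i0, hi0, h0⟩
  obtain ⟨i1, hi1, h1⟩ := Nat.find_spec hex
  generalize Nat.find hex = r at *
  let Q : ℕ → Prop := fun i => i + 1 < k ∧ Viol (mu i) (mu (i + 1)) (p i) (p (i + 1)) (p (i + 1 + 1)) r
  have h2 : Q (Nat.findGreatest Q k) := Nat.findGreatest_spec (m := i1) (by omega) ⟨hi1, h1⟩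
  exact ⟨Nat.findGreatest Q k, r, h2.1, by omega, h2.2, fun t ht j hj hv => hmin t ht ⟨j, hj, hv⟩,
    fun j hj hjk hv => Nat.findGreatest_is_greatest hj (by omega) ⟨hjk, hv⟩⟩

theorem FirstViol.unique {i' r' : ℕ} (h : FirstViol k mu p i r) (h' : FirstViol k mu p i' r') :
    i = i' ∧ r = r' := by
  have hr : r = r' := by
    rcases lt_trichotomy r r' with h1 | h1 | h1
    · exact absurd h.viol (h'.lt r h1 i h.hi)
    · exact h1
    · exact absurd h'.viol (h.lt r' h1 i' h'.hi)
  subst hr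
  refine ⟨?_, rfl⟩
  rcases lt_trichotomy i i' with h1 | h1 | h1
  · exact absurd h'.viol (h.gt i' h1 h'.hi)
  · exact h1
  · exact absurd h.viol (h'.gt i h1 h.hi)

theorem rows_of_GT (hp : p ∈ GT k κ) (hi : i + 1 < k) : Rows (p i) (p (i + 1)) (p (i + 1 + 1)) :=
  ⟨hp.2.2.1 i, hp.2.2.1 (i + 1), hp.2.2.2 i (by omega), hp.2.2.2 (i + 1) hi⟩

theorem togRow_of_ne {j : ℕ} (h : j ≠ i + 1) : togRow mu p i r j = p j := Function.update_of_ne h _ _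

theorem togRow_self : togRow mu p i r (i + 1) =
    tog (mu i) (mu (i + 1)) (p i) (p (i + 1)) (p (i + 1 + 1)) r := Function.update_self _ _ _

theorem togRow_mem (hmu : Antitone mu) (hp : p ∈ GT k κ) (h : FirstViol k mu p i r) : togRow mu p i r ∈ GT k κ := by
  have hR := rows_tog (rows_of_GT hp h.hi) (hmu (Nat.le_succ i)) h.viol fun t ht => h.lt t ht i h.hi
  have hi := h.hi
  refine ⟨fun s => ?_, fun j hj => ?_, fun j s => ?_, fun j hj s => ?_⟩
  · rw [togRow_of_ne (by omega)]; exact hp.1 s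
  · rw [togRow_of_ne (by omega)]; exact hp.2.1 j hj
  · rcases eq_or_ne j i with rfl | h1
    · rw [togRow_self, togRow_of_ne (by omega)]; exact hR.ab s
    · rcases eq_or_ne j (i + 1) with rfl | h2
      · rw [togRow_self, togRow_of_ne (by omega)]; exact hR.bc s
      · rw [togRow_of_ne h2, togRow_of_ne (by omega)]; exact hp.2.2.1 j s
  · rcases eq_or_ne j i with rfl | h1
    · rw [togRow_self, togRow_of_ne (by omega)]; exact hR.ba s
    · rcases eq_or_ne j (i + 1) with rfl | h2
      · rw [togRow_self, togRow_of_ne (by omega)]; exact hR.cb s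
      · rw [togRow_of_ne h2, togRow_of_ne (by omega)]; exact hp.2.2.2 j hj s

theorem togRow_firstViol (hp : p ∈ GT k κ) (h : FirstViol k mu p i r) :
    FirstViol k mu (togRow mu p i r) i r := by
  have hc : ∀ j t, t ≤ r → cs (togRow mu p i r j) t = cs (p j) t := fun j t ht => by
    rcases eq_or_ne j (i + 1) with rfl | h1
    · rw [togRow_self, cs_tog ht]
    · rw [togRow_of_ne h1]
  refine ⟨h.hi, h.hr, ?_, fun t ht j hj => ?_, fun j hj hjk => ?_⟩
  · rw [togRow_self, togRow_of_ne (by omega), togRow_of_ne (by omega)]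
    exact viol_tog (rows_of_GT hp h.hi) h.viol
  · rw [Viol, hc _ _ ht, hc _ _ ht, hc _ _ ht.le, hc _ _ ht.le]
    exact h.lt t ht j hj
  · rw [Viol, hc _ _ le_rfl, hc _ _ le_rfl, togRow_of_ne (by omega), togRow_of_ne (by omega)]
    exact h.gt j hj hjk

theorem togRow_togRow (hp : p ∈ GT k κ) (h : FirstViol k mu p i r) :
    togRow mu (togRow mu p i r) i r = p := by
  funext j
  rcases eq_or_ne j (i + 1) with rfl | h1
  · rw [togRow_self, togRow_self, togRow_of_ne (by omega), togRow_of_ne (by omega)]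
    exact tog_tog (rows_of_GT hp h.hi) h.viol
  · rw [togRow_of_ne h1, togRow_of_ne h1]

/-- `mu` shifted by `(k, k - 1, …, 1)`. -/
def shiftz (k : ℕ) (mu : ℕ → ℕ) (i : Fin k) : ℤ := (mu i : ℤ) + k - i

theorem shiftz_togRow (hp : p ∈ GT k κ) (h : FirstViol k mu p i r) :
    shiftz k mu + wtz k (togRow mu p i r) = (shiftz k mu + wtz k p) ∘
      Equiv.swap (⟨i, by have := h.hi; omega⟩ : Fin k) ⟨i + 1, h.hi⟩ := by
  have hs : cs (tog (mu i) (mu (i + 1)) (p i) (p (i + 1)) (p (i + 1 + 1)) r) k + cs (p (i + 1)) k +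
      mu i + 1 = cs (p i) k + cs (p (i + 1 + 1)) k + mu (i + 1) := by
    have h1 := cs_tog_add (rows_of_GT hp h.hi) h.viol (k - (r + 1))
    have := h.hr
    have := h.hi
    rw [show r + 1 + (k - (r + 1)) = k by omega, show r + (k - (r + 1)) + 1 = k by omega,
      GT_zero hp (i := i) (by omega) (by omega), GT_zero hp h.hi h.hi] at h1
    omega
  funext j
  rw [Function.comp_apply]
  rcases eq_or_ne j ⟨i, by have := h.hi; omega⟩ with rfl | h1
  · rw [Equiv.swap_apply_left]
    simp only [Pi.add_apply, shiftz, wtz, togRow_self, togRow_of_ne (show i ≠ i + 1 by omega)]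
    push_cast
    omega
  · rcases eq_or_ne j ⟨i + 1, h.hi⟩ with rfl | h2
    · rw [Equiv.swap_apply_right]
      simp only [Pi.add_apply, shiftz, wtz, togRow_self,
        togRow_of_ne (show i + 1 + 1 ≠ i + 1 by omega)]
      push_cast
      omega
    · rw [Equiv.swap_apply_of_ne_of_ne h1 h2]
      have h1 : (j : ℕ) ≠ i := fun h => h1 (Fin.ext h)
      have h2 : (j : ℕ) ≠ i + 1 := fun h => h2 (Fin.ext h)
      simp only [Pi.add_apply, wtz, togRow_of_ne h2, togRow_of_ne (show (j : ℕ) + 1 ≠ i + 1 by omega)]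

open Classical in
/-- Only good patterns contribute to a product of an alternant with a Schur polynomial. -/
theorem sum_alt_eq_good (hmu : Antitone mu) (u : Fin k → ℤ) :
    ∑ p ∈ gts k κ, alt u (shiftz k mu + wtz k p) =
      ∑ p ∈ (gts k κ).filter (Good k mu), alt u (shiftz k mu + wtz k p) := by
  rw [← sum_filter_add_sum_filter_not _ (Good k mu), add_eq_left]
  choose! I R hIR using fun p => exists_firstViol (k := k) (mu := mu) (p := p)
  have hne : ∀ p ∈ (gts k κ).filter (fun p => ¬ Good k mu p), p ∈ GT k κ ∧ FirstViol k mu p (I p) (R p) :=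
    fun p hp => ⟨mem_gts.mp (mem_filter.mp hp).1, hIR p (mem_filter.mp hp).2⟩
  have hneg : ∀ p ∈ (gts k κ).filter (fun p => ¬ Good k mu p),
      alt u (shiftz k mu + wtz k (togRow mu p (I p) (R p))) = - alt u (shiftz k mu + wtz k p) :=
    fun p hp => by
      obtain ⟨h1, h2⟩ := hne p hp
      rw [shiftz_togRow h1 h2, alt_comp, Equiv.Perm.sign_swap (by simp)]
      simp
  refine sum_involution (fun p _ => togRow mu p (I p) (R p)) (fun p hp => ?_)
    (fun p hp h0 h1 => ?_) (fun p hp => ?_) (fun p hp => ?_)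
  · rw [hneg p hp, add_neg_cancel]
  · have := hneg p hp
    rw [h1] at this
    omega
  · obtain ⟨h1, h2⟩ := hne p hp
    have h3 := togRow_firstViol h1 h2
    exact mem_filter.mpr ⟨mem_gts.mpr (togRow_mem hmu h1 h2), fun h =>
      absurd h3.viol (not_lt.mpr (h _ _ h3.hi h3.hr))⟩
  · obtain ⟨h1, h2⟩ := hne p hp
    have h3 := togRow_firstViol h1 h2
    obtain ⟨h4, h5⟩ := (hIR _ fun h => absurd h3.viol (not_lt.mpr (h _ _ h3.hi h3.hr))).unique h3
    rw [h4, h5, togRow_togRow h1 h2]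

end

section

open Finset Module

section

variable {k : ℕ} {lam mu κ : ℕ → ℕ} {p : ℕ → ℕ → ℕ}

theorem shiftz_strictAnti (h : Antitone mu) : StrictAnti (shiftz k mu) := fun i j hij => by
  have h1 := h (Fin.le_def.mp hij.le)
  rw [shiftz, shiftz]
  omega

theorem strictAnti_of_good (hmu : Antitone mu) (hp : p ∈ GT k κ) (hg : Good k mu p) :
    StrictAnti (shiftz k mu + wtz k p) := by
  have h : StrictAnti fun i : ℕ => (mu i : ℤ) + cs (p (i + 1)) k - cs (p i) k - i := by
    refine strictAnti_nat_of_succ_lt fun i => ?_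
    have h1 := cs_le hp i k
    have h2 := hmu (Nat.le_add_right i 1)
    push_cast
    rcases lt_or_ge (i + 1) k with hi | hi
    · obtain ⟨l, rfl⟩ : ∃ l, k = l + 1 := ⟨k - 1, by omega⟩
      have h3 := hg i l hi (Nat.lt_succ_self l)
      have h4 := GT_zero hp (i := i) (r := l) (by omega) (by omega)
      rw [cs_succ, cs_succ (p (i + 1))] at h3
      simp only [cs_succ]
      omega
    · have h3 := hp.2.1 (i + 1) hi
      have h4 := hp.2.1 (i + 1 + 1) (by omega)
      rw [h4, ← h3]
      omega
  intro i j hij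
  have h1 := h (Fin.lt_def.mp hij)
  simp only [Pi.add_apply, shiftz, wtz] at h1 ⊢
  omega

/-- Littlewood–Richardson coefficients as signed sums over patterns. -/
theorem sum_alt_eq_lrCoeff (hlam : Antitone lam) (hmu : Antitone mu)
    (hlk : ∀ i, k ≤ i → lam i = 0) (hmk : ∀ i, k ≤ i → mu i = 0) :
    ∑ p ∈ gts k κ, alt (shiftz k lam) (shiftz k mu + wtz k p) = lrCoeff lam mu κ := by
  classical
  rw [sum_alt_eq_good hmu, lrCoeff_eq_card hlam hmu hlk hmk, ← filter_filter,
    card_filter]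
  push_cast
  refine sum_congr rfl fun p hp => ?_
  obtain ⟨h1, h2⟩ := mem_filter.mp hp
  rw [alt_of_strictAnti (shiftz_strictAnti hlam) (strictAnti_of_good hmu (mem_gts.mp h1) h2)]
  refine if_congr ⟨fun h i hi => ?_, fun h => funext fun i => ?_⟩ rfl rfl
  · have := congrFun h ⟨i, hi⟩
    simp only [Pi.add_apply, shiftz, wtz] at this
    omega
  · have := h i i.2
    simp only [Pi.add_apply, shiftz, wtz]
    omega

/-- The pattern of highest weight. -/
def topGT (κ : ℕ → ℕ) (i r : ℕ) : ℕ := if r < i then κ r else 0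

theorem cs_topGT (κ : ℕ → ℕ) (i r : ℕ) :
    cs (topGT κ (i + 1)) r = cs (topGT κ i) r + if i < r then κ i else 0 := by
  have h : (if i < r then κ i else 0) = ∑ s ∈ range r, if s = i then κ i else 0 := by simp
  rw [h, cs, cs, ← sum_add_distrib]
  refine sum_congr rfl fun s _ => ?_
  rw [topGT, topGT]
  rcases lt_trichotomy s i with h | rfl | h
  · grind
  · simp
  · grind

theorem eq_topGT (hp : p ∈ GT k κ) (hg : Good k 0 p) : p = topGT κ := by
  have h1 : ∀ i < k, ∀ r < i, p (i + 1) r = p i r := by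
    intro i
    induction i with
    | zero => exact fun _ r hr => absurd hr (Nat.not_lt_zero r)
    | succ i ih =>
      intro hi r hr
      have h2 := hg i i hi (by omega)
      have h3 : cs (p (i + 1)) i = cs (p i) i := sum_congr rfl fun s hs =>
        ih (by omega) s (mem_range.mp hs)
      have h4 : cs (p (i + 1)) (i + 1) = cs (p (i + 1 + 1)) (i + 1) := by
        have := cs_le hp (i + 1) (i + 1)
        simp only [Pi.zero_apply] at h2
        omega
      exact ((sum_eq_sum_iff_of_le fun s _ => hp.2.2.1 (i + 1) s).mp h4 r
        (mem_range.mpr hr)).symm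
  funext i r
  rw [topGT]
  split_ifs with hr
  · have h2 : ∀ j, i ≤ j → p j r = p i r := fun j hj => by
      induction j, hj using Nat.le_induction with
      | base => rfl
      | succ j hj ih =>
        rw [← ih]
        rcases lt_or_ge j k with h | h
        · grind
        · rw [hp.2.1 j h, hp.2.1 (j + 1) (by omega)]
    rw [← h2 (max i k) (le_max_left _ _), hp.2.1 _ (le_max_right _ _)]
  · rcases le_total i k with h | h
    · exact GT_zero hp h (not_lt.mp hr)
    · rw [hp.2.1 i h, GT_top_zero hp (h.trans (not_lt.mp hr))]

/-- Jacobi's bialternant formula. -/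
theorem sum_alt_zero (hκ : Antitone κ) (hκk : ∀ i, k ≤ i → κ i = 0) (u : Fin k → ℤ) :
    ∑ p ∈ gts k κ, alt u (shiftz k 0 + wtz k p) = alt u (shiftz k κ) := by
  classical
  have h0 : topGT κ ∈ GT k κ := by
    refine ⟨fun r => rfl, fun i hi => funext fun r => ?_, fun i r => ?_, fun i _ r => ?_⟩
    · rw [topGT]
      split_ifs with h
      · rfl
      · grind
    · rw [topGT, topGT]
      split_ifs <;> omega
    · have := hκ (Nat.le_add_right r 1)
      rw [topGT, topGT]
      split_ifs <;> omega
  have hs : (gts k κ).filter (Good k 0) = {topGT κ} := by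
    ext p
    rw [mem_filter, mem_singleton, mem_gts]
    refine ⟨fun h => eq_topGT h.1 h.2, ?_⟩
    rintro rfl
    refine ⟨h0, fun i r _ _ => ?_⟩
    have := hκ (Nat.le_add_right i 1)
    rw [cs_topGT κ (i + 1), cs_topGT κ i r]
    simp only [Pi.zero_apply]
    split_ifs <;> omega
  rw [sum_alt_eq_good (fun _ _ _ => le_rfl), hs, sum_singleton]
  congr 1
  funext i
  simp only [Pi.add_apply, shiftz, wtz, cs_topGT, if_pos i.2, Pi.zero_apply]
  push_cast
  ring

end

variable {k n : ℕ}

theorem sum_wtz {κ : Fin k → ℕ} {p : ℕ → ℕ → ℕ} (hp : p ∈ GT k (ext0 κ)) :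
    ∑ i, wtz k p i = ∑ i, (κ i : ℤ) := by
  have h : ∀ l, ∑ i ∈ range l, ((cs (p (i + 1)) k : ℤ) - cs (p i) k) = cs (p l) k := fun l => by
    rw [sum_range_sub fun i => (cs (p i) k : ℤ), show cs (p 0) k = 0 from
      sum_eq_zero fun s _ => hp.1 s]
    simp
  have h1 := h k
  rw [sum_range] at h1
  refine h1.trans ?_
  rw [hp.2.1 k le_rfl, cs, sum_range]
  push_cast
  exact sum_congr rfl fun i _ => by rw [ext0_val]

theorem kz_of_sum_ne {κ : Fin k → ℕ} {x : Fin k → ℤ} (h : ∑ i, x i ≠ ∑ i, (κ i : ℤ)) : kz κ x = 0 :=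
  sum_eq_zero fun p hp => if_neg fun h1 => h (by rw [← h1, sum_wtz (mem_gts.mp hp)])

theorem kz_zero (x : Fin k → ℤ) : kz (0 : Fin k → ℕ) x = if x = 0 then 1 else 0 := by
  have he : ∀ r, ext0 (0 : Fin k → ℕ) r = 0 := fun r => by rw [ext0]; split_ifs <;> rfl
  have h : gts k (ext0 (0 : Fin k → ℕ)) = {0} := by
    ext p
    rw [mem_gts, mem_singleton]
    constructor
    · exact fun hp => funext fun i => funext fun r => Nat.le_zero.mp ((GT_le hp i r).trans (he r).le)
    · rintro rfl
      exact ⟨fun _ => rfl, fun i _ => funext fun r => (he r).symm, fun _ _ => le_rfl,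
        fun _ _ _ => le_rfl⟩
  have h1 : wtz k 0 = 0 := funext fun i => by simp [wtz, cs]
  rw [kz, h, sum_singleton, h1]
  exact if_congr eq_comm rfl rfl

/-- Integral weight of a symmetric exponent. -/
def swz (e : Up k →₀ ℕ) (c : Fin k) : ℤ := swt e c

/-- Dimension count in a fixed integral right weight. -/
theorem sum_finrank_mul_kz (hk : 2 * k ≤ n) (hk' : n ≤ 2 * k + 1) (ν : Fin k → ℕ) {N M : ℕ}
    (hMN : M ≤ N) (x : Fin k → ℤ) (hx : ∑ i, x i = M) :
    ∑ κ ∈ piAntidiag univ M,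
      (finrank ℂ ↥(Dsub n ν ⊓ HWs n κ) : ℤ) * kz κ x =
    ∑ e ∈ swts fun _ : Fin k => N, kz ν (x - swz e) := by
  by_cases h0 : ∀ i, 0 ≤ x i
  · choose γ hγ using fun i => Int.eq_ofNat_of_zero_le (h0 i)
    obtain rfl : x = fun i => (γ i : ℤ) := funext hγ
    obtain rfl : ∑ i, γ i = M := by
      simp only at hx
      exact_mod_cast hx
    have h1 := sum_finrank_Dsub hk hk' ν γ
    have hsub : swts γ ⊆ swts fun _ : Fin k => N := fun e he => mem_swts.mpr fun c =>
      (mem_swts.mp he c).trans ((single_le_sum (fun i _ => Nat.zero_le (γ i))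
        (mem_univ c)).trans hMN)
    rw [← sum_subset hsub fun e _ he => ?_]
    · have h2 := congrArg (Nat.cast : ℕ → ℤ) h1
      push_cast at h2
      convert h2 using 2 with κ _ e he
      · rw [kz_natCast]
      · rw [← kz_natCast]
        congr 1
        funext c
        have := mem_swts.mp he c
        simp only [Pi.sub_apply, swz]
        omega
    · have he : ¬ ∀ c, swt e c ≤ γ c := fun h => he (mem_swts.mpr h)
      push Not at he
      obtain ⟨c, hc⟩ := he
      exact kz_neg ν (i := c) (by simp only [Pi.sub_apply, swz]; omega)
  · push Not at h0
    obtain ⟨i, hi⟩ := h0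
    rw [sum_eq_zero fun κ _ => by rw [kz_neg κ hi, mul_zero], sum_eq_zero fun e _ => ?_]
    exact kz_neg ν (i := i) (by simp only [Pi.sub_apply, swz]; omega)

open Classical in
/-- Even partitions with at most `k` parts, each at most `N`. -/
def evens (k N : ℕ) : Finset (Fin k → ℕ) :=
  (Fintype.piFinset fun _ => range (N + 1)).filter fun κ => Antitone κ ∧ ∀ c, Even (κ c)

theorem mem_evens {N : ℕ} {κ : Fin k → ℕ} :
    κ ∈ evens k N ↔ (∀ c, κ c ≤ N) ∧ Antitone κ ∧ ∀ c, Even (κ c) := by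
  rw [evens, mem_filter, Fintype.mem_piFinset]
  simp only [mem_range, Nat.lt_succ_iff]

theorem card_swz_eq (hk : 2 * k ≤ n) (hk' : n ≤ 2 * k + 1) {N : ℕ} (x : Fin k → ℤ)
    (hx : ∑ i, x i ≤ N) :
    ∑ e ∈ swts fun _ : Fin k => N, (if x = swz e then 1 else 0 : ℤ) = ∑ κ ∈ evens k N, kz κ x := by
  by_cases h0 : 0 ≤ ∑ i, x i
  · obtain ⟨M, hM⟩ := Int.eq_ofNat_of_zero_le h0
    have h1 := sum_finrank_mul_kz hk hk' 0 (N := N) (M := M) (by omega) x hM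
    simp only [kz_zero, sub_eq_zero, finrank_Dsub_zero hk hk'] at h1
    rw [← h1]
    simp only [Nat.cast_ite, Nat.cast_one, Nat.cast_zero, ite_mul, one_mul, zero_mul]
    rw [← sum_filter]
    refine sum_subset (fun κ hκ => ?_) fun κ hκ hκ' => ?_
    · obtain ⟨h2, h3⟩ := mem_filter.mp hκ
      have h4 : ∑ i, κ i = M := (mem_piAntidiag.mp h2).1
      exact mem_evens.mpr ⟨fun c => (single_le_sum (fun i _ => Nat.zero_le (κ i))
        (mem_univ c)).trans (by omega), h3⟩
    · refine kz_of_sum_ne fun h2 => hκ' (mem_filter.mpr ⟨mem_piAntidiag.mpr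
        ⟨?_, fun c _ => mem_univ c⟩, (mem_evens.mp hκ).2⟩)
      rw [hM] at h2
      exact_mod_cast h2.symm
  · rw [sum_eq_zero fun e _ => if_neg ?_, sum_eq_zero fun κ _ => kz_of_sum_ne ?_]
    · intro h
      exact h0 (h ▸ sum_nonneg fun i _ => Int.natCast_nonneg _)
    · rintro rfl
      exact h0 (sum_nonneg fun i _ => Int.natCast_nonneg _)

theorem finrank_HWs_inf_Dsub (hk : 2 * k ≤ n) (hk' : n ≤ 2 * k + 1) {lam ν : Fin k → ℕ}
    (hlam : Antitone lam) (hν : Antitone ν) {N : ℕ} (hN : ∑ c, lam c = N) :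
    finrank ℂ ↥(HWs n lam ⊓ Dsub n ν) =
      ∑ κ ∈ evens k N, lrCoeff (ext0 lam) (ext0 ν) (ext0 κ) := by
  set u := shiftz k (ext0 lam) with hu
  have hsum : ∀ κ : Fin k → ℕ, ∑ i, shiftz k (ext0 κ) i = ∑ i, (κ i : ℤ) + ∑ i, shiftz k 0 i := by
    intro κ
    rw [← sum_add_distrib]
    refine sum_congr rfl fun i _ => ?_
    simp only [shiftz, ext0_val, Pi.zero_apply]
    push_cast
    ring
  have hsub : ∀ (v : Fin k → ℤ) (w : Equiv.Perm (Fin k)),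
      ∑ i, (u - v ∘ w) i = ∑ i, u i - ∑ i, v i := fun v w => by
    simp only [Pi.sub_apply, Function.comp_apply]
    rw [sum_sub_distrib, Equiv.sum_comp w v]
  have hN' : ∑ i, (lam i : ℤ) = N := by exact_mod_cast hN
  have hJ : ∀ (κ : Fin k → ℕ) (x : Fin k → ℤ), Antitone κ →
      ∑ w : Equiv.Perm (Fin k), (Equiv.Perm.sign w : ℤ) * kz κ (x - shiftz k 0 ∘ w) =
        alt x (shiftz k (ext0 κ)) := fun κ x hκ => by
    rw [sum_sign_kz, sum_alt_zero (ext0_antitone hκ) fun i => ext0_of_le κ]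
  have hL : ∑ w : Equiv.Perm (Fin k), (Equiv.Perm.sign w : ℤ) *
      ∑ κ ∈ piAntidiag univ N,
        (finrank ℂ ↥(Dsub n ν ⊓ HWs n κ) : ℤ) * kz κ (u - shiftz k 0 ∘ w) =
      finrank ℂ ↥(Dsub n ν ⊓ HWs n lam) := by
    simp_rw [mul_sum]
    rw [sum_comm]
    rw [sum_eq_single_of_mem lam (mem_piAntidiag.mpr ⟨hN, fun c _ => mem_univ c⟩)]
    · simp_rw [mul_left_comm]
      rw [← mul_sum, hJ lam u hlam, alt_of_strictAnti (shiftz_strictAnti (ext0_antitone hlam))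
        (shiftz_strictAnti (ext0_antitone hlam)), if_pos rfl, mul_one]
    · intro κ _ hκ
      simp_rw [mul_left_comm]
      rw [← mul_sum]
      by_cases h : Antitone κ
      · rw [hJ κ u h, alt_of_strictAnti (shiftz_strictAnti (ext0_antitone hlam))
          (shiftz_strictAnti (ext0_antitone h)), if_neg, mul_zero]
        refine fun h1 => hκ (funext fun i => ?_)
        have := congrFun h1 i
        simp only [shiftz, ext0_val] at this
        omega
      · rw [show Dsub n ν ⊓ HWs n κ = ⊥ from (Submodule.eq_bot_iff _).mpr fun f hf => by
          by_contra h0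
          exact h (antitone_of_HWs hf.2 h0), finrank_bot, Nat.cast_zero, zero_mul]
  have hR : ∑ w : Equiv.Perm (Fin k), (Equiv.Perm.sign w : ℤ) *
      ∑ e ∈ swts fun _ : Fin k => N, kz ν (u - shiftz k 0 ∘ w - swz e) =
      ∑ κ ∈ evens k N, (lrCoeff (ext0 lam) (ext0 ν) (ext0 κ) : ℤ) := by
    simp_rw [mul_sum, sub_right_comm]
    rw [sum_comm]
    simp_rw [hJ ν _ hν, alt]
    rw [sum_comm]
    simp_rw [← mul_sum]
    have h1 : ∀ w : Equiv.Perm (Fin k),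
        ∑ e ∈ swts fun _ : Fin k => N, (if shiftz k (ext0 ν) ∘ w = u - swz e then 1 else 0 : ℤ) =
        ∑ κ ∈ evens k N, kz κ (u - shiftz k (ext0 ν) ∘ w) := fun w => by
      rw [← card_swz_eq hk hk' _ ?_]
      · grind
      · rw [hsub, hu, hsum, hsum, hN']
        have : 0 ≤ ∑ i, (ν i : ℤ) := sum_nonneg fun i _ => Int.natCast_nonneg _
        omega
    simp_rw [h1, mul_sum]
    rw [sum_comm]
    refine sum_congr rfl fun κ _ => ?_
    rw [sum_sign_kz, sum_alt_eq_lrCoeff (ext0_antitone hlam) (ext0_antitone hν)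
      (fun i => ext0_of_le lam) fun i => ext0_of_le ν]
  have h := hL.symm.trans ((sum_congr rfl fun w _ => by
    rw [sum_finrank_mul_kz hk hk' ν le_rfl (u - shiftz k 0 ∘ w)
      (by rw [hsub, hu, hsum, hN', add_sub_cancel_right])]).trans hR)
  rw [inf_comm] at h
  exact_mod_cast h

end

section

variable {f : ℕ → ℕ}

theorem lt_plen_iff (hf : IsPartition f) {i : ℕ} : i < plen f ↔ 0 < f i := by
  refine ⟨fun h => Nat.pos_of_ne_zero fun h0 => Nat.notMem_of_lt_sInf h h0, fun h => ?_⟩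
  by_contra hi
  have h1 : f (plen f) = 0 := Nat.sInf_mem (s := {k | f k = 0}) hf.2
  have := hf.1 (not_lt.mp hi)
  omega

theorem eq_zero_of_plen_le (hf : IsPartition f) {i : ℕ} (h : plen f ≤ i) : f i = 0 :=
  Nat.eq_zero_of_not_pos fun h0 => h.not_gt ((lt_plen_iff hf).mpr h0)

theorem conj_zero_eq_plen (hf : IsPartition f) : conj f 0 = plen f := by
  rw [conj, show {j | 0 < f j} = ((Finset.range (plen f) : Finset ℕ) : Set ℕ) from
    Set.ext fun j => by simp [lt_plen_iff hf], Set.ncard_coe_finset, Finset.card_range]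

theorem conj_antitone (hf : IsPartition f) : Antitone (conj f) := fun i j hij => by
  refine Set.ncard_le_ncard (fun a (ha : j < f a) => hij.trans_lt ha) ((Set.finite_lt_nat (plen f)).subset
    fun a (ha : i < f a) => (lt_plen_iff hf).mpr (by omega))

theorem ext0_restrict {k : ℕ} (h : ∀ i, k ≤ i → f i = 0) : ext0 (fun c : Fin k => f c) = f := by
  funext i
  rcases lt_or_ge i k with hi | hi
  · exact ext0_val _ ⟨i, hi⟩
  · rw [ext0_of_le _ hi, h i hi]

theorem assocPtn_eq_zero {n : ℕ} (hf : IsPartition f) (h : conj f 0 + conj f 1 ≤ n) {i : ℕ}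
    (hi : n - conj f 0 ≤ i) : assocPtn n f i = 0 := by
  rw [assocPtn, conj]
  refine (congrArg _ (Set.eq_empty_of_forall_notMem fun j hj => ?_)).trans (Set.ncard_empty ℕ)
  rw [Set.mem_ofPred_eq] at hj
  split_ifs at hj with h0
  · omega
  · have := conj_antitone hf (Nat.one_le_iff_ne_zero.mpr h0)
    omega

theorem lrCoeff_eq_zero {lam mu nu : ℕ → ℕ} {i : ℕ} (h : lam i < mu i) : lrCoeff lam mu nu = 0 := by
  rw [lrCoeff, Set.eq_empty_of_forall_notMem (s := {T | _}) fun T hT => ((hT.1 i).trans_lt h).false, Set.ncard_empty]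

/-- The partition `κ / 2`. -/
def halfPtn {k : ℕ} (κ : Fin k → ℕ) (h : Antitone κ) : Ptn :=
  ⟨fun i => ext0 κ i / 2, fun _ _ hij => Nat.div_le_div_right (ext0_antitone h hij), k, by
    simp only [ext0_of_le _ le_rfl, Nat.zero_div]⟩

theorem double_halfPtn {k : ℕ} {κ : Fin k → ℕ} (h : Antitone κ) (he : ∀ c, Even (κ c)) :
    double (halfPtn κ h).1 = ext0 κ := by
  funext i
  change 2 * (ext0 κ i / 2) = ext0 κ i
  rcases lt_or_ge i k with hi | hi
  · rw [ext0_val κ ⟨i, hi⟩]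
    exact Nat.two_mul_div_two_of_even (he _)
  · rw [ext0_of_le _ hi]

theorem double_injective : Function.Injective double := fun f g h => funext fun i => by
  have := congrFun h i
  simp only [double] at this
  omega

theorem bound_of_lrCoeff_ne_zero {k : ℕ} {lam mu nu : ℕ → ℕ} (hlam : Antitone lam) (hmu : Antitone mu)
    (hlk : ∀ i, k ≤ i → lam i = 0) (hmk : ∀ i, k ≤ i → mu i = 0) (h : lrCoeff lam mu nu ≠ 0) :
    (∀ i, k ≤ i → nu i = 0) ∧ ∀ i, nu i ≤ cs lam k := by
  classical
  rw [lrCoeff_eq_card hlam hmu hlk hmk] at h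
  obtain ⟨p, hp⟩ := Finset.card_pos.mp (Nat.pos_of_ne_zero h)
  obtain ⟨hp, -, hw⟩ := Finset.mem_filter.mp hp
  rw [mem_gts] at hp
  have hz : ∀ i, k ≤ i → nu i = 0 := fun i hi => GT_top_zero hp hi
  refine ⟨hz, fun i => ?_⟩
  rcases lt_or_ge i k with hi | hi
  · have hc : ∀ j ≤ k, cs (p j) k ≤ cs lam j := fun j => by
      induction j with
      | zero => exact fun _ => (Finset.sum_eq_zero fun s _ => hp.1 s).trans_le (Nat.zero_le _)
      | succ j ih =>
        intro hj
        have h1 := hw j (by omega)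
        have h2 := ih (by omega)
        rw [cs_succ]
        omega
    rw [← hp.2.1 k le_rfl]
    exact (Finset.single_le_sum (f := p k) (fun _ _ => Nat.zero_le _) (Finset.mem_range.mpr hi)).trans
      (hc k le_rfl)
  · rw [hz i hi]
    exact Nat.zero_le _

theorem finsum_lrCoeff {k : ℕ} {lam ν : Fin k → ℕ} (hlam : Antitone lam) (hν : Antitone ν) {N : ℕ}
    (hN : ∑ c, lam c = N) :
    ∑ᶠ δ : Ptn, lrCoeff (ext0 lam) (ext0 ν) (double δ.1) =
      ∑ κ ∈ evens k N, lrCoeff (ext0 lam) (ext0 ν) (ext0 κ) := by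
  classical
  let g : ↥(evens k N) → Ptn := fun κ => halfPtn κ.1 (mem_evens.mp κ.2).2.1
  have hg : ∀ κ, double (g κ).1 = ext0 κ.1 := fun κ =>
    double_halfPtn (mem_evens.mp κ.2).2.1 (mem_evens.mp κ.2).2.2
  have hinj : Function.Injective g := fun κ κ' h => Subtype.ext <| funext fun c => by
    rw [← ext0_val κ.1, ← ext0_val κ'.1, ← hg, ← hg, h]
  rw [finsum_eq_sum_of_support_subset (s := Finset.univ.image g), Finset.sum_image hinj.injOn,
    ← Finset.sum_coe_sort (evens k N)]
  · exact Finset.sum_congr rfl fun κ _ => by rw [hg]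
  · intro δ hδ
    obtain ⟨h1, h2⟩ := bound_of_lrCoeff_ne_zero (ext0_antitone hlam) (ext0_antitone hν)
      (fun i => ext0_of_le lam) (fun i => ext0_of_le ν) hδ
    have h3 : cs (ext0 lam) k = N := by
      rw [← hN, cs, Finset.sum_range]
      exact Finset.sum_congr rfl fun c _ => ext0_val lam c
    have hκ : (fun c : Fin k => double δ.1 c) ∈ evens k N := mem_evens.mpr
      ⟨fun c => (h2 c).trans h3.le, fun a b hab => Nat.mul_le_mul_left 2 (δ.2.1 hab),
        fun c => even_two_mul _⟩
    refine Finset.mem_coe.mpr (Finset.mem_image.mpr ⟨⟨_, hκ⟩, Finset.mem_univ _, ?_⟩)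
    exact Subtype.ext (double_injective ((hg ⟨_, hκ⟩).trans (ext0_restrict h1)))

end

end Littlewood

theorem littlewood_restriction_On_sub_GLn
    (n : ℕ) (lam mu : ℕ → ℕ) (hlam : IsPartition lam) (hmu : IsPartition mu)
    (hlamlen : 2 * plen lam ≤ n) (hmucol : conj mu 0 + conj mu 1 ≤ n)
    {V W : Type*} [AddCommGroup V] [Module ℂ V] [AddCommGroup W] [Module ℂ W]
    (ρ : Representation ℂ (GL (Fin n) ℂ) V) (π : Representation ℂ (OGL n) W)
    (hρ : IsGLHW n (polyWeight n lam) ρ) (hπ : IsOIrrep n mu π) :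
    repMult (ρ.comp (OGL n).subtype) π = ∑ᶠ δ : Ptn, lrCoeff lam mu (double δ.1) := by
  obtain ⟨hirr, hfd, hw⟩ := hπ
  obtain ⟨k, hk, hk'⟩ : ∃ k, 2 * k ≤ n ∧ n ≤ 2 * k + 1 := ⟨n / 2, by omega, by omega⟩
  have hlk : ∀ i, k ≤ i → lam i = 0 := fun i hi =>
    Littlewood.eq_zero_of_plen_le hlam (by omega)
  have hl := Littlewood.ext0_restrict hlk
  have hla : Antitone fun c : Fin k => lam c := fun a b hab => hlam.1 hab
  obtain ⟨T, hT, hTi, hTr⟩ := Littlewood.exists_GL_realization (by omega) hla hl ρ hρ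
  rw [Littlewood.conj_zero_eq_plen hmu] at hw
  split_ifs at hw with hc
  · obtain ⟨w, hw0, hw, hs⟩ := hw
    have hmk : ∀ i, k ≤ i → mu i = 0 := fun i hi => Littlewood.eq_zero_of_plen_le hmu (by omega)
    have hm := Littlewood.ext0_restrict hmk
    have hma : Antitone fun c : Fin k => mu c := fun a b hab => hmu.1 hab
    have hs' : (∃ c : Fin k, 2 * ((c : ℕ) + 1) = n ∧ mu c ≠ 0) ∨ π (Littlewood.refl n) w = w := by
      rcases hs with hs | hs
      · rcases Nat.eq_zero_or_pos n with rfl | hn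
        · refine Or.inr ?_
          rw [show Littlewood.refl 0 = 1 from Subsingleton.elim _ _, map_one, Module.End.one_apply]
        · exact Or.inl ⟨⟨k - 1, by omega⟩, by dsimp only; omega,
            ((Littlewood.lt_plen_iff hmu).mp (by dsimp only; omega)).ne'⟩
      · exact Or.inr (hs _ (Littlewood.mat_refl))
    rw [Littlewood.repMult_eq_finrank hk hk' π hirr T hT hTi hTr w hw0 (hm.symm ▸ hw) hs',
      Littlewood.finrank_HWs_inf_Dsub hk hk' hla hma rfl, ← Littlewood.finsum_lrCoeff hla hma rfl, hl, hm]
  · obtain ⟨w, hw0, hw, hs⟩ := hw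
    have hz : ∀ i, n - plen mu ≤ i → assocPtn n mu i = 0 := fun i hi =>
      Littlewood.assocPtn_eq_zero hmu hmucol (by rwa [Littlewood.conj_zero_eq_plen hmu])
    have hm : Littlewood.ext0 (fun c : Fin k => assocPtn n mu c) = assocPtn n mu :=
      Littlewood.ext0_restrict fun i hi => hz i (by omega)
    rw [Littlewood.repMult_eq_zero hk hk' π hirr T hT hTi hTr w hw0 (hm.symm ▸ hw)
      (fun c hc => hz _ (by omega)) (hs _ Littlewood.mat_refl)]
    refine (finsum_eq_zero_of_forall_eq_zero fun δ =>
      Littlewood.lrCoeff_eq_zero (i := plen lam) ?_).symm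
    rw [Littlewood.eq_zero_of_plen_le hlam le_rfl]
    exact (Littlewood.lt_plen_iff hmu).mp (by omega)

end
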